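/- For every natural number n with n ≤ 12, every tree on n vertices with maximum degree at most 4 admits an L-shaped embedding in every point set of n points. -/

import Mathlib

/-- A point set: finitely many points in the plane, no two of which share
an x-coordinate or a y-coordinate. -/
def IsPointSet (S : Finset (ℝ × ℝ)) : Prop :=
  ∀ p ∈ S, ∀ q ∈ S, p ≠ q → p.1 ≠ q.1 ∧ p.2 ≠ q.2

/-- The drawing of the edge `uv`: the union of the two axis-parallel segments
joining `φ u` and `φ v` through the corner point `c u v`. -/
def LDraw {α : Type*} (φ : α → ℝ × ℝ) (c : α → α → ℝ × ℝ) (u v : α) : Set (ℝ × ℝ) :=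
  segment ℝ (φ u) (c u v) ∪ segment ℝ (c u v) (φ v)

/-- `φ` together with the corner assignment `c` is an L-shaped embedding of the
graph `G` in the point set `S`:  `φ` is an injective map of the vertices into `S`,
every edge `uv` is drawn as an `L` whose corner is `((φ u).1, (φ v).2)` or
`((φ v).1, (φ u).2)`, and the drawings of two distinct edges intersect only in the
image `φ w` of a common endpoint `w` of the two edges. -/
def IsLEmbedding {α : Type*} (G : SimpleGraph α) (S : Finset (ℝ × ℝ))
    (φ : α → ℝ × ℝ) (c : α → α → ℝ × ℝ) : Prop :=
  Function.Injective φ ∧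
  (∀ v, φ v ∈ S) ∧
  (∀ u v, c u v = c v u) ∧
  (∀ u v, G.Adj u v → c u v = ((φ u).1, (φ v).2) ∨ c u v = ((φ v).1, (φ u).2)) ∧
  (∀ u v a b, G.Adj u v → G.Adj a b → s(u, v) ≠ s(a, b) →
    ∀ p ∈ LDraw φ c u v ∩ LDraw φ c a b,
      ∃ w, (w = u ∨ w = v) ∧ (w = a ∨ w = b) ∧ p = φ w)

/-- `G` admits an L-shaped embedding in the point set `S`. -/
def HasLEmbedding {α : Type*} (G : SimpleGraph α) (S : Finset (ℝ × ℝ)) : Prop :=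
  ∃ φ c, IsLEmbedding G S φ c

/-!
Trees are coded by lists of parents, the most recent vertex first: the vertices of `q` are
`1, …, q.length + 1`, and the head of `p :: q` is the parent of the vertex `q.length + 2`.
The remaining nodes stand for the sides of a box around the points: `0` is the left side, `13` the
right side, `14` the top and `15` the bottom.  An oriented edge `(h, v)` is drawn as the horizontal
segment from `h` to the corner `(X v, Y h)` followed by the vertical segment from the corner to `v`.
-/

open Set

/-- The edges of the tree with parent list `q`, as pairs (child, parent). -/
def codeEdges : List ℕ → List (ℕ × ℕ)
  | [] => []
  | p :: q => (q.length + 2, p) :: codeEdges q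

/-- The horizontal part of `d` does not meet the vertical part of `e`, unless both start in the
same vertex. -/
def Avoids (X Y : ℕ → ℝ) (d e : ℕ × ℕ) : Prop :=
  d.1 ≤ 12 → e.2 ≠ 0 → e.2 ≤ 12 → d.1 ≠ e.2 →
    X e.2 ∈ uIcc (X d.1) (X d.2) → Y d.1 ∉ uIcc (Y e.2) (Y e.1)

/-- A drawing, in the point set `S` inside the box `(l, r) × (b, t)`, of the tree coded by `q` and
of a ray for every pair (vertex, side) in `R`; the oriented edges that are drawn satisfy `D`. -/
structure RayDrawing (S : Finset (ℝ × ℝ)) (l r b t : ℝ) (q : List ℕ) (R : ℕ × ℕ → Prop)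
    (X Y : ℕ → ℝ) (D : ℕ × ℕ → Prop) : Prop where
  left : X 0 = l
  right : X 13 = r
  bottom : Y 15 = b
  top : Y 14 = t
  mem : ∀ i, 1 ≤ i → i ≤ q.length + 1 → (X i, Y i) ∈ S
  inj : ∀ i j, 1 ≤ i → i ≤ q.length + 1 → 1 ≤ j → j ≤ q.length + 1 → X i = X j → i = j
  parent : ∀ e ∈ codeEdges q, 1 ≤ e.2 ∧ e.2 ≤ q.length + 1
  edge : ∀ e ∈ codeEdges q, D e ∨ D e.swap
  ray_left : ∀ u, R (u, 0) → D (u, 0)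
  ray_right : ∀ u, R (u, 13) → D (u, 13)
  ray_top : ∀ u, R (u, 14) → D (14, u)
  ray_bottom : ∀ u, R (u, 15) → D (15, u)
  ends : ∀ d, D d → (1 ≤ d.1 ∧ d.1 ≤ q.length + 1) ∧ (1 ≤ d.2 ∧ d.2 ≤ q.length + 1) ∨
    (1 ≤ d.1 ∧ d.1 ≤ q.length + 1) ∧ (d.2 = 0 ∨ d.2 = 13) ∨
    (d.1 = 14 ∨ d.1 = 15) ∧ (1 ≤ d.2 ∧ d.2 ≤ q.length + 1)
  avoids : ∀ d, D d → ∀ e, D e → d ≠ e → Avoids X Y d e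

/-- Every point set of the right size in every box has a drawing of `q` with the rays `R`. -/
def RayEmbeds (q : List ℕ) (R : ℕ × ℕ → Prop) : Prop :=
  ∀ S : Finset (ℝ × ℝ), IsPointSet S → S.card = q.length + 1 → ∀ l r b t : ℝ,
    (∀ p ∈ S, (l < p.1 ∧ p.1 < r) ∧ b < p.2 ∧ p.2 < t) →
    ∃ X Y D, RayDrawing S l r b t q R X Y D

theorem RayEmbeds.mono {q : List ℕ} {R R' : ℕ × ℕ → Prop} (h : RayEmbeds q R)
    (hR : ∀ r, R' r → R r) : RayEmbeds q R' := by
  intro S hS hc l r b t hbox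
  obtain ⟨X, Y, D, H⟩ := h S hS hc l r b t hbox
  exact ⟨X, Y, D, { H with
    ray_left := fun u hu => H.ray_left u (hR _ hu)
    ray_right := fun u hu => H.ray_right u (hR _ hu)
    ray_top := fun u hu => H.ray_top u (hR _ hu)
    ray_bottom := fun u hu => H.ray_bottom u (hR _ hu) }⟩

/-- Exchange the left and the right side. -/
def flipSide (k : ℕ) : ℕ := if k = 0 then 13 else if k = 13 then 0 else k

/-- Reflection of the sides in the main diagonal. -/
def swapSide (k : ℕ) : ℕ :=
  if k = 0 then 15 else if k = 15 then 0 else if k = 13 then 14 else if k = 14 then 13 else k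

theorem flipSide_flipSide (k : ℕ) : flipSide (flipSide k) = k := by
  grind [flipSide]

theorem swapSide_swapSide (k : ℕ) : swapSide (swapSide k) = k := by
  grind [swapSide]

theorem flipSide_of_vertex {k n : ℕ} (hn : n ≤ 12) (h : 1 ≤ k ∧ k ≤ n) : flipSide k = k := by
  grind [flipSide]

theorem swapSide_of_vertex {k n : ℕ} (hn : n ≤ 12) (h : 1 ≤ k ∧ k ≤ n) : swapSide k = k := by
  grind [swapSide]

theorem swapSide_cases (k : ℕ) : k = 0 ∧ swapSide k = 15 ∨ k = 15 ∧ swapSide k = 0 ∨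
    k = 13 ∧ swapSide k = 14 ∨ k = 14 ∧ swapSide k = 13 ∨
    (k ≠ 0 ∧ k ≠ 13 ∧ k ≠ 14 ∧ k ≠ 15) ∧ swapSide k = k := by
  unfold swapSide
  split_ifs <;> omega

theorem bounds_of_mem_codeEdges {q : List ℕ} {e : ℕ × ℕ} (he : e ∈ codeEdges q) :
    2 ≤ e.1 ∧ e.1 ≤ q.length + 1 := by
  induction q with
  | nil => simp [codeEdges] at he
  | cons p q ih =>
    simp only [codeEdges, List.mem_cons] at he
    rcases he with rfl | he
    · simp
    · have := ih he
      simp only [List.length_cons]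
      omega

theorem IsPointSet.image {S : Finset (ℝ × ℝ)} (hS : IsPointSet S) {f : ℝ × ℝ → ℝ × ℝ}
    (hf : ∀ p q : ℝ × ℝ, p.1 ≠ q.1 ∧ p.2 ≠ q.2 → (f p).1 ≠ (f q).1 ∧ (f p).2 ≠ (f q).2) :
    IsPointSet (S.image f) := by
  intro p hp q hq hpq
  obtain ⟨p', hp', rfl⟩ := Finset.mem_image.1 hp
  obtain ⟨q', hq', rfl⟩ := Finset.mem_image.1 hq
  exact hf _ _ (hS p' hp' q' hq' fun h => hpq (by rw [h]))

theorem neg_mem_uIcc_neg {a b c : ℝ} : -c ∈ uIcc (-a) (-b) ↔ c ∈ uIcc a b := by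
  simp only [mem_uIcc, neg_le_neg_iff]
  tauto

theorem RayEmbeds.flip {q : List ℕ} {R : ℕ × ℕ → Prop} (hq : q.length + 1 ≤ 12)
    (h : RayEmbeds q R) : RayEmbeds q fun p => R (p.1, flipSide p.2) := by
  intro S hS hc l r b t hbox
  have hinj : Function.Injective fun p : ℝ × ℝ => (-p.1, p.2) := by
    rintro ⟨_, _⟩ ⟨_, _⟩ h
    simpa using h
  obtain ⟨X, Y, D, H⟩ := h (S.image fun p => (-p.1, p.2))
    (hS.image fun p q h => by simpa using h)
    (by rw [Finset.card_image_of_injective _ hinj, hc]) (-r) (-l) b t (by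
      intro p hp
      obtain ⟨p', hp', rfl⟩ := Finset.mem_image.1 hp
      have := hbox p' hp'
      exact ⟨⟨neg_lt_neg this.1.2, neg_lt_neg this.1.1⟩, this.2⟩)
  have hX : ∀ k, 1 ≤ k ∧ k ≤ q.length + 1 → flipSide k = k := fun k => flipSide_of_vertex hq
  refine ⟨fun k => -X (flipSide k), Y, fun d => D (d.1, flipSide d.2), ?_⟩
  constructor
  · simp [flipSide, H.right]
  · simp [flipSide, H.left]
  · exact H.bottom
  · exact H.top
  · intro i h1 h2
    obtain ⟨p, hp, hpi⟩ := Finset.mem_image.1 (H.mem i h1 h2)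
    simp only [Prod.mk.injEq] at hpi
    simp only [hX i ⟨h1, h2⟩, ← hpi.1, ← hpi.2, neg_neg]
    exact hp
  · intro i j h1 h2 h3 h4 hij
    simp only [hX i ⟨h1, h2⟩, hX j ⟨h3, h4⟩, neg_inj] at hij
    exact H.inj i j h1 h2 h3 h4 hij
  · exact H.parent
  · intro e he
    have hb := bounds_of_mem_codeEdges he
    have hp := H.parent e he
    simp only [Prod.fst_swap, Prod.snd_swap, hX _ hp, hX e.1 ⟨by omega, hb.2⟩]
    exact H.edge e he
  · intro u hu
    exact H.ray_right u hu
  · intro u hu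
    exact H.ray_left u hu
  · intro u hu
    have h := H.ray_top u hu
    have := H.ends _ h
    simp only at this ⊢
    rwa [hX u (by omega)]
  · intro u hu
    have h := H.ray_bottom u hu
    have := H.ends _ h
    simp only at this ⊢
    rwa [hX u (by omega)]
  · intro d hd
    have := H.ends _ hd
    grind [flipSide]
  · intro d hd e he hde h1 h2 h3 h4 h5
    have hv : flipSide e.2 = e.2 := flipSide_of_vertex le_rfl ⟨by omega, h3⟩
    have hh : flipSide d.1 = d.1 := by
      have := H.ends _ hd
      grind [flipSide]
    have hne : (d.1, flipSide d.2) ≠ (e.1, flipSide e.2) := by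
      have := flipSide_flipSide d.2
      have := flipSide_flipSide e.2
      grind
    have := H.avoids _ hd _ he hne
    simp only [Avoids, hv] at this
    rw [neg_mem_uIcc_neg, hv, hh] at h5
    exact this h1 h2 h3 h4 h5

theorem RayEmbeds.transpose {q : List ℕ} {R : ℕ × ℕ → Prop} (hq : q.length + 1 ≤ 12)
    (h : RayEmbeds q R) : RayEmbeds q fun p => R (p.1, swapSide p.2) := by
  intro S hS hc l r b t hbox
  obtain ⟨X, Y, D, H⟩ := h (S.image Prod.swap)
    (hS.image fun p q h => And.symm h)
    (by rw [Finset.card_image_of_injective _ Prod.swap_injective, hc]) b t l r (by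
      intro p hp
      obtain ⟨p', hp', rfl⟩ := Finset.mem_image.1 hp
      exact And.symm (hbox p' hp'))
  have hX : ∀ k, 1 ≤ k ∧ k ≤ q.length + 1 → swapSide k = k := fun k => swapSide_of_vertex hq
  have hmem : ∀ i, 1 ≤ i → i ≤ q.length + 1 → (Y i, X i) ∈ S := by
    intro i h1 h2
    obtain ⟨p, hp, hpi⟩ := Finset.mem_image.1 (H.mem i h1 h2)
    rw [← Prod.swap_swap p, hpi] at hp
    exact hp
  refine ⟨fun k => Y (swapSide k), fun k => X (swapSide k),
    fun d => D (swapSide d.2, swapSide d.1), ?_⟩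
  constructor
  · exact H.bottom
  · exact H.top
  · exact H.left
  · exact H.right
  · intro i h1 h2
    simp only [hX i ⟨h1, h2⟩]
    exact hmem i h1 h2
  · intro i j h1 h2 h3 h4 hij
    simp only [hX i ⟨h1, h2⟩, hX j ⟨h3, h4⟩] at hij
    by_contra hne
    exact (hS _ (hmem i h1 h2) _ (hmem j h3 h4)
      fun h => hne (H.inj i j h1 h2 h3 h4 (Prod.ext_iff.1 h).2)).1 hij
  · exact H.parent
  · intro e he
    have hb := bounds_of_mem_codeEdges he
    have hp := H.parent e he
    simp only [Prod.fst_swap, Prod.snd_swap, hX _ hp, hX e.1 ⟨by omega, hb.2⟩]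
    exact (H.edge e he).symm
  · intro u hu
    have h := H.ray_bottom u hu
    have := H.ends _ h
    simp only at this ⊢
    rwa [hX u (by omega)]
  · intro u hu
    have h := H.ray_top u hu
    have := H.ends _ h
    simp only at this ⊢
    rwa [hX u (by omega)]
  · intro u hu
    have h := H.ray_right u hu
    have := H.ends _ h
    simp only at this ⊢
    rwa [hX u (by omega)]
  · intro u hu
    have h := H.ray_left u hu
    have := H.ends _ h
    simp only at this ⊢
    rwa [hX u (by omega)]
  · intro d hd
    have := H.ends _ hd
    have := swapSide_cases d.1
    have := swapSide_cases d.2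
    simp only at *
    omega
  · intro d hd e he hde h1 h2 h3 h4 h5 h6
    have hv : swapSide e.2 = e.2 := swapSide_of_vertex le_rfl ⟨by omega, h3⟩
    have hh : swapSide d.1 = d.1 := by
      have := H.ends _ hd
      have := swapSide_cases d.1
      simp only at *
      omega
    have hne : (swapSide e.2, swapSide e.1) ≠ (swapSide d.2, swapSide d.1) := by
      have := swapSide_swapSide d.2
      have := swapSide_swapSide e.2
      have := swapSide_swapSide d.1
      have := swapSide_swapSide e.1
      grind
    have := H.avoids _ he _ hd hne
    have hd1 : d.1 ≠ 0 := by
      have := H.ends _ hd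
      have := swapSide_cases d.1
      simp only at *
      omega
    simp only [Avoids, hv, hh] at this h5 h6
    exact this h3 hd1 h1 h4.symm h6 h5

/-- A leaf placed in the rightmost point is reached along a ray to the right. -/
theorem RayEmbeds.cons_right {q : List ℕ} {R : ℕ × ℕ → Prop} {u : ℕ} (hq : q.length + 2 ≤ 12)
    (h : RayEmbeds q R) (hu : R (u, 13)) :
    RayEmbeds (u :: q) fun p => p = (q.length + 2, 13) ∨ R p ∧ p.2 ≠ 13 := by
  intro S hS hc l r b t hbox
  rw [List.length_cons] at hc
  obtain ⟨z, hz, hmax⟩ := S.exists_max_image Prod.fst (Finset.card_pos.1 (by omega))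
  have hlt : ∀ p ∈ S.erase z, p.1 < z.1 := fun p hp =>
    lt_of_le_of_ne (hmax p (Finset.mem_of_mem_erase hp))
      (hS p (Finset.mem_of_mem_erase hp) z hz (Finset.ne_of_mem_erase hp)).1
  obtain ⟨X, Y, D, H⟩ := h (S.erase z)
    (fun p hp p' hp' => hS p (Finset.mem_of_mem_erase hp) p' (Finset.mem_of_mem_erase hp'))
    (by rw [Finset.card_erase_of_mem hz, hc]; rfl) l z.1 b t
    (fun p hp => ⟨⟨(hbox p (Finset.mem_of_mem_erase hp)).1.1, hlt p hp⟩,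
      (hbox p (Finset.mem_of_mem_erase hp)).2⟩)
  have hD := H.ray_right u hu
  have hru : 1 ≤ u ∧ u ≤ q.length + 1 := by
    have := H.ends _ hD
    simp only at this
    omega
  have hXlt : ∀ k, k ≤ q.length + 1 → X k < z.1 := by
    intro k hk
    rcases Nat.eq_zero_or_pos k with rfl | hk0
    · rw [H.left]
      exact (hbox z hz).1.1
    · exact hlt _ (H.mem k hk0 hk)
  obtain ⟨X', hX13, hXz, hXk⟩ : ∃ X' : ℕ → ℝ, X' 13 = r ∧ X' (q.length + 2) = z.1 ∧
      ∀ k ≤ q.length + 1, X' k = X k :=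
    ⟨fun k => if k = 13 then r else if k = q.length + 2 then z.1 else X k, by grind⟩
  obtain ⟨Y', hYz, hYk⟩ : ∃ Y' : ℕ → ℝ, Y' (q.length + 2) = z.2 ∧
      ∀ k, k ≠ q.length + 2 → Y' k = Y k :=
    ⟨fun k => if k = q.length + 2 then z.2 else Y k, by grind⟩
  refine ⟨X', Y', fun d => d = (u, q.length + 2) ∨ d = (q.length + 2, 13) ∨ D d ∧ d.2 ≠ 13, ?_⟩
  constructor
  · rw [hXk 0 (by omega), H.left]
  · exact hX13
  · rw [hYk 15 (by omega), H.bottom]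
  · rw [hYk 14 (by omega), H.top]
  · intro i h1 h2
    simp only [List.length_cons] at h2
    by_cases hi : i = q.length + 2
    · rw [hi, hXz, hYz]
      exact hz
    · rw [hXk i (by omega), hYk i hi]
      exact Finset.mem_of_mem_erase (H.mem i h1 (by omega))
  · intro i j h1 h2 h3 h4 hij
    simp only [List.length_cons] at h2 h4
    have := hXlt i
    have := hXlt j
    have := H.inj i j
    grind
  · intro e he
    simp only [codeEdges, List.mem_cons] at he
    rcases he with rfl | he
    · simp only [List.length_cons]
      omega
    · have := H.parent e he
      simp only [List.length_cons]
      omega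
  · intro e he
    simp only [codeEdges, List.mem_cons] at he
    rcases he with rfl | he
    · exact Or.inr (Or.inl rfl)
    · have hp := H.parent e he
      have hb := bounds_of_mem_codeEdges he
      rcases H.edge e he with h | h
      · exact Or.inl (Or.inr (Or.inr ⟨h, by omega⟩))
      · exact Or.inr (Or.inr (Or.inr ⟨h, by simp only [Prod.snd_swap]; omega⟩))
  · rintro v (hv | hv)
    · simp at hv
    · exact Or.inr (Or.inr ⟨H.ray_left v hv.1, by simp⟩)
  · rintro v (hv | hv)
    · exact Or.inr (Or.inl hv)
    · exact absurd rfl hv.2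
  · rintro v (hv | hv)
    · simp at hv
    · have h := H.ray_top v hv.1
      have := H.ends _ h
      simp only at this
      exact Or.inr (Or.inr ⟨h, by simp only; omega⟩)
  · rintro v (hv | hv)
    · simp at hv
    · have h := H.ray_bottom v hv.1
      have := H.ends _ h
      simp only at this
      exact Or.inr (Or.inr ⟨h, by simp only; omega⟩)
  · rintro d (rfl | rfl | ⟨hd, -⟩) <;> simp only [List.length_cons]
    · exact Or.inl ⟨⟨hru.1, by omega⟩, by omega, by omega⟩
    · exact Or.inr (Or.inl ⟨⟨by omega, by omega⟩, Or.inr trivial⟩)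
    · have := H.ends d hd
      omega
  · rintro d hd e he hde h1 h2 h3 h4 h5
    rcases hd with rfl | rfl | ⟨hd, hd'⟩ <;> rcases he with rfl | rfl | ⟨he, he'⟩ <;>
      try simp only at h1 h2 h3 h4 h5 hde
    · simp at hde
    · omega
    · have hee := H.ends e he
      have := H.avoids _ hD e he (by rintro rfl; exact he' rfl) h1 h2 h3 h4
      rw [hXz, hXk u hru.2, hXk e.2 (by omega), ← H.right] at h5
      rw [hYk u (by omega), hYk e.1 (by omega), hYk e.2 (by omega)]
      exact this h5
    · omega
    · omega
    · exfalso
      have hee := H.ends e he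
      have := hXlt e.2 (by omega)
      have := (hbox z hz).1.2
      rw [hXz, hX13, hXk e.2 (by omega), mem_uIcc] at h5
      grind
    · exfalso
      have hdd := H.ends d hd
      have := hXlt d.1 (by omega)
      have := hXlt d.2 (by omega)
      rw [hXz, hXk d.1 (by omega), hXk d.2 (by omega), mem_uIcc] at h5
      grind
    · omega
    · have hdd := H.ends d hd
      have hee := H.ends e he
      have := H.avoids d hd e he hde h1 h2 h3 h4
      rw [hXk d.1 (by omega), hXk d.2 (by omega), hXk e.2 (by omega)] at h5
      rw [hYk d.1 (by omega), hYk e.1 (by omega), hYk e.2 (by omega)]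
      exact this h5

theorem RayEmbeds.cons {q : List ℕ} {R : ℕ × ℕ → Prop} {u s : ℕ} (hq : q.length + 2 ≤ 12)
    (h : RayEmbeds q R) (hs : s = 0 ∨ s = 13 ∨ s = 14 ∨ s = 15) (hu : R (u, s)) :
    RayEmbeds (u :: q) fun p => p = (q.length + 2, s) ∨ R p ∧ p.2 ≠ s := by
  have hq' : q.length + 1 ≤ 12 := by omega
  have hq'' : (u :: q).length + 1 ≤ 12 := hq
  rcases hs with rfl | rfl | rfl | rfl
  · refine ((((h.flip hq').cons_right hq (u := u) hu)).flip hq'').mono ?_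
    grind [flipSide]
  · exact h.cons_right hq hu
  · refine ((((h.transpose hq').cons_right hq (u := u) hu)).transpose hq'').mono ?_
    grind [swapSide]
  · refine (((((h.transpose hq').flip hq').cons_right hq (u := u) hu).flip hq'').transpose
      hq'').mono ?_
    grind [swapSide, flipSide]

theorem eq_of_mem_uIcc_of_mem_uIcc {a x y p : ℝ} (hx : p ∈ uIcc a x) (hy : p ∈ uIcc a y)
    (hxy : x ∉ uIcc a y) (hyx : y ∉ uIcc a x) : p = a := by
  simp only [mem_uIcc, not_or, not_and_or, not_le] at *
  rcases hx with hx | hx <;> rcases hy with hy | hy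
  · rcases le_total x y with h | h <;> grind
  · linarith
  · linarith
  · rcases le_total x y with h | h <;> grind

/-- Two drawn edges meet at most in a common end. -/
theorem RayDrawing.meet {S : Finset (ℝ × ℝ)} {l r b t : ℝ} {q : List ℕ} {R : ℕ × ℕ → Prop}
    {X Y : ℕ → ℝ} {D : ℕ × ℕ → Prop} (hS : IsPointSet S) (hq : q.length + 1 ≤ 12)
    (H : RayDrawing S l r b t q R X Y D) {d e : ℕ × ℕ} (hd : D d) (he : D e) (hde : d ≠ e)
    (hd1 : 1 ≤ d.1 ∧ d.1 ≤ q.length + 1) (hd2 : 1 ≤ d.2 ∧ d.2 ≤ q.length + 1)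
    (he1 : 1 ≤ e.1 ∧ e.1 ≤ q.length + 1) (he2 : 1 ≤ e.2 ∧ e.2 ≤ q.length + 1)
    (hd3 : d.1 ≠ d.2) (he3 : e.1 ≠ e.2) {p : ℝ × ℝ}
    (hpd : p.2 = Y d.1 ∧ p.1 ∈ uIcc (X d.1) (X d.2) ∨ p.1 = X d.2 ∧ p.2 ∈ uIcc (Y d.2) (Y d.1))
    (hpe : p.2 = Y e.1 ∧ p.1 ∈ uIcc (X e.1) (X e.2) ∨ p.1 = X e.2 ∧ p.2 ∈ uIcc (Y e.2) (Y e.1)) :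
    ∃ k, (k = d.1 ∨ k = d.2) ∧ (k = e.1 ∨ k = e.2) ∧ p = (X k, Y k) := by
  have hYinj : ∀ i j, 1 ≤ i ∧ i ≤ q.length + 1 → 1 ≤ j ∧ j ≤ q.length + 1 → Y i = Y j → i = j := by
    intro i j hi hj hij
    by_contra hne
    exact (hS _ (H.mem i hi.1 hi.2) _ (H.mem j hj.1 hj.2)
      fun h => hne (H.inj i j hi.1 hi.2 hj.1 hj.2 (Prod.ext_iff.1 h).1)).2 hij
  have h1 := H.avoids d hd e he hde (by omega) (by omega) (by omega)
  have h2 := H.avoids e he d hd hde.symm (by omega) (by omega) (by omega)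
  rcases hpd with ⟨hp, hp'⟩ | ⟨hp, hp'⟩ <;> rcases hpe with ⟨hp₂, hp₂'⟩ | ⟨hp₂, hp₂'⟩
  · have h := hYinj _ _ hd1 he1 (hp.symm.trans hp₂)
    have h1 := mt (h1 (by omega)) (not_not.2 (by rw [h]; exact right_mem_uIcc))
    have h2 := mt (h2 (by omega)) (not_not.2 (by rw [h]; exact right_mem_uIcc))
    refine ⟨d.1, Or.inl rfl, Or.inl h, Prod.ext ?_ hp⟩
    rw [← h] at h2 hp₂'
    exact eq_of_mem_uIcc_of_mem_uIcc hp' hp₂' h2 h1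
  · by_cases h : d.1 = e.2
    · exact ⟨d.1, Or.inl rfl, Or.inr h, Prod.ext (by rw [hp₂, h]) hp⟩
    · exact absurd (hp ▸ hp₂') (h1 h (hp₂ ▸ hp'))
  · by_cases h : e.1 = d.2
    · exact ⟨e.1, Or.inr h, Or.inl rfl, Prod.ext (by rw [hp, h]) hp₂⟩
    · exact absurd (hp₂ ▸ hp') (h2 h (hp ▸ hp₂'))
  · have h := H.inj _ _ hd2.1 hd2.2 he2.1 he2.2 (hp.symm.trans hp₂)
    have h1 := h1 (by omega) (by rw [h]; exact right_mem_uIcc)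
    have h2 := h2 (by omega) (by rw [h]; exact right_mem_uIcc)
    refine ⟨d.2, Or.inr rfl, Or.inr h, Prod.ext hp ?_⟩
    rw [← h] at h1 hp₂'
    exact eq_of_mem_uIcc_of_mem_uIcc hp' hp₂' h1 h2

theorem mem_uIcc_of_mem_segment {a b p : ℝ × ℝ} (h : p ∈ segment ℝ a b) :
    p.1 ∈ uIcc a.1 b.1 ∧ p.2 ∈ uIcc a.2 b.2 := by
  rw [← segment_eq_uIcc, ← segment_eq_uIcc]
  exact Prod.segment_subset a b h

theorem exists_box (S : Finset (ℝ × ℝ)) :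
    ∃ M : ℝ, ∀ p ∈ S, (-M < p.1 ∧ p.1 < M) ∧ -M < p.2 ∧ p.2 < M := by
  refine ⟨∑ p ∈ S, (|p.1| + |p.2|) + 1, fun p hp => ?_⟩
  have h := Finset.single_le_sum (f := fun p : ℝ × ℝ => |p.1| + |p.2|)
    (fun p _ => by positivity) hp
  have := abs_nonneg p.1
  have := abs_nonneg p.2
  exact ⟨abs_lt.1 (by linarith), abs_lt.1 (by linarith)⟩

theorem RayEmbeds.hasLEmbedding {V : Type*} {G : SimpleGraph V} {q : List ℕ} {R : ℕ × ℕ → Prop}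
    (h : RayEmbeds q R) (hq : q.length + 1 ≤ 12) {f : V → ℕ} (hf : Function.Injective f)
    (hfq : ∀ v, 1 ≤ f v ∧ f v ≤ q.length + 1)
    (hadj : ∀ u v, G.Adj u v → (f u, f v) ∈ codeEdges q ∨ (f v, f u) ∈ codeEdges q)
    {S : Finset (ℝ × ℝ)} (hS : IsPointSet S) (hc : S.card = q.length + 1) :
    HasLEmbedding G S := by
  classical
  obtain ⟨M, hM⟩ := exists_box S
  obtain ⟨X, Y, D, H⟩ := h S hS hc _ _ _ _ hM
  obtain ⟨c, hc⟩ : ∃ c : V → V → ℝ × ℝ, c = fun u v =>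
      if D (min (f u) (f v), max (f u) (f v)) then (X (max (f u) (f v)), Y (min (f u) (f v)))
      else (X (min (f u) (f v)), Y (max (f u) (f v))) := ⟨_, rfl⟩
  have hcomm : ∀ u v, c u v = c v u := by
    intro u v
    rw [hc]
    simp only [min_comm (f u), max_comm (f u)]
  have hD : ∀ u v, G.Adj u v → D (f u, f v) ∧ c u v = (X (f v), Y (f u)) ∨
      D (f v, f u) ∧ c u v = (X (f u), Y (f v)) := by
    intro u v huv
    have hsym : D (f u, f v) ∨ D (f v, f u) := by
      rcases hadj u v huv with he | he
      · exact H.edge _ he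
      · exact (H.edge _ he).symm
    rw [hc]
    simp only
    rcases le_total (f u) (f v) with hle | hle
    · rw [min_eq_left hle, max_eq_right hle]
      split_ifs with hd
      · exact Or.inl ⟨hd, rfl⟩
      · exact Or.inr ⟨hsym.resolve_left hd, rfl⟩
    · rw [min_eq_right hle, max_eq_left hle]
      split_ifs with hd
      · exact Or.inr ⟨hd, rfl⟩
      · exact Or.inl ⟨hsym.resolve_right hd, rfl⟩
  refine ⟨fun v => (X (f v), Y (f v)), c, fun u v huv => hf ?_, fun v => ?_, hcomm, ?_, ?_⟩
  · exact H.inj _ _ (hfq u).1 (hfq u).2 (hfq v).1 (hfq v).2 (Prod.ext_iff.1 huv).1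
  · exact H.mem _ (hfq v).1 (hfq v).2
  · intro u v huv
    rcases hD u v huv with h | h
    · exact Or.inr h.2
    · exact Or.inl h.2
  · have hmem : ∀ u v, G.Adj u v → ∃ u' v', (u' = u ∧ v' = v ∨ u' = v ∧ v' = u) ∧
        D (f u', f v') ∧ ∀ p ∈ LDraw (fun v => (X (f v), Y (f v))) c u v,
          p.2 = Y (f u') ∧ p.1 ∈ uIcc (X (f u')) (X (f v')) ∨
          p.1 = X (f v') ∧ p.2 ∈ uIcc (Y (f v')) (Y (f u')) := by
      intro u v huv
      rcases hD u v huv with h | h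
      · refine ⟨u, v, Or.inl ⟨rfl, rfl⟩, h.1, fun p hp => ?_⟩
        rw [LDraw, h.2] at hp
        rcases hp with hp | hp <;> have hp := mem_uIcc_of_mem_segment hp <;>
          simp only [uIcc_self, mem_singleton_iff] at hp
        · exact Or.inl ⟨hp.2, hp.1⟩
        · exact Or.inr ⟨hp.1, uIcc_comm (Y (f u)) _ ▸ hp.2⟩
      · refine ⟨v, u, Or.inr ⟨rfl, rfl⟩, h.1, fun p hp => ?_⟩
        rw [LDraw, h.2] at hp
        rcases hp with hp | hp <;> have hp := mem_uIcc_of_mem_segment hp <;>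
          simp only [uIcc_self, mem_singleton_iff] at hp
        · exact Or.inr hp
        · exact Or.inl ⟨hp.2, uIcc_comm (X (f u)) _ ▸ hp.1⟩
    intro u v a b huv hab hne p hp
    obtain ⟨u', v', h1, h2, h3⟩ := hmem u v huv
    obtain ⟨a', b', h4, h5, h6⟩ := hmem a b hab
    have huv' : u' ≠ v' := by
      have := huv.ne
      grind
    have hab' : a' ≠ b' := by
      have := hab.ne
      grind
    obtain ⟨k, hk1, hk2, hk3⟩ := H.meet hS hq h2 h5 (by
        intro heq
        simp only [Prod.mk.injEq] at heq
        have := hf heq.1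
        have := hf heq.2
        apply hne
        rw [Sym2.eq_iff]
        grind) (hfq _) (hfq _) (hfq _) (hfq _) (hf.ne huv') (hf.ne hab') (h3 p hp.1) (h6 p hp.2)
    obtain ⟨w, rfl⟩ : ∃ w, k = f w := by
      rcases hk1 with rfl | rfl
      · exact ⟨_, rfl⟩
      · exact ⟨_, rfl⟩
    simp only [hf.eq_iff] at hk1 hk2
    exact ⟨w, by grind, by grind, hk3⟩

/-- The `a`-th binary digit of `A`. -/
def hasBit (A a : ℕ) : Bool := Nat.beq (Nat.land 1 (Nat.shiftRight A a)) 1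

/-- The ones in all sixteen-bit lanes. -/
def laneUnits : ℕ := 0x0001000100010001000100010001000100010001000100010001000100010001

/-- `U` stores a relation on `{0, …, 15}` as a `16 × 16` bit matrix; add the arrow from `i` to `j`
and close under transitivity. -/
def addArrow (U i j : ℕ) : ℕ :=
  Nat.lor U (Nat.mul
    (Nat.lor (Nat.land (Nat.shiftRight U i) laneUnits) (Nat.shiftLeft 1 (Nat.mul 16 i)))
    (Nat.lor (Nat.mod (Nat.shiftRight U (Nat.mul 16 j)) 65536) (Nat.shiftLeft 1 j)))

/-- Record in `P`, in all lanes strictly between `h` and `v`, that the horizontal segment of `h`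
passes there. -/
def addCross (P h v : ℕ) : ℕ :=
  Nat.lor P (Nat.shiftLeft (Nat.land laneUnits
    (Nat.add (Nat.sub (Nat.shiftLeft 1 (Nat.mul 16 v)) (Nat.shiftLeft 65536 (Nat.mul 16 h)))
      (Nat.sub (Nat.shiftLeft 1 (Nat.mul 16 h)) (Nat.shiftLeft 65536 (Nat.mul 16 v))))) h)

/-- Record in lane `v` of `Q` that the horizontal segment of `h` ends there. -/
def addEnd (Q h v : ℕ) : ℕ := Nat.lor Q (Nat.shiftLeft 1 (Nat.add (Nat.mul 16 v) h))

/-- Every digit `1` of `M` is one of `A`. -/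
def contains (A M : ℕ) : Bool := Nat.beq (Nat.land A M) M

/-- For every oriented edge `(h, v)` of `E`, the relations `U` (below) and `W` (above) imply that no
other horizontal segment recorded in lane `v` of `P` or `Q` is at a height between `h` and `v`. -/
def clearAll (U W P Q : ℕ) (E : List (ℕ × ℕ)) : Bool :=
  List.rec true (fun e _ ih =>
    (fun h v =>
      bif contains
        (Nat.lor (Nat.land (Nat.shiftRight U h) (Nat.shiftRight U v))
          (Nat.land (Nat.shiftRight W h) (Nat.shiftRight W v)))
        (Nat.mod (Nat.lor (Nat.shiftRight P v)
          (Nat.xor (Nat.shiftRight Q v) (Nat.shiftLeft 1 e.1))) 65536)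
      then ih else false)
    (Nat.mul 16 e.1) (Nat.mul 16 e.2)) E

/-- The `i`-th hexadecimal digit of `π`. -/
def nibble (π i : ℕ) : ℕ := Nat.mod (Nat.shiftRight π (Nat.mul 4 i)) 16

/-- Read the position and the orientation of the vertex `i` with parent `p` from `s`.  The digits of
`π` are the positions of the earlier vertices, those of `av` the free positions, and the edges drawn
so far are in `D`, `P` and `Q`. -/
def extend (m p : ℕ) (k : ℕ → ℕ → ℕ → ℕ → ℕ → ℕ → List (ℕ × ℕ) → ℕ → Bool)
    (i π av used P Q : ℕ) (D : List (ℕ × ℕ)) (s : ℕ) : Bool :=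
  (fun r s₁ =>
    (fun d =>
      (fun pt pp av' =>
        bif hasBit used pt then false else
        bif Nat.beq (Nat.mod s 2) 1 then
          k (Nat.succ i) (Nat.add π (Nat.shiftLeft pt (Nat.mul 4 i))) av'
            (Nat.lor used (Nat.shiftLeft 1 pt)) (addCross P pt pp) (addEnd Q pt pp)
            ((pt, pp) :: D) (Nat.div s₁ r)
        else
          k (Nat.succ i) (Nat.add π (Nat.shiftLeft pt (Nat.mul 4 i))) av'
            (Nat.lor used (Nat.shiftLeft 1 pt)) (addCross P pp pt) (addEnd Q pp pt)
            ((pp, pt) :: D) (Nat.div s₁ r))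
      (nibble av d) (nibble π p)
      (Nat.add (Nat.mod av (Nat.shiftLeft 1 (Nat.mul 4 d)))
        (Nat.shiftLeft (Nat.shiftRight av (Nat.mul 4 (Nat.succ d))) (Nat.mul 4 d))))
    (Nat.mod s₁ r))
  (Nat.sub (Nat.succ m) i) (Nat.div s 2)

/-- Read the positions of all vertices and the orientations of all edges of `q` from `s`. -/
def place (m : ℕ) (q : List ℕ) :
    (ℕ → ℕ → ℕ → ℕ → ℕ → ℕ → List (ℕ × ℕ) → ℕ → Bool) → ℕ → Bool :=
  List.rec
    (fun k s =>
      (fun pt => k 2 (Nat.shiftLeft pt 4)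
        (Nat.add (Nat.mod 0xCBA987654321 (Nat.shiftLeft 1 (Nat.mul 4 (Nat.pred pt))))
          (Nat.shiftLeft (Nat.shiftRight 0xCBA987654321 (Nat.mul 4 pt)) (Nat.mul 4 (Nat.pred pt))))
        (Nat.lor (Nat.sub 65537 (Nat.shiftLeft 2 m)) (Nat.shiftLeft 1 pt)) 0 0 [] (Nat.div s m))
      (Nat.succ (Nat.mod s m)))
    (fun p _ ih k s => ih (extend m p k) s) q

/-- Add the rays `R` to the drawing. -/
def addRays (π : ℕ) (R : List (ℕ × ℕ)) (k : ℕ → ℕ → List (ℕ × ℕ) → Bool) :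
    ℕ → ℕ → List (ℕ × ℕ) → Bool :=
  List.rec k (fun r _ ih P Q D =>
    (fun pt =>
      bif Nat.ble 14 r.2 then ih P (addEnd Q r.2 pt) ((r.2, pt) :: D)
      else ih (addCross P pt r.2) Q D)
    (nibble π r.1)) R

/-- The points are numbered from left to right.  The decision tree `s` branches on the vertical
order of pairs of points, and each leaf is a drawing of `q` with the rays `R`. -/
def search (m : ℕ) (q : List ℕ) (R : List (ℕ × ℕ)) (fuel : ℕ) :
    ℕ → ℕ → (ℕ → Bool) → ℕ → Bool :=
  Nat.rec (fun _ _ _ _ => false) (fun _ ih U W k s =>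
    bif Nat.beq (Nat.mod s 2) 0 then
      place m q (fun _ π _ _ P Q D s' =>
        addRays π R (fun P Q D => bif clearAll U W P Q D then k s' else false) P Q D) (Nat.div s 2)
    else
      (fun s₁ =>
        (fun i j =>
          bif Nat.beq i j then false else
          ih (addArrow U i j) (addArrow W j i)
            (fun s' => ih (addArrow U j i) (addArrow W i j) k s')
            (Nat.div s₁ (Nat.mul m m)))
        (Nat.succ (Nat.mod s₁ m)) (Nat.succ (Nat.mod (Nat.div s₁ m) m)))
      (Nat.div s 2)) fuel

/-- Every point lies below the node `14` and above the node `15`. -/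
def initialUp (m : ℕ) : ℕ :=
  Nat.rec (addArrow 0 15 14) (fun k U => addArrow (addArrow U 15 (Nat.succ k)) (Nat.succ k) 14) m

/-- The converse relation of `initialUp m`. -/
def initialDown (m : ℕ) : ℕ :=
  Nat.rec (addArrow 0 14 15) (fun k U => addArrow (addArrow U (Nat.succ k) 15) 14 (Nat.succ k)) m

/-- `s` is a decision tree that shows how to draw `q` with the rays `R` in all point sets. -/
def checkBase (q : List ℕ) (R : List (ℕ × ℕ)) (s : ℕ) : Bool :=
  search (Nat.succ q.length) q R 70 (initialUp (Nat.succ q.length))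
    (initialDown (Nat.succ q.length)) (fun s' => Nat.beq s' 0) s

theorem hasBit_eq_testBit (A a : ℕ) : hasBit A a = A.testBit a := by
  have h : Nat.land 1 (Nat.shiftRight A a) = 1 &&& (A >>> a) := rfl
  rw [hasBit, h, Nat.testBit, Nat.one_and_eq_mod_two]
  rcases Nat.mod_two_eq_zero_or_one (A >>> a) with h | h <;> rw [h] <;> rfl

/-- All bits of `U` are arrows of the relation `r`. -/
def Sound (r : ℕ → ℕ → Prop) (U : ℕ) : Prop :=
  ∀ k l, l < 16 → U.testBit (16 * k + l) → r k l

theorem mul_eq_of_lanes {A : ℕ} (B : ℕ) (hA : ∀ p, A.testBit p → 16 ∣ p) :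
    A * B = 2 ^ 16 * (A / 2 ^ 16 * B) + (A.testBit 0).toNat * B := by
  have hbit : A % 2 ^ 16 = (A.testBit 0).toNat := by
    apply Nat.eq_of_testBit_eq
    intro p
    rw [Nat.testBit_mod_two_pow]
    rcases Nat.eq_zero_or_pos p with rfl | hp
    · cases A.testBit 0 <;> rfl
    · have h1 : (A.testBit 0).toNat.testBit p = false := by
        cases A.testBit 0
        · simp
        · exact eq_false_of_ne_true (Nat.testBit_one_eq_true_iff_self_eq_zero.not.2 (by omega))
      rw [h1]
      by_contra hne
      have := hA p (by grind)
      grind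
  conv_lhs => rw [← Nat.div_add_mod A (2 ^ 16), hbit]
  ring

theorem testBit_of_testBit_lane_mul {A B l : ℕ} (hB : B < 2 ^ 16) (hl : l < 16) (k : ℕ)
    (hA : ∀ p, A.testBit p → 16 ∣ p) (h : (A * B).testBit (16 * k + l)) :
    A.testBit (16 * k) ∧ B.testBit l := by
  have hlt : ∀ a : Bool, a.toNat * B < 2 ^ 16 := by
    rintro (_ | _)
    · simp
    · rwa [Bool.toNat_true, one_mul]
  induction k generalizing A with
  | zero =>
    rw [mul_eq_of_lanes B hA, Nat.testBit_two_pow_mul_add _ (hlt _), if_pos (by omega)] at h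
    cases h0 : A.testBit 0 <;> simp_all
  | succ k ih =>
    rw [mul_eq_of_lanes B hA, Nat.testBit_two_pow_mul_add _ (hlt _), if_neg (by omega),
      show 16 * (k + 1) + l - 16 = 16 * k + l by omega] at h
    have := ih (fun p hp => by
      rw [Nat.testBit_div_two_pow] at hp
      have := hA _ hp
      omega) h
    rw [Nat.testBit_div_two_pow] at this
    rwa [show 16 * (k + 1) = 16 * k + 16 by omega]

theorem testBit_laneUnits {p : ℕ} (h : laneUnits.testBit p) : 16 ∣ p := by
  by_cases hp : p < 256
  · have : ∀ p < 256, laneUnits.testBit p → 16 ∣ p := by decide +kernel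
    exact this p hp h
  · rw [Nat.testBit_lt_two_pow (lt_of_lt_of_le (by norm_num [laneUnits])
      (Nat.pow_le_pow_right two_pos (not_lt.1 hp)))] at h
    cases h

theorem Sound.addArrow {r : ℕ → ℕ → Prop} (htrans : ∀ a b c, r a b → r b c → r a c) {U i j : ℕ}
    (hU : Sound r U) (hi : i < 16) (hj : j < 16) (hij : r i j) : Sound r (addArrow U i j) := by
  intro k l hl h
  have hdef : _root_.addArrow U i j = U ||| ((U >>> i &&& laneUnits) ||| 1 <<< (16 * i)) *
      ((U >>> (16 * j) % 65536) ||| 1 <<< j) := rfl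
  rw [hdef, Nat.testBit_or, Bool.or_eq_true] at h
  rcases h with h | h
  · exact hU k l hl h
  have hB : (U >>> (16 * j) % 65536) ||| 1 <<< j < 2 ^ 16 := by
    apply Nat.or_lt_two_pow
    · exact Nat.mod_lt _ (by norm_num)
    · rw [Nat.one_shiftLeft]
      exact Nat.pow_lt_pow_right (by norm_num) hj
  obtain ⟨h1, h2⟩ := testBit_of_testBit_lane_mul hB hl k (by
    intro p hp
    rw [Nat.testBit_or, Bool.or_eq_true, Nat.testBit_and, Bool.and_eq_true, Nat.one_shiftLeft,
      Nat.testBit_two_pow, decide_eq_true_eq] at hp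
    rcases hp with hp | hp
    · exact testBit_laneUnits hp.2
    · omega) h
  rw [Nat.testBit_or, Bool.or_eq_true, Nat.testBit_and, Bool.and_eq_true, Nat.one_shiftLeft,
    Nat.testBit_two_pow, decide_eq_true_eq, Nat.testBit_shiftRight, add_comm] at h1
  rw [Nat.testBit_or, Bool.or_eq_true, Nat.one_shiftLeft, Nat.testBit_two_pow, decide_eq_true_eq,
    show (65536 : ℕ) = 2 ^ 16 by norm_num, Nat.testBit_mod_two_pow, Bool.and_eq_true,
    Nat.testBit_shiftRight] at h2
  have hkj : r k j := by
    rcases h1 with h1 | h1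
    · exact htrans _ _ _ (hU k i hi h1.1) hij
    · rwa [show k = i by omega]
  rcases h2 with h2 | h2
  · exact htrans _ _ _ hkj (hU j l hl h2.2)
  · rwa [← h2]

theorem testBit_addCross {P h v c : ℕ} (hh : h < 16) (hv : v < 16)
    (hc : h < c ∧ c < v ∨ v < c ∧ c < h) : (addCross P h v).testBit (16 * c + h) := by
  have key : ∀ h < 16, ∀ v < 16, ∀ c < 16, h < c ∧ c < v ∨ v < c ∧ c < h →
      (addCross 0 h v).testBit (16 * c + h) := by decide +kernel
  have := key h hh v hv c (by omega) hc
  have h0 : addCross P h v = P ||| addCross 0 h v := by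
    have : addCross 0 h v = 0 ||| _ := rfl
    rw [this, Nat.zero_or]
    rfl
  rw [h0, Nat.testBit_or, this, Bool.or_true]

theorem testBit_addCross_of_testBit {P h v a : ℕ} (ha : P.testBit a) :
    (addCross P h v).testBit a := by
  have h0 : addCross P h v = P ||| _ := rfl
  rw [h0, Nat.testBit_or, ha, Bool.true_or]

theorem testBit_addEnd {Q h v : ℕ} : (addEnd Q h v).testBit (16 * v + h) := by
  have h0 : addEnd Q h v = Q ||| 1 <<< (16 * v + h) := rfl
  rw [h0, Nat.testBit_or, Nat.one_shiftLeft, Nat.testBit_two_pow_self, Bool.or_true]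

theorem testBit_addEnd_of_testBit {Q h v a : ℕ} (ha : Q.testBit a) : (addEnd Q h v).testBit a := by
  have h0 : addEnd Q h v = Q ||| _ := rfl
  rw [h0, Nat.testBit_or, ha, Bool.true_or]

theorem testBit_of_contains {A M a : ℕ} (h : contains A M) (ha : M.testBit a) : A.testBit a := by
  have h : A &&& M = M := Nat.eq_of_beq_eq_true h
  rw [← h, Nat.testBit_and, Bool.and_eq_true] at ha
  exact ha.1

/-- In every lane `e.2` with `e ∈ E`, the registered nodes other than `e.1` lie, according to `U`
and `W`, on the same side of both ends of `e`. -/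
theorem testBit_of_clearAll {U W P Q : ℕ} {E : List (ℕ × ℕ)} (h : clearAll U W P Q E)
    {e : ℕ × ℕ} (he : e ∈ E) {a : ℕ} (ha : a < 16)
    (hPQ : P.testBit (16 * e.2 + a) ∨ Q.testBit (16 * e.2 + a) ∧ a ≠ e.1) :
    U.testBit (16 * e.1 + a) ∧ U.testBit (16 * e.2 + a) ∨
      W.testBit (16 * e.1 + a) ∧ W.testBit (16 * e.2 + a) := by
  induction E with
  | nil => cases he
  | cons e' E ih =>
    have hdef : clearAll U W P Q (e' :: E) = bif contains
        ((U >>> (16 * e'.1) &&& U >>> (16 * e'.2)) ||| (W >>> (16 * e'.1) &&& W >>> (16 * e'.2)))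
        ((P >>> (16 * e'.2) ||| (Q >>> (16 * e'.2) ^^^ 1 <<< e'.1)) % 65536)
        then clearAll U W P Q E else false := rfl
    rw [hdef, Bool.cond_false_right, Bool.and_eq_true] at h
    rcases List.mem_cons.1 he with rfl | he
    · have := testBit_of_contains (a := a) h.1 (by
        rw [show (65536 : ℕ) = 2 ^ 16 by norm_num, Nat.testBit_mod_two_pow, Nat.testBit_or,
          Nat.testBit_xor, Nat.testBit_shiftRight, Nat.testBit_shiftRight, Nat.one_shiftLeft,
          Nat.testBit_two_pow]
        grind)
      simpa only [Nat.testBit_or, Nat.testBit_and, Nat.testBit_shiftRight, Bool.or_eq_true,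
        Bool.and_eq_true] using this
    · exact ih h.2 he

/-- The oriented edge `d` has been entered in the tables `P` and `Q` and in the list `E`. -/
def Recorded (P Q : ℕ) (E : List (ℕ × ℕ)) (d : ℕ × ℕ) : Prop :=
  (d.1 ≤ 12 → (∀ c, d.1 < c ∧ c < d.2 ∨ d.2 < c ∧ c < d.1 → P.testBit (16 * c + d.1)) ∧
    (d.2 ≠ 0 → d.2 ≤ 12 → Q.testBit (16 * d.2 + d.1))) ∧
  (d.2 ≠ 0 → d.2 ≤ 12 → d ∈ E)

theorem Recorded.mono {P Q P' Q' : ℕ} {E E' : List (ℕ × ℕ)} {d : ℕ × ℕ} (h : Recorded P Q E d)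
    (hP : ∀ a, P.testBit a → P'.testBit a) (hQ : ∀ a, Q.testBit a → Q'.testBit a)
    (hE : ∀ e, e ∈ E → e ∈ E') : Recorded P' Q' E' d :=
  ⟨fun h1 => ⟨fun c hc => hP _ ((h.1 h1).1 c hc), fun h2 h3 => hQ _ ((h.1 h1).2 h2 h3)⟩,
    fun h2 h3 => hE _ (h.2 h2 h3)⟩

theorem Recorded.add {P Q : ℕ} {E : List (ℕ × ℕ)} {d : ℕ × ℕ} (h : Recorded P Q E d) (a b : ℕ) :
    Recorded (addCross P a b) (addEnd Q a b) ((a, b) :: E) d :=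
  h.mono (fun _ => testBit_addCross_of_testBit) (fun _ => testBit_addEnd_of_testBit)
    fun _ => List.mem_cons_of_mem _

theorem recorded_add {P Q : ℕ} {E : List (ℕ × ℕ)} {a b : ℕ} (ha : a < 16) (hb : b < 16) :
    Recorded (addCross P a b) (addEnd Q a b) ((a, b) :: E) (a, b) :=
  ⟨fun _ => ⟨fun _ hc => testBit_addCross ha hb hc, fun _ _ => testBit_addEnd⟩,
    fun _ _ => List.mem_cons_self⟩

theorem nibble_lt (π i : ℕ) : nibble π i < 16 := Nat.mod_lt _ (by norm_num)

theorem nibble_add_shiftLeft_self {π a i : ℕ} (hπ : π < 16 ^ i) (ha : a < 16) :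
    nibble (Nat.add π (Nat.shiftLeft a (Nat.mul 4 i))) i = a := by
  change (π + a <<< (4 * i)) >>> (4 * i) % 16 = a
  rw [Nat.shiftRight_eq_div_pow, Nat.shiftLeft_eq, pow_mul, show 2 ^ 4 = 16 by norm_num,
    Nat.add_mul_div_right _ _ (by positivity), Nat.div_eq_of_lt hπ, zero_add, Nat.mod_eq_of_lt ha]

theorem nibble_add_shiftLeft_of_lt {π a i j : ℕ} (hj : j < i) :
    nibble (Nat.add π (Nat.shiftLeft a (Nat.mul 4 i))) j = nibble π j := by
  change (π + a <<< (4 * i)) >>> (4 * j) % 16 = π >>> (4 * j) % 16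
  obtain ⟨k, rfl⟩ := Nat.exists_eq_add_of_lt hj
  rw [Nat.shiftRight_eq_div_pow, Nat.shiftRight_eq_div_pow, Nat.shiftLeft_eq,
    show a * 2 ^ (4 * (j + k + 1)) = 16 * (a * 2 ^ (4 * k)) * 2 ^ (4 * j) by ring,
    Nat.add_mul_div_right _ _ (by positivity), Nat.add_mul_mod_self_left]

/-- The vertices of `q` sit in the points `1, …, m` stored in `π`, and all edges are recorded. -/
structure Placed (m : ℕ) (q : List ℕ) (π used P Q : ℕ) (E : List (ℕ × ℕ)) : Prop where
  lt : π < 16 ^ (q.length + 2)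
  mem : ∀ j, 1 ≤ j → j ≤ q.length + 1 → 1 ≤ nibble π j ∧ nibble π j ≤ m
  inj : ∀ i j, 1 ≤ i → i ≤ q.length + 1 → 1 ≤ j → j ≤ q.length + 1 → nibble π i = nibble π j → i = j
  used_nibble : ∀ j, 1 ≤ j → j ≤ q.length + 1 → used.testBit (nibble π j)
  unused : ∀ a < 16, ¬used.testBit a → 1 ≤ a ∧ a ≤ m
  edge : ∀ e ∈ codeEdges q, Recorded P Q E (nibble π e.1, nibble π e.2) ∨
    Recorded P Q E (nibble π e.2, nibble π e.1)

theorem Placed.cons {m : ℕ} {q : List ℕ} {π used P Q : ℕ} {E : List (ℕ × ℕ)}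
    (h : Placed m q π used P Q E) (hq : ∀ e ∈ codeEdges q, 1 ≤ e.2 ∧ e.2 < e.1) {p : ℕ}
    (hp : 1 ≤ p ∧ p < q.length + 2) {a b c : ℕ} (ha : a < 16) (hused : ¬used.testBit a)
    (hbc : b = a ∧ c = nibble π p ∨ b = nibble π p ∧ c = a) :
    Placed m (p :: q) (Nat.add π (Nat.shiftLeft a (Nat.mul 4 (q.length + 2))))
      (Nat.lor used (Nat.shiftLeft 1 a)) (addCross P b c) (addEnd Q b c) ((b, c) :: E) := by
  have hself := nibble_add_shiftLeft_self h.lt ha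
  have hlt : ∀ j, j < q.length + 2 → _ = _ := fun j => nibble_add_shiftLeft_of_lt (π := π) (a := a)
  have hor : ∀ k, (Nat.lor used (Nat.shiftLeft 1 a)).testBit k ↔ used.testBit k ∨ a = k := by
    intro k
    change (used ||| 1 <<< a).testBit k ↔ _
    rw [Nat.testBit_or, Bool.or_eq_true, Nat.one_shiftLeft, Nat.testBit_two_pow, decide_eq_true_eq]
  have hlt' : Nat.add π (Nat.shiftLeft a (Nat.mul 4 (q.length + 2))) < 16 ^ (q.length + 3) := by
    change π + a <<< (4 * (q.length + 2)) < _
    rw [Nat.shiftLeft_eq, pow_mul, show 2 ^ 4 = 16 by norm_num, pow_succ 16 (q.length + 2)]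
    have := h.lt
    nlinarith
  generalize Nat.add π (Nat.shiftLeft a (Nat.mul 4 (q.length + 2))) = π' at hself hlt hlt' ⊢
  have hne : ∀ j, 1 ≤ j → j < q.length + 2 → nibble π j ≠ a := by
    rintro j h1 h2 rfl
    exact hused (h.used_nibble j h1 (by omega))
  constructor
  · exact hlt'
  · intro j h1 h2
    rw [List.length_cons] at h2
    rcases Nat.lt_or_ge j (q.length + 2) with hj | hj
    · rw [hlt j hj]
      exact h.mem j h1 (by omega)
    · rw [show j = q.length + 2 by omega, hself]
      exact h.unused a ha hused
  · intro i j h1 h2 h3 h4 hij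
    rw [List.length_cons] at h2 h4
    rcases Nat.lt_or_ge i (q.length + 2) with hi | hi <;>
      rcases Nat.lt_or_ge j (q.length + 2) with hj | hj
    · rw [hlt i hi, hlt j hj] at hij
      exact h.inj i j h1 (by omega) h3 (by omega) hij
    · rw [hlt i hi, show j = q.length + 2 by omega, hself] at hij
      exact absurd hij (hne i h1 hi)
    · rw [hlt j hj, show i = q.length + 2 by omega, hself] at hij
      exact absurd hij.symm (hne j h3 hj)
    · omega
  · intro j h1 h2
    rw [List.length_cons] at h2
    rw [hor]
    rcases Nat.lt_or_ge j (q.length + 2) with hj | hj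
    · rw [hlt j hj]
      exact Or.inl (h.used_nibble j h1 (by omega))
    · rw [show j = q.length + 2 by omega, hself]
      exact Or.inr rfl
  · intro k hk hk'
    rw [hor, not_or] at hk'
    exact h.unused k hk hk'.1
  · intro e he
    rcases List.mem_cons.1 he with rfl | he
    · have hb : b < 16 ∧ c < 16 := by
        have := nibble_lt π p
        omega
      have := recorded_add (P := P) (Q := Q) (E := E) hb.1 hb.2
      simp only [hself, hlt p hp.2]
      rcases hbc with ⟨rfl, rfl⟩ | ⟨rfl, rfl⟩
      · exact Or.inl this
      · exact Or.inr this
    · have h1 := (bounds_of_mem_codeEdges he).2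
      have h2 := hq e he
      rw [hlt e.1 (by omega), hlt e.2 (by omega)]
      exact (h.edge e he).imp (fun h => h.add b c) fun h => h.add b c

theorem exists_placed_of_extend {m p : ℕ} {q : List ℕ}
    {k : ℕ → ℕ → ℕ → ℕ → ℕ → ℕ → List (ℕ × ℕ) → ℕ → Bool} {π av used P Q : ℕ}
    {E : List (ℕ × ℕ)} {s : ℕ} (h : Placed m q π used P Q E)
    (hq : ∀ e ∈ codeEdges q, 1 ≤ e.2 ∧ e.2 < e.1) (hp : 1 ≤ p ∧ p < q.length + 2)
    (hk : extend m p k (q.length + 2) π av used P Q E s) :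
    ∃ π av used P Q E s, Placed m (p :: q) π used P Q E ∧
      k (q.length + 3) π av used P Q E s := by
  unfold extend at hk
  simp only [hasBit_eq_testBit] at hk
  cases hb : used.testBit (nibble av (s.div 2 |>.mod (Nat.sub (Nat.succ m) (q.length + 2))))
  · rw [hb, cond_false] at hk
    have hb := (Bool.eq_false_iff.1 hb)
    cases ho : Nat.beq (s.mod 2) 1
    · rw [ho, cond_false] at hk
      exact ⟨_, _, _, _, _, _, _,
        h.cons hq hp (nibble_lt _ _) hb (Or.inr ⟨rfl, rfl⟩), hk⟩
    · rw [ho, cond_true] at hk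
      exact ⟨_, _, _, _, _, _, _,
        h.cons hq hp (nibble_lt _ _) hb (Or.inl ⟨rfl, rfl⟩), hk⟩
  · rw [hb, cond_true] at hk
    cases hk

theorem exists_placed_of_place {m : ℕ} (hm : 1 ≤ m) (hm' : m ≤ 12) {q : List ℕ}
    (hq : ∀ e ∈ codeEdges q, 1 ≤ e.2 ∧ e.2 < e.1)
    {k : ℕ → ℕ → ℕ → ℕ → ℕ → ℕ → List (ℕ × ℕ) → ℕ → Bool} {s : ℕ} (h : place m q k s) :
    ∃ π av used P Q E s, Placed m q π used P Q E ∧ k (q.length + 2) π av used P Q E s := by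
  induction q generalizing k with
  | nil =>
    obtain ⟨a, ha, av, s', hk⟩ : ∃ a, a = (s % m).succ ∧ ∃ av s', k 2 (Nat.shiftLeft a 4) av
      (Nat.lor (Nat.sub 65537 (Nat.shiftLeft 2 m)) (Nat.shiftLeft 1 a)) 0 0 [] s' :=
      ⟨_, rfl, _, _, h⟩
    have ham : 1 ≤ a ∧ a ≤ m := by
      have := Nat.mod_lt s hm
      omega
    have hnib : nibble (Nat.shiftLeft a 4) 1 = a := by
      change a <<< 4 >>> 4 % 16 = a
      rw [Nat.shiftLeft_shiftRight, Nat.mod_eq_of_lt (by omega)]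
    have hor : ∀ k, (Nat.lor (Nat.sub 65537 (Nat.shiftLeft 2 m)) (Nat.shiftLeft 1 a)).testBit k ↔
        (65537 - 2 <<< m).testBit k ∨ a = k := by
      intro k
      change ((65537 - 2 <<< m) ||| 1 <<< a).testBit k ↔ _
      rw [Nat.testBit_or, Bool.or_eq_true, Nat.one_shiftLeft, Nat.testBit_two_pow,
        decide_eq_true_eq]
    refine ⟨_, _, _, _, _, _, _, ⟨?_, ?_, ?_, ?_, ?_, ?_⟩, hk⟩
    · change a <<< 4 < 16 ^ 2
      rw [Nat.shiftLeft_eq]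
      omega
    · intro j h1 h2
      rwa [show j = 1 from le_antisymm h2 h1, hnib]
    · intro i j h1 h2 h3 h4 _
      exact (le_antisymm h2 h1).trans (le_antisymm h4 h3).symm
    · intro j h1 h2
      rw [show j = 1 from le_antisymm h2 h1, hnib, hor]
      exact Or.inr rfl
    · intro j hj hj'
      have key : ∀ m ≤ 12, ∀ j < 16, ¬(65537 - 2 <<< m).testBit j → 1 ≤ j ∧ j ≤ m := by
        decide +kernel
      rw [hor, not_or] at hj'
      exact key m hm' j hj hj'.1
    · intro e he
      cases he
  | cons p q ih =>
    have hp := hq (q.length + 2, p) List.mem_cons_self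
    have hq' : ∀ e ∈ codeEdges q, 1 ≤ e.2 ∧ e.2 < e.1 :=
      fun e he => hq e (List.mem_cons_of_mem _ he)
    obtain ⟨π, av, used, P, Q, E, s', h1, h2⟩ := ih hq' (k := extend m p k) h
    exact exists_placed_of_extend h1 hq' hp h2

/-- The oriented edge towards a side `r.2` of the box that starts in the vertex `r.1`. -/
def rayEdge (π : ℕ) (r : ℕ × ℕ) : ℕ × ℕ :=
  if 14 ≤ r.2 then (r.2, nibble π r.1) else (nibble π r.1, r.2)

theorem exists_recorded_of_addRays {π : ℕ} {R : List (ℕ × ℕ)} (hR : ∀ r ∈ R, r.2 = 0 ∨ 13 ≤ r.2)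
    (hR' : ∀ r ∈ R, r.2 < 16) {k : ℕ → ℕ → List (ℕ × ℕ) → Bool} {P Q : ℕ} {E : List (ℕ × ℕ)}
    (h : addRays π R k P Q E) :
    ∃ P' Q' E', (∀ d, Recorded P Q E d → Recorded P' Q' E' d) ∧
      (∀ r ∈ R, Recorded P' Q' E' (rayEdge π r)) ∧ k P' Q' E' := by
  induction R generalizing P Q E with
  | nil => exact ⟨P, Q, E, fun _ => id, by simp, h⟩
  | cons r R ih =>
    have hdef : addRays π (r :: R) k P Q E = bif Nat.ble 14 r.2 then
      addRays π R k P (addEnd Q r.2 (nibble π r.1)) ((r.2, nibble π r.1) :: E)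
      else addRays π R k (addCross P (nibble π r.1) r.2) Q E := rfl
    have ih {P Q E} := @ih (fun r hr => hR r (List.mem_cons_of_mem _ hr))
      (fun r hr => hR' r (List.mem_cons_of_mem _ hr)) P Q E
    have hr := hR r List.mem_cons_self
    have hr' := hR' r List.mem_cons_self
    rw [hdef] at h
    cases hb : Nat.ble 14 r.2
    · rw [hb, cond_false] at h
      have hb : ¬14 ≤ r.2 := fun hle => by simp [Nat.ble_eq_true_of_le hle] at hb
      obtain ⟨P', Q', E', h1, h2, h3⟩ := ih h
      refine ⟨P', Q', E', fun d hd => h1 d (hd.mono (fun _ => testBit_addCross_of_testBit)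
        (fun _ => id) fun _ => id), fun r' hmem => ?_, h3⟩
      rcases List.mem_cons.1 hmem with rfl | hmem
      · apply h1
        rw [rayEdge, if_neg hb]
        exact ⟨fun _ => ⟨fun c hc => testBit_addCross (nibble_lt _ _) hr' hc,
          fun h2 h3 => absurd h3 (by simp only at *; omega)⟩,
          fun h2 h3 => absurd h3 (by simp only at *; omega)⟩
      · exact h2 r' hmem
    · rw [hb, cond_true] at h
      have hb := Nat.le_of_ble_eq_true hb
      obtain ⟨P', Q', E', h1, h2, h3⟩ := ih h
      refine ⟨P', Q', E', fun d hd => h1 d (hd.mono (fun _ => id)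
        (fun _ => testBit_addEnd_of_testBit) fun _ => List.mem_cons_of_mem _), fun r' hmem => ?_, h3⟩
      rcases List.mem_cons.1 hmem with rfl | hmem
      · apply h1
        rw [rayEdge, if_pos hb]
        exact ⟨fun h => absurd h (by simp only; omega), fun _ _ => List.mem_cons_self⟩
      · exact h2 r' hmem

/-- The tree `q` with rays `R` can be drawn on the points `1, …, m`, numbered from left to right,
when the node `k` has height `y k`. -/
def Drawable (m : ℕ) (q : List ℕ) (R : List (ℕ × ℕ)) (y : ℕ → ℝ) : Prop :=
  ∃ (π : ℕ) (D : ℕ × ℕ → Prop),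
    (∀ j, 1 ≤ j → j ≤ q.length + 1 → 1 ≤ nibble π j ∧ nibble π j ≤ m) ∧
    (∀ i j, 1 ≤ i → i ≤ q.length + 1 → 1 ≤ j → j ≤ q.length + 1 →
      nibble π i = nibble π j → i = j) ∧
    (∀ e ∈ codeEdges q, D (nibble π e.1, nibble π e.2) ∨ D (nibble π e.2, nibble π e.1)) ∧
    (∀ r ∈ R, D (rayEdge π r)) ∧
    ∀ d, D d → ∀ e, D e → d ≠ e → d.1 ≤ 12 → e.2 ≠ 0 → e.2 ≤ 12 → d.1 ≠ e.2 →
      e.2 ∈ uIcc d.1 d.2 → y d.1 ∉ uIcc (y e.2) (y e.1)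

theorem drawable_of_place {m : ℕ} (hm : 1 ≤ m) (hm' : m ≤ 12) {q : List ℕ}
    (hq : ∀ e ∈ codeEdges q, 1 ≤ e.2 ∧ e.2 < e.1) {R : List (ℕ × ℕ)}
    (hR : ∀ r ∈ R, r.2 = 0 ∨ 13 ≤ r.2) (hR' : ∀ r ∈ R, r.2 < 16) {U W : ℕ} {k : ℕ → Bool} {s : ℕ}
    (h : place m q (fun _ π _ _ P Q D s' => addRays π R
      (fun P Q D => bif clearAll U W P Q D then k s' else false) P Q D) s) :
    (∀ y : ℕ → ℝ, Sound (fun a b => y a < y b) U → Sound (fun a b => y b < y a) W →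
      Drawable m q R y) ∧ ∃ s', k s' := by
  obtain ⟨π, av, used, P, Q, E, s', hP, h⟩ := exists_placed_of_place hm hm' hq h
  obtain ⟨P', Q', E', h1, h2, h3⟩ := exists_recorded_of_addRays hR hR' h
  rw [Bool.cond_false_right, Bool.and_eq_true] at h3
  refine ⟨fun y hU hW => ⟨π, Recorded P' Q' E', hP.mem, hP.inj, fun e he =>
    (hP.edge e he).imp (h1 _) (h1 _), h2, ?_⟩, s', h3.2⟩
  intro d hd e he hde hd1 he0 he2 hne hmem hy
  have hPQ : P'.testBit (16 * e.2 + d.1) ∨ Q'.testBit (16 * e.2 + d.1) ∧ d.1 ≠ e.1 := by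
    by_cases heq : e.2 = d.2
    · refine Or.inr ⟨?_, fun h => hde (Prod.ext h heq.symm)⟩
      rw [heq] at he0 he2 ⊢
      exact (hd.1 hd1).2 he0 he2
    · refine Or.inl ((hd.1 hd1).1 _ ?_)
      rw [mem_uIcc] at hmem
      omega
  rw [mem_uIcc] at hy
  rcases testBit_of_clearAll h3.1 (he.2 he0 he2) (by omega) hPQ with h | h
  · have := hU _ _ (by omega) h.1
    have := hU _ _ (by omega) h.2
    grind
  · have := hW _ _ (by omega) h.1
    have := hW _ _ (by omega) h.2
    grind

theorem drawable_of_search {m : ℕ} (hm : 1 ≤ m) (hm' : m ≤ 12) {q : List ℕ}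
    (hq : ∀ e ∈ codeEdges q, 1 ≤ e.2 ∧ e.2 < e.1) {R : List (ℕ × ℕ)}
    (hR : ∀ r ∈ R, r.2 = 0 ∨ 13 ≤ r.2) (hR' : ∀ r ∈ R, r.2 < 16) {fuel U W : ℕ} {k : ℕ → Bool}
    {s : ℕ} (h : search m q R fuel U W k s) :
    (∀ y : ℕ → ℝ, (∀ i j, 1 ≤ i → i ≤ m → 1 ≤ j → j ≤ m → y i = y j → i = j) →
      Sound (fun a b => y a < y b) U → Sound (fun a b => y b < y a) W →
      Drawable m q R y) ∧ ∃ s', k s' := by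
  induction fuel generalizing U W k s with
  | zero => cases h
  | succ fuel ih =>
    have hdef : search m q R (fuel + 1) U W k s = bif Nat.beq (Nat.mod s 2) 0 then
        place m q (fun _ π _ _ P Q D s' => addRays π R
          (fun P Q D => bif clearAll U W P Q D then k s' else false) P Q D) (Nat.div s 2)
      else bif Nat.beq (s / 2 % m).succ (s / 2 / m % m).succ then false else
        search m q R fuel (addArrow U (s / 2 % m).succ (s / 2 / m % m).succ)
          (addArrow W (s / 2 / m % m).succ (s / 2 % m).succ)
          (fun s' => search m q R fuel (addArrow U (s / 2 / m % m).succ (s / 2 % m).succ)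
            (addArrow W (s / 2 % m).succ (s / 2 / m % m).succ) k s') (s / 2 / (m * m)) := rfl
    rw [hdef] at h
    cases hb : Nat.beq (Nat.mod s 2) 0
    · rw [hb, cond_false] at h
      have hi : (s / 2 % m).succ ≤ m := Nat.mod_lt _ hm
      have hj : (s / 2 / m % m).succ ≤ m := Nat.mod_lt _ hm
      have hi' : 1 ≤ (s / 2 % m).succ := Nat.succ_pos _
      have hj' : 1 ≤ (s / 2 / m % m).succ := Nat.succ_pos _
      generalize (s / 2 % m).succ = i at *
      generalize (s / 2 / m % m).succ = j at *
      cases hij : Nat.beq i j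
      · rw [hij, cond_false] at h
        have hij : i ≠ j := Nat.ne_of_beq_eq_false hij
        obtain ⟨h1, s', h2⟩ := ih h
        obtain ⟨h3, h4⟩ := ih h2
        refine ⟨fun y hy hU hW => ?_, h4⟩
        have hlt : ∀ a b c : ℕ, y a < y b → y b < y c → y a < y c := fun _ _ _ => lt_trans
        have hgt : ∀ a b c : ℕ, y b < y a → y c < y b → y c < y a := fun _ _ _ h h' => h'.trans h
        rcases lt_trichotomy (y i) (y j) with h | h | h
        · exact h1 y hy (hU.addArrow hlt (by omega) (by omega) h)
            (hW.addArrow hgt (by omega) (by omega) h)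
        · exact absurd (hy i j hi' hi hj' hj h) hij
        · exact h3 y hy (hU.addArrow hlt (by omega) (by omega) h)
            (hW.addArrow hgt (by omega) (by omega) h)
      · rw [hij, cond_true] at h
        cases h
    · rw [hb, cond_true] at h
      obtain ⟨h1, h2⟩ := drawable_of_place hm hm' hq hR hR' h
      exact ⟨fun y _ => h1 y, h2⟩

theorem sound_zero (r : ℕ → ℕ → Prop) : Sound r 0 := by
  intro k l _ h
  simp at h

theorem sound_initialUp {r : ℕ → ℕ → Prop} (htrans : ∀ a b c, r a b → r b c → r a c) {m : ℕ}
    (hm : m ≤ 12) (h : ∀ k, 1 ≤ k → k ≤ m → r 15 k ∧ r k 14) (h' : r 15 14) :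
    Sound r (initialUp m) := by
  induction m with
  | zero => exact (sound_zero r).addArrow htrans (by omega) (by omega) h'
  | succ m ih =>
    have hm1 := h (m + 1) (by omega) le_rfl
    exact ((ih (by omega) fun k h1 h2 => h k h1 (by omega)).addArrow htrans (by omega) (by omega)
      hm1.1).addArrow htrans (by omega) (by omega) hm1.2

theorem sound_initialDown {r : ℕ → ℕ → Prop} (htrans : ∀ a b c, r a b → r b c → r a c) {m : ℕ}
    (hm : m ≤ 12) (h : ∀ k, 1 ≤ k → k ≤ m → r k 15 ∧ r 14 k) (h' : r 14 15) :
    Sound r (initialDown m) := by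
  induction m with
  | zero => exact (sound_zero r).addArrow htrans (by omega) (by omega) h'
  | succ m ih =>
    have hm1 := h (m + 1) (by omega) le_rfl
    exact ((ih (by omega) fun k h1 h2 => h k h1 (by omega)).addArrow htrans (by omega) (by omega)
      hm1.1).addArrow htrans (by omega) (by omega) hm1.2

theorem drawable_of_checkBase {q : List ℕ} (hq' : q.length + 1 ≤ 12)
    (hq : ∀ e ∈ codeEdges q, 1 ≤ e.2 ∧ e.2 < e.1) {R : List (ℕ × ℕ)}
    (hR : ∀ r ∈ R, r.2 = 0 ∨ 13 ≤ r.2) (hR' : ∀ r ∈ R, r.2 < 16) {s : ℕ} (h : checkBase q R s)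
    {y : ℕ → ℝ}
    (hy : ∀ i j, 1 ≤ i → i ≤ q.length + 1 → 1 ≤ j → j ≤ q.length + 1 → y i = y j → i = j)
    (hy' : ∀ k, 1 ≤ k → k ≤ q.length + 1 → y 15 < y k ∧ y k < y 14) :
    Drawable (q.length + 1) q R y := by
  have h1 := hy' 1 le_rfl (by omega)
  exact (drawable_of_search (Nat.succ_pos _) hq' hq hR hR' h).1 y hy
    (sound_initialUp (r := fun a b => y a < y b) (fun _ _ _ => lt_trans) hq' hy' (h1.1.trans h1.2))
    (sound_initialDown (r := fun a b => y b < y a) (fun _ _ _ h h' => h'.trans h) hq' hy'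
      (h1.1.trans h1.2))

theorem exists_sorted_points {S : Finset (ℝ × ℝ)} (hS : IsPointSet S) {m : ℕ} (hm : m ≤ 12)
    (hc : S.card = m) (l r b t : ℝ) :
    ∃ x y : ℕ → ℝ, x 0 = l ∧ x 13 = r ∧ y 15 = b ∧ y 14 = t ∧
      (∀ k, 1 ≤ k → k ≤ m → (x k, y k) ∈ S) ∧ ∀ i j, 1 ≤ i → i < j → j ≤ m → x i < x j := by
  have hT : (S.image Prod.fst).card = m := by
    rw [Finset.card_image_of_injOn, hc]
    intro p hp p' hp' h
    by_contra hne
    exact (hS p hp p' hp' hne).1 h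
  have hmem : ∀ k : Fin m, ∃ y, ((S.image Prod.fst).orderEmbOfFin hT k, y) ∈ S := by
    intro k
    obtain ⟨p, hp, hpk⟩ := Finset.mem_image.1 (Finset.orderEmbOfFin_mem _ hT k)
    exact ⟨p.2, by rwa [← hpk]⟩
  choose y hy using hmem
  refine ⟨fun k => if h : 1 ≤ k ∧ k ≤ m then (S.image Prod.fst).orderEmbOfFin hT ⟨k - 1, by omega⟩
      else if k = 0 then l else r,
    fun k => if h : 1 ≤ k ∧ k ≤ m then y ⟨k - 1, by omega⟩ else if k = 15 then b else t,
    by simp, ?_, ?_, ?_, ?_, ?_⟩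
  · exact (dif_neg (by omega)).trans (if_neg (by omega))
  · exact (dif_neg (by omega)).trans (if_pos rfl)
  · exact (dif_neg (by omega)).trans (if_neg (by omega))
  · intro k h1 h2
    beta_reduce
    rw [dif_pos ⟨h1, h2⟩, dif_pos ⟨h1, h2⟩]
    exact hy _
  · intro i j h1 h2 h3
    beta_reduce
    rw [dif_pos ⟨h1, by omega⟩, dif_pos ⟨by omega, h3⟩, OrderEmbedding.lt_iff_lt]
    exact Fin.mk_lt_mk.2 (by omega)

theorem rayEmbeds_of_checkBase {q : List ℕ} (hq' : q.length + 1 ≤ 12)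
    (hq : ∀ e ∈ codeEdges q, 1 ≤ e.2 ∧ e.2 < e.1) {R : List (ℕ × ℕ)}
    (hR : ∀ r ∈ R, (1 ≤ r.1 ∧ r.1 ≤ q.length + 1) ∧ (r.2 = 0 ∨ r.2 = 13 ∨ r.2 = 14 ∨ r.2 = 15))
    {s : ℕ} (h : checkBase q R s) : RayEmbeds q (· ∈ R) := by
  intro S hS hc l r b t hbox
  obtain ⟨x, y, hx0, hx13, hy15, hy14, hmem, hx⟩ := exists_sorted_points hS hq' hc l r b t
  obtain ⟨m, hm⟩ : ∃ m, m = q.length + 1 := ⟨_, rfl⟩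
  rw [← hm] at hmem hx hq'
  have hylt : ∀ k, 1 ≤ k → k ≤ m → y 15 < y k ∧ y k < y 14 := by
    intro k h1 h2
    rw [hy15, hy14]
    exact (hbox _ (hmem k h1 h2)).2
  have hxinj : ∀ i j, 1 ≤ i → i ≤ m → 1 ≤ j → j ≤ m → x i = x j → i = j := by
    intro i j h1 h2 h3 h4 hij
    rcases lt_trichotomy i j with hlt | heq | hlt
    · exact absurd hij (hx i j h1 hlt h4).ne
    · exact heq
    · exact absurd hij (hx j i h3 hlt h2).ne'
  have hyinj : ∀ i j, 1 ≤ i → i ≤ m → 1 ≤ j → j ≤ m → y i = y j → i = j := by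
    intro i j h1 h2 h3 h4 hij
    by_contra hne
    exact (hS _ (hmem i h1 h2) _ (hmem j h3 h4)
      fun h => hne (hxinj i j h1 h2 h3 h4 (Prod.ext_iff.1 h).1)).2 hij
  have hxlt : ∀ i j, i < j → i ≤ m → j ≤ m ∨ j = 13 → x i < x j := by
    intro i j hij hi hj
    have hxl : ∀ k, 1 ≤ k → k ≤ m → x 0 < x k ∧ x k < x 13 := by
      intro k h1 h2
      rw [hx0, hx13]
      exact (hbox _ (hmem k h1 h2)).1
    have h1 := hxl 1 le_rfl (by omega)
    rcases Nat.eq_zero_or_pos i with rfl | hi'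
    · rcases hj with hj | rfl
      · exact (hxl j hij hj).1
      · exact h1.1.trans h1.2
    · rcases hj with hj | rfl
      · exact hx i j hi' hij hj
      · exact (hxl i hi' hi).2
  have hxle : ∀ i j, i ≤ m ∨ i = 13 → j ≤ m ∨ j = 13 → x i ≤ x j → i ≤ j := by
    intro i j hi hj hij
    by_contra hlt
    exact absurd hij (not_le.2 (hxlt j i (by omega) (by omega) hi))
  obtain ⟨π, D, hπ, hinj, hedge, hray, havoid⟩ := drawable_of_checkBase (by omega) hq
    (fun r hr => by have := hR r hr; omega) (fun r hr => by have := hR r hr; omega) h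
    (fun i j => hm ▸ hyinj i j) (fun k => hm ▸ hylt k)
  rw [← hm] at hπ hinj
  obtain ⟨σ, hσ, hσ'⟩ : ∃ σ : ℕ → ℕ, (∀ k, 1 ≤ k → k ≤ m → σ k = nibble π k) ∧
      ∀ k, k = 0 ∨ 13 ≤ k → σ k = k :=
    ⟨fun k => if k = 0 ∨ 13 ≤ k then k else nibble π k, by grind⟩
  have hσm : ∀ k, 1 ≤ k → k ≤ m → 1 ≤ σ k ∧ σ k ≤ m := by
    intro k h1 h2
    rw [hσ k h1 h2]
    exact hπ k h1 h2
  have hσinj : ∀ i j, i ≤ m ∨ 13 ≤ i → j ≤ m ∨ 13 ≤ j → σ i = σ j → i = j := by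
    intro i j hi hj hij
    have := hσm i
    have := hσm j
    have := hσ' i
    have := hσ' j
    by_cases hv : (1 ≤ i ∧ i ≤ m) ∧ 1 ≤ j ∧ j ≤ m
    · rw [hσ i hv.1.1 hv.1.2, hσ j hv.2.1 hv.2.2] at hij
      exact hinj i j hv.1.1 hv.1.2 hv.2.1 hv.2.2 hij
    · omega
  refine ⟨fun k => x (σ k), fun k => y (σ k), fun d => D (σ d.1, σ d.2) ∧
    ((1 ≤ d.1 ∧ d.1 ≤ m) ∧ (1 ≤ d.2 ∧ d.2 ≤ m) ∨ (1 ≤ d.1 ∧ d.1 ≤ m) ∧ (d.2 = 0 ∨ d.2 = 13) ∨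
      (d.1 = 14 ∨ d.1 = 15) ∧ (1 ≤ d.2 ∧ d.2 ≤ m)), ?_⟩
  constructor
  · simp only [hσ' 0 (by omega), hx0]
  · simp only [hσ' 13 (by omega), hx13]
  · simp only [hσ' 15 (by omega), hy15]
  · simp only [hσ' 14 (by omega), hy14]
  · intro i h1 h2
    exact hmem _ (hσm i h1 (hm ▸ h2)).1 (hσm i h1 (hm ▸ h2)).2
  · rw [← hm]
    intro i j h1 h2 h3 h4 hij
    exact hσinj i j (Or.inl h2) (Or.inl h4)
      (hxinj _ _ (hσm i h1 h2).1 (hσm i h1 h2).2 (hσm j h3 h4).1 (hσm j h3 h4).2 hij)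
  · intro e he
    have := hq e he
    have := bounds_of_mem_codeEdges he
    omega
  · intro e he
    have h1 := hq e he
    have h2 := bounds_of_mem_codeEdges he
    have h3 := hedge e he
    rw [← hσ e.1 (by omega) (by omega), ← hσ e.2 (by omega) (by omega)] at h3
    refine h3.imp (fun h => ⟨h, by omega⟩) fun h => ⟨h, ?_⟩
    simp only [Prod.fst_swap, Prod.snd_swap]
    omega
  · intro u hu
    have h1 := (hR _ hu).1
    simp only at h1
    rw [← hm] at h1
    have h := hray _ hu
    rw [rayEdge, if_neg (by simp), ← hσ u h1.1 h1.2] at h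
    refine ⟨by simpa only [hσ' 0 (by omega)] using h, Or.inr (Or.inl ⟨h1, Or.inl rfl⟩)⟩
  · intro u hu
    have h1 := (hR _ hu).1
    simp only at h1
    rw [← hm] at h1
    have h := hray _ hu
    rw [rayEdge, if_neg (by simp), ← hσ u h1.1 h1.2] at h
    refine ⟨by simpa only [hσ' 13 (by omega)] using h, Or.inr (Or.inl ⟨h1, Or.inr rfl⟩)⟩
  · intro u hu
    have h1 := (hR _ hu).1
    simp only at h1
    rw [← hm] at h1
    have h := hray _ hu
    rw [rayEdge, if_pos (by simp), ← hσ u h1.1 h1.2] at h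
    refine ⟨by simpa only [hσ' 14 (by omega)] using h, Or.inr (Or.inr ⟨Or.inl rfl, h1⟩)⟩
  · intro u hu
    have h1 := (hR _ hu).1
    simp only at h1
    rw [← hm] at h1
    have h := hray _ hu
    rw [rayEdge, if_pos (by simp), ← hσ u h1.1 h1.2] at h
    refine ⟨by simpa only [hσ' 15 (by omega)] using h, Or.inr (Or.inr ⟨Or.inr rfl, h1⟩)⟩
  · intro d hd
    rw [← hm]
    exact hd.2
  · rintro d ⟨hd, hd'⟩ e ⟨he, he'⟩ hde h1 h2 h3 h4 h5
    have hv1 := hσm d.1 (by omega) (by omega)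
    have hv2 := hσm e.2 (by omega) (by omega)
    have hd2 : σ d.2 ≤ m ∨ σ d.2 = 13 := by
      have := hσm d.2
      have := hσ' d.2
      omega
    refine havoid _ hd _ he ?_ (by simp only; omega) (by simp only; omega) (by simp only; omega)
      ?_ ?_
    · intro heq
      simp only [Prod.mk.injEq] at heq
      exact hde (Prod.ext (hσinj _ _ (by omega) (by omega) heq.1)
        (hσinj _ _ (by omega) (by omega) heq.2))
    · exact fun h => h4 (hσinj _ _ (by omega) (by omega) h)
    · rw [mem_uIcc] at h5 ⊢
      exact h5.imp
        (fun h => ⟨hxle _ _ (Or.inl hv1.2) (Or.inl hv2.2) h.1, hxle _ _ (Or.inl hv2.2) hd2 h.2⟩)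
        fun h => ⟨hxle _ _ hd2 (Or.inl hv2.2) h.1, hxle _ _ (Or.inl hv2.2) (Or.inl hv1.2) h.2⟩

/-- The side with the number `c`. -/
def side (c : ℕ) : ℕ := bif Nat.beq c 0 then 0 else Nat.add 12 c

/-- Append `k` leaves to the tree `q` with rays `R`; the base 64 digits of `t` are the rays at the
end of which they are put. -/
def grow : ℕ → ℕ → List ℕ → List (ℕ × ℕ) → Option (List ℕ)
  | 0, _, q, _ => some q
  | k + 1, t, q, R =>
    bif R.any fun r => Nat.beq r.1 (t % 16) && Nat.beq r.2 (side (t / 16 % 4)) then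
      grow k (t / 64) (t % 16 :: q)
        ((q.length + 2, side (t / 16 % 4)) :: R.filter fun r => !Nat.beq r.2 (side (t / 16 % 4)))
    else none

/-- A tree with rays, together with a certificate for `checkBase` in base `2 ^ 368`. -/
abbrev Base := List ℕ × List (ℕ × ℕ) × List ℕ

/-- The entries of the tree and of its rays are in the right range, and the certificate is
accepted. -/
def Base.check (b : Base) : Bool :=
  (codeEdges b.1).all (fun e => Nat.ble 1 e.2 && Nat.blt e.2 e.1) && Nat.ble (b.1.length + 1) 12 &&
    b.2.1.all (fun r => Nat.ble 1 r.1 && Nat.ble r.1 (b.1.length + 1) &&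
      (Nat.beq r.2 0 || Nat.beq r.2 13 || Nat.beq r.2 14 || Nat.beq r.2 15)) &&
    checkBase b.1 b.2.1 (b.2.2.foldr (fun c s => c + s <<< 368) 0)

/-- The tree with `n` vertices that arises from the base number `t % 256` by appending leaves as
prescribed by `t / 256`. -/
def draw (B : List Base) (n t : ℕ) : Option (List ℕ) :=
  (B[t % 256]?).bind fun b =>
    bif Nat.ble (b.1.length + 1) n then grow (n - (b.1.length + 1)) (t / 256) b.1 b.2.1 else none

/-- In the tree `q`, every parent comes before its child, and the rays of `R` start in a vertex. -/
structure IsCode (q : List ℕ) (R : List (ℕ × ℕ)) : Prop where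
  parent : ∀ e ∈ codeEdges q, 1 ≤ e.2 ∧ e.2 < e.1
  ray : ∀ r ∈ R, 1 ≤ r.1 ∧ r.1 ≤ q.length + 1

theorem IsCode.bounds {q : List ℕ} {R : List (ℕ × ℕ)} (h : IsCode q R) {e : ℕ × ℕ}
    (he : e ∈ codeEdges q) : (1 ≤ e.1 ∧ e.1 ≤ q.length + 1) ∧ 1 ≤ e.2 ∧ e.2 ≤ q.length + 1 := by
  have h1 := bounds_of_mem_codeEdges he
  have h2 := h.parent e he
  omega

theorem IsCode.cons {q : List ℕ} {R : List (ℕ × ℕ)} (h : IsCode q R) {u : ℕ} (hu : 1 ≤ u)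
    (hu' : u ≤ q.length + 1) {R' : List (ℕ × ℕ)}
    (hR : ∀ r ∈ R', r ∈ R ∨ r.1 = q.length + 2) : IsCode (u :: q) R' := by
  constructor
  · intro e he
    rcases List.mem_cons.1 he with rfl | he
    · exact ⟨hu, by simp only; omega⟩
    · exact h.parent e he
  · intro r hr
    rw [List.length_cons]
    rcases hR r hr with hr | hr
    · have := h.ray r hr
      omega
    · omega

theorem side_cases (c : ℕ) (hc : c < 4) :
    side c = 0 ∨ side c = 13 ∨ side c = 14 ∨ side c = 15 := by
  interval_cases c <;> decide

theorem rayEmbeds_of_grow {k t : ℕ} {q : List ℕ} {R : List (ℕ × ℕ)} {q' : List ℕ}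
    (hq : q.length + 1 + k ≤ 12) (hR : IsCode q R) (h : RayEmbeds q (· ∈ R))
    (hg : grow k t q R = some q') :
    q'.length = q.length + k ∧ IsCode q' [] ∧ ∃ R', RayEmbeds q' R' := by
  induction k generalizing t q R with
  | zero =>
    cases hg
    exact ⟨rfl, ⟨hR.parent, by simp⟩, _, h⟩
  | succ k ih =>
    rw [grow] at hg
    cases hb : R.any fun r => Nat.beq r.1 (t % 16) && Nat.beq r.2 (side (t / 16 % 4))
    · rw [hb] at hg
      cases hg
    · rw [hb, cond_true] at hg
      have hmem : (t % 16, side (t / 16 % 4)) ∈ R := by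
        simp only [List.any_eq_true, Bool.and_eq_true, Nat.beq_eq] at hb
        obtain ⟨r, hr, h1, h2⟩ := hb
        rwa [← h1, ← h2]
      have hray := hR.ray _ hmem
      obtain ⟨h1, h2, h3⟩ := ih (by simp only [List.length_cons]; omega)
        (hR.cons hray.1 hray.2 fun r hr => by
          rcases List.mem_cons.1 hr with rfl | hr
          · exact Or.inr rfl
          · exact Or.inl (List.mem_filter.1 hr).1)
        ((h.cons (by omega) (side_cases _ (Nat.mod_lt _ (by norm_num))) hmem).mono fun r hr => by
          rcases List.mem_cons.1 hr with rfl | hr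
          · exact Or.inl rfl
          · have hr := List.mem_filter.1 hr
            refine Or.inr ⟨hr.1, fun h => ?_⟩
            simp [h] at hr) hg
      refine ⟨?_, h2, h3⟩
      rw [h1, List.length_cons]
      omega

theorem Base.rayEmbeds_of_check {b : Base} (h : b.check) :
    b.1.length + 1 ≤ 12 ∧ IsCode b.1 b.2.1 ∧ RayEmbeds b.1 (· ∈ b.2.1) := by
  simp only [Base.check, Bool.and_eq_true, List.all_eq_true, Nat.ble_eq, Nat.blt_eq,
    Bool.or_eq_true, Nat.beq_eq] at h
  obtain ⟨⟨⟨h1, h2⟩, h3⟩, h4⟩ := h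
  refine ⟨h2, ⟨h1, fun r hr => (h3 r hr).1⟩, rayEmbeds_of_checkBase h2 h1 (fun r hr => ?_) h4⟩
  obtain ⟨h5, h6⟩ := h3 r hr
  exact ⟨h5, by tauto⟩

theorem rayEmbeds_of_draw {B : List Base} (hB : ∀ b ∈ B, b.check) {n t : ℕ} (hn : n ≤ 12)
    {q : List ℕ} (h : draw B n t = some q) :
    q.length + 1 = n ∧ IsCode q [] ∧ ∃ R, RayEmbeds q R := by
  obtain ⟨b, hb, h⟩ := Option.bind_eq_some_iff.1 h
  have hb := Base.rayEmbeds_of_check (hB b (List.mem_of_getElem? hb))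
  cases hl : Nat.ble (b.1.length + 1) n
  · rw [hl] at h
    cases h
  · rw [hl, cond_true] at h
    have hl := Nat.ble_eq.mp hl
    obtain ⟨h1, h2⟩ := rayEmbeds_of_grow (by omega) hb.2.1 hb.2.2 h
    exact ⟨by omega, h2⟩

/-- Adjacency in the tree `q`. -/
def CodeAdj (q : List ℕ) (a b : ℕ) : Prop := (a, b) ∈ codeEdges q ∨ (b, a) ∈ codeEdges q

/-- The adjacency matrix of the tree `q` after the renaming `σ` of the vertices. -/
def codeMatrix (σ : ℕ) : List ℕ → ℕ
  | [] => 0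
  | p :: q =>
    (fun a b => Nat.lor (codeMatrix σ q)
      (Nat.lor (Nat.shiftLeft 1 (Nat.add (Nat.mul 16 a) b))
        (Nat.shiftLeft 1 (Nat.add (Nat.mul 16 b) a))))
      (nibble σ p) (nibble σ (Nat.add q.length 2))

theorem testBit_codeMatrix {σ : ℕ} {q : List ℕ} {a b : ℕ} (hb : b < 16) :
    (codeMatrix σ q).testBit (16 * a + b) ↔
      ∃ x y, CodeAdj q x y ∧ nibble σ x = a ∧ nibble σ y = b := by
  induction q with
  | nil => simp [codeMatrix, CodeAdj, codeEdges]
  | cons p q ih =>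
    have key : ∀ c d : ℕ, d < 16 → ((Nat.shiftLeft 1 (Nat.add (Nat.mul 16 c) d)).testBit
        (16 * a + b) ↔ c = a ∧ d = b) := by
      intro c d hd
      change ((1 <<< (16 * c + d)).testBit (16 * a + b)) = true ↔ _
      rw [Nat.one_shiftLeft, Nat.testBit_two_pow, decide_eq_true_iff]
      omega
    have h1 := key (nibble σ p) _ (nibble_lt σ (q.length + 2))
    have h2 := key (nibble σ (q.length + 2)) _ (nibble_lt σ p)
    have h3 : (codeMatrix σ (p :: q)).testBit (16 * a + b) ↔
        (codeMatrix σ q).testBit (16 * a + b) ∨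
          (nibble σ p = a ∧ nibble σ (q.length + 2) = b) ∨
          (nibble σ (q.length + 2) = a ∧ nibble σ p = b) := by
      rw [← h1, ← h2]
      change ((codeMatrix σ q) ||| (_ ||| _)).testBit _ = true ↔ _
      rw [Nat.testBit_or, Nat.testBit_or, Bool.or_eq_true, Bool.or_eq_true]
    rw [h3, ih]
    constructor
    · rintro (⟨x, y, h, hx, hy⟩ | ⟨hx, hy⟩ | ⟨hx, hy⟩)
      · exact ⟨x, y, h.imp (List.mem_cons_of_mem _) (List.mem_cons_of_mem _), hx, hy⟩
      · exact ⟨_, _, Or.inr List.mem_cons_self, hx, hy⟩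
      · exact ⟨_, _, Or.inl List.mem_cons_self, hx, hy⟩
    · rintro ⟨x, y, h | h, hx, hy⟩ <;> rcases List.mem_cons.1 h with h | h
      · cases h
        exact Or.inr (Or.inr ⟨hx, hy⟩)
      · exact Or.inl ⟨x, y, Or.inl h, hx, hy⟩
      · cases h
        exact Or.inr (Or.inl ⟨hx, hy⟩)
      · exact Or.inl ⟨x, y, Or.inr h, hx, hy⟩

/-- The trivial renaming. -/
def idCode : ℕ := 0xFEDCBA9876543210

theorem nibble_idCode {x : ℕ} (hx : x < 16) : nibble idCode x = x := by
  interval_cases x <;> rfl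

theorem IsCode.bounds_of_codeAdj {q : List ℕ} {R : List (ℕ × ℕ)} (h : IsCode q R) {a b : ℕ}
    (hab : CodeAdj q a b) :
    (1 ≤ a ∧ a ≤ q.length + 1) ∧ 1 ≤ b ∧ b ≤ q.length + 1 := by
  rcases hab with hab | hab
  · exact h.bounds hab
  · exact (h.bounds hab).symm

theorem testBit_codeMatrix_idCode {q : List ℕ} (hq : IsCode q []) (hl : q.length + 1 ≤ 12)
    {a b : ℕ} (ha : a < 16) (hb : b < 16) :
    (codeMatrix idCode q).testBit (16 * a + b) ↔ CodeAdj q a b := by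
  rw [testBit_codeMatrix hb]
  constructor
  · rintro ⟨x, y, h, hx, hy⟩
    have := hq.bounds_of_codeAdj h
    rw [nibble_idCode (by omega)] at hx hy
    rwa [← hx, ← hy]
  · intro h
    exact ⟨a, b, h, nibble_idCode ha, nibble_idCode hb⟩

/-- The degree of the vertex `i` in the tree with the adjacency matrix `M`. -/
def rowCount (M i : ℕ) : ℕ := Nat.count (fun a => hasBit M (16 * i + a)) 13

/-- The set of the values of `σ` at `1, …, n`, as a bit vector. -/
def rangeBits (σ : ℕ) : ℕ → ℕ
  | 0 => 0
  | n + 1 => Nat.lor (rangeBits σ n) (Nat.shiftLeft 1 (nibble σ (n + 1)))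

theorem testBit_rangeBits {σ n a : ℕ} :
    (rangeBits σ n).testBit a ↔ ∃ i, (1 ≤ i ∧ i ≤ n) ∧ nibble σ i = a := by
  induction n with
  | zero =>
    simp only [rangeBits, Nat.zero_testBit, Bool.false_eq_true, false_iff]
    rintro ⟨i, hi, -⟩
    omega
  | succ n ih =>
    change (rangeBits σ n ||| 1 <<< nibble σ (n + 1)).testBit a = true ↔ _
    rw [Nat.testBit_or, Bool.or_eq_true, ih, Nat.one_shiftLeft, Nat.testBit_two_pow,
      decide_eq_true_iff]
    constructor
    · rintro (⟨i, hi, h⟩ | h)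
      · exact ⟨i, by omega, h⟩
      · exact ⟨n + 1, by omega, h⟩
    · rintro ⟨i, hi, h⟩
      rcases hi.2.lt_or_eq with h' | rfl
      · exact Or.inl ⟨i, by omega, h⟩
      · exact Or.inr h

theorem injOn_nibble {σ n : ℕ} (h : rangeBits σ n = 2 ^ (n + 1) - 2) :
    InjOn (nibble σ) (Finset.Icc 1 n : Finset ℕ) ∧
      ∀ i ∈ Finset.Icc 1 n, nibble σ i ∈ Finset.Icc 1 n := by
  have hbit : ∀ a, (rangeBits σ n).testBit a ↔ a ∈ Finset.Icc 1 n := by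
    intro a
    have : 2 ^ (n + 1) - 2 = (2 ^ n - 1) <<< 1 := by
      rw [Nat.shiftLeft_eq, pow_succ]
      omega
    rw [h, this, Nat.testBit_shiftLeft, Nat.testBit_two_pow_sub_one, Finset.mem_Icc]
    simp only [Bool.and_eq_true, decide_eq_true_iff]
    omega
  have hmaps : ∀ i ∈ Finset.Icc 1 n, nibble σ i ∈ Finset.Icc 1 n := fun i hi =>
    (hbit _).1 (testBit_rangeBits.2 ⟨i, Finset.mem_Icc.1 hi, rfl⟩)
  refine ⟨Finset.injOn_of_surjOn_of_card_le _ hmaps (fun a ha => ?_) le_rfl, hmaps⟩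
  obtain ⟨i, hi, hia⟩ := testBit_rangeBits.1 ((hbit a).2 ha)
  exact ⟨i, Finset.mem_coe.2 (Finset.mem_Icc.2 hi), hia⟩

/-- Appending a leaf at the vertex `i` of the tree `q` with `n` vertices yields, up to the renaming
`w / 512`, the tree number `w % 512` of the list `T`. -/
def checkLeaf (B : List Base) (T : List (ℕ × List ℕ)) (n : ℕ) (q : List ℕ) (i w : ℕ) : Bool :=
  match (T[w % 512]?).bind fun t => draw B (n + 1) t.1 with
  | none => false
  | some q' => Nat.beq (rangeBits (w / 512) (n + 1)) (2 ^ (n + 2) - 2) &&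
      Nat.beq (codeMatrix (w / 512) (i :: q)) (codeMatrix idCode q')

/-- Appending a leaf at a vertex of degree less than four always leads from the list `T` of trees
with `n` vertices to the list `T'`. -/
def checkLevel (B : List Base) (T T' : List (ℕ × List ℕ)) (n : ℕ) : Bool :=
  T.all fun t =>
    match draw B n t.1 with
    | none => false
    | some q => (List.range n).all fun i =>
      Nat.blt 3 (rowCount (codeMatrix idCode q) (i + 1)) ||
        checkLeaf B T' n q (i + 1) (t.2.getD i 0)

theorem codeAdj_of_checkLeaf {B : List Base} (hB : ∀ b ∈ B, b.check) {T : List (ℕ × List ℕ)}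
    {n : ℕ} (hn : n < 12) {q : List ℕ} {i w : ℕ} (h : checkLeaf B T n q i w) :
    ∃ t ∈ T, ∃ q', draw B (n + 1) t.1 = some q' ∧ ∃ g : ℕ → ℕ,
      InjOn g (Finset.Icc 1 (n + 1) : Finset ℕ) ∧
      (∀ x ∈ Finset.Icc 1 (n + 1), g x ∈ Finset.Icc 1 (n + 1)) ∧
      ∀ x ∈ Finset.Icc 1 (n + 1), ∀ y ∈ Finset.Icc 1 (n + 1),
        IsCode (i :: q) [] → q.length + 1 = n →
          (CodeAdj (i :: q) x y ↔ CodeAdj q' (g x) (g y)) := by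
  rw [checkLeaf] at h
  split at h
  · cases h
  · rename_i q' hq'
    obtain ⟨t, ht, hq'⟩ := Option.bind_eq_some_iff.1 hq'
    simp only [Bool.and_eq_true, Nat.beq_eq] at h
    obtain ⟨hinj, hmaps⟩ := injOn_nibble h.1
    obtain ⟨hl, hc, -⟩ := rayEmbeds_of_draw hB (by omega) hq'
    refine ⟨t, List.mem_of_getElem? ht, q', hq', nibble (w / 512), hinj, hmaps, ?_⟩
    intro x hx y hy hq hqn
    rw [← testBit_codeMatrix_idCode hc (by omega) (nibble_lt _ _) (nibble_lt _ _), ← h.2,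
      testBit_codeMatrix (nibble_lt _ _)]
    constructor
    · intro h
      exact ⟨x, y, h, rfl, rfl⟩
    · rintro ⟨x', y', h, hx', hy'⟩
      have hb := hq.bounds_of_codeAdj h
      rw [List.length_cons, hqn] at hb
      rwa [← hinj (Finset.mem_coe.2 (Finset.mem_Icc.2 hb.1)) hx hx',
        ← hinj (Finset.mem_coe.2 (Finset.mem_Icc.2 hb.2)) hy hy']

/-- `G` is, up to the names of its vertices, one of the trees of the list `T`. -/
def Listed {V : Type} (G : SimpleGraph V) (B : List Base) (T : List (ℕ × List ℕ)) (n : ℕ) : Prop :=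
  ∃ t ∈ T, ∃ q, draw B n t.1 = some q ∧ ∃ f : V → ℕ, Function.Injective f ∧
    (∀ v, 1 ≤ f v ∧ f v ≤ n) ∧ ∀ u v, G.Adj u v ↔ CodeAdj q (f u) (f v)

theorem codeAdj_cons_iff {q : List ℕ} {n i : ℕ} (hqn : q.length + 1 = n) {a b : ℕ} :
    CodeAdj (i :: q) a b ↔ CodeAdj q a b ∨ a = n + 1 ∧ b = i ∨ a = i ∧ b = n + 1 := by
  have : q.length + 2 = n + 1 := by omega
  simp only [CodeAdj, codeEdges, List.mem_cons, Prod.mk.injEq, this]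
  tauto

/-- The degree of a vertex in a listed tree is at most its degree in the graph. -/
theorem rowCount_le {V : Type} [Fintype V] {G : SimpleGraph V} {q : List ℕ} (hq : IsCode q [])
    (hl : q.length + 1 ≤ 12) (hV : Fintype.card V = q.length + 1) {f : V → ℕ}
    (hf : Function.Injective f) (hfq : ∀ v, 1 ≤ f v ∧ f v ≤ q.length + 1)
    (hadj : ∀ u v, G.Adj u v ↔ CodeAdj q (f u) (f v)) (w : V) :
    rowCount (codeMatrix idCode q) (f w) ≤ (G.neighborSet w).ncard := by
  classical
  have hsurj : ∀ a, 1 ≤ a → a ≤ q.length + 1 → ∃ v, f v = a := by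
    intro a h1 h2
    have := Finset.surj_on_of_inj_on_of_card_le (s := Finset.univ)
      (t := Finset.Icc 1 (q.length + 1)) (fun v _ => f v) (fun v _ => Finset.mem_Icc.2 (hfq v))
      (fun u v _ _ h => hf h)
      (by simp [hV]) a (Finset.mem_Icc.2 ⟨h1, h2⟩)
    obtain ⟨v, -, h⟩ := this
    exact ⟨v, h.symm⟩
  rw [rowCount, Nat.count_eq_card_filter_range, ← Set.ncard_image_of_injective _ hf,
    ← Set.ncard_coe_finset]
  refine Set.ncard_le_ncard ?_ (Set.toFinite _)
  intro a ha
  simp only [Finset.coe_filter, Finset.mem_range, Set.mem_ofPred_eq] at ha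
  have hw := hfq w
  obtain ⟨ha, h⟩ := ha
  rw [hasBit_eq_testBit, testBit_codeMatrix_idCode hq hl (by omega) (by omega)] at h
  obtain ⟨v, rfl⟩ := hsurj a (hq.bounds_of_codeAdj h).2.1 (hq.bounds_of_codeAdj h).2.2
  exact ⟨v, (hadj w v).2 h, rfl⟩

/-- The list `T'` is complete if the list `T` is. -/
theorem Listed.of_checkLevel {B : List Base} (hB : ∀ b ∈ B, b.check) {T T' : List (ℕ × List ℕ)}
    {n : ℕ} (hn : n < 12) (hT : checkLevel B T T' n)
    (ih : ∀ (V : Type) [Fintype V] (G : SimpleGraph V), G.IsTree → Fintype.card V = n →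
      (∀ v, (G.neighborSet v).ncard ≤ 4) → Listed G B T n)
    {V : Type} [Fintype V] {G : SimpleGraph V} (hn' : 1 ≤ n) (hG : G.IsTree)
    (hV : Fintype.card V = n + 1) (hdeg : ∀ v, (G.neighborSet v).ncard ≤ 4) :
    Listed G B T' (n + 1) := by
  classical
  have : Nontrivial V := Fintype.one_lt_card_iff_nontrivial.1 (by omega)
  obtain ⟨v, hv⟩ := hG.exists_vert_degree_one_of_nontrivial
  obtain ⟨w, hvw, hw⟩ := SimpleGraph.degree_eq_one_iff_existsUnique_adj.1 hv
  have hwv : w ∈ ({v}ᶜ : Set V) := fun h => G.ne_of_adj hvw h.symm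
  have hinj : Function.Injective (Subtype.val : ({v}ᶜ : Set V) → V) := Subtype.val_injective
  have hsub : ∀ u : ({v}ᶜ : Set V),
      Subtype.val '' (G.induce {v}ᶜ).neighborSet u ⊆ G.neighborSet u := by
    rintro u - ⟨x, hx, rfl⟩
    exact hx
  obtain ⟨t, ht, q, hq, f, hf, hfn, hadj⟩ := ih ({v}ᶜ : Set V) (G.induce {v}ᶜ)
    ⟨hG.connected.induce_compl_singleton_of_degree_eq_one hv, hG.isAcyclic.induce _⟩
    (by rw [Fintype.card_compl_set, hV]; simp)
    (fun u => by
      rw [← Set.ncard_image_of_injective _ hinj]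
      exact (Set.ncard_le_ncard (hsub u) (Set.toFinite _)).trans (hdeg u))
  obtain ⟨hl, hc, -⟩ := rayEmbeds_of_draw hB (by omega) hq
  have hrow : rowCount (codeMatrix idCode q) (f ⟨w, hwv⟩) ≤ 3 := by
    refine (rowCount_le hc (by omega) ?_ hf (by rwa [hl]) hadj _).trans ?_
    · rw [Fintype.card_compl_set, hV]
      simp [hl]
    · rw [← Set.ncard_image_of_injective _ hinj]
      have : Subtype.val '' (G.induce {v}ᶜ).neighborSet ⟨w, hwv⟩ ⊂ G.neighborSet w := by
        refine ⟨hsub _, fun h => ?_⟩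
        obtain ⟨x, -, hx⟩ := h (show v ∈ G.neighborSet w from hvw.symm)
        exact x.2 hx
      have := Set.ncard_lt_ncard this (Set.toFinite _)
      have := hdeg w
      omega
  have hlevel := List.all_eq_true.1 hT t ht
  simp only [hq, List.all_eq_true, List.mem_range] at hlevel
  have hleaf := hlevel (f ⟨w, hwv⟩ - 1) (by have := hfn ⟨w, hwv⟩; omega)
  rw [Nat.sub_add_cancel (hfn _).1, Bool.or_eq_true, Nat.blt_eq] at hleaf
  obtain ⟨t', ht', q', hq', g, hg, hg', hgadj⟩ :=
    codeAdj_of_checkLeaf hB hn (hleaf.resolve_left (by omega))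
  have hc' : IsCode (f ⟨w, hwv⟩ :: q) [] :=
    hc.cons (hfn _).1 (by rw [hl]; exact (hfn _).2) (by simp)
  let F : V → ℕ := fun u => if h : u ∈ ({v}ᶜ : Set V) then f ⟨u, h⟩ else n + 1
  have hFv : F v = n + 1 := dif_neg (by simp)
  have hFu : ∀ u (h : u ∈ ({v}ᶜ : Set V)), F u = f ⟨u, h⟩ := fun u h => dif_pos h
  have hF : ∀ u, F u ∈ Finset.Icc 1 (n + 1) := by
    intro u
    rw [Finset.mem_Icc]
    by_cases h : u = v
    · rw [h, hFv]
      omega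
    · rw [hFu u h]
      have := hfn ⟨u, h⟩
      omega
  have hFinj : Function.Injective F := by
    intro x y hxy
    by_cases hx : x = v <;> by_cases hy : y = v
    · rw [hx, hy]
    · rw [hx, hFv, hFu y hy] at hxy
      have := hfn ⟨y, hy⟩
      omega
    · rw [hy, hFv, hFu x hx] at hxy
      have := hfn ⟨x, hx⟩
      omega
    · rw [hFu x hx, hFu y hy] at hxy
      exact congrArg Subtype.val (hf hxy)
  refine ⟨t', ht', q', hq', g ∘ F, fun x y h => hFinj (hg (hF x) (hF y) h),
    fun u => Finset.mem_Icc.1 (hg' _ (hF u)), fun x y => ?_⟩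
  rw [Function.comp_apply, Function.comp_apply, ← hgadj _ (hF x) _ (hF y) hc' hl,
    codeAdj_cons_iff hl]
  have hlarge : ∀ a b, CodeAdj q a b → a ≠ n + 1 ∧ b ≠ n + 1 := fun a b h => by
    have := hc.bounds_of_codeAdj h
    omega
  have hFw : F w = f ⟨w, hwv⟩ := hFu w hwv
  rw [← hFw, ← hFv]
  by_cases hx : x = v
  · subst hx
    have h1 : ¬ CodeAdj q (F x) (F y) := fun h => (hlarge _ _ h).1 hFv
    have h2 : G.Adj x y ↔ y = w := ⟨hw y, fun h => h ▸ hvw⟩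
    rw [h2]
    constructor
    · rintro rfl
      exact Or.inr (Or.inl ⟨rfl, rfl⟩)
    · rintro (h | ⟨-, h⟩ | ⟨h, h'⟩)
      · exact absurd h h1
      · exact hFinj h
      · exact absurd (hFinj h) fun h => G.ne_of_adj hvw h
  · by_cases hy : y = v
    · subst hy
      have h1 : ¬ CodeAdj q (F x) (F y) := fun h => (hlarge _ _ h).2 hFv
      have h2 : G.Adj x y ↔ x = w := ⟨fun h => hw x h.symm, fun h => h ▸ hvw.symm⟩
      rw [h2]
      constructor
      · rintro rfl
        exact Or.inr (Or.inr ⟨rfl, rfl⟩)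
      · rintro (h | ⟨h, -⟩ | ⟨h, -⟩)
        · exact absurd h h1
        · exact absurd (hFinj h) hx
        · exact hFinj h
    · have h := hadj ⟨x, hx⟩ ⟨y, hy⟩
      rw [← hFu x hx, ← hFu y hy] at h
      change G.Adj x y ↔ _ at h
      rw [h]
      constructor
      · exact Or.inl
      · rintro (h | ⟨h, -⟩ | ⟨-, h⟩)
        · exact h
        · exact absurd (hFinj h) hx
        · exact absurd (hFinj h) hy

/-- Consecutive lists of trees pass `checkLevel`. -/
def checkLevels (B : List Base) : ℕ → List (List (ℕ × List ℕ)) → Bool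
  | n, T :: T' :: L => checkLevel B T T' n && checkLevels B (n + 1) (T' :: L)
  | _, _ => true

theorem checkLevel_of_checkLevels {B : List Base} {L : List (List (ℕ × List ℕ))} {n : ℕ}
    (h : checkLevels B n L) {k : ℕ} {T T' : List (ℕ × List ℕ)} (hT : L[k]? = some T)
    (hT' : L[k + 1]? = some T') : checkLevel B T T' (n + k) := by
  induction k generalizing n L with
  | zero =>
    match L, h with
    | T₀ :: T₁ :: L, h =>
      cases hT
      cases hT'
      exact (Bool.and_eq_true _ _ ▸ h).1
  | succ k ih =>
    match L, h with
    | T₀ :: T₁ :: L, h =>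
      have := ih (Bool.and_eq_true _ _ ▸ h).2 hT hT'
      rwa [Nat.add_right_comm] at this

theorem listed_of_checkLevels {B : List Base} (hB : ∀ b ∈ B, b.check)
    {L : List (List (ℕ × List ℕ))} (h : checkLevels B 1 L) (hL : L.length = 12)
    (h1 : ∃ T, L[0]? = some T ∧ ∃ t ∈ T, draw B 1 t.1 = some []) {k : ℕ} (hk : k < 12) :
    ∃ T, L[k]? = some T ∧ ∀ (V : Type) [Fintype V] (G : SimpleGraph V), G.IsTree →
      Fintype.card V = k + 1 → (∀ v, (G.neighborSet v).ncard ≤ 4) → Listed G B T (k + 1) := by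
  induction k with
  | zero =>
    obtain ⟨T, hT, t, ht, hd⟩ := h1
    refine ⟨T, hT, fun V _ G hG hV _ => ⟨t, ht, [], hd, fun _ => 1, ?_, ?_, ?_⟩⟩
    · have := Fintype.card_le_one_iff_subsingleton.1 hV.le
      exact Function.injective_of_subsingleton _
    · exact fun _ => ⟨le_rfl, le_rfl⟩
    · intro u v
      have := Fintype.card_le_one_iff_subsingleton.1 hV.le
      rw [Subsingleton.elim u v]
      simp [CodeAdj, codeEdges]
  | succ k ih =>
    obtain ⟨T, hT, ih⟩ := ih (by omega)
    obtain ⟨T', hT'⟩ : ∃ T', L[k + 1]? = some T' := ⟨_, List.getElem?_eq_getElem (by omega)⟩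
    have hlevel := checkLevel_of_checkLevels h hT hT'
    rw [Nat.add_comm] at hlevel
    exact ⟨T', hT', fun V _ G hG hV hdeg =>
      Listed.of_checkLevel hB (by omega) hlevel ih (by omega) hG hV hdeg⟩

theorem hasLEmbedding_of_checkLevels {B : List Base} (hB : B.all Base.check)
    {L : List (List (ℕ × List ℕ))} (h : checkLevels B 1 L) (hL : L.length = 12)
    (h1 : ∃ T, L[0]? = some T ∧ ∃ t ∈ T, draw B 1 t.1 = some []) {n : ℕ} (hn : n ≤ 12)
    {G : SimpleGraph (Fin n)} (hG : G.IsTree) (hdeg : ∀ v, (G.neighborSet v).ncard ≤ 4)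
    {S : Finset (ℝ × ℝ)} (hS : IsPointSet S) (hcard : S.card = n) : HasLEmbedding G S := by
  have hB := List.all_eq_true.1 hB
  obtain ⟨k, rfl⟩ : ∃ k, n = k + 1 :=
    ⟨n - 1, by have := hG.connected.nonempty.some.pos; omega⟩
  obtain ⟨T, -, hT⟩ := listed_of_checkLevels hB h hL h1 (k := k) (by omega)
  obtain ⟨t, -, q, hq, f, hf, hfn, hadj⟩ := hT (Fin (k + 1)) G hG (by simp) hdeg
  obtain ⟨hl, -, R, hR⟩ := rayEmbeds_of_draw hB hn hq
  exact hR.hasLEmbedding (by omega) hf (by rwa [hl]) (fun u v huv => (hadj u v).1 huv) hS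
    (by rw [hcard, hl])

/-- The trees with rays from which all other trees are grown. -/
def bases : List Base := [
  ([], [(1, 15), (1, 0), (1, 13)], [
]),
  ([], [(1, 15), (1, 0), (1, 13), (1, 14)], [
]),
  ([], [(1, 15)], [
]),
  ([], [], [
]),
  ([2, 1], [(1, 15), (1, 0), (2, 13)], [
    0x1e15403]),
  ([2, 1], [(1, 15), (1, 0), (3, 13), (3, 14)], [
    0xfaccc3]),
  ([3, 2, 1], [(1, 15), (1, 0), (2, 13)], [
    0x1a76a0bd15f74db4684341d48014e3]),
  ([1, 2, 1], [(1, 15), (1, 0), (2, 13)], [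
    0x5b09645261a92bd00af643224a233]),
  ([3, 2, 1], [(1, 15), (1, 0), (4, 13), (4, 14)], [
    0x53b01cdcf8d1b01d]),
  ([3, 2, 1], [(1, 15), (1, 0), (1, 13), (3, 14)], [
    0x2083e39ec329690a2bea5f1df7]),
  ([2, 3, 2, 1], [(1, 15), (1, 0), (3, 13), (3, 14)], [
    0xb5ac3c44d33042e3478ff209d3671591e75c1222d6dae9708387c44e9c595671361bcae24202cb4f5b12084c4939,
    0x10b917c690f8342d9]),
  ([2, 3, 2, 1], [(1, 15), (1, 0), (3, 13)], [
    0x397bb98ec9899075e1c0525d9ad954d5537ddaf7511]),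
  ([3, 3, 2, 1], [(1, 15), (1, 0), (4, 13), (4, 14)], [
    0x4e19325cc321272ff2f2e1e8d837812e49e724fd2b8e8bd]),
  ([4, 3, 2, 1], [(1, 15), (1, 0), (5, 13), (5, 14)], [
    0x6533b74a685c471432107985f]),
  ([2, 3, 2, 1], [(1, 15), (1, 0), (1, 13), (3, 14)], [
    0x3614ab5963941fa0edec93effb76307f4ce432b064df393b0035eddb15fa858aaa16e88e1efe5362274274c12b33,
    0x2bd76656a2d29604fde1f52e17eb96]),
  ([2, 4, 3, 2, 1], [(1, 15), (1, 0), (3, 13)], [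
    0x39d132f71b737d577cb34f650af96d03e24ac25d25ca2cd1160e637dffbc729eebc8f9a92e1f4e86181245aa427d,
    0x22c5c39a0c64b609515da4e1c913b4041b59d3af201ad12efafb3f3d324628852efc6a9256c90d7d52ab45db7415,
    0x1f47f32b79]),
  ([5, 2, 3, 2, 1], [(1, 15), (1, 0), (3, 13)], [
    0x90a2c69b8ae391e4d41fb905717a182dd9abbcba23b010b60a45d8fd310d396d159080c14f4aca435332eb45fcb5,
    0xc15e87493a9c60dab89467cf1b842107dec77f8c0cc1f78]),
  ([3, 4, 3, 2, 1], [(1, 15), (1, 0), (4, 13), (4, 14)], [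
    0x15b7dd75a7553b8da10c501e6b1ba4473ef844dd9394760fd83189f135e072dd94f939121111f2784e4d23b80b95,
    0x46ac9f2ba172a1e2072b1381cfde7d1b273411037b394c4f2e27f06d987b4bb272a1ec8d3d337fc0]),
  ([2, 4, 3, 2, 1], [(1, 15), (1, 0), (4, 13), (4, 14)], [
    0x4eece95465d2f7e3a445a0a253fd8f744a30c7c0b9a37ab180979e0617da02a896395cd05e2f66818cb30ea4889f,
    0xb46636bb95f4a34cf356a058bf06302cdd74d1e0c07953850a3062a18d98b403f0fcaf2046fb32c58d3be]),
  ([2, 3, 3, 2, 1], [(1, 15), (1, 0), (4, 13), (4, 14)], [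
    0x6be870a06130eb741e9c32f965e30da51d057067ed7ef29982e77c1679ebfdfe0e7677aa2e582a52bdddc75b718d,
    0x35584661c4e6b68f05629623204672e71bed9ac0f3d9e3e4be3b3555a3aba10b]),
  ([5, 2, 3, 2, 1], [(1, 15), (1, 0), (4, 13), (4, 14)], [
    0x2cee4cfad5f459d347fc5ab5b7d976f9842667bc02ebe041288c5d8a069d45c78d96cadea04572a5b2bac597cbcf,
    0x2d1f4ec4c5b3bc267e8324306c8742995a992bbaee1323d]),
  ([1, 3, 3, 2, 1], [(1, 15), (1, 0), (4, 13), (5, 14)], [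
    0x6b3d8ccb2bbe0e28b1bd93399c3b4be6efda1c28e68177bb3164e2491c5541e22aa04f9a9247f060faf88e1681ff,
    0x71f98a1347f6ed36732e0cdd958c446cb6548c6e8e61aa6]),
  ([5, 4, 3, 2, 1], [(1, 15), (1, 0), (5, 13), (5, 14)], [
    0x5e13fc9b7005f3effe3e2d6e26dbf848af0b79545e2e4b87932c32d0011c5b257cb3c84f44e7c2c27c815f48530f,
    0xc06a]),
  ([4, 4, 3, 2, 1], [(1, 15), (1, 0), (5, 13), (5, 14)], [
    0x27f33ddbbb3f758837dede21ccf62428e0f54b6520b7f2283b8a7bc289df9c052abd7f6680eed1029c6d4c331475,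
    0xae9f]),
  ([3, 4, 3, 2, 1], [(1, 15), (1, 0), (5, 13), (5, 14)], [
    0xf087e2aa6916e22d3fd27dd36994e0b5a5f59285a972cc47612d7d839b1fc5dc4915d7f0ba094ffdf90da23c2075,
    0xcb9e]),
  ([5, 4, 3, 2, 1], [(1, 15), (1, 0), (6, 13), (6, 14)], [
    0x5a82e8f23a2a86de7391497dcacf3ac258a1c5f72d]),
  ([1, 4, 3, 2, 1], [(1, 15), (1, 14), (4, 0), (6, 13)], [
    0x2c848d3063390989137c693470f4d79]),
  ([1, 4, 3, 2, 1], [(1, 15), (1, 14), (4, 0)], [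
    0x2c848d3063390989137c693470f4d79]),
  ([1, 4, 3, 2, 1], [(1, 15), (2, 14), (4, 0)], [
    0x5510879ed8e0108fbda74c5372e2b44caf00f2269a9dba185ab9a2c6aa40510c949608021fe7da9583319ad158b5,
    0x4330257e995a6ff3cae3]),
  ([1, 1, 3, 2, 1], [(1, 15), (2, 14)], [
    0x21e489e49d658042f117]),
  ([1, 1, 2, 2, 1], [(1, 15), (2, 14)], [
    0x24e6f66398635c03fc901d4338f84f5d8c9f253ceb]),
  ([1, 2, 3, 2, 1], [(1, 15), (3, 0), (5, 13)], [
    0x580fee0487b04137f5a2ca4046b87d7160172775f1cea704c565ab2e6012499b0694ebcd18aefa2203306d66ed31,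
    0x17c38fd57e8a4fd7f7ecc]),
  ([1, 5, 4, 3, 2, 1], [(1, 15), (1, 0), (3, 13), (5, 14)], [
    0x71cbbca70c35f702ae4ff39bffee20343ed635c57dde317a1d9a4d05834cfc9695007efba8e2387a0a263d071645,
    0xefb41066c3de64d3eecc2ae9e43a55f22434225f551d0fc52a017e38d6b64c2bbaa1d8e27fa48cbe0dee6f118dc4,
    0xfd226f555ed95f447c9fb5d24ea63a89594daeb0213de680a26740e3b01a6edef5cb3908eab4fd915325c538cd5c,
    0xc92087187703ba59e3fa54a9518adc4d16eac92a0ed1801a6c5ee83daab506e5fc643ae8fab47191deb0ddb90137,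
    0x3b9c53bd5d961156969752e362a0e7c244a5263b244d74fcc79641e908f920163f281eec734c112e70afabad363a,
    0xb8b28ec9f32c55bdd55de4386f3f032c6ed59c78c88ff0248b434904f484619fb909825e0ace579ed84c28a0b7a6,
    0x7a2cbf2c00420d9246bec77f8768974d8848a1018d8fca050903471fbb631c6697e1a23cd20e610187f6207cc5d9,
    0xfd60434b865631ac3390ad8733ee6fa88ae31faff2eedb9c0119ae4d8dc3e27850f054bb187cf92db5324960e7f4,
    0x6ff371c9038f8b59a709bde31221b92d3c7a777c56bc74e12b847dc574aa1668c9c2911c3c49babababdcd79cdc8,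
    0x28f7a608511c0c183121ec06ca851d5b57b3864374095870900bb3da7afd210c8ac67fa7109981c887c798ef4b28,
    0x74278b8af1701e3b022abb61cd72d4eeaaf5ca10d8e1a23a91ecae86dcc01572c9d32ed740615a1ef503aa328fe6,
    0x183c3aa958157853097a34e2b3665bc49eea76b28e49782d73ea454000d8b61aaddd582ac6eecd8d60]),
  ([3, 4, 4, 3, 2, 1], [(1, 15), (1, 0), (3, 13)], [
    0xb8196fae7d2a0abcfa482bbc0c4c3cfef72b04fe030d1f7658b37654b5a3b63e16e501d1dbc636a64afa432d831,
    0xf3f8b17dca42e3a65edbb2f0c363cc9c6df545455daa9663c3a910f8d87dc19923f1f437e8cdcfeb444a3f418874,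
    0x8bbec4e2f84e25e74a7d715f9e96c33de7b22907aade093b437ef6aa9c3eeec902cb199b04751ac8c1a49d23b3e5,
    0x763864451d546b9de3a4fda3f3a64a9bd51668033a1563144ecc1b714046db114dfb7c0b45ebcef8ad96bf5e5154,
    0x4f5890358021c98ab58e555a086b0f1bd72500c3e5ef811b1b529559fb9911ab7b45603a3c068bd87b935f534f9d,
    0xdbf3c9800da4d318610c170e0550303c505bb65f83ed0d14c5fa50ea38847c3be7835eef6b31db014bafc82eae51,
    0x42e0ff4673badfda07779ddb011faed0fdad6de12b903f0b9891f6e48c5a1f5e4b2f35548302b8262bac2f4b25eb,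
    0xbd95388a22185913619df625c79e9c79b0a2c5878502648f9de140185a595fa4371fbf87cef70334f6c4977e6a71,
    0xff644d894b98a8f71d2a2a574cbc34c49e7dbb65c32c35b096e044f172db1700b45db26b299e465d1944fd59dc4a,
    0x62ac6f2b38308ec1deeff3bb4cb56cb6d1606c730b20e3ac107730d4351ac89960301a9413609bf0a021add0294,
    0xd85a99cc3f12fe4f61658192bf5a2dcd91939bec8461b456721d7feec63ce8c4f3cd7893d7c2bb6ace70d5756d7d,
    0x27fb76d87b3cf7efe7e790002204d888b17f279526a57b9104249a4c2379e8d8fbf6f1576ecb3018ab329a37bcb1,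
    0x27403c5e7e9fe46823b141d0cea2cae5bb18de56ec1efa9cb2d134de5f463d60c5c845805a84ffb95a57d2398c8b,
    0x9d8ccbfbab8de3cd16de7682812bd3c58457dee7d87860ebb6ce34cec3c2433055bcf52e5bd47f3a442bbdb025f8,
    0x508c8705d8e1b10050a30f06164c354669f265c2a5bb3521d8da2b3f8c98b792c18b31d83ad4c9b2ab7c]),
  ([6, 2, 3, 3, 2, 1], [(1, 15), (1, 0), (3, 13)], [
    0x7fffabcd5ee54cee95aba138b592ee8bf5208c0b0c0d466ede56ccb74104a7b0793206ed04a719921d018468ebaf,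
    0x844c8bb33714aa884b797a29cf62e1f5ebf29aab0cd0947e889b5a7ff798497afb048764a77858e84b6595a9edc,
    0x5808025fe9138e3671227991819df1dff8d9886e1c4ac711b94b669780d16e9a8c78f1aeb6c3e6c7f9ba5569e0ea,
    0x84fab7e07831328985d2b26d620fa606ad2e55023fa4e61391cfac51220a1485eaa2323b4583566e31d86a3a1ec3,
    0x2c02a724984a9a0dce7378a14804ac10bd832610ad4fd2f09e37e3e9509f3dd2e64ca1ff59be5f16bfafd2995f3,
    0x2ec27753a654265975aa2c7dbe662fc77831257dc33215d1ee34014f6fa503fc3c7f550e798a39a1d9561a544c2f,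
    0x6f03e4eeca402b6a7967036e28172a7cb8aaaf7a9a1065e93e905d45f7efab44d028aac37ef02cb00fd294aa8e0e,
    0xe71b60dca789e4ccb026c983e82482b61fff1ae08d44ff8e1eb2479b6041010954c00ac0d2a1e0ec774879d7b331,
    0xdd9294e7b75c427f3d062af8484a2bbd4504d255051845ed2f56bd35f95818b076df577c32733347559488eaba7c,
    0x100daa4783a707d740f62c8f943d45d16e0dde4aff2951a95f11f9e1b57dcdd45e845a56fbb6856c7cc5b86652ea,
    0x534a0caea17d03c387f0cf056d1d8d25f226c29b341236b217522edbcf92dc224b3e60365a341d75ef1bc7144fe,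
    0xa6a96ee5b60378d28177325b78c891ee0ed38b8b93a770b197606f5cee193f4c3513c8ac93b56243e4869951b331,
    0x94b32d0e2a67ca0097ec6891d72d40934967cf3ca6aa11ca3a249b836159b0a84f89158f9d517b5ee9453911cc9c,
    0x34a30a595f20cb5bbeb8cdf0e8]),
  ([1, 2, 3, 3, 2, 1], [(1, 15), (1, 0), (3, 13)], [
    0x359056090d284168c6f169aeef531e2affffb53b7a55ead95115c4302bf362b5ae1b24154f554f92f1cfb13ab7f9,
    0xb13cb31f7320695cc53867f76e0039b971a9b0e2c1cc6a038319b9858187cc98f036655670797bcec1615dad4107,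
    0x2915c5614e9cef6588147daa7424da387b5059fdf7367842d931ce254529721aa8b7cd659c9285d1bcc3ff1f00c9,
    0xc548b4950666853e0fa67efafa7668d6bf061f3a2bf30637e95912ebca126e05ad86e4f8798daac270c584f48549,
    0x2e5ee36be906b69ce158ec76c6aea94af52cd7ae9a598c1e5b5e3cc82fd86f9aaa979421ca3693313c43b1189f39,
    0x4ec222c7c938e3db47a73b7ad4de2c6ac4944e356cec46915b524981550cafc6ba679ee0043ade87bfed4feff61,
    0x2bbedf9f447d732cb87b48193c8bad0e04bb8d08475fd04bb4bb7798e35e70bb6494c36d276a4f759dab28a8b0d5,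
    0x7887f03ba2581fe29011fb0c0e8d1e4fa33017016e77eab58242b71ad974e1f9e6f52ef0e208c5a4514dd088eb77,
    0xd142b3f7375b0a300125dcafe63d9cf4d92796d8248b5f17b4d07208bd925b36f9293dbe40f99152ef64bf8f279a,
    0x684ca09ffe3b92fdca991f86ea51ad267766eecc0f0d30f6bff469deb72658a54cc83748b98944368e0da8598f2a,
    0x91ef63ae897d3aeba1371285a8356eb06eac2d9cb482cb05206133626fc511131c23ea1aee53aa963aee85eb42fd,
    0x8cb8dfc3bb0347a40023963c46ae0b6a41816eff911fa4b25b3656a76c491c0e96d4379d343f56a9c9625a4e40e,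
    0x2da8e32157ba5a72c4996669abb6be46715668ddff6098735879be9471269a81a5682f91f43988e1282c7174759f,
    0xa9f0a184191df5136fb33422d52b28ba8ac923b7fc7b7134fffff36f4aad4ed71ae0eb07d81aa836db00ba970a3c,
    0xcef02c50e6acccd8cdb6c9ea8ee6ed8827e15029216bfa96b864c0dc9390addb7d047880ff15f2167d98efa0160b,
    0x71c37705ce4]),
  ([1, 5, 2, 3, 2, 1], [(1, 15), (1, 0), (3, 13)], [
    0x1f29702cef9042dd3aa7760a29445aae29c7b4835b51e25bc355256225f5172ef8bb0ef00d1eaecddd318e30509d,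
    0xb9266a4fad7a0b01fe814b143406a0adf85d7ad1f0bbfac2fdd2424ba1c6f5a8b7c2db84c26c78018c616eb4d613,
    0x337bc82e85edbc7422c874e54da836f73690735bc45a50f1c9cc2bc2b59225da6d29efd24f478bb1225b1d3acdf5,
    0x3d8de6a56e9d501e59cefe329311d2524b293c5adacb9a91f6c050c43f476f06333e81c930b3b1fba8559990c0d,
    0xb84247bd64b0c675cbbbf2ccd363f55deae5db73ad67453f26723eab383994e9e3ad7596dc54b3585c61d7a84fa5,
    0xf85db9869ce433f643368ea200855cf1a019094dd5460842eb55defdd9344da3a0457232bdc9cac5eac1a0912109,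
    0xbb00ebf0ff8619853c62b06801293e35bd19ac72bfb2ec119c29be9b78951fdecdb1ca3017dd1a72490aa5c64fe1,
    0x3eb3b8ccb1671946eb2c124d09f1ed2105d7257e0cfc4cf01c5fc7c6013988663688543d603b8fd0bc38c2f108d7,
    0x1f44885642ec3763c36d18453578312bba550b291387dd1b379b5]),
  ([2, 3, 4, 3, 2, 1], [(1, 15), (1, 0), (4, 13), (4, 14)], [
    0xa3d5d48f2e2bd98e1a0cb25fb74d1dbc9005ff200115adf9c13ba990407a91aa4e6deeb83379c5b4ddd4112caad,
    0x63351ee6b1c2f1da02f31d49a1a5cf6eceb5cbb0bac635189fd93e901746aa1e467e4119e9de4bc8d45af800db2,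
    0x53d12658747d12b5c4d1b8d342687f924fa6a453b00ebe72bc40245804568b28152e27af7f330c3342054eb3f712,
    0xd5e278285a7a40ed8c4152b7ef3d48b3e88560d7df11ff3ca07ebf4ae18b42bacbec1343be3fe0bd87a793aa0b66,
    0x570e6974ac331aa45dbba2800bd86f8d4919ce136c9fb5684fee54742a07f847d4129169f299be83648fc30e4073,
    0x3e33dd2a233e8a83908c2fbe456780793b00024cd45277bc206ea1d5cad8b8fbe5701472cbe2ebee4bc887ba12b0,
    0x4b7dfa5e4cb8533fb597c502d73cfbb257ceac6aa55a515014dc98f40e39615c8842d6460211a798375b2aa31366,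
    0x51b1f9163]),
  ([6, 5, 4, 3, 2, 1], [(1, 15), (1, 0), (4, 13), (6, 14)], [
    0x26e1b97a2ef43fec79db82465b81bbe0ae086ba2ae525a7d7301ff9871d1c08ea57470d9159b10f2e33e14b90fb7,
    0x95ccfb1c5b951c5d820d61f0bf187839b695465001fccaf4f48b95c050a05d951a332da6aede02fba566a642bd29,
    0xe15df369f623ca4039b91d4d89aa4fbb214d37b6848fd2fd9b7c027bdffee6cc4534c25c9fe0178a80030fcef55,
    0xada2624b210e788a2bc5d6a1d376314e600caafe4959e0]),
  ([3, 4, 4, 3, 2, 1], [(1, 15), (1, 0), (4, 13), (7, 14)], [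
    0xdbe75b6479d46dbe0bb70836f0e776a6647121e8e19ba67bcaee6055bd61c59ffd53fc8882995f8aeccc59571331,
    0x6dc71b12da91348fa69168a9f7102a2fffb27aa8ddf8fc42c9c45ca5ddee5671f707b45f577d97a94484843c0353,
    0x7348b6d52e5cefdd761c5c088db68216f6bde8bc716a0fc3a1d312ab6d8cb0a5071e2e30643fb09ce8fd1d27ceb7,
    0x59ae353ffcb3e8020911f7dbbe72772ed1851cedc71652f006156c5500d663db6c0a2b2b328af0f88314df0a3670,
    0x4b33ef659fce7d6aa8d1185d9110b2833e66975e9f7172adbd4c1df725d343fad7cd21c5670fbfc52594d455e78b,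
    0x519ad18d6e1e9623e12d135efbc7fbd6ba831ee6fe35ccccd098302dfa93f43150918e4a92288a3d7026cc0cd3e4,
    0x56de96e693cfc592426ec14c0d524bdd11dbe5120ec52839aca11981f3c737e6b4d4802d290b3101e50dfaf8e80,
    0x131a948ffa3eb045a464a037545f1e68dc39f09c456dfa4bb508ad6b2f886e99da04e713e6a779189034f1d89403,
    0xd50e2531fb4cd6a66d9ff79a492c2ec7af6236afab948a9ee121b3eb383ae0d88c5794a212beed087dc2cfc53d50,
    0xc6bf300294754c7a00b8113499d27fd9bd83be0d2abf2ee1f14fda54da4aefbf7d55ef78a0a585c367d43727180,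
    0x8fe3b8cb75a9c301b681cd1c7bca6482e984a89ae042f2cb6e8c9004611bc29e9cbe13146df72b875d90fa28bf24,
    0x7171fb2d2f74d5dc3470735e73caac861269d69220dd6503ee77cb6b2a201726fc18a80083291bccaf16e0697891,
    0x3d462d4a4f9324d5a43692e960174eb79cc964e4b1314e9c2823340f9ac07d83df84935a77cc39c32864536233ac,
    0xdac57bbf148b5e76e6edecea18c7b37706392d44ec5c2df1a047f0f34c84131fd349f68ab1cc6d1b1aa8deae5801,
    0x4922b8fe683ca38edc61771780b29901f005e8454aef9b741d84da8a821d9a1ea4b94ab41b69b38e40719df0c999,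
    0x272089e7c40b2b9af17e5d4f82c10d5db2e87f28ff2e5d22720e261d8140b691270584d25d540872be8]),
  ([1, 4, 4, 3, 2, 1], [(1, 15), (1, 0), (4, 13)], [
    0x8d78bfa55e28ad3372c94038eb309916f7acdad986127f40f4831fed496945017040e5a506402c81a84374a4d1d1,
    0xde0f6287abbccb028dc47ba9f732e75cc5904201d461656f241e1f3df6d35092d6ca97ba3fce19403bfa618482a0,
    0x92602405fc196b2455084ba6a4b85eeb5ffe356a6236b47505c270ad0641c732834d019f1d7d8f6326b5d3a7953d,
    0xd7a9cd07863b2d1f229b09d8e8a1e16b6423514588f7cbb2f95e3f1c13fa5e4671347413da3ec4d1d6c3b1ace0c9,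
    0x3bc7e3514de5de24d21a47e3feffee525cb12dee994d381ddd62ae4f50f3d265b6adac1947e47ff28b1a13be5f69,
    0xc3792c7ec93f0b1c149fb43e1e75f9703496e64893b9b75b33c4094ce631218ef058e416a43ece2f88e6d21b054a,
    0x459d7574f68df3049138815d8fc50d71be53b5275ce6773a774236931b39ce43e9b1c243908ff250e96efb052ac8,
    0x7ca109bb714aa49682bd0e564b3c24c488a707cd8d59af2ac542b3cc6d21483df86015109efe454ae0f601903eaf,
    0x29f14f959c60b23e9bfbf99d4ca5af5954c995c0379c4e1fec0cd21db210ea7bf72b69afa6c35f9]),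
  ([2, 2, 4, 3, 2, 1], [(1, 15), (1, 0), (4, 13)], [
    0x958b62da253843a650f337ec2d47d255d960f9d8f7df230f96b188d4108261f7b4f75b78fb0f463ee80924310619,
    0xa20b9fe836039a2487e66b27a04c85cdc5ef0cf76e73fa014313a7d0c8727b36a28d848c4a9ef38dac66e9f21fdc,
    0xbe7d4b1619af0d88e78eaa4000d404b3f20b1f392473467c1608b932856d461c0c4e304823fdd0243e26fc2ab53d,
    0xcad6579ff14bad1ca41c1a4c0aa106ba7c18c768e3914325163002e07f65870805c9d431c6189448d8ad568b1500,
    0x1c5e681b2f67282f782ca982bbeb87ad03f5bc88fcc1f712ed1b70c8d3dd19f48cafae47e80051a0bb298761d402,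
    0xb28a257782592a794954eee32316fa3ee37d1c2bfa5076d066047e57d4d3c360bf913a284da12bcfcaaeda595e87,
    0xb05868f8bf0866fd8e0b33d1a2cf049b0d8913a5ab6a75de73e98120d83af579379b21d0ac0e7c656c90c0fe1296,
    0x4ab83ec78698675c68de731a6e1d7430ddda2e4990c9c590f51e38196e4bc76e41b1ea185ab855c435572e43db96,
    0xb553400d03a8c3e3a3c36da16ef21560a5c61c629c8cf87265106aba1295dc0616767ceb2da2e7880782129bbe33,
    0x8a9296]),
  ([4, 5, 4, 3, 2, 1], [(1, 15), (1, 0), (5, 13), (5, 14)], [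
    0xd6f6285eeda7967587891207e3759cd3f8e450be0766296c535a617c834b2d29020e77c06511d5471966f3b33b0f,
    0x7a52b005108ce35212fab4169ee999b1fd9086fe321bbee72db2d055a4fa06b0aa515c058fb5643646af959b37e6,
    0x8ad61def5d0adc318a8964b47c14a14e464ad66a5405a339b3faa5d93730037d46c5abd33f9c9236082112e820c8,
    0xe65719ebcd623824f8de597a8ac7553036a544341d095fa94c57f6ed728]),
  ([2, 5, 4, 3, 2, 1], [(1, 15), (1, 0), (5, 13), (5, 14)], [
    0xb5653b756596d1b588eba51170c009187ccf21cb79ac4ab7dd68f3a391670b951f8278b9ff48254cf85ea9d4b691,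
    0xfddfccc441116c3782ec058febd607256d31d05889b878402c6dc743a75b36f32d191c9fc29533292e4e5e58cf1b,
    0x31091ba9101c2ad5114c1efce8964b2fe9db4d68ed10d3beb179f8bf0a9868cdce91d897c40b2bd199e4a33f01c0,
    0xecc4838f1d3b43b594e3]),
  ([1, 5, 4, 3, 2, 1], [(1, 15), (1, 0), (5, 13), (5, 14)], [
    0xb38a6251b70cd92943b713de7bcfca5a68e4bb91987a7c0cfdc2db6807a3c05d16094a6b020e356165a4a1bffb07,
    0x8e28eda9284f8dd33e52fc7ffaf89f723671b8fcdc77db9494715f1f7492a07481e61bcfea4ad050a57b74e16d89,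
    0x772648f938ef4dccad4b67889adfe66e73f6b1e9a03c511acb93fc46b9dbe9edf8c42673b603d70588caca940ede,
    0xc7f03a757d9b91b54170a0582bb74ce5d10a018bfb89ae0fb1b9b134e349c81b83655a4676ca3e36e006d8efb2a4,
    0x11efc13]),
  ([3, 4, 4, 3, 2, 1], [(1, 15), (1, 0), (5, 13), (5, 14)], [
    0xbeedb8eb4e5f8fb16a82463fd498a32eae01e26d56d01a3181ec59644541330a6073aa5af38ed5ae385c8f60b8bd,
    0x64566a4ecbf990b1e09a3a4066f7578f1e9cd60d0cd87d064378ca25bc5f4b2441925eae1bb51d2dd7a5cfd018d4,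
    0x148a83fa6188b756ebacfc7c82591f4ea6c11db344e4588c12a99ff5570f210fb1661b2dacc7461e9ba9b320c5aa,
    0x2899d17e5e3526692ce11993b9cdd714f52d8fb706c8671a5bff8]),
  ([6, 5, 4, 3, 2, 1], [(1, 15), (1, 0), (5, 13), (6, 14)], [
    0xe571cff9bbc187e751fd5d3643b0396ccd2a74e18a4909f572598a15925014ecf92f7466d6547a9311af66a33d99,
    0xeefdf4ffd2294c79d24b55a0b9ecb9c678254dc1a81ef4bcc75c2f1239f695cdffe5874f8fa75331cd800233bc0e,
    0x72ecee4f3b3f3d8625def3d01b31c0fb134f8d4dabbaa45c2eb5ec14f6277917d242e2abaf68625141d540b530d1,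
    0xa931adcb81da7e90f4b8a7b81554d45e5e7c2f8e5c7fd7b18206ddb2888ded2cccf48292030e4265e2a7e6ef7977,
    0x1232d0848311c107ab18d55582402d0798be4fc2341f08c61be71bd3c168254bccc71b2ff471c0c67808330950be,
    0x9683682b8b1a67ea90877289a84237c542585d410d6794a0728c63d9cd483810a47dd5a83d53572446fc2b85a751,
    0x73a88905c0f3aa3f7288cf689f1615f0963406348f778cf71d01d9df0f82f]),
  ([6, 5, 4, 3, 2, 1], [(1, 15), (1, 0), (6, 13), (6, 14)], [
    0x6662cfd3ce8285b72514f278a9204b24ac602e73e4bb53d73387fb64ec20efa6b3b7170f234c7c5b792bddb68a35,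
    0x943403d5eb3549c86bce191]),
  ([6, 5, 4, 3, 2, 1], [(1, 15), (1, 0), (7, 13), (7, 14)], [
    0xb81db6413fea7dc4aa2b994c20020cf21abf5d8cc2327f0ab22f02b9492905f]),
  ([6, 2, 3, 3, 2, 1], [(1, 15), (1, 0), (6, 13)], [
    0x6853a8056a3be64c5d2db162b045a27b3a7e856527df2e6736ece1c9a04784bf8d9de1e1274b3a6edb2103c7ac29,
    0xb65ce278f5be9cca2196e51ec46091dadebc11a7803df105cab7d1a8bb3e56ef60120739cdd514a13c7006296a3d,
    0xa09e4b99167e74caeb4cffe2515580d3ffcbea2766c7d2db00bea7dbcae6b56138bf670ddad968d2dece2b1f7e3b,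
    0x872573bb933f847326e33a989ce76319eddf92a9a83338438e96d286bfd72c262c8e7a7dcca0f02b4dd81a41cfc8,
    0x37ed4466e51d87de0f2fb717e8761733bac9c33bc922a67974cd1630d201d22449e0fa61ab98520cc01b4f81b776,
    0xf5c6be710d6ff6c827d7c46faf49c47c2575aa8913dcb7c78cc1f1199770eb66993aae165487bb7d7a31da55fde8,
    0x7769f2f48b10832026387254d23826ac79481db9132649dfd5a19c6c7d9092aab759e9067bccd569d4b4836fc419,
    0xa8f3e0c3631634732ed49f10d2428c5b3810276cec339ec5fc8fbfea3d1fe331cb602738c27e51b0762774e2ba6e,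
    0x964591765a9ebf0a3b7a6ac4ec3144acdabdcb7b02fdf1d0ad38c464507941791d586f930376f1ee915a0e5b73d0,
    0x38e31796a51ca]),
  ([5, 5, 4, 3, 2, 1], [(1, 15), (1, 0), (1, 13), (4, 14)], [
    0x697322f00fb07bcfa3320f0766f6e41f9a4f86602d4762c1e0bf4c44020d7f8ab4770f875ec6406bfc72d89d8c6b,
    0x35d89a4cc40030b68bfc40535edec6fcd0596567585d6392666320cdc6ef4fd19ea6c2658b319b0e547bc63c594e,
    0xed937b0124c6cda6a16d00b0da8702c2098c246b31b35076011feec25241b072ac5c34d8ad73986cee81daa2759e,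
    0x5dc9c28f8870c17f399279b358c124257ac549141cedc600268f2bfceb9fd6bb641ff5f20d3d0f48b808d7f43215,
    0x535ddd108862cd4d5ea7c1c53b20547a2dfeee80bb6525f06ed8311ce21e80144b8068caa11f0ee37b77df563832,
    0x67ad39330e6b5a96cd02673040dc4a2be1c4543856d38725e56986d979cb2d6e545ddab0a215a193f018adaec13d,
    0x5a863699266fcef574c1b123cb1d54634e72a63e1e993c580d64a2fd25b97378790e448646b1c1274bc8358c33b2,
    0x52c6e559b2163f19d8154e66db40df7833870ee8008f1bf6ce9314d5e7102711259c3a6f130693c654099983c574,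
    0x6aedcc137365fd547e9313fab9557017723c1b54c784e4ec7299f293cf8f1a76fcb858ff1517795691a352e07a39,
    0x7f64b32be8f0dd96a20be1cf565e86e4cb47a14f5afc220f175cd445475b330a937ce39b8ee8a891a3ff0b2d26d2,
    0xaf5afbb62f831eea63d8e42fba48efc8f9232cb1d0a2164f496c6141908a2191fe3691fee3fa13f14f2b27d598c,
    0xb65a62ca64cc602572ca18c6949c438e72f126463f80cf8b18d04ca62871fc4b36cd60e9e7b6be82757f98741433,
    0x9e9d282d3b85ba1120180a71132ceb159817eaae4b10fabd0b8a26095b3ed5594a6b3ea99aef02ee09292f59db43,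
    0x2c78e4a657ad2577c30404550c26c02440a752721e80855db0e6d2fcd755dd05880788a076c953374049274f3dd,
    0x8d7e24780e22c489cb13543da9e4b5f431efe54d0662a7b8d5f3dbf096da84e543b953ad775252623283aabeb86b,
    0x55c52bd2d91b4453022f9e949eeea14d79e7c038996d870f299cc9e7c98e9bf3c78f3ef1f1524abdcf460e8a167,
    0xc8cd8db65ee0ef9176bb7869c78f8c9bedea10cb08aa7e214ec3f8fa9a1f77171201db56fe58ccb280c579cea5d2,
    0xb3025bfb011ed8a13fccd02bbca9effb41f738bf440b72d4e26d4b4ec99e18afa00452598ccdb751852e06f4dff0,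
    0x5b5141e6307772442ceb]),
  ([6, 5, 1, 3, 2, 1], [(1, 15), (1, 14), (3, 0), (6, 13)], [
    0xc9773cf51008934492c6c7c0a32efeb49dcb049d88ecbf1f86ae9b17fddb96377421b5a3ddff497fb0ea0219a147,
    0xd756323bd33c4ce421ef8d6d7fc6e9663ac59d05f7da9059a76e74d0e56ac133b76ab41c97a5591b939b85898ec0,
    0x4490de9a2d57f17feea1e0d8a5171a3794b6662bdf7c6c5d]),
  ([1, 5, 4, 3, 2, 1], [(1, 15), (1, 14), (4, 0)], [
    0xa57294a95ca64e42ff8ed43072d0be5b1025365647ec0efbc8f567720121d9011788508ac5014d02974aaea42f,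
    0x1dd1b37b6bc94f689ee2c53014cc02b50d1a]),
  ([1, 3, 3, 3, 2, 1], [(1, 15), (1, 14)], [
    0xf00d3c5f8f375c7133e5845f008135d951eb67fe4d1d8bf577fa061733a3af0b890fea6ff448142bb9da0aecbdcd,
    0x33032c8359ec8cb0b084276ceca5da6a715a2ecd21cdb0c9f344547d4e15c6]),
  ([1, 5, 2, 3, 2, 1], [(1, 15), (1, 14), (7, 0)], [
    0xf4458d692c5a58cd91be1b073ea432d5401f462d69813ea45388f51770ee8f49c90378b2b560c01e4320e890c865,
    0x86d9126b560d51d093f07110920009f9d73214734996694c3794916b50c9c7b83405944c02c8e708597cad392084,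
    0x540b226b142961633c09cbb23339ab63c5e8ac2f0b33e1d35092f99f5dc9543dd9b]),
  ([1, 4, 4, 3, 2, 1], [(1, 15), (2, 14), (4, 0)], [
    0xf963d03a9cdfac843d59b29987462481c35baccc614d3a3e85f8ff8a90138f94a621caa0bcf9ebec8a92d0c1b461,
    0x92afc1aac43f8aa0289fbd3152e28b31c50b5b5d2363331694e070a8daee2e46f67924e412efdde6adab1b7e96a,
    0x28f71be41e7b10e0a820a520958a3e4edc410568ecd683de4eebaebc7e855c95678b8c960099e1d54608c4642310,
    0x507dd94dcd90d6245d4c701593ad982f451ed53d59ba52e7b6d5d15a904464a498a394586732b586ee0f5ee026ab,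
    0xe75180814ba215008d78a567ff28663094c989430e1a7682dbf3135c217aa1d165d94726112ce1422f71046172d3,
    0x3ffc91d45cc43a7ad829bcb00677ec1db5f8c43c5c38e80c207f15907dd4d2c8c57672f4690d39e4b333494fb73b,
    0xcfc364f823bb99d3b59e8d31c63cfc8626c0eb821a4b296b28d987209a6e8f564b3f9f9d3bf12c4e02368635775c,
    0x1013876f99febe26]),
  ([1, 3, 4, 3, 2, 1], [(1, 15), (2, 14), (4, 0)], [
    0x8733e300271803f1b24a4b48d955252bd434db1f76b4f1fa3658af522359af0c14359e7a1472dfc7f9c43e62123f,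
    0x2732f7ef7646ad2f101ede023937a734dd0710e0c26c5025c6f9d5e5cfefef2b3dbfd92c59a87458998a64ad7bd6,
    0xdab37b4488c8a87fc8704ff81073554fd8fab5fde3e85e48f765fd23832eaaa44c1f35dcb1c2708a241589ad9a25,
    0x4f28ce71c78dbb5fb6f70dc2a137ff3fb80a353c7fe1fb501bf06e954467d1416f]),
  ([1, 2, 3, 3, 2, 1], [(1, 15), (2, 14), (4, 0)], [
    0x570b8181d53b9237611c7adb51581706a2b0e92f5e2a045b5ccf859f7ed886d61e5f858a636c09cf350c770fe79f,
    0x3d7aadcde83a9707ffb1ad4c4e1ff123b1d3b37721c5aeb1fce7242b93a4d4bc697f41e8fc0d07f8751c51bfd976,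
    0x4204eaa95d70c944e6caa540afd36143106]),
  ([1, 5, 2, 3, 2, 1], [(1, 15), (2, 14), (4, 0)], [
    0x5794e8f5d08fc189be127f6a4933eb960b42b7fefcc3]),
  ([1, 1, 2, 3, 2, 1], [(1, 15), (2, 14), (4, 0)], [
    0xaa74687726e40abcdc39cdeb1cec52f7624bdab137b96e39bab12e63eb5cd5f97f3431081e623fb081f87bc25]),
  ([1, 5, 4, 3, 2, 1], [(1, 15), (2, 14), (5, 0)], [
    0xe7df7d00f713abdb474579c39170979a996d25f7dc6c680e296d889c92b31d44ab78658813675e3c0da7c1e73621,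
    0x19999c92f99909915e0ab9]),
  ([1, 1, 4, 3, 2, 1], [(1, 15), (2, 14)], [
    0x83a0f8becb5221d866dc003cad9ea54f24eb9f8587955346c5a3814207d776716c773]),
  ([1, 2, 3, 3, 2, 1], [(1, 15), (2, 14)], [
    0x1936ef7b11a5efe02f7c5623ac4b8a994dd7bd37e53103ee56c1f034c61674d89ee3ca92353baecf6e30bb12bbb5,
    0x2047]),
  ([6, 1, 3, 3, 2, 1], [(1, 15), (2, 14)], [
    0xb42a1b656167d655933f5c10995163a3de693036f1ed580bb508e7c71846df6dd981bbfb109c7b2ec152819f27f5,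
    0x2d]),
  ([1, 1, 3, 3, 2, 1], [(1, 15), (2, 14)], [
    0x8a42326f0897e1785d1d8215c134ac9c988b3603e634a3fdb055a2f08d5b33e0ee3d90827247c63402dadbc76863,
    0xb36911bfd179282d598563bf3881f4370bbae19826b963abe52125b2cd21e4b09ccec253cce61598f32b29ee840e,
    0xb6e4786602354a8d83f1e71b7dc3bf7c41c060d5a433dbe]),
  ([1, 3, 3, 3, 2, 1], [(1, 15), (2, 14)], [
    0x10dac3fd443c85aeefa5b767e2541137224ca48ef283dfea5ca05aa5c4cb780eac388691146cb4ccc45ccba5e7c7,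
    0xc32ff3036cd6ea56039e8cdd93349dcbb8694037b2a8c7aa9ee116833fa46e086385d19c2782e2ec18c42dc4412e,
    0x12e27e7d1149bb1e4b89570d8d756ecb5e3e8e6f9fe4e849fd2eeb2f8af6f489033]),
  ([1, 5, 2, 3, 2, 1], [(1, 15), (2, 14)], [
    0x8c8e15df5d4598188634b4a6f3fb087dfccc3]),
  ([6, 1, 2, 3, 2, 1], [(1, 15), (2, 14)], [
    0xc3ab74f6f82b1ea1a9d48bc5]),
  ([1, 5, 4, 3, 2, 1], [(1, 15), (3, 0), (5, 14)], [
    0xe81e1bab5c77ca25700c76382b87883286446401bf77425d36471da40b36e3bc2e9fbfba04acf000a3c7450d9ab9,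
    0x2216bf5fc0a6a2d704cf07]),
  ([1, 1, 3, 3, 2, 1], [(1, 15), (3, 14)], [
    0x2e25201e404b3e7f10deae54c208c0688226239c6e4bbc5f4de427cfd2778cc376d6fac42b19]),
  ([3, 4, 5, 4, 3, 2, 1], [(1, 15), (1, 0), (5, 13), (5, 14)], [
    0x2b1b7a219eebf90aee3a6c6dc70fa5efe0fd9804e7af77ecded8fd7dae6ae489f6b1bac9203b0fa3387923a54b9,
    0xc28b8e9ba52c0112edd05ad0e308bc0600b8eede548660c4f2146855f68e6c631a42fd601c09356e4f5825984864,
    0x90995d8e61399291c6c745a498cab6b90cb94665b7f8f0fb0ae675e69c139e19239ef1b14ec8eb8748d3a8d60898,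
    0xd72aa6431bcc41ea746a61dda7a526545306e5fe453e5c0bb6b413b5e31d601fcf9332675e4e5dcdc7ddafbe57de,
    0x866bbd44cb3828a8a7ef3bfad064d7e118bce1dc0c86af879c8476537abd97d1b7c61a9cd5f4f5f31a8734dc9949,
    0xf8027d9c5e18eeb4f18170039d8f129db5f66ca48ac72db2fc11eb9c971ea75a9dde499e30cfc7fffb31f9395f6b,
    0xd56ebdb3cfc60fb5436d01e0bfd160f706ab81488df8e90414129258158576a448432c23172c0152f3df913050a1,
    0xd901ec3e186fc0a7ec6f4d7a33be35867cd5ee4a2112e91e759717521617862fbccd8c240e6a1487509a7272e15c,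
    0x4005b4d8bc0250d760b8f8210eaecaefd9187be515dc0585f0d45a86a638841e64c11ec8fc2cd743427ed33881e1,
    0xf7a5e44941dab8ebdd198c495e605f062c2b22e739575b1d1923501b61f33100e80081eda197f3f08c2cf34d56b2,
    0xed405ab13d7339b2b1614dab1ae72db3deac2f7b29b66c2d3094220344f9020fb15d9cc81aeb90616ba94e97b048,
    0x988434d2b090c29c4cc020fa0dc3f301be88fa1b5079dc9fe2e913dd292688fb266cafbab932478b0c93fe88faf5,
    0x421922377979735db065727dc6c988b26b18deea9f4e93a51d1e2ef6f48bdaef69156d2b50d758739177cf736e,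
    0x51953276517df0b7faf9c688521c37f75fe62]),
  ([2, 4, 5, 4, 3, 2, 1], [(1, 15), (1, 0), (5, 13), (5, 14)], [
    0x2b486105d3800e4f04f06a23e9195d3553537ddf21ba76fceac6f397fe7600dfa48dc80ddd62ffd641811f29f497,
    0xcc27250c5e205bb6d64f68489a44df6a5d7c7ccf5432dd4c1dea57ee699c0cb94456c5066d354021dede29676bcc,
    0x3c889508fc078bd2dad4ea44e023011e8dda1f78ac88f3bbbd7bc3a4a9705d3dd475c27d1e49767999b896c4798b,
    0xa4507a50600af62957e42b2ed79f307f49d25ca2731ca8a7514cbbf67a3dd4398bdeae1271f2d0fa32839396b249,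
    0x20aa03497833f31da459cec1fbd13fb8ca76d563a3b795143feca7e4a64efa5bc551b7f3b762a73ed40b92e33e8b,
    0x5e6b13fc66e1adec16a018a9c8083ce53b71cea880926880b7de25eda1c6be42e6ef5599974695b4ce39123fdefa,
    0xc96dc5b3ae489b2e7cac58a414076160ad6da49885deabec584ae0a0e06dc909f3e9cae00d6e5091766181c29591,
    0xe669f2230ca0a1dc142357244f477400175d43b20d7fb60b6d2e1400e605fcfea0a60f37db7f7655d75bc54d7a50,
    0x4eb68df032b5ce3ce77cce53d78c2063675075a5b1218d2d3b64b144e3146d7655572450d72c5bfe703ce1131eb1,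
    0xcdf4bfca1c9d88c0c1d76354ea1f6612d63aa025354f891fcbaacbf679b7122267e8e3d8d318ac1ed9fd068cb1bf,
    0xad6ffa9641f11c758ef20174d004859c3b07706aad88b99568400b6153da51cb72b453c34277ed8238f8e4cd2c7,
    0x58fcf2e063073636e1a2ec73cc01ef394a3c5c261124196dcee37d6d05cead6e1298e933616e8a15150c27f6e226,
    0x39e3f1de3193945651e7eb861a1667c246124614518b9969a46e82d17d83e]),
  ([1, 4, 5, 4, 3, 2, 1], [(1, 15), (1, 0), (5, 13), (5, 14)], [
    0x3f9ecff042a198dac68cc5ab985ccd3eb04ef6cba38f5746af43809af0d424a38b256b4eb158fff88485047a50f9,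
    0xc3bafdd2ee146ea0f616fc9bc79549fb4919569a4c7d1240aa40983352c6249a41c974eda28c45b2b382fcf73a19,
    0xc11b13892efed2d3510a18b006138c39e17f0e8b6fb400d76d7bc4e69e22b985f2afe1f085dc84f484248c257607,
    0x28aec118cb007c086896f3f01f464cdfd9690171feef0a6fda9261c683d1928ac7bf799b63419270f7fb535d9c7b,
    0xc5297c0bf8c3a9b0d4ccc21329cd5839f425db76a603aa737b74fbb508ec6f1f027cff0f9b1eef2f86f9e1c84c18,
    0xc0e6cef5a7b22498f3f57388261b05416b49728ba657458942087f0273bbc3d891cfe017a39dbdb72ef487a8da76,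
    0x4dd05f5b545ebc7d248a0a5f46e9a9102059b9acf16d4d1e750b3be1300b8e735a60498471e4b2c2ca63f7101681,
    0x9baac1c43c6fb838dc08fdba8506dcfc7ee6e42e33c09daf85e7045e5684f099d6091b3eb40bf3196ca4518f863,
    0x3d37d002e0eb24bd0927ed900b83bf7035d4f07b303470cd44098aa4937edb1f66a842dc6d8e33fe5b813aa223a5,
    0xb079d8e652fa3301cdf80803b5e1ba93d4b49de70c8608a84c9bc36cb4c7c30d93952e4648b5a5889be964d392a0,
    0xe834ea18fb2536b5c5455d490c8a81de95e41f55afa1f9fe30b4a6e34e2379c980e92af11a79e5aeda0a2aa3db9,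
    0x1c5d4ace5f9ee9d2a755948b0b598b94da064627ec1093d7cc771e318aea59a02928544cee7c7b0b74450b9724e0,
    0x11fc3ce9c4d196f8b62ab524133fb3435069d42609541e129113771932abc53ca90592f6af39f3afaf1b83692d05]),
  ([1, 3, 5, 4, 3, 2, 1], [(1, 15), (1, 0), (5, 13), (5, 14)], [
    0x3a2704f5272cb036b7a34937ea0fe0473ff12c3fe5dc05e88fa5fe0a0057f7dadf0c049a5e7bdff8852d047afda1,
    0x279720e4be681a5c21ddf1a935069f1259774a734e73a2d71c1abe04bcf037bea9a0c6881112c20e55a71496975c,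
    0x406ab4edc24ce5c58b51d9478e452831c31b16352c7f0f43dd7141f8ab8e1f1ac21f62a3f5bed9e9cba663160a0c,
    0x2a6881531a9e3a0d47a1d8bbc40b7b8eb6707ea0cc10351d42f42c29bdefe17ec3787d44dd0216d368de4e576339,
    0xce806d7742bd3db2e17a4b4a189fdf1549bc817ec0698afafad919f822e1b47262d2bad24b451a2f4f5004f88fc4,
    0x48bdf1b03ef3b10eb2576479f70ea9b37f45ae8d48817a0c16c4eef4ba324c626e8745abb70c0a933ee1d9260042,
    0xe7678e572594de4f392a4d8b36c1f2ad7ab5c9e896e0da5da37f1b89cf518fe16fa96b967fe14fb42272284e94d6,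
    0xb5ad1cf0169a2d485c5b4eba7b88480bc2af00e5127f94fa9809c6d63c5991d522e35b4e1c5ce78387d4f9e2e708,
    0x75bfa36b4a4a2fd1404ef25cf86222b20f77348af694bd5e41ca5c54fd42d563c5099af83db1294454cf8752827,
    0x61889e1f5266b48bd66b1b074cb3f2ab2fcb351c7ff5531c640382cec6334d5765a48c19151137b1df2f0547a46c,
    0xa73fc1f08041481dd6568ac55b37431b256e51616a01c1dcb59a39b6182157027f34e84f3c01e3fa615e3f266e14,
    0x570c8fa1a3b62e5bf11c7b56533b1052f0d7790c3447c5a65808f7298f3a1232e32d7ee28bdb2c3b7d95d2e5c551,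
    0x8f2bc55406d8dcffca208f40b44b674fb245a0478b0c5df6da97e339e5cedd3eb5e637bf9a4dffa4d078eb0753a4,
    0xdd9360fd1b688b5b6b7a209199dab354f64ea3d39bba1aa3bdc34ea0443c75a6ba120dce9388759b7b4647a5af3a,
    0xce0f4fcb689d88507bbec83ffd8fcf7abd50aef21611c7f54892e29e3f8a44f2914beaf31c2e19131f704e18ceb2,
    0x1e4195da398272565d8fb6592bc2ddd161d9ffbbdb9a5a0ba61bc2820b80ccf94ddbdfc4ee1d4f077f02b7240d23,
    0xa0eb5904d35]),
  ([2, 3, 4, 4, 3, 2, 1], [(1, 15), (1, 0), (5, 13), (5, 14)], [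
    0x2619410a26098ee560bba07e13ef2977ebcb0b08cf25cb56cee2524f93c6fcbe4903c4a11d536ba5c08cdfb2d499,
    0x9276f97abe097399f2eb553ebb34ef8af36b64a310222ed35f1df389be96124b4de7c16b8ba0efac25bb81780e0e,
    0x30e689096ab534d04bfd969735e4f9d379d73319382de7d79eb1823917c3ff864d578e9dc27812fa057ed1948860,
    0xcdbafb7f62b080f4156b383008c9625ab8dca036e478b9f7f951f2f66d4252661674a134c53f6425810605475802,
    0xa8d94a48c6860753b1e2a4f86cc07eeada1ae4f95116d5a2d19468b76008bbdb648c92815d0e68d329b1ea614ac6,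
    0xb14abd08ae2531aa17c5c7190c5e9b37365e78900c06ffdeef4e84e2dfdb32a14ad1d9b022e2a7f5e4d7c6bcf8bf,
    0xbadb3209b7f33c652abb4c63dd7bf9b1d6d2838db56a8e2e2744a704e2159adfc46ecb42431d59634901efd930e6,
    0x931188e747aa88e52ec77d77ade8b8d21a4bf1f27ae69ac017f407abc807bf39852cae1fdcab2209130ceb7caa7a,
    0xcbda65b7e5ea1a6b16da2396ec2b341e4a739696bb83e28f8e7c687a4685fa516bf64f0a2443ebd0ad3ad3aa4582,
    0xc0c9b4b50a4b3f238af1c33cefd48da810c80e3ced51004cc01452fbfaec7e9b033b71bdcda9bc8f723e00491cc3,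
    0x912ca86a7d5c525d1c099107af14f34ba6254bd0284b6f78e6e9d59bc5325b08d94b873c6631ebe4039ab3393ff,
    0xc]),
  ([6, 6, 2, 4, 3, 2, 1], [(1, 15), (1, 0), (5, 13), (5, 14)], [
    0x20290068e6706165f5fcb2e30e0bc43ccf23a245d0bad81b40202e5674c3a720b702d59f16c0c2e11587d87062c7,
    0x3f4b49cd8de5560d6e943d4812a305faf53ef49b51d77ef5d22f92d1e48f169fee96e460cab613c8ac4fb592a6da,
    0x44cc37b7b0a73c0906f3f6c84a204b48bdfebebd13a0abfa090d3df818d21fce657768df96172e06959f4a26847f,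
    0xd59d674bfaebd04aa240425874e04bc823fcf50cac818a4b54eb345b3b69fd4caebc5390dcf54ccab100910ded74,
    0x3d45881523d59f2ddad00f61fa4c0998380f70cc8422fd72079fe50494d4d1e674bdb48fb8134eb9c518d3ae1749,
    0x2a140fad095eacbba43160675d3c716a35589b69432ef94c5ae039b47d15153d71314a4cf00b50165931b5100285,
    0x84d2d0052d08f1d2075fd4d4e7905202ed3aa2b8b9fc8323b98596ed922973b757e307741ce7b1a3997445615a09,
    0xfdeb19de5045994c46711d7778602978894a735c9f30f2aa8601a3e87c6eb5eefc72fa9e68f677327747e515b820,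
    0xdb7b39d90667342ecccc79e03775580c16fcddd4e3777d5f0310129bdcd902eb473608c5b65fcb199348c01ea899,
    0x34716cc4dc1371a6c9de9c67e5b6f1bb365b271ef2754fb5721ddd469b1a528110c69dfe515bd67a4bb40c6f1140,
    0xfc49647e3ec7aab41ef1a6ed6a57595a5aad6f7ca52edfab06b5d1a10a42e8fbe9de95f25a992063696e7b80fd00,
    0xadb72ba548044101dea3ae0a9f58deab4e4573b8370aeb53b04e9b6f03845364ab919a023dcc0d353a97b0d404e7,
    0x6c7ef549ce9f0e20aef6a4d240305f09b28f47b8616c190588276]),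
  ([7, 3, 5, 4, 3, 2, 1], [(1, 15), (1, 0), (5, 13), (7, 14)], [
    0x925c03c7e7ccab1eef5b680651df5da7149c01080f769b88b019d0a6b6ababfe6b14373d3d8643778785f6b16e91,
    0x6273f1080a4489317105f67902de2c7456837c61f8ed17dbb012bf48db0b8684aa9bc1cab3f058e6d3e4b1d873f7,
    0xa418ff950caba9e9f32af9e14427e31e3dd40ea80c0dbc534facbe7e841383bd64a13774d91717f837e201af6142,
    0x6bf20479d43c7a2c3365ced2e9e14d74ffd0a80f5a7d1dfbb542914f43ad39e08ae537892933e5eb744f6d345712,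
    0xa47c2cf11c5cebcda1ebaf33fae251140a6e6ece6440e14839c9f83c59adbc8f8c887ea83ed63439bff662fe810d,
    0xf0b87061208196b733f68628780f760aeedfce33cfbcd35577e5a197fda976d40394ced6fd8599b3f38bec46b407,
    0x4fbf2d985fee7240074f64a4e9a2fbdf708716cc909175498c76b1c8452e4eb7cf377ca0f04c8c5a4585f75fae61,
    0x3fc7b4303d0e68173f90e8c41a0ce2434b0efd8b82c57947da240ed3919d0a531441845fac1050363182626657c0,
    0x86d7e1698b245e40bdf99638e142bd7863b04fd3e8c1669700a39f81d08762c72c8f8cb28717bd323f15a3794227,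
    0x384]),
  ([5, 6, 5, 4, 3, 2, 1], [(1, 15), (1, 0), (6, 13), (6, 14)], [
    0x4acc8483e1dc8b52296b68f50d646263295dcdccbe6a9e1b46c5c5ee2167834fef8b6f9f402685f6cb068e1e48e9,
    0xc640497bf50314726291ffa5bbfa3d5727f243603ab09648f8fa559e8ae38947fcde0f044819355b13f889d466d5,
    0xea5a9ac37004f5518ba3f703d97e45566f3dc4f485659816ccdf408dcad248edeb0a2592f4bdc4c4f8f2859b799,
    0x253466ac52a0441ff87bc478f4aec1f28d1a969250c4e1b4e45af58ab49da0d41e22c266c21c98661be462aa09e0,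
    0xc488323798e405d75e7092fdccff32541732290e82d79577de171b44bf3d852a6117f5f5a912d961a0b3bbaffcc,
    0x5972d57138f39191c62071b0448d5e443fc9154aad5ba433da04fcb47ccae]),
  ([4, 6, 5, 4, 3, 2, 1], [(1, 15), (1, 0), (6, 13), (6, 14)], [
    0xf69abc92146b55a977e34adfed4bf51f9742bc665cecc5ae94e07f6dff6e8836ae96179d654c9226e213ae1ef591,
    0xe917a0751686ce6682af23a15769183e442b4e9fac5edebc38421a0270cb79c7ae0d32ccb1ac332b9458829ecf7f,
    0xc115f946d8d0a6874b536ff2fd816ed273249c497505b16cb2878a14bbc94fc60683094ba5ce891be77ec7458132,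
    0x7f257c3d969bcae65e8e480f71698b51cb3a9e10273c058136aeea03714b5c61da5cc7c2a4243df4b08ca9d68ac7,
    0x92f5af276c379eea0a5f0834359f70267ef3f534f47bdb24c1904f49cd094bc067030968218935e32e27bc2e224f,
    0x93d8382a0e1d900da572edb6049c32aad2f11fe6342197caa8c788320ef1d5410ffbc9054841]),
  ([1, 6, 5, 4, 3, 2, 1], [(1, 15), (1, 0), (6, 13), (6, 14)], [
    0xcd8767fab69ae16f393869749e939a12dbdef571bdf81a8276abb94efbc6eecfd6eac3bbe579edc55698aa08f7a1,
    0x4c1315a454cd48b9498348e79c521d0e7980ee9012cbeef204cc6ac26b9ccf8e4b2d9f7ee86faab45c929cc1d4d6,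
    0x5c84c1bc2d64a9bb317d9e1cbe1a17206edc80a3a8d665808f5ca8942dc9ebf65491614a90221606df5fe4efd5ec,
    0xacf2bb324ec4bf12741607eeba40a3f0dc7ac1d1f596e0625c5af4afbe701b44dcf596dd8946f64f3a48e7985a2d,
    0x4d2a5b50836cae3ce9cb90057877a99cdce965a232e603b3a036a94d3179224fac1b92]),
  ([4, 5, 5, 4, 3, 2, 1], [(1, 15), (1, 0), (6, 13), (6, 14)], [
    0x94c4f53cf01bfad73486e3cdb42f6ec3bd6aaf0c859d3dcc658de8697a2a414e50bdcedf1a9a0e16cef707647ebd,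
    0xf1f02d0ca889a2e862f94682b2afc87cd580f96bb293d7e66315b68cdf8a97eea68d63bdca4e756d646fbc3c78df,
    0xf7e412116af43f378eabb175fe79f9f852ec22e7f51eeecf6b669ff20c1cbfb33a465cb0af0d122a6c9e885c17ea,
    0xaef25bede6095af0532835e9b03341c032d804109dd224fe49624a91d085b2c6cb2b1a6e95321f74492ccdb21c66,
    0x999cf3b9d4b5a7aa9f40b0280b2754d2ddb41c54d81b7db2fb7fad0aca2bfdf65d83bce969d60043cd436e21da7d,
    0x1eb5b2e037c89fb92552fc3e9684f21e8377c1]),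
  ([3, 5, 5, 4, 3, 2, 1], [(1, 15), (1, 0), (6, 13), (6, 14)], [
    0x7a29e5150f9f03374f8e3a723e34b165d829b2d3510c56e2cdbe4083db7de02211e98e831175932e079f09a47ecb,
    0x3ea1e42ff4cbf7ef02ea32b1a4d72624e972f45f95415a93676d71a24f9c3faf7d243b6559c0d6107e70dc803977,
    0x5898d10378dc3b74ec997501c2405cb50f1bd32af8b1b862118a7196d753cb725722578d67fbd55ff8d56784a27,
    0xb34b00a274c5f05b6c47fca0052304e75ed8c17bff3027a22b27252e7b914f73c1a52b4ac27ef32b262eb7be4482,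
    0x99c3b49ce45cd00b1c23e983cf163133a7ea3ddb17ab96ddff1ea08b39a39f1dd8173f96a6b4c249a5801463fed2,
    0xcc6612c4f72e08d77571d54fe8d59a905daf2b6c3391bbf9fc15e2c7497d661c5d6e6da9c057d3a6d874e4976154,
    0x1ae02e3]),
  ([2, 5, 5, 4, 3, 2, 1], [(1, 15), (1, 0), (6, 13), (6, 14)], [
    0x3e95d29c5ab76dde01048a72afc0a49658451a3c44c49518c4787bbced1503fc1bfe200db97827cae0d306647db5,
    0xbd7852085bd143e86a02b23d33f94bd72b48e9bc0a32fd07a74530741210f10f946c015bfe2127d8af0349058726,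
    0xe8bd24cfd8ec68375f3b7eff2b7b83058c3f06fd533899f517d0b5bf44c0f246c0358b158d755e5717dce68418f1,
    0x175a80521771c8152440592a7689311e926c48a7dc502724817d9e21baefa90bdc1a920e0fc18606a7617b321620,
    0xdd2d0026098d39f87777c6cd45876cb16a6c2114815c124ef93479b8c8efa7bf6f0dc5bd49bfcadb2169c1501e60]),
  ([3, 4, 5, 4, 3, 2, 1], [(1, 15), (1, 0), (6, 13), (6, 14)], [
    0xa194c14941430298fa3b8681ce2d578a9a60460a383289e0cd683cae03aa4f577f9236c492ac71eed0ef057f5491,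
    0x89366a8570af5524490358f5dea6a6addcec6dd9b40a89098a84bc04b32bc9b8f0b4672edff2dad76ca23b5a7761,
    0xc0aa1d4520d3612b0ade9a4595d99699f8fa28cc02f249d9706dbbe8d0aa5a567faa5f6a156f0d5bf9cab07744b7,
    0xc6d9c9aaf2cb2e8d4185c02c832dcfdecbf3411b85c8964bd0f82f35ddb9aff8430e07c51392a9c76ed7862f4d01,
    0x5504defe1ca0e83e901aa9f351e0c1655bb7b326032231f5ec5bee5c85c9688594b2f408fe00063f700be40c2e18,
    0x1f596a12ab342f3227e8e4dd73efb7cb5d0caeeb320d99e69919ad40170606bc6ed91c079e0ec7cba0a9]),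
  ([5, 6, 5, 4, 3, 2, 1], [(1, 15), (1, 0), (7, 13), (7, 14)], [
    0x7267e9af636e45883c60752db3728c8e974bc77d7d6cfa695157b0014e4935f671d129d0f8a685f6a3c4691c3e91,
    0x6e2de03afaab393888f82b87d3f49a0e6857fa59dac312b638036d68fa5529eb812e0c0a43647b4dcc8417f83f3f,
    0x1b909932dcccb31b1d94f846ca9f94b1528e774eb4765c561bce30b017a47cd45]),
  ([4, 6, 5, 4, 3, 2, 1], [(1, 15), (1, 0), (7, 13), (7, 14)], [
    0xae165f44c1ee3c21aed3dfbe894db47eb801fcb14e4669af9c55cf5e5bfa6efa1a60192ae6905daba00a835c3e91,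
    0x5db5257f03dc252c114b8b73d589bb63f429b67492f95978c61141ac08e7d041193c130f866633b0e766c0963231,
    0x7bb3c6d1dbdf6a8c2aac8f6c0d1d75b9043e2bdf9ac595123b8f02aae457ff809cb3d3e97a8d5edcc401645bffce,
    0x2d634ddc407cc8c240]),
  ([7, 6, 5, 4, 3, 2, 1], [(1, 15), (1, 0), (8, 13), (8, 14)], [
    0x6d0a2e603683a14d2523a3362259c010169161793bb27b8d026a6d63811]),
  ([6, 6, 2, 4, 3, 2, 1], [(1, 15), (1, 0), (1, 13), (4, 14)], [
    0xef984297f121168758b928696c0be3c8f6b7f0b6d8153388d248b92ed90bb224cdb1b15d55a0f813e6c9532e73a9,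
    0x51ed9601ba4e275ec8dcaae219f26891cb243fd49131fea8b714316ffc238eaf3620e6a440b763ff6294276afa6b,
    0xf5fda344362cc9b7d7d484976ae623f8de96aa4ef75a90cd2f6f5da5d6b8e511a3ef39823fb1ad97b8e67fdb02b1,
    0x50a695dc3f30cb4a498e89e550bb4dad878a9f61ec2ab99518dc34971d1515634f685678b81ae941c988f4830737,
    0x313e6ac33c03a91b9a39b7488be41b90b2e7605b7fa5db849999c022bb92971e7e41e9a3c4c8dd1ee870a35512e8,
    0xbd8a1f9a009130ab18d0074d755da7a69d0df830c2411b8852e34070d185e67c7399a037a29d3c47549853f1591c,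
    0xbf44cd232a987101b73a89f8f8f8963034a42a86ca27bce2cda67d6c374dd25990b681b1b24a691407d361796e5b,
    0x8e0a8ebb9dee705ada8d58387f8e5f1ee8655ca0661287f9fec13e8185590790f7d8d139d72df386928f3d14b21d,
    0x29e711a51fc38aa93473586091f8c88bd87bf3b709c1b57bb87746f8e286ade4cdcc1b2a6441e51d7ef2709c06f5,
    0xee80b9a1f075a085e9998f7adc600e00b8c11fd5803d857140a19d64de248cee1b4bb2992e6a01acf85b083be1d6,
    0xc1fe33f133c2bee60bef6d08f896247c7406550e22585377c1b1b2535b1df957a284940db378aefda807fed03c43,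
    0xc21f20125a63e49db7460b067c0d41023f6c5b5108b9b3368d57b7bed49d8d16d1a688fcc0c0583e4487eca9989,
    0x16f58610e55c0d0a434f841299b1c8912e923084bc3e0af0f1c46753e4f3294641fb2ef848c0b8aa3348912af6fc,
    0x71181ad6cc9a8a900b76ae97a85c8ab1f700c36a641c9cec1df7f4c71b96fc6e369d643201dc2bc63b65c72a6500,
    0xfe4659624bf81a25250a77132bdd0490b9bb5034d71d89284d6cf64deedcee7d2e07c67bd23998aac4fd683a32ad,
    0x9b8bf72da5e4415f33fdd9177b0e7288d85d9123af546fc1a3a4f109a0888ced9d265470fba1fd4877d0bd39fc3b,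
    0x7ea13f935e3b67e469efe8773378d8d74dd74710b98b8acf25da3e92b43d56ee8ce97c8c3b8832dbe7ec24a63e66,
    0x4bc396b0014c69276f553a4801b28116f82bac0207af0b1180d4f759b2a5c17fac923778a66c297c3fb816f3ebba,
    0x3c79a3a45268f9d344381cab0a0cfb3995677dbc4d15156ee96d3018afc5da1fc62968b77cf94d3f7c2ec31e23c,
    0x5e2e1395e0e431bc91aecd1edc0a098c659b44f6d7348a09c09dd075a251be503e89f1d593325711b2dda72ad736,
    0xacde5e8a57568b17ac1cf07b78a2b8762617105026b50d5e79b243a18c3345150816f3d1f0d935231f818700989e,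
    0xce9b8c130fb82f3e377adfafe70dd0a7442a5d0befe0abe48ed0cffa24f71a15db7d44c4f2854c2d378f4aeab0c5,
    0x8e92150026abb2c812b9cc0221d23ea88ad1f811b395d7e2e6c2b89614b8c669340cfabcf06a40288c3500116706,
    0xd1373979ed9bf2f3674181895f7e0e1c2f5b6170318037ff64df1899c509ee20db72ff024c86e49333f669e4aa2d,
    0xf1922f10b2ad8cbd4368d2cae9bc34904ef61f1e8a42b646028294a18a82e6a8d8403916dec06ea32aa30464e3cd,
    0xc682de232447efd344ca2e82458304c705d08502a89a81ec56772aff63d8712053a66568671154fae738f13297e9,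
    0x59f9a771abe6b50662b8eba1941e6f8510b6a853b005fdfc96740861c01cf7c96e078aee515dbbcb7d72b427ef8e,
    0xe422ed04f133ed04d6bd96ce7ad62f188dc05c413a6a1972d94673191afeeaf5ce2abbcf1d89a08a1c09a4d56822,
    0x2e753914161938c9b96fc068bd809d753411772b56e6fdfc9207434d95f35c9b455d9b2ba462af362c5e279d8fa0,
    0xc647ac3b88fd9647851e2f26f7f5ed8e84bce964ee29ff83b26b337722068274104da3b0d10517dedf887f477257,
    0x2ed91023ea29420c9fe4d395b3f533aecc22a8b33e4ca128c343f26019e3c77810f4adeb8cfebf6135c99bf7b0ea,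
    0x457cdc45e89cc0ec3abd42d79a762add3eb0d867068274ec2d0c0a03d04d093467d9a200fdeb676116e38e53c3ee,
    0x11dad45028c9fba5dee50b49b3ba4903110798cc0e62e265919713a51ecded870fb7295ff70ea3186975a107e3a2,
    0x6d1ccca942380372dfa76c9d067b63a581cddf9f4613dfad52af56af34b616c2aa7a2be3642e424a082dafac12f0,
    0x4193510eaa191ec0a0fc330d180f48a9c966543f4c5a0ac7316bcbf09470457b6bc3ea18d9372ea61523ea14557b,
    0x255fc316040c6adf69f4a28389b5994681180b8562d47ce788c2621be324241b34a14723684b272db9109355a437,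
    0x39eee90494fde907a6cab83c7848fabb72bb18ecbac31bb189d8ec923c0d73bfa296624b076cb84bf68ef4c8158f,
    0xc66737083a5038bd4a3441242a56c9f42c0cbb031f69372aec1174768389401ecfbaf0041049b72491511c658fb3,
    0xf84e83c112de247f20e86e56b060a5b51d5ab519dcc3bc39e09e88a51df192c6ba7ea84f12b81321ffb86fa7e522,
    0x901537e6c39a544f4c9d201d9e6e7392c6241bc4cf4448380a98de360ba5dd8c23edaed68e31513bf383482e130c,
    0xe39ee189e08a20ce52524caf7464cd8f1d9b5cf7aa4f83c6d36eaf611433131ab45746526aff241ad2ca955ce9ff,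
    0xa88047477be9c07ab7e1774813c93f0b00425fb2a711a6aba64908cfa548e99ed3c27c2de42d0dbf905c560db1fd,
    0x4194614842dd9c035470d34c34c2037a4d8deb800fd7271aa55f9fac4a83f2288e7baf6e64db0eeb5ca9aefc0db4,
    0xcd84dcfb5544b22cb41f29f24104d691e4edf5ccb74574e38205174dd32a3d05b34d3990ba4d8c01ec27f56d6115,
    0x17e7aaf7b5484f15f66f7990fac78a7e45589203add700a558cabc31]),
  ([7, 3, 4, 4, 3, 2, 1], [(1, 15), (1, 0), (1, 13), (7, 14)], [
    0x9cd42498fd8db6c80e96c540cf79f1942e5e3d74809685cea33e7c189ab08f2b970cef7c4561168e1fb9b4f5f599,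
    0xa62807d4f105d5aee26e57a19bd576a6e5b7d3a293f0204d576d5cf65e811f8bf20ddcdc7c16f74f2a5206d195ee,
    0xa04a4394f4f28355aa65663f406022b41cf13cd12ef148eed277ec8ea20d63fddf0f5a43775f33cada848b6b0abe,
    0x300939a6f0cb5b5a0c9c7a636dfee98dd038497880563c7abb9db2844fbb60dc6da8f7b2bf5f1fc64f6864808b32,
    0xbbc92cfc6ab567505a7e01cb9de6173a493325be781e3d58a6821b1e7dd49590ba10753b31ae1bc49f9629f17190,
    0x35562b4d6857a30e731f33c1d239c89d5a3303e1a50a47c5a621a492e889f97934947dd6a7f31c3ad70045eb6821,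
    0x23377cab0a5e38098a29e5c0529af00adb89cdf8f205e5ee77020f56ca555a6fc185b0c05221945595f313f5e6b8,
    0x6ce853bc54d40910ecc243ddb49e63990ed9173b320a3967f9d3da82a379306d6ea51d69039b26130e22dc5d461c,
    0x7c82d4b74ff5f5f54ce9f129c70f9838852b6c9459156f10493565e8ebd4cd936772c26452cb089f6322df33398a,
    0xd3c5a43749434cf38a28f310882863dca6aac7cc3edfc3edca19bd9340afa5665ef2dfe74a6e6acba4125c0ee1cd,
    0xea0eebac1f400ce23afa623fa029a0924d4d1c027d729c691a0d2f615dd6d3373ed4b6c89f8504c41fd3dbd30c8d,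
    0x1bb116cca63d7d4087c94bf557551a36066a8d6d44863c504139d001db06c85c8b6ce3f496fb0dcde6f3e65a4e19,
    0x1aa9163d325dc67606ff6f67eddab7d2b2f62ef7729dabd6081ea62e6a12ed06651142a9973191fe10664b635321,
    0x7e329776f43bcc1ae0389921530fa5a7ca42b1b10a6aae497d8d8b3a11437c76e7d75d24e56d332500f7a38898cc,
    0x2bb5a1c1596a81c3fac37fe96caabade92df4ad8f3bfbd75943daa60fd51e0cee8c6d3cf0924fd2923b7217f2d7,
    0x36e2967646e21c2c2c03df979740f06ccb1a83f7f53bbf7d096b71dc70acd49c12807fe736d9d08fae05e3e45961,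
    0x1db3b6fc6bd34eb8442e53034049419f648e6d5d2ef84f13aeab168c0e49596191b92ca7d31a3df1e4513ed495da,
    0x212688958402ea90ad49bd0adab67622af8452ad94ff2c96b107399ea0b3d5a37bd5f0bb5bed2178167fe8f0dffa,
    0x46381a945d5cf31485e4fdefb03e612e494973bbacea7c6aecfd03e7ea82cdcac3ce44be8b4a0bd2535f968f958c,
    0xb006195e158ae09c0c89b3d86b252b4ce1af5d311777cb55569f65a7d0cd15b1d4f54bd26656e19d079a5a44ca8f,
    0x29136d525d2df695f21fce62cb5a86a2cbf56f004eb6e7f3b7c0bc0f0dab0a793c0610ca01a94fcddf814fcaa9a9,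
    0x5060f3dc8a3b98039547ee684012f63d46613372dfd04a3cbf687bc586d92f8a09494f01615534aee9fb977c07e8,
    0x5859a463197ebd8cd21257042e519ff5b78d6119d4a9c242e98ff58bddb31757971c58bb01128645739945a7f8a1,
    0xb81fa851de539ae1fce153b0b08f1ec253cd98bac14bb30a058f679ff15bd984c8bd87eb6c53fde7212e67ffdabb,
    0x6c44b71decac902df350c93428b5cc72019756573b74c69936b2fa6a66596d57cfd2bbf6695eb09d6b2e82a64644,
    0x11aee8fd8e83e6539f8ba386d9c1ee63f77dcc2f887f5b52e82d6367c168caf3d924b7d701bc38d05792bd1f4fe1,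
    0xa824fcd37adc15f031fd0fcb252f9bd884d2ebfcd2bdd93ac90fa51408f747c64b1e4917bc2979ddd20663672759,
    0xe0ed97e219af248362c5843764d117975718c7f645bdb193eef7b94ff2af4ef889d5fabb347fa031a48d8d36e48a,
    0x700a3bdf67bd9bcc3e68610f335c39d5e7488aac14927887c5425f27f0187e2b7996435a8c56cd191f549226889f,
    0xf25f86f057fe49997d093b1b685d31732ce6bdb951e8b3f4bb1a4b65f2e6c9183cbbce6c6ebd7af85310f470bc36,
    0x63dccc4bb57b99232cdaeb0c21c6d9d8ff748cdb7e1ad4a487d98faffaa848fadbe924df3b37c4fa7b86ac392c45,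
    0xa4fc4cd82a24ec1ef96ad2c2075b5541cd7e8d0282eb3048af7ff25260bebbc8a87e09aab43ed9bb3fa644112e5c,
    0x406a17e6a718d34b8a68603a6415f65b81cdf9416a74147007110a86c4e98d81ad827f57a4035b3ea5385a0ff7d1,
    0xa60f3a5aa6a32fcdbac120135c0b6d1ce84fe9c70436737b2b91595083c04b2b2b274f2a33271e109b591c4132ea,
    0x606348cddec4ae091dbc51a4e6e408be741d3f7671a50f5564d69108ee8e3dcbbb4ea5eef89d1b8beabf03d4ffbb,
    0xcc546eb4722da5db13d9ee914d995f1090e9b4d399d3352ab26b41a58be915fc60e3b72dc9598fe325f50e06207,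
    0x2797f900a6c11debf348c0d3a2d3402fb14c77da069750624378fb80bb1e650200e11d2783a78c3c8e235ace5010,
    0x5c3c8b17267b8e247c3361c69ba9aded53b5c62396524f7c0e60e90243e456869df16b4e977a8e7b79710275a1b3,
    0x337ec09e8fcf63ee97fcafa52d491b0fe0a8e2fc768f334a0e9d3ad0d3d0bf7b90dc564f90e2c4ae07072602d007,
    0xba6a7454bf81a8ac2201812ee86b41187b042c4a10bb6ed23c0ac8ba1c6c709aefef7d9105c81072cc827debfa11,
    0x399b79b472c2df6b1d41ed3c65b373bc1e9abb37db680e1af44816e6dc03d5939d3aacae65a7dea3fb236591389,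
    0x29bfb31cfaafabf90a3d10c35c60b980841bfabaf490b2d742d30b77b031d6f189dd0878ed6a5543b323afb77fe8,
    0x825268b012d5028524d9aa6223756ec1d065ce793f74b01459e68d4e2d486d19670eead3c27736aee1f4ae570fca,
    0x5db9f9bfcda1af5b6f613a7d6834dd5f7838dbfe392990e01c23678d79fb17190dcdb1dacae1afdbe23ee1b50e4c,
    0xba9b96a25d63d011bec2f78bded0a15ea2fef09815a6ab8398a24dfca30089542c695f88d89870aa448dbb879024,
    0x18314d9fe7c78e90a3f9675eba18540677882137946ae99be40e9a138260119c965e6855fb9c4ab7b12bad19a86f,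
    0x9d66b3f552ed07e11c8905776caf7f17b9e129a81f2caf75275b8fec05a13780839a4966a93ca5b8e8578d11fdae,
    0x68962282ad4643a93df3bea29f900988584f65a9f5e510ba9e9ff37143f9c1000923fbf66bbe76fdccb08a4d1504,
    0x2a1823475fc11adda59feb9de80d04c6c661268aeecb9d6c3b9da2d417d52574f221d9bf34542666404f2bc44fa7,
    0x9991e781a43452c44fde497236071382892b041972242f13aaa39cf894c499e078d0d955f9ec293006aa71b863a2,
    0xba5bc782c1fb1f50a621ef4bd19641ba5ed5721c3a755d61f44f295ecfb4eccd5fecaa417fd0ee59c0c2aad13a3,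
    0x27f61d61e0d168117726c69e9d959b4431e44d73942b6ef7790d14898e08c79bc9061e97a1a44b4ab065fec9da20,
    0x9cad135c1b55f0e6eaf3f1e35c1c68ff091f3662954aa7103e3c8bbb38ad7a61c81bd5ebc7d1ff558f456cbc874f,
    0x20d2a69cb4a9b33504a4c320391ac1b37172d5686738176dd09d816ddce18d72235d2eedae846f2f557f6949a8e4,
    0x7709219cc26809de5f7aa32f5d07094d77e70228e624b4e8dfbb3db82dc4bab612dd30ed88dda129678c2eab4352,
    0x5d985b05fe3d02c47e8db57b21baee82919ff8e3e39c3c97f28db2978c01c2dfd858139e2d6dcc008d5e0e503852,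
    0x77d282f1f55bc856106c2ef9dbd4b2f97778165316ca8f1a5c54a52c13d63b4b1d0cc1e1d33aa1464ace85c3be9c,
    0x602ee64c3065f2a4ac5e6d639a0bd52f21e1492170508dbd7fdcdd5bc874b734861480242249c1c70f12ab649c8e,
    0x339c467aa40f05d7f2c2cf20d606170fc8355677e691aa11ed0d8797172326f65911773cbb4afa366a795ed1676b,
    0x6805a1bc64f33f038933eb83bd6e065e7e4c6c01d4bd424f3d49de3a42e09d18bba6d17276ffee2f11a4ee228bf2,
    0x9d79da2432e0b8ccb920416b872a61046ab0c9fc6e48a46d679df400789266bae5bc]),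
  ([7, 6, 1, 2, 3, 2, 1], [(1, 15), (1, 14), (3, 0), (7, 13)], [
    0xeffabd0f2c62ce1954d1e8b68b1496c8d51669048159f0d225d0edaeb641c7132db720aa973a38122fc52a16ec7,
    0xaa81ad14bd6a7d67f9bf323c4f85b1db6148c7868c681517fd2e89f501d5b3ecb8bfc3dc563c9c032e589dd1f726,
    0xfb519f58ebe87ccb11ee3e9bdb32a71fddd9bf006240eb4e230e3a72678b6095e8b7ee0448509847c56b6d1533a1,
    0x12285924645f85c57703ad8d053c12f33e6d62247ca3f337b0481e42dcf63b55f042ae1580e1c153a66718b58ff8,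
    0xede0f2fa1d9c616ce554e9bdebd458aedb8c6fb12b76ce25552f1da834f15fb0e41228faee6f56bf0179d5937fef,
    0xe6b89f80281a3af9e98a901a161287c0f8f2a05b154c88f62032baeda0af2865b76caa72ab90baa374ebcdd672c0,
    0x4ffc03f24f3e62392304e82e9ae8276b6264dc05eedde88dfce0d97784ca9c89458cff2c484e777f068f8c2d2ae,
    0xe66cd160d49748d198e5e396ad70ace379b1954557228cd8456937e141d929054615c31d4ac2c62096af895f9b2a,
    0x6eb32eabf6736018e8df3b03a0e6e25a56cc0f26c2d9dd29add183213de05232d7e93920071c9fd3e1a1168e54af,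
    0xe40e4da68965c8f1d65e4ac7a843cb9d08ca7804fcf81ee14f1979475949b5c8aa8770bf6cdf66f8c6e37d7ab0f2,
    0x813b16a018a8fff23e2f3fab879c5eac92fe4bfdcd82bffbbd6d773bddbedaba4367b0dc307b06e586645e8e4114,
    0x690a8842a75559560c7ca6acdc8efa7930a92554983bf72653705efffcdad2bd1e62db04144006c6b23e315403fe,
    0x1]),
  ([1, 2, 3, 4, 3, 2, 1], [(1, 15), (2, 14), (4, 0)], [
    0xae039e30584f4338db7fbc58a4a1c9fa658960d0fcda573f0846bcc7c627212c3e1394bf78fe2b3e68e5d8a14ad5,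
    0xdc3beb8ce62c1ce16aa5e3138a47a11d62eebc91c132226c08952dcfb8bc05ecb8fa412bbe381afebaa373e6a07c,
    0xc7c2a6718bc70e31cfcdabd5324f6c8194660237190938ace02c2164e04114fde89c85c129afc68431851e4f91c4,
    0x494fcb58babebdab5b87f37378cdfb6e7a599498e3fef7ddc5e9346e16783783b321d59b76d7e22b393fb7dccbbd,
    0x89a0f9138235eac124dea5d206eda787fc03cadc5f2ab4a7a11655f8dcbe6acd38ad089a8afca49f623d8cb4762a,
    0xf12f6feb1024d1de9d5524aa4e5768b99b305dd2b4cd5ebc8de00deaa25e1fb87fcfcb0cb8a4de62fdb54f89b57a,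
    0x29e8021bf59c7626544d031be542fe933e47adeb9a835ff784590aa35fc0279d75ce19d149286bdcd3d0de6504a1,
    0xbda6fbb52fa9b06c241581c07f14cb3901d24b43028e8a21d6d25422e010de1daae2535bbe8f0e83cea94b35c8c8,
    0x3cab7]),
  ([1, 1, 2, 4, 3, 2, 1], [(1, 15), (2, 14), (4, 0)], [
    0x55346746c840ada51b7503075d477c82cf9fd5a81f8651791224506c837a6173c7a71058f4febe2e5587c6b362cb,
    0x51937271fcbd95a1f7b6abb11f1e75cb91c527cd299baa8bf8f5e67b8f098aee38e6003ebf292edfc9afee0f4746,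
    0x8cd3358bdb9ddbe61fc6a73f72a25cc2425ce51a70353f9734f48ef8c4b1adc8f5158d1521d6187f2ed0ac6f1433,
    0x3ce92b389239ae09357239e581389a775f61539b1812646d866ad3255a855188d8329aa8975119e4cfac0d3c919a,
    0x1c136dc4286d709923c23424a7c344bb12990a36f00f45136d8169e9011ffdd8693c0d4ba8ff7cdc07424d832ab6,
    0xeebe6574e664126795976fe95a3f48d51a99fe44d8174aef844908216d4cc3a3c04d83c8c3adb250eb06ba26c53c,
    0x5f78d9c20db7d8b61ab27d27e5b3a4f8b85aa22c84eb3f68be10252b534b5ce2d55d06237061c4b45368c7e27e42,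
    0x78c31a54b0c21d519461341f7d272a298fa9306f998fbed9fc5ad552535d3f7fd21a8d092a2d26aef7114c722]),
  ([1, 2, 5, 4, 3, 2, 1], [(1, 15), (2, 14), (5, 0)], [
    0x6fa9c27fbc1b44b54a57f9bdd798c8bbeeb3e67e9e0062ef1ebade04d8e45bf15de0e5ee0a3b486041ed8b91ebdd,
    0x174b7251a4942e853ab8caf49e5c4b6c1b2b36a910705da7933398a2098cbc449133fc5d0fa079c820e87d385b4,
    0x7364aeebd831f1187321dcd26197456ea3be53b2dceb84cc95e5b3ab14031084b08acd088b7ee82cf3f91a595e12,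
    0x458b26783dd9262a187a22ecf7d507f111f2af23312f48b7]),
  ([7, 1, 2, 3, 3, 2, 1], [(1, 15), (2, 14)], [
    0xfe1d893501a6e0bb97cd8d882c03850ab5688b3b2d8cc46e7f7a12348e044b3110600247e430809df37d8750d9cb,
    0x4724b5f31d3bc8b85fabb63a91617af8d4cdf063af8026175e16313d410d3eaf5adc663af6539e1e2e4d689b3818,
    0x135857405c166525ec]),
  ([1, 1, 2, 3, 3, 2, 1], [(1, 15), (2, 14)], [
    0xe19519e7d2c5a484ee62c3791fc40f84d5cf5da5837e0478ced0613cb999e376d998eaaa27aed778bec3c97361b3,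
    0xd56ba3406c183835cff089d8b9a30fcbdc2032290491850b384ca769aa06f308c3fc5259db26f48e614815369a10,
    0x9cd7f70f8d8150853216b9948a289457fa207218aba5e083b26ff786a307a6c348e10f5dfc3cc0978526ed49c4cc,
    0x304e6cffd501b135e1f0a366dd6806bf20136a233c558c5695c3b9a962d4d24]),
  ([6, 6, 1, 3, 3, 2, 1], [(1, 15), (2, 14)], [
    0xfd87b2075c2ef49fc0a8ea8543bf6050db472b1bdb55826fbe5b68a0f5b614d69abd4b3af9153eea27c1896ce6b9,
    0xe77fde8288447da509dd0ac688a45a6f1cfd00a56b9b267de865dfb83e080911eae8f62bd395c07e3962962a9038,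
    0xba7c23b696bffd43e92ea4baf68f19ac7cf9aa4d7332cce09bc17cfe4d6a9a727c749dc2589f55b9fbfada161b3,
    0xe18a5cfa82fbfad2e5adad13aa80001fc65e422af0fc2a2c51fff6f0283a2c814ab07f0c09475f5cfe5c6cc59067,
    0xfac1eb6ce3eb717d38a5dc9b61c7f033da89c0b529fa48c918222aafdbf6a4673b6066ad72c69ab7334e4b4cdb40,
    0x28510044e3687a2855cefc23ddb22430ee9aa29a47fa65cbd631689c0271a822fc8acf3ab10a1a6c393797a9aa01,
    0x5ce2a78d1c9d98]),
  ([1, 2, 3, 3, 3, 2, 1], [(1, 15), (2, 14)], [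
    0xb4446ed87fc5f047ba27bd322d593a651235cf2a63ddf8c2bd1c331892388d8ec900c866957776d871ad58a8d9dd,
    0x9b376485f2802d96525c03500d70bb94965c7c9551caa539ed1f3226e5ef8a1fb06ce1d922fa3011e4e0cba8739,
    0x44d92bee4c03f615b3eccb5193fe671ba2c173ada544fbd8d312eb1a0c7387c7d8208f2b5bc01cd66130bea2cd8b,
    0x419b5804ae3135ca41cc279fd3e8be66366b74bd1999e94f20de5ad0571a96c72463750]),
  ([1, 1, 5, 2, 3, 2, 1], [(1, 15), (2, 14)], [
    0x5cd36224ca2ebd21dfe5fddd52fd9f62a58d376d47348130e84ebb4dca7916ed5cda5c42de591c93ab20cbb35ead,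
    0x284c1d163a605dad3d61d45eb238d04d61d8478b0d05a6d8153b62e3aadd16c9aaed7724e70685086b29ae9e2c71,
    0x18b741ee2f7591bc712635e9fba]),
  ([1, 6, 1, 2, 3, 2, 1], [(1, 15), (2, 14)], [
    0x8521f783ad92dfb5a52322bbd56ec5e0a47b41f3cb4a28995ab674d5cbb]),
  ([2, 7, 6, 5, 4, 3, 2, 1], [(1, 15), (1, 0), (7, 13)], [
    0x7a283bcb1f4132fddc25b268f9e710ee1b786ae1e04a8eef98a090f63dee56e3faf9815a50a7d6839baf366502bd,
    0x508cc1e13fdebbae449d3f0208a287b327a42dccd3c9977476430f373cdc59a55dd55d821e27f1be9d398515816c,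
    0x32fa8651e79a31a7bcb9b7518743e703c08c78d92]),
  ([1, 3, 4, 5, 4, 3, 2, 1], [(1, 15), (1, 14), (5, 0)], [
    0x7bf770cc10ebb666d40dcb4a4217a1fa629a1be32f7e11d01791792167b091e5e5a9331b73051b158e32c5d2c70f,
    0x3dc9a5123d233283c8095ac207476280865eb42246da3ad674bd9e0a8ea96480dff7a68726b7e3dfb13fd1bf7b9f,
    0x976b1f34f6b4b3c39a04203d53bea11f1b110a0411c03e1766cffc3abb2cebde06ec9fabbadb587c3b75b5e5e2e9,
    0x1739c1a54a8bf78b39b6df7ae94adab569e32d6b70ad9053e83e234f48c46efb9652d8e32826564773cfb51633ad,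
    0x6395ff252aaf81e22862a090735659295bb3ea404c9024cc9ec79a8aafc9b17e48fd133606a31d216fa1c322f021,
    0x4542030e93debb2c55c1caa09440cbc14d2d1f18884920b8404e7b9beeaa466b8a4b01a1071ae9c55a7a93d536d4,
    0xd76264a3d10957c3a0631c746db2e34d02db8b9ca12029c1906287f21c73b0fb6b291f3712880aea793d9eec8335,
    0x32057686bbf46c8974ee898d07cdc893f0da6bf5dc4e332e1340e75a82c022b7835429e9322130a5af62d64ed496,
    0x1469a69bd6b6fdce631b16530a5ce5ff0ac67a564811d]),
  ([1, 5, 6, 5, 4, 3, 2, 1], [(1, 15), (1, 14), (6, 0)], [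
    0x4c35a6109d9d6bf8f905b3b4a2d9be3835e0c85fce01281695798a053a81afd924030fb6b29b2b87590996759c45,
    0x424028096970edb395038edf420862da2f1f2eac5cbda381b9a66b281f10f2d286b8fdb175d8458995fb5cd0b4fa,
    0x6a4e4363e26a58c19c3d94]),
  ([1, 4, 6, 5, 4, 3, 2, 1], [(1, 15), (1, 14), (6, 0)], [
    0x54f7c1912d6f313bd42faba4affceec3308d2ebe4367f122a857c41ef6949b97fa5000d121ebe365ecd070d11665,
    0xc30219fa43a2ac994b0f070595725663d66fdd516af0fa2ff66d265ca87e04f99d79e62beefe0e0847727ee11741,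
    0x516fc7e4cb3384ceda96bd69695b24fb9a730e4544156df9c0f07030ed74c439b192e3650585366db9d233779bc6,
    0x6c7d9b0c17d1ef12267a1d236100f052aa6468a4f46003b85a79479be1d96f34e9caf7ac9e7a47]),
  ([1, 7, 6, 5, 4, 3, 2, 1], [(1, 15), (1, 14), (7, 0)], [
    0x91fda84d192c145f1970c533bfea27df8e9f691a62ddad3ad9]),
  ([8, 7, 1, 4, 4, 3, 2, 1], [(1, 15), (1, 14), (8, 0)], [
    0x7cb62c898b2628a075d0c2443c81dc271d068f078b08ed6180927635b4cdca7b16c3e35fb02886b5566ecae0f64f,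
    0x4df3e42dc0a4194905a9bf65a2f5c8912cff6a527ce31b411fa3857cb0e5d952cddd98020a4537523b5da5372740,
    0x6de1e2b1eec9d7a39ed3840d8af70ed496f406859777f0fa679769be2748021300f4b8cce5c709c74d7d5d9095f2,
    0xa503635dfec32134783354a2635e3cf249f0bda7da24949a9171e]),
  ([1, 2, 4, 5, 4, 3, 2, 1], [(1, 15), (2, 14), (5, 0)], [
    0x1c572bedc780b6f90b8b77ec2f36964de2da9eab6a0addc91019163ff7ebf0cdf71383f2cc0c0e3aaf06d831043f,
    0x7a2073166be3e9e260ea082a5e25d03c3ca144fa8c71e07351e323986273ee7424b37202b5adb896e1fad85f8a76,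
    0xe84311e0c74d4432329b45d193e330458a483813e69a8261aae645972f11bd935c365790cb4d37757fb0ad654038,
    0x9acc4c4f75e5c7f177aec43ed0dc6ee31c2db8f8ba9ed7214288bbd23a1b27b19305cefcc9da41b73e3ca326fbb,
    0xf8c7ebab22241e0ebade846d2c1cb0eeba4db8c034556ea751de52ea3294978f96063132e34c88bddc1db20323ce,
    0xdf5c1618f1c2beb584558accd5b98db019030f06a60869faecd9b456240d6667fd8c76b05cad8460ab1ff16f63d7,
    0x111ac38ebfeecc0c28ea38b6e11000179d31ca099102b87467717c911adf2ce707548d96fcab724e87921e53d3d6,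
    0xeb7a620da0a910cafc79da4087acb813f0d723d202d765ddabeeb3df238a98d7ddac17b4dde4a70f30ed6f24f796,
    0xc1873a861f30432e766803e5837053b2f109f16587cf5ff847947ae008c2d9718a20ab963685c680dba523b14727,
    0x563b9890d2d7bc80cdff94612ad7f6101fb02a7f1894dfb696f3d1382443ca1141537b7a72be3d8014ebad1e5006,
    0x25e11a3c38fcf65e83e3704057fd7ae28901]),
  ([1, 2, 3, 5, 4, 3, 2, 1], [(1, 15), (2, 14), (5, 0)], [
    0x4a7687233a4d60ac9b019e210d8bc448c6d5bd2b91944f21bc8f8312c7e2d08c310d08b6b3c64e880710ab3fd445,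
    0x8377a697665792d79a85510b65bc47740d3ad57513a6bf683b9b727ff0b92554ae364096dcd3f670b0568781ac1,
    0x8744eead60e12789864b964d33338fd368f4dbc74224a10a8c51e38349c925511b45e39b45ea062d1f77801b84e2,
    0x35d628f459859017e94246fcdcb8df3b7ca4bfc470c78a2cc43a9657161d52b9febba95ab4f3592da0ea1a1fec50,
    0x37a8774a848ec395516928c6df057c769e621ef60974be74361ff11f3f8dff4d8aea434c76e0b5c7c067ed671f66,
    0x1654f7548b3b04103f5066204d48f3d6d5c20ebf811e65716a19730aba39a0b6dcf349090c261fdcfdf21a4c8173,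
    0x4661ef174d809358dc352d9c3f24d3878ff62dc5d4b37cee63680a45addf4fd779bbcc0b552579e6df8bda423414,
    0x678ddd5ab9dcc4530be817b376b5757ea8c10c0a435507c21a45c788a44caf28dec4ad7e2b438272e1f8acd0117d,
    0x7fd0f02c25922b4bd1dff4e62db1f832e3f0037acc9f35765efbb53dfea70f34e7d14473b06a61d680dbdd09a72b,
    0x4d9fb4355d8cd11ea1de7ffb34a8ca21fac29ca916c76996ae3c9903854d364e6bbce0562453d8c2bdaaea612013,
    0x69518e0635c311cfc05fe69b386c914fe1a158cdd05f9048f12582a81522b12416850c715ee743e741890fd6c4fd,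
    0x22e661f1e837d829aaa9b8ad845cdb4e56437f4724b7ad3904955cc6d1a8e0ea086c662bf451bff8d8f2bc0d41a6,
    0x24a33655c09dfeedd500a1eb30f07791a03af3d7959f117c54fd983888df3713522bd]),
  ([1, 1, 2, 5, 4, 3, 2, 1], [(1, 15), (2, 14), (5, 0)], [
    0x730045f34844a8c0eea5a724976d5d8e9f0b02169f468ca403cfba9e072eaf9212608b9458ed27973d05193ad15,
    0xb7c6c4fac46b9a7d5aabd0ed209723137f55b311859e16c11864e28361249596f872931ea5116dc32a93538c0e33,
    0x50124234387cafc3a536d8c600c3a839a5812f17a1383ddeb84344f363501faaaf3d05f8a48efd33f2be4c359a6d,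
    0x99f3c1201196ea3bd4fbb672e4eaf7ce02473c7dd86142146320690f77a650e0980c002e25d19b024f6267bfacb8,
    0x13064564822ea0e5cfdf001a32632045905fb49ae7cbdcf473efbea7d82ddeb63dcd359cf08afa186d7492ca532c,
    0x98ce64bf3dc9aef951beafed0f00d85d5d0f04ba508d1432a0d31f351ee98c78d19d5854ff5defbcde5cd5fcf0de,
    0x1f3509cb3736a741ec24b96355c1f4fdf6bd1a8cfdcd5ba4ec224077e1591c6e152d0c10eaeefb3215c63784fef2,
    0x66fbec1e23604006f20511c66bf879f58828c436238ace41819eb6a423509d1725ac1be39af5561acaaf4c9b2c32,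
    0x2d8ca98f326f9dd8565a94bf77463c74c46dfd9c3dbf84ce6c7c94e9ecce31e25d41007d7335e485b23de6784cd4,
    0x71cdf7e7e4d39d8891782e1bf7ae8b6f57a020df9d9d8b5d173637d43737f858255ec372238f66367fcacb69547d,
    0x4ed1d8e4dffcf56504d5335d0298c5ab2db77e5493f6a7f5935b100b7c10b78d0a8171d22cb6d35434deb8d60199,
    0x38cfb4f95f8874f4861e038898b93ba66e6679d5b1e9ec1418e169e80]),
  ([1, 2, 6, 5, 4, 3, 2, 1], [(1, 15), (2, 14), (6, 0)], [
    0xc2d5ac14663b746e3b1ab6d179f01e5cc6f7badecea50f08d1769096f7de99d231f8697453e8a789c850a411fbcf,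
    0xd8471b7aff6d199f3777dbd12aef3b3ac32bd74e1eab964b278aa3973b4e4b59834f88d49209c31eb08fe4fa9fdc,
    0x6fa5389a615918bf7ebef9285d1ba9ce873cdbcaa0282ea4fe957f3a46dc3f35a4b48da39c85c642bced68a5a3ae,
    0x1bdd103ab42a6aae43abbcb0a85976319b098c0f38010d616ac85dabd450716bef862a14d6c3802ae3d43631]),
  ([1, 1, 5, 5, 4, 3, 2, 1], [(1, 15), (2, 14)], [
    0x85ab78803a76019615e99fe333942cc96768d53f357368535ba30ca05298e0ffdebde2794e430c7a4c63e37b4f85,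
    0x7dd3da7dadd9a91d021ba0aec278e1f6c09b2d52c2e8394b2d701745096197699075e04f5f89b73a4b1600780a14,
    0xb7f387e3d01b6bbd958b5df6588e2e0a81ebfd9f563bccaf1a6c187d05efe062817cdc65d3371e26ab2797e421bb,
    0xaf89fe7fbb6e2d26928ca4dd3d829fc711c24083c0cdeeaffecd692a270c03f1d58407ae3e75faf]),
  ([1, 1, 3, 4, 4, 3, 2, 1], [(1, 15), (2, 14)], [
    0x4843f642e04f17450aed27a089f67f316dceaa3bd34649b96af723aa496d9eb5c80fd8aa43360dc16b1ac65d0845,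
    0x35d0f8b215b676e8a64d73640b4438b8817dc93827ecbcc839051ff7051d6dfee6077c3bdaa42e51b517322326cd,
    0xecc584a74c4445f9238cb86cd7fd5d678aabd57ec24d50fe67f77ca8517970629f76dc13d7c01c96aef318a94d8d,
    0x5adf7c31ca384987906a7cee644c697fea3d41c7321882e2a9bdb5f5700b39cef0acad8bada98ba6b01c74a4dcec,
    0x5f338b7960962448b296ad6e84faf2d4f56ebebf9c966ced5fe9541a057c4ce37258b8be3023c5c6706a28f2e53d,
    0x98f17fb32bdee0d1457a571ac24822ed1c1d46b65919554cd71d31560b3b126e75c54e8a4ac46e96101c87d51f6b,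
    0x8b70b15115583eb4c7d139e2e8bee7f180e5357803995ed1d7e894d81ff30d5961077b35cb2ea97c5c0a7669a29a,
    0x23b28b65cdaa5dc07862483226df3828352b5dad4]),
  ([1, 7, 2, 4, 4, 3, 2, 1], [(1, 15), (2, 14)], [
    0x9874ceb5057d90eee09d7ca7fe0efd5cedec9130d521cdc4f08705fe2511b249bc539a76cfdae73347d8e23c8c19,
    0xa6d8c52a3d8d51292d4855dc906cdc23ad0b8688408a055fd7f87256a512ad2e9944384ff2f139b861eee2936d46,
    0x572a65ffcd1df5989eb3603211a5a73278b2882aa7943fef9cc8bb1e020dc8589c9bb3b9b87f690e9a4c587f7927,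
    0x78823298d20a6255d03217bfe90f40731ae71eb456d3]),
  ([7, 7, 1, 4, 4, 3, 2, 1], [(1, 15), (2, 14)], [
    0x73c78e8d0261207b3e01e42b2bfb44809cc07eca82459d9bfb781e0b17f6489ef6364877e4978eca51bc956ceba5,
    0xc4e54ad5a3dcca38f785587aa913ff47c9f637c3ad1accf910f283f08d6f9da1c8524c4e9c6e6ce437b54f05bc4a,
    0x7ec3f1cb4079b4b1866d3baedcec7b3c38a28baddb49bd96fd8518514db40f652bdc912f717aa5878978a6d41979,
    0x9181af72fa9c157b096cbb1f445d2632efa537174c75a3c4bf37b7a625293c7419c0d4b37a817f58d5ae00f04cfc,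
    0x9e6747e85098308627bbfd0dc7073d92f03cabb4f92df0e3179dc35337bca561fedfe468fb623f3adaded6a5e75f,
    0xbff97357f4eef1b01278f4165034e54f65c241dfd087d95d6c823c4d276a885690e442851e3cbd4292109b45ee0a,
    0xdf3610f02381d787dbf73f34df516d1a3dc9aa6d79636cce3eb45ade4378bcfd929e72db48eb8449462fa6653f9e,
    0x1fd0a2187b2554d6c6da82ce14e358f89]),
  ([1, 2, 4, 4, 4, 3, 2, 1], [(1, 15), (2, 14)], [
    0xbdbdae7d495b08a72859504845eb60aac8c9e74b6e24ad31722bf1255b544072888b2d85249b33a021dfadf2c7ed,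
    0xf4e6c41409d64c08db7d9c821ee1e879c9b0687eac677775b343859b44636ec528d8866760c5cdfb741d4eb0a08d,
    0xeac8757b80e16efa1daa59e53e43df606105651d65a4c1a4db2f8c444f19f893062c46f88e84192dc242ac47edda,
    0x5871eed364a6623bb10ea6a7921a322d0c50115dab39d6a1a7d779826ceb092e7215fe598df6177a0af7a89bd2de,
    0x6a8d48cfb1ee35a579a892a1a13125e56817a7f96ab6476d7731fb3307461790d1923d376f9873377e1f0887fc9d,
    0x568a2e85953bb4a0a409952c24b52aa4930951bf692727b57d07d767106e329824ecd26ba33d0b6c2fe7c8a5e49e,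
    0xeee1e03008651fa65376ac1603e75b3011912cd1cf0be3c9a202bab2a7b2eb9d8a8abf7752b756fd7aeadc500726,
    0xe1a8f99b2f2377d3184239ad91b15ff241f54ac40ebc27b3c550955b1c1b721d4ce54f8d44e34f41f3765d6a3c7f,
    0x163d470a01efc9686f219d954b729b36bf7de9837acb568a97041d34d1899093cdc2edef8c40d0634abb6d1f1c88,
    0xdf9d0]),
  ([1, 1, 4, 4, 4, 3, 2, 1], [(1, 15), (2, 14)], [
    0x1edd5b6c8d23d97868aa5ecbb86cb76d2643d21a500f7aabc971bf41c56d94272bb1ea823f7e16c857b2862b7779,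
    0x1eafd8ff63282aea9854d93385e305d522bcd1de43479e95d6dd20c6625dad76ea4332d769c66da4c863bbacd4,
    0x621e4c3d9581155f2bcc43f94734c3e56f2125ca73049369014bf2f23c91254f99e946ddc09a444e478532db73d5,
    0x2bb6f0a9bca3ebfe477c27a20355c244a3ccf6631b8c4e0984e3909c39894ee7f52069d99bced492e90d056fe5ae,
    0x2a47f7c1321304da9bb8e278655a86692c5221b17af872dfe2bffa0d73233da8a7776fbc2eadbd801c0103409934,
    0x66fa3e3412689d2f94be777af5efbb8b6dfeca3846b54b1fd9cb2a5d811cd2669a1e3f4dcd366ea66b352620147a,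
    0xb02f5e0d99301390c76aee36306b2a86dfa5ba50df111e016f81d3d186d39bca2128ba8459042c3967df0675cf83,
    0x7ef1af54c6fcd2339909ac8f8429a06f38fe6e1539218b3340d7c0751683ddf561e4af3d507a310425324c40c5d,
    0xe977086df53b5e78ee94c51c7ebd3971995578a0845800e0dc55e89ad22b53fbaba3558d5b38d3468270aec7a2fa,
    0xf38e077f324dff9bd13e7a5feefd74c66b8164eb052cfd0cdd4035044db062fedeb35aca8e0bb40171e87571e0b1,
    0x397479114e29abc1c2fc7ec39a4fb4f88a52b13e24d7794da667766642a17de730e1d3046b34382a94866e4fe5f5,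
    0x9b22bcd92d36d5d9d76ee4aa10b93965a49ec024c3e41026d966e4571f5722bcad65b37344ba776413adf19ee78d,
    0x62b09d27144d03d5523f3614fd2c603b5042476c1b712a13121485f1c2c70333eed051e6e282d577f98560553dc1,
    0x7bd03efd2ba71ffb98cfb2bce6ad200a2eccc9c549e2621666992547bd8b4c5c0e69ef68b6f0d868d757acd7ef65,
    0x964ca9b3a6ec9be98fa8fed664ec22f537a6edae4a6b1f5bebc67d9082cb173ea4f3cc91ab951ca6df67abc03230,
    0x21a69570c7aa1289f5fe4a54794f06da9444b7ec595af6f3a62d783c8b645b355e733918e52c86c64266a6084e97,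
    0x246112d8ac9e28221756a936bde407fb4c663fa3cbeef0a29]),
  ([1, 2, 6, 3, 4, 3, 2, 1], [(1, 15), (2, 14)], [
    0xd78c3c827c35e669ae1699ce95d8254e93799ac1379d080c6e7e46e69fc54fe09b4f1fe2e8e85adca9489aa283eb,
    0x9f7a4fedebe49df7126db9f1b39269f623ecfed9029c01ee909c9cbc0196aef83746126fea5f0d512db1f42ef9bf,
    0xe51b2e4f98e361376a540359f693c4071e07f4d468ffa264994b16f8611d5d33d5f038b90922007df6bf27e6272b,
    0xeaf4883e79aafb177c433706f9eb443b54462be6d68620c0cd368012643f724ca006301cdc7ab22c1a3479cb3a2c,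
    0xc0d3524d45e865b31eadef9ecc2fbb0cddea122]),
  ([1, 6, 6, 2, 4, 3, 2, 1], [(1, 15), (2, 14)], [
    0x21ea9d07de62174f7e26df9264a764b336d7db778215685e068de3dda5428faaf27b2122b57522a56f400ac7ec01,
    0x2958f0e7f7f0cc9274b57c8ddd577c6b83aa52aa3a8ec4fc79f13f444a94d2a7a8879dd54b92911f12244e60b8fb,
    0x4dff0770e864ffe8916e35e12d19ff15d59fc8557e099d90ef789cc65a351d0f9be5437edb40121607200e49213c,
    0xfab959647ca8a473e871e64bdad3b35d10df9419448723f45b49bc5b88541cc0bad4226f1a9bab811b4462c39592,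
    0x1b93d26e6daa1cb725fedec9c75e18da5ed3179348d351f286eccd5188e0878a948782a9056139bc4fa0ade75689,
    0x137f2880a7c2bf168d9b83ae34]),
  ([1, 7, 1, 2, 3, 3, 2, 1], [(1, 15), (2, 14)], [
    0xdf173e1d3635f819bdedbd9a049f9985d786bc2b6594bc406194b001ce96b7ce85c2561aab7f569a8d59a17934fd,
    0x1bc87ad2782c36665bf12f99bd5d0c7fa0c1f4cc6cab592c3b402c6688f72fa54c5906052aa5c99ce38a569f22f9,
    0x8d899735d177ec28a2a25a115873fc5e4fcfbbc5f53a865942271cafece405dc0609f37aa85dd13e17b0db456c9f,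
    0x7885ec2d79bcdc88208f8b1579f9902498493b83f8ea0225d34961e6b3f01da5218a1e6b1ac6692ca5d4a5481acb,
    0x127feae208c1774d65d364f6f3a2f81e2f4959b24ad866608e3e4e5dfb2813534a284d292815883f0cc4b2e9072,
    0xfa7b2a39f96143fc451915848fedd229f1b6f0b36425d43d50b30132130e7654b30da6147e843cc7baa78e99b04f,
    0x129]),
  ([1, 1, 3, 4, 4, 3, 2, 1], [(1, 15), (3, 14)], [
    0x95cac5ec9e2ccbf49e1d9b5f72cbf970e5edad6d3fd7649ae80acb78321054430da8376d5ae1e99f8f1ba07d3a81,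
    0x512d10a5b5677acff5ea973ed201117cf89da7fe61c4a248f512fe5626fc5680dde3673ddaab4159e4e06e1dd208,
    0x539beefb201320a36ff191e24955491a8954558e61e104c4e4ff30086315896c68b3272557975dac0849faa4ccbd,
    0x6b495ef301cde0b176fd6adfc0d5de02582ddc0675b7fe5e0e4ae46c252c2cf662dee305c1a11d897b25b6ae5709,
    0x4e3c309f00c861aca97f1bbb20cff8efdff4906431bfdbc0c6c04ec1f4f71a42bb101c2b6e50a254e03f27eabf8e,
    0x2e861be41ea705f77240030465ee1900bcf7e353e43544f7e23f45a35ac63b222bd10751a979920da3646203e146,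
    0xa1fa3a11645e5b513750fe76ec139c164652f71484ff24568dad94debe2b1b87504ac28271355c745ab9c090a55c,
    0x8b96571747c0ccae52a4d165cf011315078edc3be]),
  ([1, 1, 2, 4, 4, 3, 2, 1], [(1, 15), (3, 14)], [
    0xfb718c83b36c17b9c9bb07a7e3e76ea7a4f4735dbda69eeaf027cef90d88b33d9f31f420b7ad638d38b72b87556b,
    0x8a51ac4034dd6b6c4d03ea6c0d297d0fec3771c4dfb9ff9806f00dfb17b2ce8bd95dd39cdd34927339b095046621,
    0x5c3678b1cdbf7826f58827e03a8bbaa513367d4668b8ee3b853c16e887aed0cec567997733d9b70811eeada05a22,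
    0x56b0b02ee4b7eecfbd343ee01f11e587efc893c66b2b93175b380887763136d3977ebf76e46bb66eaf58420033c7,
    0x1ccdbcbbe9886efcc5cc507b304f6d0cff0dd7d20edd469a66b315809238a6c9a9928fff72424a8023dd72a4c3da,
    0x3a967bc2cb100e414ede94827d78da5c2c1db2fbf64d238c980ef0b754c2d624c2096e24f2dcaecc0c9057e6a2e4,
    0xb864a1e83a793d7355c3cfaee1a5c75e6bdb72ec4712e3b16742c48f0c945a6ec2e752d96f4fd2d9d776dcd5ba17,
    0xb372c16b518e94cb8fb2d1d31315af1e52fef35ae2fde1dda28abe605a092b515e2154d143d32b14375a942d3bde,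
    0xcf491d15ccf1ca554ce0068c7004f86bdb2486f8debe6301fad10c53c9dbd586c62b392795f1d634847dfd0d6df9,
    0x14d040c4cc0c5d80e0a43410b06776e26a501e3b136358c753e5ce3b2f8bdfd323e3dde61ef5]),
  ([1, 2, 2, 4, 4, 3, 2, 1], [(1, 15), (3, 14)], [
    0xc59f2ab4ca8cbe6e5cc571427dc65b40851c0f16abc407502361749f6fd34f849afbbd0735cff3c402ae7bda2c69,
    0xee43661227c556d367971cab9c6943344e52dc8db4d1b07200f73c2800673e8fb70021d21b2b6a9a4558a6f5fad0,
    0x16e6fce3e4c2f2cb4d0ab02c75c4983b3afb1156ecf5b99e56b9137937ffcaab9108a828c7e1be1f5a81fa197c1d,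
    0x29440cf1c27540a91dd7652edddcbd872e9f3a6f7b11da26244b696757458d79c6381b809d33e0cc8edaa7de5d10,
    0xc9189da44f8efae425e805b059a667343a3d0669aacb59fe1ef5ce2aed90f378294fe96acfc21a7cce1fd9425e2a,
    0x34ca4daca173bb78643064366e5b00c0755f034c77a5896cfda7b93f4526715be39bed25a40a19c126b90ce18f8a,
    0x720c70b4249fd9d92e293a995d3a1c733d5097c6990b3f9eeeb7e3c3297b7660eecbb574a2691bf3a2f2afe72572,
    0x246ebe8cd3f7bf64ffc2c9c2e6e253f5d7906e4feff17f4908605e8714d9ab22e5499b80bb4958f0e6f32f36744f,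
    0xefb3b538377e205ce3616b010d5eff4b6e091d891b670e06061e1eae3899f681b7eca57ad0086f0ea14eb8ed5ad6,
    0x11f4cf2d13c3962fb32331297b72778613e31242bb86c5522a649fd217f47e1f5fe3b247019569fa882e755fbb39,
    0x5e90a52e4a31a0dc714abcd35dcb6e29a4141159a242199baaeb33a2abc60f1fe8a67c442ee8f87dd8e33b6db390,
    0x38889322f8c281251e7ca9865575b8616660d9894442bc527cb40fb2fd8a5ee8a159a649dd46bdaa9a61511b1dd8,
    0x212a97b291d5befdeb7b4f3694f6847d3fd0fa45af3ea9b93486]),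
  ([1, 1, 4, 4, 4, 3, 2, 1], [(1, 15), (3, 14)], [
    0xd659ab2bafc175dcc9bf1ceffcf6d7017a6a186a0bff030f4b374a175d51cf17bd6ef5bdb95cb43ed00481b7e271,
    0x7ee5beae62786d33e50e60ae2bacf0162843b5bd60e84f9f5b18160a617d83c9b27dd8201aa47b95c0ce3a987444,
    0x1e348cb8acf410f0ef179c3b4a54e7972bc616b5aee0584565471bb7ba234dcef5f9290f0d2aac4ce343dd3997ea,
    0x6626c16e428ba1e5404a9eb1c69373cb8b4f555695387c25cb4581c68ececef32eb09c89452e41d52a29f9893c81,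
    0x683f14bb2d6220f6449a682d2c7cc50d38f14943c5096fd65db00ac2aa0fbeb0132faf9075b85ce838c11d8d4050,
    0x7f3287ecbd917fc02334befdd87fe18e61546ab23c981d46df83478b6cb86d4f4fbd7ddb4081d67bdb3b59af45c1,
    0x7d1207d2a6034d7a7785a96876d14b73a26e77780ef46351180950b1cfc641470162f51cdbe5f31ee02bfda2c007,
    0x1745618ef0f5113123350ee698453e91c481e638112fe7de9e7dc0feeec57c1ae97dae35d300eea37fb1230c00a1,
    0x870c0ee2b742af34461b9e0aa77bac8a3163e158dc3ac188d271b03f0776cc918c902fdf8572cbca46ec6483a4b2,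
    0x6121abe695b3f050153d304df82f82b7f9936f6120701cb4a644c121e22cfe9718e1c4a40a66dbfb3e61b934c416,
    0xe9bcd413d8bb1b03cb4798334da94ded089b1f50224658b75e52ae0b03d539dbc7f862d2faebaa98aff8fa0da689,
    0x7080fc093b41287bf721f36466bb679c8b7866fbebf53b51f55c279baa8dba233cc53af060007b26f4a6fa9da828,
    0x92fdc4421a376fb9c0d362b8ac6e8203fe0b018ebd4d6b529445474481d323c97e55146082053b19e6537b90a9c7,
    0x1485087ec7caf697909b6f181bd2076d1a7e2907d239f2b95e0b8800837a5378b173b92db92ae1f7e73dba5875a7,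
    0x5e3f87a5ce3c17e131ddeb0f5fcadc5734a2c09160a9639c544b03ef9f045f4e1dd03045d85983817f40de409fda,
    0x29db12ea2da67433ad1c8d32a803a9834e3e4222483f9d2e2531e88f3a5ba6f69fd78c23a0163add32306e85a9ff,
    0x99b41e6f1cef17e66c48c62c512626479a8f5b41d988cfea31950ee69502c2a5c3074e17d632f440446ccab53b9b,
    0x54adac218d1ea301fd927102d8d3ae295d7f2088e13fdfa45e812e9254f4cd5a8a8ec6fa391a7555cde22cea6576,
    0x630b54bc26b7825d1480a0933129ed2e3a5fbe1a8d666341e1ff265c86e98a2097bb16fc4ce1f991857be3891e0b,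
    0xf4178c739dd7edf55e48f37bd2d710d3548f7edee90f68630e8e5f4b3ddebc43e89c5a9c5381b79a37f9fbdfc67f,
    0x4b373636f82f7d3bd0f07f023259ccc1fc6bd8776c1eaf069c2ca63638e30f0379addecd1]),
  ([1, 1, 6, 3, 4, 3, 2, 1], [(1, 15), (3, 14)], [
    0x421bf2064622a3502b2d76503fd79415675e8276fa7eec5f5e00ea275de5efdd6e60a771f79d5b2699e1f4b95887,
    0xf427022667f67b80c689b7127739759b29dfef0f867227915d897d402a6082848ec3cd845e8ff856cd7de8591aa2,
    0x87cd4634f66dc8c0f0ac29d322e3b17b0920303dc64ffe54625081b998fcbeafa398b539f0567c94f3f53cf85cb6,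
    0x1665c0164857a02426414ac3deeb761b7f951fd29ff03e5aeae73]),
  ([1, 1, 2, 2, 4, 3, 2, 1], [(1, 15), (3, 14)], [
    0x80b0472a56e90efd6766377527640c14b83c29b35ce34ea2739482acd0200a13836ecac4571420b80b08d7f17c27,
    0xaab67af6f481558fa2d180c17f99b3d78e8b1745a0b548040b635b162a0bb81c893560e9834fb0eecbc2bd247ffb,
    0x77aed6631b49cd4586aed38a13a7aa05d241ef809870b2ff4632b49d35c9b9df1879f6df36973a85a64ed702c5f8,
    0xd4c85b380c61fa83bd2287057a6cf20f24624ebd19a3b33046f1c9a819fb311d6defadde407ab3e3d530a38aac68,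
    0xacb6c82fc69ebf497730f9f85f917ac39a5b15ce12ff177ed630688d84be02e17604ba9c678341ce76f508257768,
    0x969db59ba9bdb452d15bad850c57a0b09db5a1e8924a4c32b6c3fe95f46f1097f6243564d4f8413569d7efa16cef,
    0xe7699e9d9fa93352b64ea89cc93ca5f74e21a4190ad576a379e4c9347c1cc04ac72b301c3514c8e15977c5e585cd,
    0x5d4cefea1f8466b92bf41379f6f4f3b851e9537ffe10b33569abdac9cd7]),
  ([1, 1, 6, 2, 3, 3, 2, 1], [(1, 15), (3, 14), (7, 0)], [
    0xd20604d0c289828b4d796aa29cec0cc54536aa25638ca0e69a6cf842bad6ab632add7f43e9f33a0663e72727b331,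
    0x2f94f79e7aeb0c79abb67ec483b3e339eb1735d4751f1417a305fa66d95958e6f51fff578e0149675dceef90ffc1,
    0x8a8cc7f2e8bdb66ad1f191ffcc1c15835f4717d905b5f777bd043e1913e0fb421e8be1190768bd41027ff78090b2,
    0xd9f40228ea77987ac6f3f3d5af3e3275d547283d9b8f9979bf24b31f367fac39ccad157de18e72a319033e2dd2d7,
    0x3282746af775eae59aa45a51bfd4817d731937ea77bd0e979cf2433e76031fddbf44a59d2728ab42df3cd11e8525,
    0x2cc38d435b51cda0e778b5c61eaeefb86bfab782bc5f02028ece673237019ba9a9154f74f18404604b0b3a0ec8ea,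
    0x95022de37aa332419ce6b2b0632dd21be6a6efd96d74d4b7d6063e1f70b74ff40d18e2b22f209245959b72d6b1a9,
    0xe16a2243aba8c4e75c53bd008aa80350f7cfbbf570eaf3c944f03838269ae65918743700525bf71447da6a346f81,
    0x569dba9f1b67f667a084811a7ee3ff92a0e46ebecf6b5ea1eae44472288e14748762dbaf9aa10bb9c5b6ca6d983a,
    0x314ca0108bf29749ec2d6a73a677123796caf466e9c49548437bedc1d2204ab17e25d2f96d7a6c354a40ec08040,
    0xd6e7d0d97f4e54deff35b3f3925ed24a8d84757f2175d760b17d905dce05ce27cc7d596f594149a9dd2ce210a0f0,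
    0x497a145f2a071655cd3e7af85b8e2360a39f77839f7323f83e132c713f3b163caeaa3a0b9f9aea13286ab9abdff8,
    0x4743b17c1c08148f9077949e9e629d89e35245fa69df272a827ab5a447ac7424031cd39c23325600735bce49da64,
    0xc526d1d955e7db428e9598078d4a5d9845d1b7a9ebaa94da4271ad73d368e314a7f081dc9cc5e29abe3ba239bea3,
    0xa676629dfad231d8f140d33590bc83b72734272ac4c432871869ea0b7ac82970a09265db4c6b05885736d0953283,
    0x3249c418b883b46128559a8337bb360ee09a0d594d1d872f0a8c6fa37bebc2130617a7b42475d465]),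
  ([1, 6, 6, 2, 3, 3, 2, 1], [(1, 15), (3, 14)], [
    0xbce86996e78a48bb6d60ff3ed2e1ba4a8799401d2c3735341ec18ab09322c1b25b7daa3f4e4151478d20540ba3cf,
    0x74b24eb82b6c44c53705e232ae1bcb51793d2f45836ccc48de3c2c75d3fb7f5b0487ed011f6cbb42c8f44861bf6,
    0x2531ddb888987fc99fdf2f39540e285cdee60b368d95a5a9e24b8b4152a006831d85ca622d83a50930b679b9826c,
    0x9579a7559b291741e7fe337c2b055e76487f1457153ec2df4fa57ac8d4bcf045ef1367587f6a9b2fd5dd961218e4,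
    0x1158b57c7a932121d61ca78f0ab03c3c59aa984197966eaa4471e22025e2a78002be293659985788772c2c6a8bac,
    0xadf9ea1bf597b3add2494448492de1a5995f929eceae4d26be3dbb3a86dd1727190210154045ef3c6a3a854e56cb,
    0x2baa2c88281994866dd28e015d899707cde5b1d99d21e1e2eeb53c039d01627468b3837043e0ff917350e0d1af2b,
    0xe46ca72c73329f5d81c277e5222b1858d3d680196cec00895823ebeb06538fa833314d72b802950873e365560196,
    0x18e39ba13102d044db847f61c52f0d3b71a76d72834f9687616d3f63953973eb5e7178a9a45c189105fd7b71467c,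
    0x5d3c52b4e5c009603214cc03e590e829dfca2c389f5292ec1cde835f93e0d29dca8b74c7a8c9055fa45bd49a1a74,
    0xfaeb540817a817609d6ead422da2badded54d274425ed989af3cffc6d2cc0f0dcd2d756448da9aed6e7a0d2bf64c,
    0x2ae7435f81655ff6efecca76f220ea4462b58c16052950c24725ebc738f3ca1f78486fa0821cd34ebaecfbf1d6ea,
    0x32c09debeba43013b1e721ddaa6bc07182b3c3cbc638d399ede885553dcd9a17713925517b1a922e4d33f6]),
  ([1, 1, 6, 2, 3, 3, 2, 1], [(1, 15), (3, 14)], [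
    0x1056f6f35769219ae3936e6140008bc672eca763a7f3cb4097a6669cc341efb4e6b7419416ba2cc4c6241fbb0847,
    0x957f6225082c64e9dd0264d388117317e184094b39eed8c033b8ac10e4f2b6842f6870fb2aa61ac193c5238a4973,
    0xbb36dd166960f925b4f1527448bf1ae345846039925632222a36ecd83fcdf132827643c33a42062d43ad98085249,
    0xf7c36d51848ff41b4947e404772d0340df4f6fda1b76346554d7a2aea157f0b75150c31c77ed33b02d5b4f36f05f,
    0x8e5e1c298be3aa125204c30a4619006b9d5c6867e619c3b86b617766161de3113845e24ae1027a3087e0703e0800,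
    0x154b9be0b20838c0d497a31bd0e9e2a77708cea2b845c384095203c3fa7847a640a3404c109e4833d532d6bb8bae,
    0x99536683ff8ef8a79435947ca2c0e7d7df37cebbb4aa4a8601276ed700ecc096549373a5e0ff01b398a3d1b5903c,
    0x30eb8b96d927ba4e20f07e00339501d8fbe0a2203ac018c0cc2e2e7660d45ea4c2b7f293d7f5377e8c66b50b19af,
    0x1]),
  ([1, 1, 2, 2, 3, 3, 2, 1], [(1, 15), (3, 14)], [
    0x767163d4a9b1ff3df57e4e9189ef12b780fc818c96ab1836e20f916783f713fd400d4aaab5b079bee559c07c0e55,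
    0x6ca078ac6fc1597ca57e748d01b347d84a87282b641e0107817967a6ee29cd5fe6f4bab9213268172a145589fd5c,
    0x6eab4a84eb314d0a0c1cd4e58516d0f248b666641f4737b3b07ad5b975087eedff147743342e90769be276fdf41,
    0x9625688e169db25ca9af49bfc80f356f5bfbe1c707fcf7123f376025ba63861cfb681a80149f1c9c9c53844cbc96,
    0x4f7ecc026d2550112ea52694b94a1897d95027ede8c6620b43bb8982cedb5da7f7dc4e375474441ed4202c2e4ce8,
    0xad9e454f0635d68d6feb51a06b090dbb1769ef188b4eab1864bf616f980ff1c004737aa3b4a912e3df7861848b72,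
    0x36cc6bcf705ec0f5104206031825bd1ebda3677d91fef5a83db7024a9dacb43baede742cd9b8005b36931b9be6d4,
    0x65b324a32df684d723424f4ca814a030a7129ac14693385f147960ea8badcd00443bf44f4a73913410c4704497a9,
    0xd52f4459ae41795f963e22182f118a2accd162fb9e02f8a793f4d60979143780b4fa681b056d82cdd9985e7d8447,
    0xe4247a4e57c0f7e6562ad436b779f16b1929a006acbbe98fae79828bb029d37ec7ba00ea39b6dbcc534f0c775444,
    0x761370a6f81c6195f15ada8e645e9badbddfdafb9c309a765bcd8eba14d494a43dbaefb4949748a15541b60f2e11,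
    0x61119a9fc66937388cda5aeea9729c6c1767eacaee7814810c239e089d66fb0e640fd8942eeca5e5dc6ee0eeed85,
    0x39ec02b1d1f7b74f34fba17f0ae681a3e7d02f33a02a73e1abba48a5669616b7d66a0ed8a7506066dfd42450390a,
    0x52ecd82ab1ed]),
  ([1, 7, 2, 5, 2, 3, 2, 1], [(1, 15), (3, 14)], [
    0x3ece55196aadcbc768c8ba6d406e89821b965ff6b92004a25333cecf887fe9726caa8ba5875715ecae4fb19c79c5,
    0x70b145ca754bb740f647de16fad84f7d606f799d85ad0a33bf0c38a2110ddfa3c179b9242489be9aaf1407fa2eb2,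
    0xcddb81b773ca368a9f0d52593dc90eadef2eea25bc367add9b5c706e3f9391efe7cb3926afb39f74b2c821064c5d,
    0x6c29c0655fcf49e8d428d1b457115ee3a07eaf05296a7f1182100c5d9def19286dfaefa5c64e30451f940a39a054,
    0x4dc88fd8ffd4447fbfdab0dca26205ac3b4a919bf786c25ee4acea6f27eb699e40e7a654e3627e8458c7537040af,
    0xb854215a9c744a2a661f5790368b17bd01d25bed69bd94bfe6b2652d2138ae8b73c2481fcd5a3fbb2a8a42f4b538,
    0x5792cb29f9ebc40ed3a6e5ddd6b83]),
  ([1, 2, 5, 5, 4, 3, 2, 1], [(1, 15), (4, 14)], [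
    0xa48ef7da66bffbb74893793ce9b8a3e5bf19a917d6841493abf967d7c15b93dc21b6731e96afe68b18617d1ea019,
    0x1fd734726845f3a5e174735a8abb49177a8a16fe627bef035c593de4e2a092dfeb0417f1e14a63d79ac773533d49,
    0x108c7b50bf03f30e2ff8d81f47a43d7aa0ae6e38c5ae09daac9179667ff6bdf90577d0fa8e9e3d923b8122efa28]),
  ([1, 6, 6, 2, 4, 3, 2, 1], [(1, 15), (4, 14)], [
    0xa9d60a87ad0f81700ef12fe3c0afa4287f4770763de109fcfc73b18dd223c686cb883dd1e876ec15514bc4232835,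
    0x1372199fe57c87a2f70deec4b1bb20fd22889ed051963c6efb23bec1f3beb2bcb5aac586c5930c022a8925591df6,
    0x9864b28a1bd8acfe9b9ee23f6c908bc4bd4638d7b3c41fc5017f223e5fba8e7fcb5e55a2a29b03fb9983007e438d,
    0x97e68d8ae0de50df438c2667c2ee08f1f3f979e51ba7992b513f03b007182d05ae44f3bbeaaef6f4dc66540ea491,
    0x53461fcc2e344ad9d00c0effb285324a2ceab009d2c0f2d00f9f82cb17af397dc1b5ff1ccc7c2a5212]),
  ([1, 2, 6, 2, 3, 3, 2, 1], [(1, 15), (6, 14)], [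
    0x119771ca33864b8ce54a077b9b427d575662b8acce83de7caf0d89e8eb0417374809e01b49e59341915c29681c81,
    0x187222623099fec6610d309087177a018319c5dfabe3a9e40a90cd2fdf0d132660e9809fd6b06695d1a7a0cdc527,
    0xded3e24a4517eca5b7b5ab38d74a23f1a7ad23797ddf41954488eb986fbd670e3cb4a9bc720f2ada9c91a8951ce4,
    0x7c8a90fc989fa260f71ee57900175bae75fc7e06720616802549685f166f5c8fb4e9bc99151069b2c900f15cf8fb,
    0xb889682e651005d3b16b2f4df4df0071a106ea9dcf5cde916bf065e29c742c340936b7548689f1139138fc66a490,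
    0x1dd84e7abda86ed7de8dc8baf98420bfa1627a74320a4144072b7fa2c5fc6bd0eeec0a978bda87bc78c1bf724d70,
    0x3ca608685a849ed8e4fdd08c3c2992afae554a33bad54b289395e1315b9352c55be4b9b6f89148c3b85580f6324b,
    0x5eed7176b18725b0563fa5be038fa7d76e928faaedb2cfd76d34552fd4b536676ea8f51d042222e8cf678f5c12d5,
    0x8d5dcba602f8f081f6d7824938d382f083d5699c4c65c5015d1054b38e693e1948b2ce9deb305a40dcd46db82840,
    0x4f557196e8e4114980e06816c59bb17d33ef572b0b135d4f085294855d6d93a08b4883f88286e2eb633761a91c00,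
    0x5a74c27d92de0b7f57]),
  ([1, 2, 5, 5, 5, 4, 3, 2, 1], [(1, 15), (2, 14)], [
    0xfb338dad8ba20417d8aafc0832b8f61ebb9167eb79fc33e79c074e41093c9e37e219026eee83a2a4396c6dd263ad,
    0x4e9f3a91b7d0134c188e039019343234de728e7d262d4ce497ea2f90351af4779a3ec9232b960ee894d6812a6a72,
    0xb685f21e515d142c42d6913cebe79dccfa759642859ecf4a0f3f66b344374f19c8104d483958413346722b3fce6b,
    0x3cf2c5f7a434f42770faec5ced0d6f039996845fe5f36cb62eb0ae66e724ba61ddf5769111daa15ae72e074bd519,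
    0xa9c1c36428a8957289928fafc3ea2c21a4e72db3fe36ca42533b381ae5c23aea67a70c03280a70541597f46cc19e,
    0x1e205d5b0c3ac61e8ff29e8436b30802d0d0b216819f5bc3cec7788bb322bb37744db55951ddd84a765801ab777d,
    0xb3c61645908c0695b78adb1ac7bdb5fccae60c0db6f01a69db578c2c63f7801425099ffee36c108b7efe8498882b,
    0xa6772185b0c27298371cf9ef337e628623e57983c20df9519cadcc6ff4b71d2ec5b44937c33d12989ceb996bb4a3,
    0xd1703835503138d58a2115eef0113c47d92ab863916ec4b1a6ba0f64930667f91d64fdfe15b7dfec0523a44b7947,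
    0x3755e3a23fc31a6aea867ce05a0b60542b1687ea946bd6dd33376b7cf44f08a2ff62d5843cbeaf4b7b75e096ec98,
    0x36eb37be3c536efafc093baf6d61d1b36650f23651ca1fcc0b0cca76615be9b70f0a1ba7b45ef3e252acc0187175,
    0xaf6de283908cb40acbfb8338adb8e2e602bc8e14183d3057fb60c99af9cd03491cb8d5eed887a2e5c9cd602acf7c,
    0xfd4ad5b4727b726117af8068572ee6d26bb00d71084478898356b6407cd384298f465b3d3b63d5b36182de28ed79,
    0x8473fa7eb03a9c01146a0bc80f80f867f66e943fe565c7145550e54b455f77fa4fb05a689621c6e6ff30d94d8e63,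
    0x247b6de4cc2232b4df7308e0905eed2]),
  ([1, 1, 2, 3, 4, 4, 3, 2, 1], [(1, 15), (2, 14)], [
    0x72f531691e266c938c9b20f9aeb6e75758aeaf4ac3b7d8c5fcd7bfd47716fabd3b73b88e0495749844f4c2244e8f,
    0x60d7b42ef8e28a084cdd97dad42acd42085381c89c34d8151ace2b531819217f05a47adf11ad939fa80fe96f3b92,
    0xd6d4742f6c5114348383d9747eeab1448889056e3b348c8ad070f101d9968b21aa743f0de978930602a9dd333c39,
    0xcd2df0ea6b824c155d9d80415b71e490570b51ec44b67e3e68ad5367d4cc36c049a33f97fb35374db1033eb34587,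
    0x6368c6000c2418b7782bbd033a8197ea09d32fbeeb358777d48c2c9c411a387680785200e7f4f74bd9bc355bf439,
    0x65e196c52df0e6a8f9154a8223ffc4b884c60dd60ab9a3121accb50a25370462c79970c06fd7001ad24cc0d84642,
    0x243530ba71abc66894cf3ade947011842225745dc18eb80c1447cea42dd695bb106e509b8ebbfa12fc082b8fec8e,
    0xa5b3037ce6152826af2f046dd0c345a7f894ecfe8588eccc26e364c8e35c79472e47bf016fa601f9e73095682080,
    0x77c8910a0436be5d0076a1e08f4de8acbdd099c7426044e9a9e73e681e46b54a5d43cc073e8ad61ad405b390761b,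
    0xb0cb6e66b717488d8e8ead2e5be4e3aa56c7195c6a8889680de3db167f212cd2dbd71825fc331bae84bd2cced44b,
    0x56ce8940abe82686402c0df4031bc43eb2daeb09a66e816c93e95661210de09de62178c169fd6ab43530ad08bd9e,
    0x9a7f49e9a018148cc546794e2bf47bbcdc3101f35faf0ca7915dbfae36ba242f24fd4ba8ab24da788f859ac7c77a,
    0x5f9cf312f3d0329dad0e25e332dad8461f4c84ad63938373c467b80660532c708e6de5df77bca7a81225c7084327,
    0x30a92578fe50051723c18506046614114d3fb18c05c3f80f820a442f4926a164ae9212d33be0a1c2fc33e3fd3a4b,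
    0x2d644aee6091151f407ed7523f63f1546b0d2178ffc8a7e26a4f9e2b19e16fd834e391c4c66723f2759c35e0a00f,
    0x5a51d2b088af2189042ced0c960a0d06f5e1aafa80a1f6b77406e81ec8dbba2f0c2600c18ede2c2a34aebe6badc7,
    0xfefbb39c30f9240c03d9af5409a2bac64924813cd53b72e8b5307825a12471ba0f0628f3818fa6ce25590ac6b1cb,
    0x34fe53ee45aece614a338ec2cb9bf77710df0fcb06e76911ad4b48d056d761f2bc11ad4b8889610ac4ba391d5d60,
    0x63c3048042c2ca7fd96b4cbb9147730ee99f43a3a8d44492789c52a9e6d1fef93251b3f1080f1]),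
  ([1, 1, 2, 4, 4, 4, 3, 2, 1], [(1, 15), (2, 14)], [
    0x1704048e1e6feced0613889753fc9574b19c5f05980a750f6eecffa39d068f2277d956bc84434c967a1bcec49b1f,
    0xbebceb9ce66920a80de72f12a8be5dd3a66f084ee04ece384a771e54c15ae31d8e250b50078482f4a3ca9406496,
    0xdaad7b28e235f18495a23ca8766608744ea167952c459e247467a402bac70a85e1f478a9246f75fd4c2e413106dd,
    0x470eaa22151c3c4adcf0e0b975afb1f716a2b1203301448de8e5bbebf7e75732baf773d567950811567fc8bffa2c,
    0xac350907ac9c77237c4188bd729e6a74da4918177a7f5ab9c9168588b631229f208a7c2ccf244530b4dde409e072,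
    0x81f6144b1a0cf4ba84b9ec1954e93906a938ff7233fae3c13311f98f76c6e024073f49f6bdf0b6968f484149a92d,
    0x9231deeaa9068fc1d6aa8a653f444a58a25b95b5999a4517cc3d0cce766ecfdc277d781f290bcfae92fa7d50d471,
    0x981a5f395421f53529530b1d96a9a7bc09143b099c52346a7f418d659e0676abd12702e59ef0181e6cd6c25f9e41,
    0x5c25296827f0d8eddb823faca455d28195fb49384bac4a60265ca2848df3accfc9b15ad37892a50b92e96ea5cf0b,
    0xcb3d683629af6ce18a6c52a186cf51849905d1e5b0121afd14bfc3e74fab86583bfa7ca36879851648822360c6b0,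
    0xa32eb62fa226d07d7d711301f19613cf248635b54ab795a0b15260c6ba5fd570bedf5747acd9ba0cb9b9d273156e,
    0x3db1dedb5bc1682c08a357cdc67aca951e1f12a1c90b00f37189ce06873d51d97455c2aa674a2c6040e3a3320a5a,
    0x51c0c895f3f9040c691a2f8fd89d9a80b2508cfb1041ae75481fc9837def5ce647a2be1febf3685c3bc9d1ec29c6,
    0xd3467d3de77f58843cc4981a2d753cf841feb59ea544b278d510942d3602616341f68f840ea90aa6dd8b24791b85,
    0xc5755df40a5e8308497a0530a973c27a29deaf0943620ee986f762346b7340e199cc6b42a7bcf90767f800e0da27,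
    0x1fdf41fb3065b58074026362ae89296780a25b736faf6b1bcce6eed3405129e7b0c474cfb596ee1970076f60cd15,
    0xe1fb3d747122224f3b9e2b7fa7947afcfe155c3a599f5add4207f3d335c7ad761de106ab66c8e9e2c935f665630e,
    0xf998c4c58244602b330c16f7b9d8474431d5a3ae0837b95f7d4cd3153654a48de7cf0e1651134e4bec95942b9960,
    0xc26458e4f05b9f24bb9f2850dbbef7112d3102d66cb10af6a899e1f53777d9a2be681fc42664ec44cddb2314f379,
    0x69c46af823de26a26e3969ec990f77a99330921290dd180fe5e4829695fc81f5af1c050505519360f5f8055c10f7,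
    0x57bc7e5de29706b12e747ce7aff6bd84e0db05693a5512f73f67787e55a0ce6f9b797bbc93118f8c7d620f34184a,
    0x4d799befdd0f4a15ef1f91aca6071616a06d6ea9f6bef1c606a36274fe541c53585fc8d2fc25ff70cf8ad9d47829,
    0x3b2a399fc98f7bc8164aa88bd7449eb8319ec143d55b739a3f20e2d2711872b8b1b881901467dc80303df9d197eb,
    0x4c4f91434b03319a300d088125cbdac10a3f09322eb740b101b1076ff29c27207b16eb5d8680a5ff8b6154b20dd9,
    0x17b5b1f2549586f411c273b196eb48397c089b58e3d213af9afba43dd5dd8e50c876b7e0a3e963f001567e2de01c,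
    0x83f68c9b23a1bb3cdb0f7dbb3024b9283fbd32b6d3e8b34a0fecdd2b137aaef7c85925a4349bac78cb05d9727a85,
    0xe287e24adafb6e59fcaf6380b9c7e8adf8daabf737030d211135986ed53f196fc866c3d6ff9659cf8369912b34e9,
    0x63b1b4a73b7bf61502e87fd4d0882c3b2007b6ba005362b0c00ffb0351f63d39782e9a3e49b237f2687c2dca5231,
    0x9661eaf056598306efce6f9b6697192fdb1ee7bef1657e059e3eded503708f3e933da48b71d2d569d64fefd5fe19,
    0x4c1c9a935a615ab4195bb8cabc41b04cc337fce42183fe3ac8f3f2729674d2bb8649df768ae20905deb8be42d3a0,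
    0x8ae41f8d31c1f907e6ebcc38bb8feffb5328639d5c04f6f4d8ff4a36cd0ea6dfaf6489aca3c2dba5ce3eb3fb0cba,
    0x96de9d646fb5ae0776aabcc315dfedebfada219617f394d45f16fd4c118e57d59d4c9a8b5a688854ec3f2d93033,
    0x2d5a5e860cc3402e65c7e3966a7095893f1739b5f6f97025fd7b695a313e46506bd7382a82c3f5f6e9119b328d06,
    0x88ebe3445ac07d592f72632279aebc42364ac0077d49f7da]),
  ([1, 7, 7, 1, 2, 3, 3, 2, 1], [(1, 15), (2, 14)], [
    0xe8874152b52d463e0158c450947e78b5cbdf1e79da9491c87ad38ff0c88017fff4f332376408f3b96bc40aff7703,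
    0xf9ec2dc14afb83511a844c1ae8a38f12df69ffc727b33fbe815928ed3ba212b2f708c6022436fcd5550daf3e393d,
    0x193093aab2fb631c10335a0de856f6303ca6ad7538c9edb08a074963a8ce05883eac70a66d50cbbb55b3f5756683,
    0xe3c14c281d0de1e35558c1a598bc89b347074059c11ae1cd3ef82e4f4dd74f170d164e91d68d9b486b22f35f382e,
    0xda16ca3156ece7343c786d2ab0f894f479e006ef0c02df14ddd90c7266cf24e23302774df9a7b924306c68ebccf,
    0xf2f83310e75b0be63355f75dce015c830fdcc0041ededecb7899c2d1a375b2712d21dad72af821176544e6355dee,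
    0x52d89c634d31a224bcc2fe06fb6c69ca778f28ef2a15c53efebfe56bdd5c0afd20baaa0627c6f03b52c17386df8c,
    0xe6da26c46cbe1f0a6a510dd9d5862ebebb587f122138b9efd252b2f2a0a46c66d72bbcd919f68029413c50040874,
    0xa4cc58879b38543f66a6ef426f4129967ac1649f71e457e33b217c3f6f000f62f6ce661897a6152e8d36773e925a,
    0xced484fae7882149f7947c8bee150bd388cea94a02a1380ef0c13ca883203d16ab37c93f0431e54b799177646f5f,
    0x6d33ee2d0f177d0f7ee0400666c66a94fc91406558731fb0be0be1aedc213a14e3c8dea32c15f298062d6d09e40,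
    0x2befe51bebd25ce304e67f0aa7c075f3a16b84550f81cd071f8a8f791e97392391597bed8be1f5121ebd37041814,
    0xa2e08131c8dde8738806738d8d2e89d2156bf2c7f383db142e4c609aa5f250e6d72360d468be4edb5b7bbf7ee527,
    0xd3ee198e3bda6ab265f6c322c722e5f60abaf16b5532ccd29bfcb65acc9e715aa7f6b4db5b1dd495c08ad56239d,
    0xc225c5084c5b6a8f1f8418afa0b6da82f7c6b946a8f0d7ee2016401aaa02807061866e54cd630adbe623d856b56b,
    0xad7dd822cd5cbf84a4a92c342bab349c52c4ac4df34959188d426caa95162383cd5926787cc07fffb427fa4de8a4,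
    0xb996144f9f23ade5e2acf441194e9a0d5388f63a2d99427f2b736fa230f4fc457f36a841d950994904f3c161b1b4,
    0x612a4cf37f6303578045fa80d5152106d5a51acec64f37444982cd59161d2e0577fbf8a923fd5ad3ee489aa4237,
    0x5b04ca0f638b636684f7b02618226c07d2d38b82b9aba518cf163b8608ed21a34b7f677f0364ead2d51cf512e71,
    0x62aae82a5b0d6623828b5e058c461d46bfb3fecb26506aec2dcfb315ee0f917a4253252221b1ce8b216179ebfb52,
    0x8ca56e01bbbcb604ff7438838ae8e29afb115669853954b13752594bca15b5a5beca24be9b01ef17ccea7d53f37b,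
    0xc7b72bfa8f5effd3f504b45859bd1c6a4a8002b5cca74e6d694ae02b3a569fbf6d940d7dac5846cf83d98d1c71af,
    0x185cc5773c6c1870370751f9501e6c9ac5c]),
  ([1, 1, 3, 5, 5, 4, 3, 2, 1], [(1, 15), (3, 14)], [
    0x182be4467ea27588d37f0ab0e622bef33e203aea028fb18b0b71021d232b3ad41252cb5b45bc2135c34186928f29,
    0x89a98308f2553610b23a49578941917e489c302c0ad22645e183f810566a5bfd3c7907729349f6a131cef18ba9db,
    0x65a91b8a930c8a377a4e744600825039d6c6309050fec30672bd18343c51261ac21a955b4849e4290625f9c75fdb,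
    0xd5f33d5f8aa2e600e1df965a4622e57a90ca55ab372eb5524d878b97acf71c8467ece53bb320001cace0cd95ad33,
    0xf8037c151e12ee4269d654b7b87a9d04461b8ce2c14025d3a5651f611523da5990339f8991644004fb4f2840818d,
    0x62145a537ffd975a8c60d65530ca604d805fafc69395a9828c719054f9d7a6a203cea498504d9b40653fabd3f3fc,
    0x7c6ff00b0ba1b2f48b60b33a08c73c2e1be547696e4c2171d83c09d6fd9358345134090a587bd02a749d3d5cd5e6,
    0x6f059432e4722da481cbddb357b22a572548354001a0fa0ed7075ea41b67368da52e8d94b1906a1e9ceecc6aa8a,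
    0xa2fe81c758969d93bbbe74f52e43321a33335a01c43f794bc09d1d8d6257c5d04c7f4a227ff8626dcb2d573f7aa5,
    0x75d9a2a30b035f50ad01659d1c03ceda60ceb3cc5e0a74db9192e2a3bc424cd9903ac8ae421a42e202fffdc85e1d,
    0x1f54121fbca287f]),
  ([1, 1, 2, 3, 4, 4, 3, 2, 1], [(1, 15), (3, 14)], [
    0xc9b1db69ae450a77c66ac44b82ad8fc6863ebbeeb696eb899aa9a53b82f1dc1479948f723b9ee3561d0e0f35fac7,
    0x8f52e5c68d174150d3103f7fb2a0f54fc44d34fd47bf6cb69934f0f8cce76f681cc77a30cca98ef1370569f0f62e,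
    0x86b48b825181445475cfaedcaede5006396fb82d6c0295c6ba07d79a96429d2861260f35fbd4e7e17b4e76cb50ab,
    0x8973de564a2dac207d8ad791d222edcbafa23d635e509cdf3ec7682fc143083a5e57e9b12193a5d7b20ac00856e,
    0x63c2c6bc8db29059f50741a9565b9424a5d627e38264fbc3b757c47a13119cb64a908538a7925cbc7ed01089d473,
    0x12cf06457905c2b9e33e543f5c9579f9d8d23338adfe9e12b4782ab622f039b0f7257a810e82abaf4a7f1c68039c,
    0x30fae81f56335b94e507e623d4e71839fb78d187c4e847aff33229f8d77ef25dcca164e08980c5c0d8be5ddd037f,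
    0x19621a96741352c43b60ac1e7d0e5649c51fd8bd1291455dd6941353d536fa459b6be1fc7b2429ffb64931ece40d,
    0xf074ba38c58bba6a4239f1b38dbdab215d365b033456e574a8578b8c773a09c9996a837d977da15c76294617d35f,
    0x4eb9987acdcbd51737ce6f42a5f4a5b8bcb4c2ec8ed350c464bba5dc56da01dd743bb821057cc8a7dbd876bfff29,
    0x129ec69f21dfc0ea743c41a3120f42c6a100064a4fd56e5e757fd48b752064e1b669def23aadd149d53606ef563f,
    0x61fec549a76f0486a34a4686596c0b7dcab19aa5a776564ceb624e243a7f959f3b29898328e2d9b48795aea00eaa,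
    0x177a1b979697ae6b8973d2617fb757e116591a8d3a6f18a26bff31bea67dc761122035c2894d199f99ecdf782848,
    0x9c6b1a876d0a3e0a45c8080d0cfe70e54f2b68198c5886441e1c04a1e07a75eb617ac04b29071dc2c41f1077e1ef,
    0x6ea3eaf22fcb56b1dc63b7f3760b1dacd5132919c7449b9efe2545ba7a2013aa57fc5928eb99cf74247414c992d2,
    0x9ffe1d5092eeafbe2398e86a424d89a31064b71be252d08579e342b94b44d4abf636b054022ea4e201e24913af67,
    0xef2e026f34bcd75fd1d88529590826529ea7667362c647ebc44302a29f27a59901b40a8c466c6cc31b3e33f72929,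
    0x51995c3f22d55d85b9687f032454d251fd2323978660a636d97af6729fa2fe82c568ed30b5ed978516946b45feb4,
    0x538666fc0835d67331346f6279141ca77873237b29a2268625adb1ddee2c65db24b7dc0a9bc285abad7163953f6f,
    0xccc883610aa52e91794c9697be6d585e8ea7aa91fd91f66e2206d6853ffa3a35cde1c9f6b5ac5dd1cba19a83ea1f,
    0x9bb6c26278d700458c4e7828d992bc04e59a6af57faaf7255d1d2811e37d991d523778f1ec2460eebf745888c65,
    0xb294f1ba03069d315ccfabd340e474aae04231276f3e9b5d23574df6d0c08159e532a26a207e3a8c7259531675d7,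
    0x874264bfccacc45395e4281a22d10821c9fc6d48ee3ece25d91c719b5ca90f9cdefa768935bae65e236dd0f80371,
    0xeb0d4ab488809ee184e13dad9f72fb6d03efe66659b7934729830931dcae6cf1cedbb14a4c623e077310db36b964,
    0x9d6ac7503b63090f890b8bc16f6101db0966f843e21353fbdeed714d1638c420a6290ca53704904be0438b068e3e,
    0xeb3aed83ea3a8a18de7884588105460684544de0b6071235f0a13c651d5e4fd0c9fd2b656b73cdc9be3f87cad933,
    0x147eb210f908aab4cea81176c808af45e978d777d2bab70cb323928150a72920691279698b16b233360759ef5e42,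
    0x80e302c1406126ce7904792ecaec3ce52df2be]),
  ([1, 1, 6, 6, 2, 3, 3, 2, 1], [(1, 15), (3, 14)], [
    0xf5ad1ac921d462919a7447d50b0419ceb97e1bce07c1c15bc36fd2f98d38e8c7530b6d26cff83db9d9369f32c08b,
    0xf0f799c6e9fe245ed5af2e7048460e9ca415df333091dc9619df79a4e3dce8b55e8f0b9d844bb836e7564153149c,
    0xe3f49467b2efa7188bf940a1760eed4db562b8fb30e499be1ab6c197af90daa0d42aba8306793f2d8380a368527e,
    0xf6bbca48c09df0c861b31f5112b0bdb6011d3327af137b176d166eccfc813252ed29fa9ff9100be2465ff2084bb1,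
    0x7b3a774474a9fc2b3218aada6eb1b66d73a59fe5a71c4d32d30c7327beb41a31a8e69b92e34c98dffa3ee8e7e6d4,
    0x1ee949831341a8720011cf4120cb198d1c38ae0c197fa12ce9e4a21a5cb2281c76464018fed94a54b8c2008a4f7c,
    0x98e65959b3dd5873f66b5aa47700e1c51c593ffdcd44979f5306c24f2ad41a91cc2871bf5fcab00796404129b3a3,
    0xf80ac7be0a8e761d4ba9f925281fd97166248582ac3b6f01aca15cd0de995fffef97d09962f7661bf2fa6e5a9b2b,
    0x834a93d53dbb6cae02959c58e0258e8d91d42b4181506b0c56da3ff33ea6ef2aaa80b0ab0068b4cbadc1ca981834,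
    0xca12e06c47514af935e6d788ea7bd27e8dbb0b91ac698f2f24403860330893a0342c5274e0c9b95c7163de67cbda,
    0xf11ff3a94d81800574bc15b64fac0d921e5e5f3098031b12aceec3c5de9aeeba6eecf4d8a5b548cab4eae3e76f7e,
    0x40962342da7078189796b3fabba7e79e9106ee549e764ec5e24ea1eec549003537e90cd0854d098902212efa0431,
    0x10a60c8b7035de99c9b526a24bfbc22ca057bd36629a488280509ef18933ef4bf0a597ae278e5cb16461f4d19b65,
    0x7b7a4bdf9937f0111cd0caa8086d92cf8c1db1c8db6442f913300871e8804d321e9443758b4b76427843896c0eb1,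
    0x2c6827981a8745baeace07a4ce0694d50befe6f238b379f33737fcc6dd3d905f993d43f11f9e1c8dafda964cfb29,
    0x85832f4c9751d3352e27017d1233f2810448a367c47030e0fea85def1a0f29405b020ee5ed6f65318260814c56bc,
    0xde8b4dec57424e6fe91df2e9703a929aeef812855d7fe94c88daf70e5b087f9e5a7e357ecd82044daf44e42fd63b,
    0x5e12c83142496563d39a17b7048a57717c48554046d4937c757fed062bf6a011df3098c3a7d89b89034ef947c3e0,
    0x28fe55ccd36959a76dd2a57e0e18c42a874114da9688a91009cc8065ae41506681b39bbad049c9370e007b3732b5,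
    0xc8fe5b36e90da5277f2da8eeed200a96722c8634fcf39aa6e2bf0ac248ef2c76da27aa631e827718bb6f73ec8f06,
    0x87accc83f9a1182fce8b36eaba1988f35b6ea15ac4a11881438ec7ea47fde7096dab8f8f36a85bb2ce3f5c26b65a,
    0x6758763654ad1b60ba7fc54c4234465323dbd1ff6690f503d3c810f050b1e355636eb87739bf2fc49ed70cc1d319,
    0xe93560dda812562f699aa41906a0dffe87f4bca9670c2e1d6aeae0f8c8843ab0268999a9656cf084d1f12752fe41,
    0xcc01a6de9466947c5a5c7eaff1d1d375840d45db7221c5c736650d401b94446f3a411a29a180f1ccf55f58a20f16,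
    0xb6f5338b083a9e05ff3e5494c062dd0d5dfb9cfd89c82aca5431c2b802357d79e28da49b08b1880a37d862004799,
    0xfbc1dda9ea10b1e5e00a76c0e8bbc87f8e18dce8efc46d25698a4b4014a573e13a780d853eb2101d4b79c79086ce,
    0xa8d6abee2e83de93517afbbb6f4b7e991123b55e266991d0ae25563bba9852366720e075136f967e151fd7af20e7,
    0x83eaa7f4ef7f82658cb8967ded299e3c030a27e512f2c54954451a613283f1d23d806e5d77de1e43072d74bf74db,
    0x9010c4c0ed8673f37debb12954e7e0c5e2cecd2556b7c968e44a49aa6c371435f0dc9d6c1ed4a2d7668cd6336047,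
    0x42ee8c68a17486c74f1854cf14c73e90f8e012d9829b5b82d72ba19f336ff095e2f00a3a06027be743c4b9f1f3fd,
    0xdfb88f752cd893a07470037ade8d40288a483fccdb353544a46f299862cfacf3464cccf23453db2d1f50bf26c7a4,
    0x9b6d7d9e51b9a90098ad736374b581a9cb7c56053fc9652bc1895f9ac802a6c6bbc1987d915219cbd5ac73603eb8,
    0xaf018bdb545bf0f381627d352092ab875d29702ff191742e441cd7028aa08655c287688421084899448703b809f4,
    0xb4c303edfb869485e23889c494d13fe5117ebece5df021ce1fd94dfe1c19e563b7772f01c0fdc2952e2119226522,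
    0xe8445ff8388051346d5861e63a73d1f58ead2ee82ac3e1217241a7585e4cdeb82a660fe4d448c8fa085ea0823032,
    0xa2fa9edf99f0f0a9bba35f88315261c38912329b7b85c2e00c2a869691993ae4e2af998940246bfa33ce8e1c068e,
    0x131786a2251bcaae532414dda26f41da70b014b2afc939f5d8ec632be864b73a7a10169baf3321f62cfc79f806c1,
    0x988de1bcc083c2b3577d0e7cc74a77953c4e7b3c7cf1b2598af91bbba7c41514022392d3d430ae5cd1e21cfded86,
    0xf607b1ab20b2d2021da2a0388d9fb2f62b7f1c8f7b9fb1962d4495f46330fbe76c4b90e6c7111bbd75a857998ae7,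
    0x775d67d9aef5cfb2142abbcfe2a5146625eab29e1500fb074486b256bc0fde64e29b484d65242f46c2f6a6378958,
    0x3f125d0d8a50bdce99166ff86ebe12a3627a2de238c735380d3b9f02a9ece55d2f6c75c65d377a5277d096c3ea95,
    0xd768b5a0e462e935b43323d3db1d13ae7aa51111e1494a515f70f8b1c7e76a2dd514fb06fe38176cb1d284682906,
    0xf2f726493f46835e3c4e70202592f6f2b76bc565a2c9892469987875e01016a4f42e8b86f1dd22062b7cf01a6ab7,
    0xa725661b7150838945f7c8f95e70024fe26468bacfcf19ee94750de41b4d9d984045b2938c70cc8d3ccb822e1cc2,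
    0x1171740a5801c49846d576f7a6f15ee017d308cefdd3e1b7beaed669adab29fb00ca059bc7ad6c8ac3cfcda120e0,
    0x294d530cc661d13c3bf8e7580178bf8ecd8b35a6f5c93c49443d21a5463e330c435189be161f9b65d0c6e815b390,
    0x2b2b1e01383d0cd3b08e022eac4583ca3835b1f3b2953cdef6c6779df6f78126966d76751aadeb12d52b9c09aecc,
    0xaa5ae414a2b28e5d3cc10a921313cfc17bdc1eee57b3d921e38d659f87337c7e2e11d75ae66739621bb167e0862f,
    0x1d1b1fb85876f20ae7]),
  ([1, 2, 6, 6, 2, 3, 3, 2, 1], [(1, 15), (3, 14)], [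
    0x9b4e9788d671cef84b667be50a76450ab9f625888fc3b7b893c7532b2bbc0bf9ca395f322fdb02ddde7c0ec2c5f1,
    0xd5db9dd0769bb58f7d96ef02997608eb5772c0c1bb3c64bdc87f20853e9a4b78a7830c2fda8b11673797d87f10d4,
    0x78bd4ffa9d48ab074a94256fa4bbaf91832da5c79ec049f8ff67a07efa7b742f3b41bc7b7cc0bb2d3b9ce41f9d7a,
    0x58d14a8e91d4e0f8e11f113032b9c4f98c044aae6834da7a11a570748a95a99d5e6d4ffb6bc82291c01c322e02cf,
    0x167895461d29136fa647238a19dabf8411a8aadb64cff7fd9935d82f8a23659f522c71b6ed5a91f24437d069c2ef,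
    0x85ef818afa4893cc17c6a6b1d9c493247d66967d844a653cf62bc87977261b2bf216173be6fd8a82efebb5fb20a0,
    0x94e89e10097c059451915d8e4a115e35d475e309dca5c1750d4e6cb7cbfcda1e9b5d41d69597187c3bc0e05e4b2c,
    0xfcaca5a71e5efc932fa5463a01699edcace24b1bf0b1acb32156c5adc8e36bc7ebcda890208aef5619b07b2e90f2,
    0x7d5f5b41783f5d9065ab175eb2892148cd03fbf5cbd87213d7550c2600a748d764816a89eeef5b945b8bffcd42b3,
    0x951bae2240ccfc637f576abd7a18de4ea1de0890392706c7c5aa0069fec4dbd9d2df157ff34392d2285d1a8923e8,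
    0x8c1aefbfe5f2e86679fa2c7b2560aac56714d16b2c32a15aee359ec4ebd08b306dffb2fee7ee62c7f309c8c45391,
    0xe911c36d28de84f587a91c2f87b7bfa2abf0a119edd718b8091bec94e8630671a0bf7fb3765a0d46d638f17a24c7,
    0x8b074bb9c61531318c6559559d8515f95c575f59f5f34a40cf12bc0e342e3b8fb5101ca5dec7f9618a2acae1bc5a,
    0x5a3bc41d96b17fd5c7f883905a9eed6c17cac8581901225948f21c16128319807be339a9f5fce2f507cfc7d48490,
    0xcaa7cda9d55df3b735b3b1fae3a058a53f780d2a03677368a27abc293b6d8f5a839f91f1e1cb70356af55748ca37,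
    0x2584a198cd873bb0c39ca2fb1f8e0bdf54baa4a01dfaa7ceaa7059b4828fa2a1df5333cdf486c33b5a7cf34cfbda,
    0xc9f1a2258c7af183c28386fe614bc84242f017e83638c5e94141929c53bc05a74cf21761b56f3a4af30089503f17,
    0x24420b35a784fc1336ccd7c88306e350b08d51adc1a5e6002e767e23f19f1de139a34b33b05fb17895433878356b,
    0x10f16ef7104db919a61d146ae3b13ca34638e9427b008fdaa9ee6ea97cd03f8010ed3a18d88bd92c812aaf14299a,
    0xb5eb3bb47c8358491a9b7890da792f1e945c1391a0c8b2dd2be22bad419d87e039c2821a720a9fc620762a48b5b8,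
    0x68daab71f5a95d5e71ffec475adbe7535e861fee75b4fa6774c13515f3a66f13ef3fc28479452a768132c94c6b54,
    0x6f440a786da99fe98cebd87e42da3c42455c2b3c6dc0c2a59c24c9ac19d856ab3f57cc19e999b1b468d8568a280f,
    0xec7b4678074341112f9c132f2fb196d0be856813d4216339ae2074888183770de8d5aa45eb351f533a0c468d9cce,
    0xb51ec850bd51348acc751e862dbd2411e0a59166fa225485b411e753c97129c263f290e1dab467d6d0fe40066567,
    0x8331997ce8a6a2fb588be35bfab4aa8be56f4e23e4c0d2307ec87ae16aa4302e3d2013a3e4738dfb70cb7b503b12,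
    0x8d8eea3a931b32e9bfa60d19deb9448932e893d16abadcdb71e6eff0996eb4f48a040fa2949022c6b7048ee2bbc,
    0xbe12d94f79f77d7f79129b4d9c6ba3ebabd3df95c3eb3130d1a6c36940373c954cfeddd3f4b52b221c7cbe1fcc14,
    0xabcdb67e57a385da719b203afef6c5fab10cd94318346ed5daf1a8b6cf4f97c4410fcf03708c96974e75ad164526,
    0xc77d6360ad48da113ebbe4c2d23f378f19fed1d229c9577b074abe15d2e21443211fb757ee029ce59fe4c2092bb7,
    0x2b78d610f08d0514b50f8af92659c88846ff751dcce944f60229eeb4ce4bd8a553c66a8a15ba1f9b4751aeeb7a6b,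
    0xe722c8dc7a1ebe3f427ac2ca179c98d3cba891d7ebebee968adc2e40a405ceb7a285c7df78d306b4946228cdd670,
    0xf981adba6f07d2104a2ea0999e1f55d34842ecc4a14f9f180309f6d4762870ab21d9bef8246be4dc4dffbf8068b6,
    0x114a29b4c64aa1dd26e2146ce326435233e8532d4a0ce62d54b719f74df0cea090e75a40d92b6eef2548648fee1c,
    0x584bcbba253a9b5ba1483da9c06f2825337cfaa6d34bbfe39d9c10012d617408fb1aca92f2da51178ec63b3421ba,
    0xee9fc712255fbb4169277e9d9dea075c2c05bfceab86d5276d4c90074f6b2ca57448a0c2ed8070fe17d43e94eefe,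
    0x104c75f691a9c4d85dc4d9bfcb9457909a0263cb23d1d0cba8fb082dfa62bab3d988f9e2d50cc9749775294bcaf,
    0x9ff67ce5f95c684a49378653afd072f1297ff967ef9d5a514d9fdcc2ab77a7c0399e24272fa6cedcc6902bc3632f,
    0xc44980e321ccee0a823af0b4ea1634a521758ca51ce259a867f1befd203065e0ac29a512265de2949d27869db5e7,
    0x5cafbcc4fd0bdbaf19845649f9191037796143f118a99855143b1d9ea2161b488c25e000fabefa5872afc0224c04,
    0xffb0397c22f9f01918a7b6cee58f0e6e22739ca97f6a8a2fae5d440e51a180dccd756a62c27cc63a6e556e326e94,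
    0xa32805f30f88c28acd6bcbfb22d59f2fda656b9bbebbade315c51cb006a43da57560757899700ccc17170c8fb0fb,
    0x379c534d80f42f18c6adde995f7c0912976205b8680d1339e24cb529ab578f8160417a74c962d9edd67386f66ec0,
    0xc9bf0c02fd0e7e6dcc0a6335e302d085d5f2d2800285aa611347273d3615a8d91096d5b5d87626a20ff60f077daf,
    0xb0d5b80a523eff9d7b384706f952b83318a3fc7be55450613255467c50a0810761f73f9d0ac0c015c34cc6dab54f,
    0xe813f9f3e54c0ddea3c908e70100a36f6941ea3b9ca63339fbc47e8d50f53935365d89e3580d15b6e598b9de93b6,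
    0x908342351707b8223b46d795c513e284a924b78acd5c18628382d55d496025c5c3ee3b985a950a7324b4617cdcc4,
    0xe611e1514a880cce972ca0e01503db3a66713069407f5d6a55155f01c704006a9687822269017654ba53df7b1205,
    0x693d7d57e42edc2b1ca81eddca38eb38a4352e7e1be829d0373a3f07dc9b517f9eb322df791ed49d105bd9bb2cc0,
    0x848bdc6ba783b37868a2883ad5cc289c77f00768439fd75ded7413744e04dcd12deec0941169e38695a98fc8e733,
    0x65156ab7bb99cb1a04b29bf609957dc178b5ffa5a9ca91fc17657abfafb2f943d5e1fe5a01]),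
  ([1, 8, 2, 6, 2, 3, 3, 2, 1], [(1, 15), (3, 14)], [
    0x66f36c2d8efb8c2d8048363b0cf7016e2217336aec7cf8f323d975e5968241250c40a4330c091784528b7f5daa99,
    0xc30eda10a53019e5df22f29e6bb5ec54747f606908a1a8e00ff2a9c8212ef496417b4cfd5a7513e39447289fc496,
    0xa008ebd4ba97d0a3317f8533bee569a5de56150516e32e9fdfa305e5012fa2a3948b9edb86545160a0a7a8f5d5fc,
    0x7d3ee11c9863200cf44bb0e95fc1bfb4ef83e325fd1c40bed4b3bfaa2659c6c2350e1c256c2c86c8102c43fb9c34,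
    0x1b2f62e94edc0266638f65cf65c68e7384984099ab6cd62dc24e545be3032fcd1a9640079a169577ddf31c169bd9,
    0x1965fe6cc8cc08bfc1d0bfaa1315f8f3d14123e3f08d571deaeb5d6ceef53c955149c6dec3767bc497c580679fba,
    0xdbbec42f3774e10adee8407f1b08192aaf713a9cfb64df0913278c4ed8724a0796e530142320db7b093d125e7c0f,
    0x1732316d3df501c419baedc389ba0edb0437deabc5f2c3f6b43edc7be02afa1571384d3e6357f587b0e430fc7fe,
    0x6ecd4d9889d7fd05c3941f9cf910aaf2177c3194166eb22fb8e31af43f9958ae3b84d8bb8c0bcd4cd0620fdd76f8,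
    0xbceb674e1d2a633246d8656ac9c9645f590278478c0c763406f637ccc6be15c52e2d5a3e4c9cff78bc945c2c91e6,
    0x71b3abf74d4cc44ad447afe627bf9970e82ee317eff785f10915b3c44140970c31c6d7c54e8da043ecddd2c0ba98,
    0x7dea2c45b1fdb3dddf34e70c21586da8668b2040d919745f1e7a5afdb2038bb216483c67367bd38c3cff436ed227,
    0xc8f56e7d665851c1573af1634da12c14ab8fd267f666e00ea08f6db9d042c724322af19e94fc3eaec62ff3ff26a0,
    0x5cec32ce9d38d0e530ce00876df901b7c8ddf760e39291664812ebc2f65bf81b05e13b57709ef35478b543392625,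
    0xccf9f4a8c756376c6c519d50f45d4a0707cbb491472842ce972762901c7a09feb25156d2e3b7a6fab2470c743f80,
    0x739744db9a8f9463e41c469ea7f6847cb5c3ab0f359f66efe05aaced6cae5c168de8ff2c09e195af9ff7880d2039,
    0x687d881b7048b224ff3f2ef06802f2262597f2c39cc17ffa9807dffd44d6f4066460ea5615839e248942ba9ab2f4,
    0x5b1b2e6e3ea63b8d8eb42193b041750b5611c0d8e371ffa8b6086d52fc72b01024e2bf09d62c3f6d7dc20a4bdc46,
    0xab71b421fb99e7c952c61423d551066946814584975a26a5c1a80d17fdd4048ddbcd2bc9f71c9cd3ee65b318e740,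
    0x6a1f0080f717bfacdf7e635af3f2c359022622185ce3e2e112bf068431cdac49525a041bd5436af1291844c75089,
    0x12f768b98ac5aaae5edd7dee8410d7e590f1a43cf8881a41f3acf68177e0899b980658a3e1233513caf4d65d8ff2,
    0x9bda66d2b7c940e74d0a0f42dddc4a4b8805656cf842538ff34787e3114ce108d0985f9061b32709052e7fe25eeb,
    0x15883fbeeafbab056363a5b547fbba759db31f9fc5dd2eea1c374a32d88f09870119746df4906284b8a70fc40422,
    0x6c7616dea224fbf36fb05f2f103b435856b598a8d9217ae6006403ba963cf725d782e9085ae6f1f1adb29e84ed72,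
    0xac77a15239a40871134719631c95d5647ac5dd85ed0ba6b477bb68370af3f454f3b5717cf08a993b3bd9b029e924,
    0x2c45d44b35944c73da5210a24112ff54a815ea91f43b7753a9a52b812c99284cea791bfd4ad03eec2027391e536c,
    0x231e842527d3c311bbfaf1e0ff72447e88cdbcfcbfff792f84230748c6a]),
  ([1, 1, 2, 6, 2, 3, 3, 2, 1], [(1, 15), (3, 14)], [
    0x2e13c8c740fbb00a990683c78f2947c4ae50d541779049ce215bd7f39a218bc680da1b9501aa8f4e9965b49dff63,
    0x1a18aff9f68fce6ce7a95303fdf3f07e77aad3e531cafff9fb07d2c4ec78d5093b3dfc4f75a7c3b3d38c05a782a9,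
    0xf3b266dc4f84f5e031132d7b5e6a408229f7bbb77c18e762777851e9ab55a7643f754b3ec269f3e75633fcca0264,
    0xf2550f5a381e95a79f364f6de2152da626165d8088ac2b46f053f967a5ec0c29853e888f10b77faf106d8e8b6186,
    0xf6f2c5f9688e29d6a91686a7e63498f931625beda33815f05877a83f2fa5b6771faac999dc44f0252489e4e55e08,
    0x60ebf4c38fe385b336ceba0454036471413681dbf1b7db5c08867caa72791425c8960ea6c7221626c9119616df0c,
    0x8241cd4806b5eb0577b97b9bfecbf7c1c0fdd39595764bd269a9005646fe8b3ecfa0614929cdad1e8deb471dbc65,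
    0x5d80cb59051dea7047314293259caed5e10731839494ba238d3a4b3570e684e734d22b34d0fa196a3aeac7b6e8fa,
    0x8a40360d67689df6b9783261ed630d94864cb7fa47d98742e5603e9469ea10c70c50865271006bcd04a015b948eb,
    0x2d669815b4b984fbe7964a88a37825c47f1b76ba2be161f58bc21b8f72c6d20bb21c2060bd9b4756567aca388ab3,
    0x9b8eb5d1b6ad86c09f30972e57a8ce7e1a08379ae652be7b362dc1ad6a0526df0aeb98e39f437debf6c6cb1232f1,
    0xb0f634367c9ba208fdc66ab30da6d0df131567c3387c14a13d4a9cacc5d592de69c3fc840f27874002e91ae31071,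
    0x81a06a47eb63fbe33cc238a138166618024cbbff44b189e8e3c35f6c26d40056e7d8449495d997de76edee8d719e,
    0x27280a065e0a818543e4a46c3a16b54e63ac71d93100f1636c9a761786da286511a76965d29a8b2aec29089ed4b4,
    0xe68a22684aedba36647b49197142c601ebb31cf194a5dd6ba79803f2205425a3a18a64f98476160686ac9c32f7c4,
    0x966c354c379b5d984e13547843a567cf6dd2980b11c809b59aa19727deb846a3f5b52bf9c95acd4d88f16cf77779,
    0x722a6b15cdedf2d3f83ca94738d0198b71b6e65b0698074468ecd4e5e4b0332096a23bdbecd99ebbc49b4c8d7df,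
    0xb3ea62a736c0bd2fae3b6915c55bc02090ac917e3c28fd36c813c7269b98bfeafbf132ac34addc238bc786a23559,
    0x9c8c1098d7f9a02b87d1acd813cb462656e3e1a65f36be5835f86769f240c1c5a929ec413d055608f042530c1839,
    0x4cd52ab6c1192c3453c01a591c5af06ab0409a18a73883b38df7dc10c98671b831923cc79b0e7aa0c427e91774f,
    0xabaaa8ed323d2932dbb5de79f8f3e33362aecf4648a4edf5a78216748d87f56fa16e8ef40cb2093742560e9a5cfc,
    0x6d92d2cbf4717e0b34f124524e3bfb8b68d81d7bb1d6a740c1cf0c55dccd16febe99b94aedd5cc3520c18cb96226,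
    0x95293a23e308e5e9a164c3a9a02e8fbe1611afe13b51048105e3a2be36d02a255fc9bd7a950d1d6819bdd0ee46ec,
    0x5bd5801404282d1860682762f54cc47b67d8a35965bfd5ae6616962c70c5a83a690813f4374a7d60a7b3bdaef7b7,
    0xdba723f17d776b391971baa3728a47d4db071f7f20980ab5ac44ae336f0d357e7bf04b134d64c6f2f1490f84090b,
    0x5c5fcde575e73d56fb44239b64ff150eccd49f715b3a4a5bea260108dd25fcff15df115b5796591fb60505520407,
    0x772e5988ff049caf794ef2850f179a94d078b9eed93291bdf87beb82b666c3e26e15afac008774e72f5a96d32af9,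
    0x3f5d05fc36f6d1c587cf3c6906a9d96dd1be92f6c1612a77c7d7889aaac8143225957dd4b31ec5c7a72dfb733436,
    0x84abcf9b2d723ab3a31c0e9483ad7d5d3ebf01616cfd5c6f9bb3ff206276dbae1dbcb68d4615c096befcaa1979b4,
    0x5700c9feb1606bd9f04dd97450b7f29a8dbae88bc00ab8a9b636f44db57e2885b9dca352e6c92fbdfb8d394f2ec2,
    0x872d1b94073cd73af0d5083c89afc403fc4b34541e4bc03849cb8d18f9f3d0d54c78e30978dfcb43a3d0018ca0e7,
    0x492f0294208219cec63ab32b277349c00dcc0fae16bfd37f0db91bc0e951149526ae22b9b83660d8452a1851bec3,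
    0x92fe1955b2c75859228e8194ec09dbce5f7d32a83759f3377d0231520a498c9fa49edd7e8a0d8fa600de5b188a6,
    0xd812060e1ae6d75a72cbe08c1577192cd0ce3a86df494cbbf85f6884d0716b274e5dc671fdb633dffe192f1c114f,
    0xba7c398bead7d7a857eda0353e16001e6b1a2f4fce523dc59d8f6ce774ce021f4f682bb8fc0c442aa0ed1dcf5aa6,
    0x3c8db59a2a294657ae1fea7e68b80da0519f3a0cf76153d09a19ba5580ee5c6e22a621c2ca5932714dff66f2048,
    0x36d31a577f32c423c43a38900b45db81b2d68ac014874e6164134f263acef3e8b1283d0e165fc2dff07294560ebf,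
    0x800a5e707bc26ffe2806fc3625961e58026fdd654f03344f6a0e223824e13ba6627aa80c52fcb80a6575733c4a8e,
    0x66838c4019de56d327d352f313822c5e88c4403ba]),
  ([1, 1, 2, 3, 4, 4, 3, 2, 1], [(1, 15), (4, 14)], [
    0x52231a8fb40c6f9eadf21036fb3b707db5dcca254e3dcac372066048cada3f5c8def35018dc94d19147026ff2af9,
    0x9a403820dca7ec6d2748638db16cdf051dd1bf355783615165fb25c5193029854f56a948db43337551b224220149,
    0xd6aed6ccf7595f718cc5e9905bd888d6fb4a701c72d41ee1f9b4bcf9a70c5d521acdc542574247970348e3f52eb7,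
    0x22f3e44074364eb5783ee095c9d5a2a7692c6d7b67e492de067258a96efad3ed4a9a0c0a9b1a950747fb8378e94f,
    0xa0d0f16440567faad85d663e91de588e6725df0b7a59ed4869f27f6f071b15ff3f58ffad082eaa0a488003f7f571,
    0xcd0617dfb931fbbb850052fd8291f11af83001b1e9a1bcab32392f3752225b33235de4da791893677d9884055320,
    0x47de93da01cddac8a05dfb79e8c19756820aa3d56d35c4a6dd1e1142fbb7197e23165f2aab9b253e113be303df45,
    0x36eee2046028d1b26c0707d654c8938d2e7ae7658a387379b14e4d19f487b8ce4927dcb179d093399e7bfca44b59,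
    0x22f5bed4224a494e4c993cc8acf908701be61db49be643336e6575915af2f19050f8d74b3595eee18c224614fd6a,
    0xe99f9e5542552817249152641d69d7167fc681cf9d1baf405e0606f129f0390bcf15007c917cef3a4332e4f17488,
    0x4ab40a45461d981dc18987d7ab6daa58ff7b66810b8e0e65af26d4799c4fda04993f16ff887d283d17bcc85dc7c2,
    0x8a34669d2c9d5d9f0aedba1c280739270f842fe0e1ac95c065cfdfddfc1890fbbcbfa0370c7923ad3a4d3680fac5,
    0x7c55905dcbb32167bcd39da9663f295f99a27f238d7a1a129066b8ab22b87f5d82d4f9e93a9f1615a4443901b4b8,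
    0x148ea01a361c5865357962b8e0677596ac25c7c635758aca1e849e9b6d8faf96a2064f7764de677c5ba82fbc2432,
    0xa815f88bf422b9097f42f1da995f39e667f8e304881e82caaa74fe107fec9fed0ef21e4b9cd4911e89eccdaf688c,
    0xcf02f468d86e8c31d6eb3b2cc907af5cc2895edf247c05049432286758a44aa0f72b877912310e28953fca693cec,
    0x11c571f049ff8c3abd23c984af7d0d43b76fc17f3ca8cefc0e000f6ff26997a0ca81217aa3dc4edc58c03d2f2e9a,
    0x69aa69da4e47684a187a46a26045407d7b3c37a42d0f4c5f842c65a0604b4c4edc6430f7215005cf8bc542829d36,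
    0xd7b112f4299e4a65266187598102e62f8beaecd0162f05b69dd22d0b9b40467aaca76784923b974d3789f9c70ef1,
    0xb4593c391fdf34bd7b62af3bff7088b4427d1b05c0288c58dec197da4990efc3c6422b8e143abea9336cc38314f4,
    0x335954e94d72f0a39079495ec918f29d71faaf71c5ef5d42de3798d4b052cc78dcfcc346c9935128b71acba995fd,
    0x6eb226f4b7ca093f4371fe5050e8821909a1e391b94d4ed7106433356a37ca4cf0e01e788e226deaea5ec46d551d,
    0x1e201ae386944595762f7f0b528d9842062ac58424a4460120ec4774f4ebe174108d36764fa9bd79d92bfc743901,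
    0xf882c3b635e3e4a4b7800ca2a37d5845de158dd188a5ab0f829d0c02b2e5c8013216e7fefc065e43d7b270361f2f,
    0x9165ad7]),
  ([1, 7, 7, 2, 3, 4, 3, 2, 1], [(1, 15), (4, 14)], [
    0x77c43df26a27410f2fc410d119e9607791b058d017cd0570fb829291cb8567b678f7d14a8e37c4fd3e6919d97f89,
    0x6c62c9372d2cea521b1075439399735f65589e3a57ecfb776957693cebd9aa17c6b21a28cfa379362a546542b1ad,
    0x6dc78abd128fa31ef3a8374a457f75c545f450479ff8ff6514bbde5f1701e55d7327aa718ff8e9c7a141d9c1fe77,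
    0xc6771ed8591f2e3f4f343bb2919b709d01cb0635fa737f36d48a46d1e86bb49094c9fde6eb71a951878d69529486,
    0x534481a23a81e909abe469595175722e2149bf1bee17965cb47fa4af9ec95c00230041f3d21649449ce4e2d9bc76,
    0xa503828024ec6739736b3d8d3f41f450b358efe9f10328c2deb3ff8a326670318239f6a3aeafc370856e4da33be8,
    0x8fd21526ebe2edba6054cd148edbf001a8ccdc95a6f69ec4c661f282cd2c1f49e3f594dd83ee2edd4996bc29d75c,
    0x41419eb90fb2cdba1b4e80c29e48d2f17020c838215099970039ce07df966834b366f89efe2d8f8277ce319667b0,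
    0xfa46f5f50946d2b52f7ac125102266cebe9f760a96c8053c4fc3a36e43547ee5be7a8ba5d30037df9cc132c74976,
    0x3ed3841e1b9ef3ed712e376c634fee5a8112ca072f6a2de5127948c8806cf367c08ce451454432e589b668b0a62e,
    0x5c4907ccb59e71be4aadc65eab26d160ac07a891c709668e70afed5bba57e3bce6f572957a229ea0b9506e3c9452,
    0xa16bc034078e6cc8c915be248ad451f347ba8a094851425454b5a7772bdd57e1101bbbc8f11a5ab99d07135d3e14,
    0x4209de22c907d58d57d51c88ad90ded0f72859412858d4c53449a68d1d04cc9ac6ed34387f34923aca1b169e49ba,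
    0x4c23cb5640c1a206c198b67044329ff90980b1ac4b4925603bd1536d761766ef94326411e3d932cec6b02e3ad974,
    0x7b59dc76ae40e2e99ee10b4333fb259ad0965af2c98f56fa517597c6903e848edbc5e100f852bc26c4302c3cca74,
    0xc8356ca85ec2b6eb298929520f93829760c5abd26e3bd054769000fa9a8f7396424ca4222f4484a93b507db49b89,
    0x3251ccfd85cc86d]),
  ([1, 2, 7, 2, 4, 4, 3, 2, 1], [(1, 15), (7, 14)], [
    0xe61ba849751a7029fc01ac86bde17a7e34f8bfaa923b49aaf9377462a752f5bfb2c752046cfb46ed80260d0cc49d,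
    0x928dcdb5f0de73460a54050c288a9183d34ecabb1f42ac09c96b604db5ce910f8e662ce8efe8945507984e1ce77f,
    0xafed6f869e3c5a791754910a669fc958ec4c7fb2a231b8b479a53fa8cb0db9bd5488544c32aee546d38acae9b2d3,
    0x5a3462691fd5ea9fabc4af45bcfd92f1f64d32f203c57bb633e4392a676f594e6bca394f2957df8d0d4f98e30286,
    0xb6db198dd634a8a33a234c52d32969f7d40ee30b52f08d14927a70e32f404ecfa781e8a1808ccf418260bae81458,
    0x4542e53590438f75f401b6f60616455fe791c77cbab4c60807a70971582d692d9823b95d8755a4a558b4dffbd1ad,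
    0x8cfda46126728ca0fd2b80d4d877e7be462561edc2abb0343708b071b3cdde0ea2b17f91e6c66b02f16231adbb47,
    0x330e0daace87b3469eb398854b54a876a372a2e0cfedcef13193666ab7a0f100428df2e98c6707eea94a184c4231,
    0x8b946bd779fbd28d4f874340561af6c57e0bf37f6eb906fe077e4a06cc014b69957a2b30907716bd3a65cf9514a2,
    0xa5e156899e4fd4da337568ced2ad2840be93703b5f6c68887f92e36b13e0b2bb390e756b3eb07bf7000260d6d878,
    0x74d3a0ff6e3243b80c017b4acf2bf1f76a7382a30ce0bae3072598d1c0c5cede7faf444586e18bc01c11c1ecbce7,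
    0x6ee70e09e5a8983ef346c6d88d6ba5ebaf72c25a268d9a88890616310a027b308f71cd253ad0ec038265a0d4f0ac,
    0x67b0afb582f649bfba4dae8f92129e2cdbafe0410d075276545036937318c7031329dcd9179c62da6ace19b5ff0d,
    0xbe858f056107ad6afb3e0c92528e95803c68df890d1d63801775cc0670b44e23e660ab911cf153f59eb8a4dc95c3,
    0x6d31428bdc59634cc83b8557c454ea4eeea1f7d87f19c0f411b3a573196337d1eeb8c85ec8ca1f2fb72c2cf0e036,
    0xf4b7b57fa9508064a3b97fb12ed117102b0d1862ace2420ed4e39904b7c69dc6e02e2be7d684f3d600600ae30033,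
    0x5e7c0b41396d2cc5f4e92af385b8e7d899967e9382a51b23a1f5449b9faba8f5]),
  ([1, 8, 2, 6, 2, 3, 3, 2, 1], [(1, 15), (6, 14)], [
    0x7b78792ba30c18f760a4e617c99cae7c6ab3210436a0760c7ac590bdafe0dcfd16a5037ba439b78106d50760138d,
    0x1151d79eeceee1c842dd824d347ed75dcea4857e27304047ef83cba1e76e85a45c50d091f41b2cc82c8ec78123c6,
    0x793ecac9ec10b10ad386ccb224b2e1fc80259da5de8534feb38a4f720cc13e0fff3baf71695b25ce7108bc305620,
    0x7799ef5cc89b2742cc24cb462743ac144bd8119845933ca058da772288d73cd6574c5f1a54478b88e071a6b13dd4,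
    0x697d8edbf8d92463122c1c49c20a0d955a4025b5c9132a210a9ca337fa6905b536dc1ecb5f40af68ca8fa603b62a,
    0x2b2af7619735e5191261683ff3b23a9a2f52d670eaf8300096e0cafd2bf036095de5f76486deca7f50df5773e52,
    0xf6a77579aff23bc298659bf6de2cccb1eead121a33bef89287dc6061bfc7e0f922504b46811985bdadf9125eb343,
    0xad4167ea52d3efd6f276821ce264fa5996f8df3e106bb0a94b4c485e21ddadef01cfa14b88b81770b4fa5b85bad2,
    0xad8190aeaf00d1cb154de910fc8f8ce432db3663e5620b71af9837480529d5f913a5403bcbae34ebd87ed8f8457b,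
    0x839f1e7d03faea2b986f3f309ce0d3a037b3804b92f970c42bfbe44d1d43476696f6419cd4515664453f81521e2c,
    0xc1d8885f4766a8afe4ff7f2aa26c136399362810a4f99fda2c98d90cb22c9bdcf85aa0fa6a9d8bd2347dca49c134,
    0xfd9d3711d4a8f4794a9b6ad906a0cca118bd14d2a139987ad64cc141b71f87257baa8210b72a2728c89ed6008e55,
    0x56028c2bfa16726723305cd7ef8b7e996b75a5834033e700f0e2442cf67e4b1c5f2ed97de3b2de63faf709b71de4,
    0xf7c9ed9eaa205e62c483b1b9ccb80440b286995850b4763e79878c6de844ec80298061fe3111a6a19e7b801157ae,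
    0x93b728526dc2714be6318669991942405753d14fa5719cee3dd567c4f17b46db1749debfa8f33a5a991514eda5d2,
    0x2dd3f3a59e36a033521dbf11b31fe55185266a7fd6be8438d898ea328e1d52203c6efbf0ce8f4c980a806e93c5ea,
    0xa3d55f431116da4694239729112380ca312337665883d3e214fc80396228dbfd011db4aefbafa4c7f1b21c824e7c,
    0x72b69bb63928a185b0a9f27024681a7729586aea267d5a87a06118790ef0485d854dafafc7902bd90d76c4c2dfaf,
    0xddc07be173c0903ca85934e769b09d8d0b617ff41231576c2a13daaaabcf5a103078738cec49c2a3d6e8a9980be9,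
    0x8897a45ee658ca590d96a7fb95cd6c25839b97165c7b98c7431bc7c8916469f450c44e6f41c1aad513fb91c8b2ad,
    0x57af5b87bfd553cf393679ddcc7f90301a4decc705df612a824a2ebe5833ed8f606e301a9da1d667d0773e5d54ab,
    0x63975d946c4ec25c9821ed5019266ae1845316289c596b28e1fb2d73f6c3259fce1af2b8b93dede5655903807bfb,
    0xfd75a9974c2fc721cc72e14e00614807a4b2b55d42b4b8cfe9412a38c7638b2f66e5450dc333fbf7c2836eb08e73,
    0x354166aa0ba1b4d5566e627a33b2def87303989875c3bb57addd7f90e07297fa8fd84c610a031fe2a5e857e9dff8,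
    0xdf0abb0fe2fa857e9ca1ee271632398461f3a13aae5927a96bfdc804ed6312d8793839e5980e4dd6a0a6ba8ea26e,
    0xd3d6155f478fc422d18e9553fdc9af9f68ec27007a13d6327c2a9359c70c996c3985e8f3e7efbcd0550ae9ea6702,
    0x31980855b57a3d3f00ca3829d585785dc1871762c84faa42a34e43aa44a1b9f49c9d90f6f9032d39d75d6b0738b3,
    0xc0a0c37c0ac793eda760137baf3170641107c110af7bb14e310aff03ed03bf36e91])]

/-- The trees with 1 vertices: how to `draw` them, and for `checkLeaf` at each vertex. -/
def trees1 : List (ℕ × List ℕ) := [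
  (0, [0x42000])]

/-- The trees with 2 vertices: how to `draw` them, and for `checkLeaf` at each vertex. -/
def trees2 : List (ℕ × List ℕ) := [
  (0x100, [0x624000, 0x642000])]

/-- The trees with 3 vertices: how to `draw` them, and for `checkLeaf` at each vertex. -/
def trees3 : List (ℕ × List ℕ) := [
  (4, [0x2864000, 0x8642001, 0x8642000])]

/-- The trees with 4 vertices: how to `draw` them, and for `checkLeaf` at each vertex. -/
def trees4 : List (ℕ × List ℕ) := [
  (6, [0x2a864000, 0xa8642001, 0xa2468001, 0xa8642000]), (0x1204, [0x8a246001, 0xa8624002,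
  0x8a642001, 0x86a42001])]

/-- The trees with 5 vertices: how to `draw` them, and for `checkLeaf` at each vertex. -/
def trees5 : List (ℕ × List ℕ) := [
  (0xd, [0x2ca864000, 0xca8642001, 0x2ca468002, 0xc2468a001, 0xca8642000]), (0xa, [0x82ca46002,
  0xca6428003, 0xac8642004, 0xac8642001, 0xca8642002]), (0xc6144101, [0, 0x6ca842003, 0x6ca482003,
  0x6c4a82003, 0x64ca82003])]

/-- The trees with 6 vertices: how to `draw` them, and for `checkLeaf` at each vertex. -/
def trees6 : List (ℕ × List ℕ) := [
  (0x16, [0xeca8642000, 0xce2468a001, 0xe2468ac002, 0xeca8642002, 0xca8642e001, 0xca8642e000]),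
  (0xf, [0xce2468a002, 0xeca8642004, 0xec2468a006, 0xae8642c007, 0xec2468a001, 0xca2468e002]),
  (0x10, [0xeca8642003, 0xeca6428005, 0xc24a86e006, 0x2ca468e002, 0xca8246e006, 0x246ca8e002]),
  (0xc4107, [0, 0xce86a24008, 0xaec2864004, 0xce8a642005, 0xcea8642005, 0xcae8642005]), (0x13,
  [0x2eca864006, 0xe8ca246008, 0xec8642a008, 0x2ce468a006, 0x2c4e68a006, 0x24ca86e006])]

/-- The trees with 7 vertices: how to `draw` them, and for `checkLeaf` at each vertex. -/
def trees7 : List (ℕ × List ℕ) := [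
  (0x20, [0x10eca8642001, 0xed02468a002, 0xf0ca8642003, 0xf0ca8642002, 0x10ce2468a001,
  0xf0ca8642000, 0xed02468a000]), (0x28, [0x102eca86400e, 0xed02468a00b, 0x2b0ec468008,
  0x10eca8642005, 0xd0ea8642002, 0xd0ae8642002, 0xcb0e2468001]), (0x2a, [0x10eca8642002,
  0x10eca864200b, 0x10eca8642009, 0xed02468a006, 0x102ec468a008, 0xcea86430003, 0x10e2468ac004]),
  (0x24, [0xcb0e246800a, 0x10eca8642007, 0xc30ea86400a, 0xc30ea864004, 0xc2a90e6400a,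
  0xc2a90e64004, 0xcb0e2468004]), (0x29, [0x10eca8642006, 0, 0xecb0246800d, 0x10eca864200f,
  0xf0c2468a005, 0x10e2a864c006, 0x102ea864c006]), (0x3114107, [0, 0xd024ea8600c, 0xaf02c864006,
  0x90ca6e24007, 0xd0a8e24600c, 0xae86d024006, 0xca870e24007]), (0x21, [0xa30ec468008,
  0x10eca8642010, 0x10eca864200c, 0xcea8643000d, 0xd0ea8642009, 0xd0ae8642009, 0x10eca864200a]),
  (0x40, [0xec30a86400f, 0xf02ca864010, 0xf0ac246800f, 0xd02ea86400b, 0xd02ae86400b, 0xceb0246800b,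
  0xcaf0246800b]), (0x221e, [0x10eca8642011, 0, 0x30cae46800c, 0x30ca4e6800c, 0x10ce2a86400d,
  0x10c2ea86400d, 0x24cb0e6800c])]

/-- The trees with 8 vertices: how to `draw` them, and for `checkLeaf` at each vertex. -/
def trees8 : List (ℕ × List ℕ) := [
  (0x4f, [0x1230eca864001, 0x10f22468ac002, 0x10f22468ac003, 0x112eca8642003, 0x112eca8642002,
  0x1302468ace001, 0x112eca8642000, 0x10f22468ac000]), (0x120, [0x130ce2468a006, 0xf30ca864200b,
  0xf30ca864200f, 0x10ed22468a016, 0xf30ca864201c, 0x1122eca864001, 0xf0d22468a002,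
  0xed122468a002]), (0x48, [0xed122468a016, 0x112eca8642010, 0x112eca864200c, 0x12cf02468a007,
  0x12cf02468a00b, 0xf30ca8642003, 0x12f0ca8642004, 0x1230eca864002]), (0x49, [0x130eca864200f,
  0xed122468a00c, 0xf2ca86430008, 0xf30ca864200c, 0x12cf02468a00f, 0x12f02468ac003,
  0x112eca8642005, 0x1230eca864003]), (0x4c, [0x130eca8642005, 0x1122a864ce00d, 0x12cb08642e009,
  0x10ed22468a00e, 0xd0ea86432011, 0xf302468ac004, 0x10eca8643200d, 0xca92246f0005]), (0x437,
  [0x12f0ca864201e, 0x10f2ca8642018, 0xd2b0e2468015, 0, 0x112ce2468a007, 0x112c2e468a007,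
  0xf230ca864006, 0x102d2e468a007]), (0x129, [0x130eca8642012, 0, 0xd12ea8642013, 0xd30ea8642017,
  0xd12ea8642007, 0xcf2b08642009, 0xceb308642009, 0x130eca8642008]), (0x223a, [0xb08ed2246014, 0,
  0xb12ec8642014, 0x112eca8642009, 0xb1286ec42014, 0x112e86ca42009, 0x1128cae246009,
  0x10f2ca864200a]), (0x4b, [0x130eca864200d, 0xf302a864c012, 0x12a870e24c019, 0x12ca90246e01b,
  0xd302a864e00b, 0x130e2a864c015, 0xcea92247000c, 0xcae92247000c]), (0x46, [0x130eca864200c,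
  0xad30e2468019, 0x12eca86430013, 0x12cf02468a013, 0xb2c8642f0019, 0x12f02468ac00c,
  0xf0ca8643200e, 0xed122468a00e]), (0x58, [0xb230ec46800d, 0x12eca8643001d, 0x10eca86432014,
  0x12cb0e246801f, 0x12ed02468a00e, 0x12ec30468a00e, 0xa873024ce01d, 0xa870ec43200d]), (0x47,
  [0x130eca8642010, 0xed122468a018, 0xcb30e2468019, 0x10cf22468a017, 0xd2ea8643001b,
  0xd2ea8643000f, 0x10cf22468a011, 0x122eca8650010]), (0x1321, [0xaed302468012, 0x12eca86430022, 0,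
  0xd2ea86430020, 0xb2ec86430013, 0xb2e8c6430013, 0xf0ca86432014, 0xed0a86432014]), (0x60,
  [0xa8d30e24601a, 0x130eca8642020, 0, 0x10ad2e2468013, 0x10ad22e468013, 0x10ac32e468013,
  0xc8b30e24601f, 0xa8d30e246015]), (0x52, [0x130eca8642016, 0xed302468a01e, 0xed302468a01b,
  0xf2ca8643001b, 0xf2ca8643001e, 0x12f02468ac016, 0x12e30468ac016, 0x122eca8650016]), (0x1429,
  [0x12d0ea8642017, 0, 0xcb308642e01a, 0xcb308642e021, 0x130ec2468a018, 0x12d02a864e017,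
  0x12c30a864e017, 0x122ed0468a018]), (0x4a, [0x112ca8642e019, 0x130ca8642e01a, 0xf2ca86430022,
  0x12ad0e246801a, 0x10ad2e2468019, 0x10acf22468019, 0xf2ca8643001d, 0x10eca86432019]), (0xc621e,
  [0, 0, 0x10d2a8e246020, 0x10d2a82e46020, 0x112ce2a864020, 0x112c2ea864020, 0x10c2a92e46020,
  0x102d2ea864020])]

/-- The trees with 9 vertices: how to `draw` them, and for `checkLeaf` at each vertex. -/
def trees9 : List (ℕ × List ℕ) := [
  (0x67, [0x15122468ace001, 0x1350eca8642002, 0x10f522468ac003, 0x1134eca8642005, 0x114eca86432003,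
  0x13142468ace002, 0x1530eca8642001, 0x15122468ace000, 0x1530eca8642000]), (0x63,
  [0x1530eca8642002, 0x15302468ace008, 0x11522468ace00e, 0x11522468ace015, 0x114eca86432020,
  0x11522468ace02e, 0x14d30e2468a038, 0x1342468acf0001, 0x1430eca8652002]), (0x65,
  [0x14f122468ac02e, 0x114eca86432021, 0x114eca86432016, 0x114eca8643200f, 0x14f122468ac009,
  0x1530eca864200e, 0xf50ca86432003, 0xd4ae246912004, 0x10f342468ac002]), (0x66, [0x1530eca8642020,
  0xed1522468a016, 0x112f4ca8642011, 0xf4ca86431200a, 0xf50ca8643200f, 0x1530eca8642015,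
  0x1530eca8642005, 0x114eca86432006, 0x1530eca8642003]), (0x20434, [0x1530eca8642022,
  0xd0f42468b2018, 0xecb4864312014, 0xf52d02468a00b, 0xd0f4a86432010, 0xd0f4a86432006,
  0x14cb2e24690004, 0xca950e6432010, 0xca950e6432006]), (0x14c, [0x14d0f22468a017, 0xa9530ec246012,
  0xae8753042c00c, 0xb1528642ce012, 0x1530eca8642017, 0x14d0f22468a006, 0x114eca86432013,
  0x14f30ca8642007, 0x1530eca8642006]), (0x9552c, [0xf52d02468a035, 0x130f4ca8642039,
  0xf530ca8642026, 0xf52d02468a01f, 0, 0x1350e2468ac009, 0x11522eca864008, 0x1342f0468ac009,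
  0x1234f0468ac009]), (0x225c, [0x1350eca864201a, 0, 0xf530ca864201d, 0xf530ca8642025,
  0x1350eca864203a, 0xf530ca8642009, 0x14f12ca864200b, 0xae8d53024600a, 0x1530eca864200b]),
  (0x20129, [0xa87530ec2401b, 0, 0xb0f528642c01b, 0x1530eca8642023, 0x14a8ed3024600a,
  0x8eca75304200c, 0x8ec6b5304200c, 0x14a8ed30246023, 0x1530eca864200a]), (0x8843a,
  [0x114af22864c01c, 0, 0xceb152864201e, 0xd2b50e8642024, 0x114b2ec864201c, 0x14ae930c24600c,
  0xeb4c87304200c, 0xceb152864200b, 0x1530eca864200d]), (0x80, [0xa930ed4246048, 0,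
  0xb530ec8642048, 0x10f52ca864200d, 0xb53086ec42048, 0x10f5286ca4200d, 0xb48730ec42048,
  0x10e8752ca4200d, 0x10952cae24600d]), (0x6b, [0x1530eca864201f, 0x1530eca864201a,
  0x114cf22468a027, 0x114cf22468a02c, 0x1530eca8642036, 0x134f02468ac00e, 0x10caf522468010,
  0xceb152246800f, 0xcaf152246800f]), (0x64, [0x14cf122468a02d, 0xf0cb528642028, 0x1512a8642ce01b,
  0x14cf122468a01d, 0x1530eca8642027, 0x1530eca8642011, 0xd4ea864312014, 0x1512a8642ce012,
  0x1530eca864200f]), (0x74, [0x130a874ec4203f, 0x1530eca864201c, 0xd530ea864202f,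
  0x1530eca8642033, 0x150ca92246e010, 0x14ea873024c03b, 0x94a650ec32012, 0x946a50ec32012,
  0x1530eca8642013]), (0x73, [0x1530eca8642029, 0x1530eca864203c, 0xead530246801e,
  0x12ad430e46802f, 0x108b52ec246012, 0x12ad0f4246802f, 0x108aed52246012, 0xc8b530e246019,
  0x152eca86430014]), (0x149, [0x152cf02468a026, 0xf4d122468a027, 0xf4ad302468023,
  0x114cf22468a02d, 0xf530ca8642037, 0x134f02468ac015, 0x114cf22468a017, 0xceb1522468016,
  0xcaf1522468016]), (0x69, [0x14cf122468a02c, 0x1530eca8642025, 0xd0eb528642028, 0x14cf122468a025,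
  0x1530eca864202c, 0x14cf122468a016, 0x114ce2468b2018, 0x102ed52a864018, 0x1530eca8642016]),
  (0x6f, [0x10f234a864c033, 0x1350eca8642024, 0x10aed522468029, 0x14aed302468034, 0x1430ed2a864018,
  0x1430f2ca864018, 0x112ed4a8642033, 0x130254ca86e017, 0x1230f4ca864017]), (0x7b,
  [0x1530eca864203d, 0, 0x12a94d0e246047, 0x12cb4f02468040, 0xd314ea864201a, 0x130f42a864c01c,
  0x130e34a864c01c, 0x8a7530ec2401b, 0x86b530ec2401b]), (0x225a, [0xb48d30e246047, 0,
  0x134f0a8642c03e, 0xd12f4a864202b, 0xd530ea864201d, 0xf530ca864203c, 0x14f12ca864201e,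
  0x114f2a8642c01b, 0x1530eca864201e]), (0x83, [0xa93430ec46046, 0, 0xd0f52a8642049,
  0xb0f52c864201e, 0xb0f528c64201e, 0x1152eca8642046, 0xb34870ec4201c, 0x1350eca8642048,
  0xa95230ec4601c]), (0x315b, [0, 0xf530ca864203d, 0x1152ce2468a02a, 0x12ecb502468030,
  0xd530ea864201f, 0xf4a8d3024603b, 0x13502eca86401d, 0x13430eca86401d, 0x12350eca86401d]), (0x81,
  [0x130f4ca8642036, 0x150f2ca864203a, 0xf314ca864202d, 0xf314ca864202c, 0x1152eca8642039,
  0xd50ea86432021, 0xd50ae86432021, 0x12d14e2468a022, 0xed1522468a020]), (0x78, [0xcb4f302468040,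
  0, 0x1530eca864202b, 0xf350ca8642045, 0xd350ea8642025, 0xd350ae8642025, 0x1152eca8642024,
  0x114f2ca8642024, 0x130ed4a8642023]), (0x71, [0x1530eca8642031, 0x1530eca8642045,
  0xe3152ca86402a, 0, 0x12cf502468a025, 0x12cf430468a025, 0x12ce350468a025, 0xead5302468034,
  0x102f52ca864026]), (0x75, [0x10f234ca86402b, 0x1530eca8642047, 0x15024f2ca8602a,
  0x14f02cb2864028, 0x14f02d2a864028, 0x14ca8330e4602f, 0xcea9152246032, 0x13024f4ca86027,
  0xeca9152246029]), (0x315e, [0, 0xf4a8d3024604a, 0x1350eca8642042, 0x352cf0468a02a,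
  0x352ce5068a02a, 0xf4a8d30246041, 0x130e34ca86402b, 0x1302f4ca86402b, 0x1230f4ca86402b]), (0x6e,
  [0xecb1522468031, 0x1152eca8642032, 0x1530eca8642040, 0xf314ca8642030, 0x134cf02468a02d,
  0x134ce30468a02d, 0x134a30ec468033, 0x1302f4ca86402c, 0x1230f4ca86402c]), (0x6d,
  [0x1530eca8642035, 0xf314ca8642036, 0x1152eca8642037, 0xf4d302468a036, 0x14ed302468a035,
  0x134f02468ac02e, 0x134e30468ac02e, 0x13034eca86402e, 0x12314eca86402e]), (0x7c,
  [0x14a8ed30246041, 0x12a9430ec46046, 0x1530eca8642041, 0xb3142c864e02f, 0xb31428c64e02f,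
  0x1152eca8642044, 0x1530eca864203f, 0xac94330e4602f, 0xa8d4330e4602f]), (0x72, [0x1530eca8642043,
  0x1152eca8642031, 0x1530eca8642030, 0, 0x112d4e2468a03a, 0x112d42e468a03a, 0x112c34e468a03a,
  0x15230eca864039, 0x14330eca864039]), (0x3161, [0, 0xeca9530246049, 0x134a8ed0246041,
  0x134a8ed024603b, 0x134a902ec46041, 0x134a902ec4603b, 0x13502eca86403c, 0x13430eca86403c,
  0x12350eca86403c]), (0x2260, [0x12f0d4a864204a, 0, 0, 0x94f12a642c03e, 0x94f126a42c03e,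
  0x94f072a42c03e, 0x14f12ca8642049, 0xae8d53024603d, 0x1530eca8642049]), (0xc6135, [0,
  0xd50f2a8642042, 0, 0x12ecb502468045, 0x12ecb430468045, 0x12eca350468045, 0x13502eca864045,
  0x13430eca864045, 0x12350eca864045]), (0x7f, [0x14a8ed3024604a, 0, 0x1530eca864204a,
  0x10a94d2e246047, 0x10a94cf2246047, 0x14a9230ec46046, 0x14a8330ec46046, 0x112f4ca8642047,
  0x10f34ca8642047])]

/-- The trees with 10 vertices: how to `draw` them, and for `checkLeaf` at each vertex. -/
def trees10 : List (ℕ × List ℕ) := [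
  (0x24156, [0x117522468ace002, 0x13750eca8642003, 0x116f522468ac005, 0x11536eca8642005,
  0x130f742468ac003, 0x112374eca864002, 0x172350eca864001, 0x1174eca86432000, 0x175122468ace001,
  0x17530eca8642000]), (0x767, [0x17530eca864207c, 0x12d6a8642f1405b, 0x117522468ace046,
  0x10f6ca86433402d, 0x10f6ca86433401b, 0x137142468ace012, 0x175122468ace009, 0x17134eca8642002,
  0x136350eca864001, 0x17530eca8642002]), (0x163, [0x17530eca8642012, 0x174f02468ad200a,
  0x116f22468ad4013, 0x116f22468ad401c, 0x1172eca8643402e, 0xf3174ca8642047, 0xd72a8642f1405b,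
  0x13702468acf4002, 0xceb75308642004, 0x17530eca8642003]), (0x2414e, [0x13750eca864202e,
  0x1174eca8643201e, 0xb0e9752642c015, 0xf74ca86431200b, 0xf23174ca864013, 0xf750ca8643201b,
  0x17530eca8642005, 0x1174eca86432006, 0x172314eca864046, 0x10ed3742468a003]), (0x92043a,
  [0xd752b0e2468014, 0x10ecb374864200c, 0xf7528cb024601a, 0xd75230ea86401f, 0xd7530a8246e014,
  0xd7530a8246e006, 0xd752b0e2468006, 0xf742d30468a030, 0xeca93746430048, 0x17530eca8642004]),
  (0x5c155, [0xf6d1522468a02d, 0xf3702468ad401c, 0x916aec24734015, 0xd6eb530864200d,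
  0x970b52642ce015, 0xf7314ca864201c, 0xed70a86433402d, 0xd6eb5308642007, 0x15730eca8642005,
  0x153702468ace005]), (0x2414c, [0xd750f22468a020, 0x117424ca86f2018, 0xecb0375246800e,
  0xe253174ca86016, 0x17530eca864201d, 0x16e2cb530864007, 0x1174eca86432017, 0xd74a8e24712008,
  0xca97530e24602f, 0x17530eca8642006]), (0x920344, [0x11752eca8642021, 0x10ca972246f4019,
  0x175308eca246010, 0x10ca9374e642019, 0x11752ce2468a021, 0x16ca8f530642008, 0x16ca94e24712008,
  0x1174f2ca8642019, 0x10e24d75268a021, 0x17530eca8642008]), (0x9964f, [0x13750eca864207b,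
  0x1174f22468ac056, 0x1174f22468ac05c, 0x11752eca8642037, 0x11752eca864202c, 0, 0x156f12ca864200a,
  0x1174f22468ac009, 0x15730eca864200a, 0x15370eca864200a]), (0x226c, [0x17530eca8642024, 0,
  0xf370ca8643402a, 0xf74d02468b2036, 0xd70f52a864205d, 0x15730eca8642057, 0x1174e2468ad200a,
  0x17134eca864200c, 0xae8d753024600b, 0x17530eca864200c]), (0x920129, [0xca870f75224027, 0,
  0x10ca92f74246025, 0x17530eca8642031, 0x16e24cb5308600d, 0x10ca8e37524600e, 0x10ca82f7524600e,
  0xb748ed30246033, 0xca877530e2405e, 0x17530eca864200b]), (0xa625c, [0x13750eca8642026, 0,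
  0xf7530ca864202b, 0xf7530ca8642034, 0x13750eca864205f, 0xf7530ca864200c, 0xd74eb30864200f,
  0x17034eca865200e, 0x13036eca8654026, 0x17530eca864200e]), (0x29a2243, [0xd752a8f0246028, 0,
  0x11752a8ce246029, 0xf530876ca24010, 0xd75308ae246011, 0x10eca8775224032, 0xd752a8f024600e,
  0xca8774f0252028, 0x10864ed7522a032, 0xca8774f025200e]), (0x298843a, [0x1174af22864c089, 0,
  0x90f72cb4642049, 0xd74b30e8642035, 0x1174b2ec8642089, 0x16cb0f528642011, 0x10cb68e35246011,
  0x13750eca864200f, 0x10ecb3748642089, 0x17530eca8642011]), (0x665, [0x17530eca864207a,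
  0xd36f02468b4058, 0xb16ce246934041, 0x10d6ea864334038, 0x156f122468ac024, 0x17530eca864202c,
  0x16f314ca8642013, 0x10d6ea864334014, 0x116f342468ac012, 0x17530eca8642013]), (0x24146,
  [0x1122ed74a864042, 0x1122ed74a864039, 0x12caf1742468025, 0x12caf174246802a, 0xd750ea86432038,
  0x170ea952642c015, 0xd74ea86431201a, 0x12250f74ca86016, 0xecb13742468059, 0x12250f74ca86013]),
  (0x24158, [0x112374eca864053, 0x117424ca86f204a, 0xecb75302468026, 0x1752eca86430061,
  0x162530f4ca86016, 0x1625314eca86016, 0xb74873024ce067, 0xb74870ec432017, 0xecb7530246807e,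
  0x17530eca8642014]), (0x58153, [0x1162ed52a864044, 0xd36f02468b4039, 0x10b6ec864334027,
  0x116acf522468027, 0xd730f4a8642039, 0x1036ce468b34044, 0x2d704a86f34018, 0x36c5152e68a018,
  0x116ea952642c015, 0x10f68ac24734015]), (0xa6159, [0xf03752ca864028, 0xaed30297464062,
  0x13750eca864203a, 0x1624ca9152e6018, 0xd7530ea8642023, 0x8cb746f302404b, 0xd0ea8737424052,
  0x330468f74ca016, 0x10eca8737424066, 0xca9225174e6019]), (0x2414b, [0x13750eca8642066,
  0xca90e375246029, 0x12a90ed74246066, 0x17530eca8642060, 0x16a90ed52246017, 0x1302ca974e64072,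
  0x172314eca864019, 0x172350eca864019, 0x16a90ed52246060, 0x17530eca8642017]), (0x920124,
  [0x11752eca8642063, 0x10ca8f75224602b, 0xd753024a86e04a, 0xd753024a86e018, 0xd7530a8246e04a,
  0xd7530a8246e018, 0x1730f4ca8642023, 0x137430eca86403c, 0x12a86d750e24045, 0x17530eca864201a]),
  (0x666, [0x17530eca8642071, 0x1174eca8643205a, 0xd16e2468b34044, 0xf74ca864312031,
  0xed70a864334038, 0x17530eca8642037, 0x16f314ca864201c, 0x1174eca8643201d, 0x16f50ca8643201b,
  0x17530eca864201c]), (0x24147, [0xd74f122468a042, 0xf30cb748642033, 0xf230d74a864039,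
  0x1702ed52a864036, 0x1174ace24692041, 0xd750ea8643201e, 0x1174ce2468b201f, 0x1122ed74a864020,
  0x16caf152246805a, 0x12250f74ca8601c]), (0x5414c, [0xd2b750e2468068, 0x12d70ea86434052,
  0x170f528642ac032, 0xb31748642ce03a, 0x10d6e2a86534055, 0x16d30f4a8642020, 0x1174eca86432060,
  0x170d52e2468a021, 0x15730eca864201d, 0x17530eca8642020]), (0x6554c, [0x13750eca8642020,
  0xf23750468ac053, 0x10cb74e86432034, 0x1174ed22468a03c, 0x1374ed02468a054, 0x1374cb08642e022,
  0xf22cb046956053, 0x137424ca86f0020, 0xca974e64312043, 0x17530eca864201f]), (0x2984736,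
  [0x117522eca86406f, 0x10eca975224606f, 0xb7530ec864204c, 0x12ca87750e24023, 0xb753086ec4204c,
  0x12ca870f7424023, 0xaec8775302404c, 0x13750eca8642023, 0xa86ed75302404c, 0x130f74ca8642023]),
  (0x226b, [0x17530eca8642064, 0, 0xf5730ca8642087, 0xf5730ca864206a, 0x15730eca8642092,
  0xf5730ca8642024, 0x16f314ca8642026, 0x17314eca8642025, 0x17350eca8642025, 0x17530eca8642026]),
  (0xc6159, [0, 0x12eca8717424065, 0x13750eca864203f, 0xb0f752c8642027, 0xd0f752a8642063,
  0xd2ea8717424088, 0xd0ea8737424075, 0xd2ea8717424025, 0x10e3752ca864028, 0x102f752ca864028]),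
  (0x2274, [0x17530eca8642085, 0, 0x12d6a870e254086, 0xd3570ea864206b, 0xcf7302a8654026,
  0xcf0a877524208a, 0xaf0c8775242028, 0xaf08c775242028, 0xac90e375246029, 0x17530eca8642089]),
  (0x226a, [0x17530eca8642087, 0, 0xf370ca86434065, 0xb70ed52864203d, 0x15730eca864204e,
  0xd370ea8643402a, 0xeb68d302474062, 0x17134eca864202b, 0x1714eca86432027, 0x17530eca864202b]),
  (0xa625a, [0xb748d30e246086, 0, 0x17528b0ec24608b, 0xb7512c8642e040, 0xd7530ea864202b,
  0xf7530ca864206f, 0xd0f2a974642049, 0x17034eca8652028, 0xa876d30e254086, 0x17530eca8642028]),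
  (0x316b, [0, 0x15730eca8642064, 0x1174cf22468a03b, 0x1174cf22468a04d, 0x15730eca8642076,
  0x1374f02468ac02c, 0xf6a8d530246061, 0x17314eca864202a, 0x17350eca864202a, 0x17530eca864202a]),
  (0x2166, [0x17530eca864205c, 0xd0eb7528642041, 0xf02d752a864044, 0x16cb530e246805e,
  0x12ed1742468a059, 0x15730eca8642071, 0x16ed1522468a02d, 0x16cb530e246802f, 0x17350eca864202e,
  0x17530eca864202e]), (0x24148, [0x1702ed52a86405d, 0xf74d122468a042, 0xf230d74a864042,
  0x1752cf02468a05d, 0x1374cf02468a058, 0xf7530ca864202e, 0x1374f0ca8642030, 0xd30af742468030,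
  0x1302ed74a864058, 0xecb1374246802e]), (0x2120434, [0x17530eca8642080, 0xed74b302468043,
  0xd374b0e2468045, 0xf374d02468a05f, 0x12f74d02468a07e, 0x12d74b0e246802f, 0x16f314ca8642030,
  0x12f02d74468a07e, 0x12d0eb74246802f, 0x17530eca8642030]), (0x1420129, [0x12d750ea8642075, 0,
  0xb30f748642c03f, 0xcb536e86430081, 0x16b30ed48642033, 0x150ed728642a032, 0x150ed368642a032,
  0x14f2370ca86407f, 0x15730eca8642031, 0x17530eca8642033]), (0x90, [0x171342ca864e06b, 0,
  0xd1374a8642e040, 0xf3174ca8642082, 0xd3174ea8642034, 0xd3174ae8642034, 0x17530eca864206b,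
  0xf56cb086432032, 0x17350eca8642035, 0xed75308642a032]), (0x2269, [0x17530eca864206a, 0,
  0xd70eb52864203d, 0xaf6c930643408d, 0x15730eca8642050, 0x1174ce2468b2036, 0xf370ca86434054,
  0x17134eca8642034, 0x12f0cb748642033, 0x17530eca8642034]), (0x95549, [0xf74d122468a069,
  0xf74d122468a04f, 0x16cb4e864312081, 0xf7530ca864203b, 0, 0x156d0f2a8642036, 0xf0d62a86534055,
  0x137430eca864037, 0x15730eca8642036, 0x15370eca8642036]), (0x564, [0x17530eca8642079,
  0x1172ed4a8642051, 0x17314a8642ce03f, 0x156cf122468a087, 0x17530eca864203b, 0x16d30f4a8642039,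
  0x2d704a86f3404a, 0x17314a8642ce03a, 0x16d50ea86432038, 0x17530eca8642039]), (0x2445a,
  [0x17234cf0468a051, 0x17530eca864203d, 0x12a970ec6434088, 0x17034ace469203d, 0xaed7308643403c,
  0xd752ea8643004b, 0xf74ad12246803c, 0x137430eca864039, 0x174b30ec8642051, 0x12256cf068b4039]),
  (0x3173, [0x1308b74ec24603e, 0xf30d74a8642093, 0x12a8d750e246040, 0x136ad430e468084,
  0x1128b74ec24603a, 0x136ad0f42468084, 0x1128aed7424603a, 0xea8d753024604c, 0x17350eca864203c,
  0x17530eca864203c]), (0x95546, [0x13750eca864203b, 0x156d0ea86432070, 0x174aec86431206e,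
  0xf734d02468a096, 0, 0x116eac24693403d, 0xf4b6c86431206c, 0x17314a8642ce03e, 0x1162ace4693403d,
  0x1036ace4693403d]), (0x2378, [0x14f370ca8642090, 0, 0xed6a9302474095, 0x14d36ea8643006e,
  0x14d16eb2864203d, 0x14d16f2a864203d, 0x16d134a8642e040, 0x16d152a8642e040, 0x10af7528642c03f,
  0x17530eca864206d]), (0x569, [0x17530eca864208e, 0x17530eca8642050, 0xf730d4a8642051,
  0x156cf122468a06a, 0x17530eca864204d, 0x16d30f4a8642042, 0x16f314ca8642053, 0x16d34ea86430043,
  0x1714ace24692041, 0x17530eca8642042]), (0x56a, [0x156cf122468a079, 0x17530eca864204e,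
  0x10d72ea86434075, 0xd730f4a8642051, 0x174cf122468a04f, 0x1316ce2468b4042, 0x10d72ea86434052,
  0x17314ca8642e045, 0x1714ce2468b2044, 0x1236cf0468b4042]), (0x66c, [0x156f122468ac07a,
  0x17530eca8642057, 0x10f72ca86434059, 0xf750ca8643205a, 0xf36d02468b4058, 0x174f122468ac056,
  0x16f314ca8642047, 0x16f34ca86430048, 0x156f122468ac046, 0x17530eca8642047]), (0x8f,
  [0x17530eca864207d, 0xd6a8730e254086, 0x116ca8f2247406d, 0x17530eca8642084, 0x162ca9152e6404a,
  0x16ea8753024c04c, 0x14ea8773024c06c, 0x16c946f3024a04b, 0x16d486f3024a04b, 0xa90ed374246066]),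
  (0x2379, [0xf0cb7522468099, 0x10f536ca8642070, 0x14d2b70e2468091, 0, 0x12f4d702468a04e,
  0x12f4d630468a04e, 0x12f4c370468a04e, 0x12f0374ca86404d, 0x12e3174ca86404d, 0x17530eca8642073]),
  (0x86, [0x17530eca8642099, 0x17530eca8642098, 0xf5316ca8642070, 0, 0x134cf702468a050,
  0x134cf630468a050, 0x134ce370468a050, 0x17314eca8642083, 0xceb1752246804f, 0xcaf1752246804f]),
  (0x85, [0x16caf1522468070, 0x17530eca8642090, 0x16caf1522468090, 0x17530eca8642070,
  0x1374cf02468a051, 0x1374ce30468a051, 0x156ac330e468084, 0x15302d6a864e084, 0x1302ed74a864051,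
  0x1230ed74a864051]), (0x2482, [0x17530eca864208f, 0x12d570ea864206b, 0xd7530ea8642084,
  0xed7302a8654083, 0x1316eca24694053, 0xf36ca902474073, 0x16d1342a864e052, 0x16d1522a864e052,
  0x15730eca8642060, 0x1236ecb04694053]), (0x317a, [0, 0xb30974ec24603e, 0x10ecb7522468082,
  0x12ecb7502468083, 0x170cae352468055, 0x12ecb0374468083, 0x170cb52e2468055, 0x17314eca8642054,
  0x17350eca8642054, 0x17530eca8642054]), (0x316d, [0, 0xf7314ca8642076, 0x11752eca8642069,
  0x130ed742468a077, 0x1570f2ca8642078, 0xf7530ca8642056, 0xf752d0a8642056, 0x137034eca864057,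
  0x136314eca864057, 0x123714eca864057]), (0x56b, [0x17530eca8642076, 0x17530eca8642092,
  0x1174cf22468a079, 0xf5730ca864208e, 0x10f752ca8642077, 0x16d30f4a8642058, 0x16f314ca864207e,
  0x16f350ca8642059, 0x16f530ca8642059, 0x17530eca8642058]), (0x88, [0x17530eca8642069,
  0xf4d1722468a079, 0x17530eca864207f, 0xf7314ca8642079, 0x16ed1522468a069, 0x156cf122468a05a,
  0x156cf302468a05a, 0x16cb530e2468068, 0x1512f6ca864205a, 0x1530f6ca864205a]), (0x868,
  [0x114ecb722468071, 0x1172254eca86071, 0x1172254eca8607a, 0x1730254eca8607b, 0x16ca87350e2405b,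
  0x16ca87530e2405b, 0x114ecb72246807a, 0x174ecb30246807b, 0x17350eca864205b, 0x17530eca864205b]),
  (0x84, [0x17530eca8642077, 0x17530eca8642074, 0x10cf7522468a04f, 0xf3174ca864204d, 0,
  0x114d6e2468b205d, 0x114d62e468b205d, 0x114c36e468b205d, 0x12d174e2468a080, 0xed17522468a05c]),
  (0x8855c, [0x13750eca8642092, 0, 0xf7530ca864204e, 0xf7530ca8642050, 0x116f52ca8642074,
  0x156d0f2a864205d, 0x16f314ca864205f, 0x136d14a8642e05e, 0x15730eca864205d, 0x17530eca864205f]),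
  (0x1320122, [0x17530eca864206c, 0xed7502a865208a, 0, 0x16b30ec94642062, 0x16b30ed48642062,
  0x1374f02a864c08c, 0x173034eca864072, 0x12f0374ca864073, 0x15730eca8642061, 0x17530eca8642062]),
  (0x2273, [0x12f0d74a8642093, 0, 0xb6f1528642c08b, 0xd12f74a864206d, 0x12b68ed02474062,
  0xd12ea97464206d, 0x12b6902ec474062, 0x17134eca864206f, 0x1714eca86432063, 0x17530eca864206f]),
  (0x317b, [0, 0, 0x15730eca8642096, 0x1370f4ca8642091, 0xd7314ea8642064, 0x10ca8e37524608a,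
  0x10ca82f7524608a, 0x17314eca8642065, 0x17350eca8642065, 0x17530eca8642065]), (0xc6262, [0, 0,
  0x12ae974d0246095, 0xb2f174c8642065, 0x156b0ed2864208b, 0x12ead0297464095, 0xaf2c8717424065,
  0x14b72870ec2408b, 0x15730eca864208b, 0x1536a870ec2408b]), (0x77c, [0x174a8ed3024608c,
  0x14b72870ec42085, 0x17530eca864208c, 0x16b0e873424c066, 0x16b0e875224c066, 0xcb748730e4207d,
  0x14b72870ec4208f, 0x16b34870ec42066, 0x16b52870ec42066, 0x17530eca8642067]), (0x2376,
  [0xf6cb1522468098, 0xf6cb1522468090, 0, 0x1752ad0e2468091, 0x170caf342468075, 0x170caf522468075,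
  0x152ca370e46806b, 0xd4eb172246806a, 0xd4af172246806a, 0x142cb370e46806b]), (0x237c,
  [0x17530eca864209a, 0x1370f42a864c094, 0, 0x130cb74e246806d, 0x130cb742e46806d,
  0x11752eca864209b, 0x15730eca864208c, 0x13570eca864206c, 0x13516eca864206c, 0x122cb750e46806d]),
  (0x314c123, [0, 0xf7530ca864209c, 0, 0x1356a8cf024606e, 0x1356a8d0e24606e, 0xf7530ca864209a,
  0x1374f0ca864206e, 0x13750eca864206e, 0x1350a8d6e24606e, 0x13156eca864206e]), (0x3172, [0,
  0x11752eca8642099, 0x10ecb7522468099, 0, 0x150ed722468a074, 0x150ed632468a074, 0x150ec372468a074,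
  0x157230eca864074, 0x156330eca864074, 0x143730eca864074]), (0x8a, [0x16a90ed5224609b,
  0x13750eca864209e, 0x17530eca864209b, 0xb7530ec864207d, 0xb7530e8c64207d, 0x1752a870ec4209b,
  0xb74c8730e4207d, 0xb748c730e4207d, 0xac930f7424607d, 0xa8d30f7424607d]), (0x2271,
  [0x15730eca8642098, 0, 0xd72f4a8643006e, 0, 0x12f6ca90643408d, 0x12f6cb08643408d,
  0x12f6d0a8643408d, 0x17134eca8642082, 0x1572eca86430081, 0x17530eca8642082]), (0x8b,
  [0x17530eca864209e, 0, 0x17530eca8642094, 0x116ca872e254086, 0x116ca86f2254086,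
  0x1752a870ec42094, 0x116d2e2a8654086, 0x116cf22a8654086, 0x13516eca864209d, 0xa950ed72246085]),
  (0x2275, [0xae974d30246095, 0, 0x16f4a8d30246096, 0xb3174ec8642088, 0xb3174e8c642088,
  0x16d30f4a8642086, 0xd6ea9152246090, 0xd4ea9172246087, 0x16f4a8d30246093, 0x17530eca8642086]),
  (0x8c, [0xa931436ec4609d, 0, 0x17530eca8642097, 0x1730eca94642049, 0x1730ecb48642049,
  0x17530eca864209d, 0xb374870ec42089, 0x174ed30a864209d, 0xb287750ec42089, 0xa975230ec46089]),
  (0xa6260, [0x1142f36a864c094, 0, 0, 0xf528b70c24608b, 0xf528b6d024608b, 0xf528ad7024608b,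
  0xf314d6a8642097, 0x17034eca865208a, 0x10ed536a8642094, 0x17530eca864208a]), (0x237f,
  [0x17530eca864209c, 0, 0, 0x16b30ec94642095, 0x16b30ed48642095, 0x1570f22a864c094,
  0x1570e32a864c094, 0xb748ed30246096, 0xb694ed30246096, 0x17530eca8642095])]

/-- The trees with 11 vertices: how to `draw` them, and for `checkLeaf` at each vertex. -/
def trees11 : List (ℕ × List ℕ) := [
  (0xa24156, [0x1197522468ace003, 0x139750eca8642005, 0x1152396eca864007, 0x130ed9742468a005,
  0x11225974eca86003, 0x11974eca86432002, 0x1952370eca864001, 0x11974eca86432000,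
  0x10ecb97522468002, 0x1970f522468ac001, 0x197530eca8642000]), (0x2860156, [0x197530eca8642114,
  0x119362468acf40db, 0x12cb88642f156095, 0x119362468acf4066, 0x10ed8a864335603c,
  0x10ed8a8643356023, 0x10ed8a8643356016, 0x196f4ca86431200b, 0x159730eca8642001,
  0xf0d8a8643356002, 0xed18a8643356002]), (0x28767, [0x197530eca86420db, 0x139750eca8642096,
  0xf2390468ad56067, 0x10cb8e864335603d, 0x10cb8e8643356024, 0x1375182468ace017,
  0x1975122468ace00c, 0x1596330eca864004, 0x18ed70a864334002, 0xecb908643356016,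
  0x197530eca8642003]), (0x28163, [0x197530eca8642017, 0x1974f02468ad200d, 0x1196f22468ad4019,
  0x1196f22468ad4026, 0x11972eca8643403f, 0x1196f22468ad4067, 0xd972a8642f14095,
  0x139702468acf4003, 0x10caf97522468006, 0xecb197522468023, 0x197530eca8642005]), (0x2892043a,
  [0xd9752b0e2468018, 0xf02475968ad200e, 0xf97528cb0246022, 0xd975230ea864027, 0xd97530a8246e018,
  0xd97530a8246e006, 0xd9752b0e2468006, 0x102469596acf2040, 0x10eca95966432069, 0x14eca93966430097,
  0x2468b596cf12004]), (0x1724155, [0xf8cb1752246803d, 0xf39702468ad4026, 0xb90e9752642c01c,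
  0xcf96a246913400f, 0xf923174ca864019, 0xed970a864334024, 0xed970a86433403c, 0xcf96a2469134008,
  0x1972314eca864066, 0x118ed3742468a005, 0x197530eca8642007]), (0xa2414c, [0xd9750f22468a02a,
  0x1197424ca86f2020, 0x10ecb23974468010, 0xf0255396ca8601a, 0x197530eca8642025, 0xf974ca246912008,
  0x11974eca8643201b, 0xd974a8e24712009, 0xf962cb530864041, 0xeca997530246068,
  0x197530eca8642006]), (0x28920434, [0x197530eca864203e, 0xd522590e68b6028, 0xe2469930ad5601d,
  0xf9752d02468a012, 0x118a876ec433401f, 0xf97530ca864200a, 0x18e2476ca9134008, 0xf974c330a86401d,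
  0xd96a950e6432028, 0x18e2476ca913403e, 0x197530eca8642008]), (0x28920344, [0x119752eca8642029,
  0x1152258ca86f601e, 0x1975308eca246013, 0x115224d96e68a01e, 0x119752ce2468a029,
  0x119752e2468ac00a, 0x1197522eca86400a, 0x11974f2ca8642021, 0xf3024d97468a02c, 0xca86539742f0042,
  0x197530eca8642009]), (0xc6167, [0, 0x1196f522468ac03b, 0x1196f522468ac04e, 0xf8cb75302468098,
  0xf96d5302468a088, 0x1196f522468ac0d9, 0x159730eca8642134, 0x1596f302468ac00b,
  0x179350eca864200c, 0x179530eca864200c, 0x175930eca864200c]), (0x266564f, [0x139750eca86420da,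
  0xf92370468ad4089, 0x11974f22468ac099, 0x119752eca864204d, 0x119752eca8642039, 0,
  0x14f9712ca864200e, 0x11974f22468ac00c, 0xd8a96e643134030, 0x179530eca864200d,
  0x197530eca864200e]), (0x28920129, [0xeca873197424036, 0, 0x12eca95196246031, 0x197530eca8642044,
  0xf9752ca2469000f, 0x12eca90397446010, 0x12eca83197446010, 0xf02478d752a804a, 0xeca87917522409a,
  0xeca87319742408b, 0x1024698f752ca00d]), (0xaa26c, [0x197530eca8642032, 0, 0xf974d02468b203a,
  0xf974d02468b204b, 0xd970f52a864209b, 0x159730eca864208c, 0x11974e2468ad200e, 0xd96eb5308642011,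
  0x192370eca8654010, 0x192370eca8654032, 0x197530eca8642010]), (0x28920437, [0x119752eca864209c,
  0xb53038ec4696046, 0x10ca8792e4356033, 0, 0x119752ce2468a012, 0x119752c2e468a012,
  0x18e2476ca913400f, 0x119742d2e468a033, 0xb96874ec4312046, 0x10e2478ca935609c,
  0x197530eca864200f]), (0x2aa625c, [0x139750eca8642035, 0, 0xf97530ca8642037, 0xf97530ca8642048,
  0xd30f78a8643409d, 0xf97530ca8642010, 0xd974eb308642014, 0x8eca79753024013, 0xca870f975242034,
  0xc2478b530e96045, 0x197530eca8642012]), (0xaa22043a, [0x10cb96e8752420f5, 0, 0x90f972cb46420f6,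
  0x99752d0e642a04c, 0x10cb968e352460f5, 0x18cb30f748642014, 0x18cb316e28654014, 0xf96a9152642c09e,
  0x159730eca8642011, 0x10e3968cb52460f5, 0x197530eca8642014]), (0xc69a2133, [0, 0xb97530ec8642038,
  0x119752eca8642047, 0x178eca8655302013, 0xb97528650ec2038, 0x119752864eca2047,
  0x178ecb5308642013, 0xb88657530ec2038, 0x118865752eca2047, 0x179530eca8642013,
  0x197530eca8642015]), (0xaa98843a, [0x11974af22864c0f7, 0, 0xb0ec9596643206a, 0xd974b30e8642049,
  0x11974b2ec86420f7, 0xf53098ca6436015, 0x9530e796ca24015, 0x139750eca8642014, 0xa8651596ec3206a,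
  0xca87930f7442049, 0x130878ecb7442014]), (0xc4163, [0x196f1522468ac03b, 0x18caf75302468030,
  0x10caf9752246804f, 0xb0ed9752864205e, 0xd30f974a864208d, 0x134f1962468ac0d6, 0x179530eca8642130,
  0x18ed17522468a016, 0x10caf97522468018, 0x179530eca8642017, 0x175930eca8642017]), (0x28665,
  [0x197530eca86420d8, 0x11974eca8643208e, 0xd238f0468b5605f, 0xb038ce469356050,
  0x1596f122468ac031, 0x197530eca8642039, 0x8cb8e6431356022, 0x159712eca864201a,
  0x1174f382468ac017, 0xca990e64335604f, 0x197530eca8642019]), (0xa24158, [0xb975230ec468081,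
  0x1197424ca86f206d, 0x10ecb75922468032, 0x19752eca864300a2, 0x1902552f6ca8601a,
  0x19025536eca8601a, 0xb974873024ce0ac, 0xb974870ec43201b, 0x1974b230ec4680df, 0x19025536eca860d7,
  0x197530eca8642018]), (0xa24359, [0x11975224eca86053, 0x13974ca8f0246033, 0x13974ca8f0246036,
  0x2ca9975046f2020, 0x139742470eca801d, 0x11975224eca86061, 0xf974ca912246090, 0x139742470eca8019,
  0xf025974ac692050, 0x10247974ce8b2064, 0x197530eca864201c]), (0xaa66152e, [0x119752eca864201a,
  0x119752e2468ac0fc, 0x108796a42cf3407f, 0xf96ca864313406e, 0xea902c653578034, 0xb96ec86431340a3,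
  0x8cb96642f13402d, 0xd96a90e643340aa, 0xd96a90e6433401e, 0xa870ec433578051, 0x197530eca864201d]),
  (0xa2414b, [0x139750eca86420a9, 0xeca930397446035, 0x11522ca996e640aa, 0x197530eca86420a0,
  0x197530eca864201f, 0x15302ca996e640c4, 0x1952316eca86401e, 0x1952370eca86401e,
  0x11224ecb9748609f, 0xeca9303974460e0, 0x197530eca864201b]), (0x2aa674c, [0x139750eca8642021,
  0x1197522a864ce0a9, 0x10ca8e7974432037, 0x9530e39664ac06e, 0xd97522a864f007e, 0x3974ec468b1201d,
  0xb974873024ce0a4, 0x1930f634864ac02e, 0x9526a50ec378054, 0x14a86c530e378065,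
  0x197530eca8642020]), (0x2a9c14c, [0x1596d0f22468a0a1, 0xea98c75304360ab, 0x18870a57522ce038,
  0xea94c79625120ab, 0x159730eca86420a1, 0x1596d0f22468a01e, 0xd530a996e6420c6, 0x8cb2659742f002f,
  0x159730eca864201e, 0x12870a59742ce056, 0x197530eca8642021]), (0x28920124, [0x119752eca86420a5,
  0xd0246f9752a803a, 0xd9753024a86e06d, 0xd9753024a86e020, 0xd97530a8246e06d, 0xd97530a8246e020,
  0x19530f6ca864202d, 0x1397430eca864058, 0x102468f9752ca062, 0x102468f9752ca091,
  0x197530eca8642022]), (0xa24151, [0x11752f8ca8642092, 0xd974f02468b2064, 0xf752d8a86430044,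
  0xf9750ca8643204f, 0x1952316eca86404e, 0xd9750ea86432024, 0xd9750ae86432024, 0x11752f8ca8642025,
  0x1396314eca8640c1, 0x19225174eca86112, 0x197530eca8642023]), (0x28666, [0x197530eca86420c3,
  0x11974eca86432093, 0xd238f0468b56061, 0xf974ca864312046, 0xd038ae469356050, 0x197530eca864204d,
  0x30f8c468b356027, 0x11974eca86432028, 0x18cb70e864334024, 0x10e38ac46935605e,
  0x197530eca8642026]), (0x152414c, [0x197530eca86420ad, 0x12d970ea8643407e, 0xad53962468f0045,
  0xcb970e864334051, 0x10d96e2a86534086, 0x18d530f6a8642028, 0x11974eca864320a0, 0xd196a8e24734029,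
  0xd4a99730e2460c2, 0x179530eca8642025, 0x197530eca8642028]), (0xa24149, [0x19752cf02468a04a,
  0xf2250d974a86053, 0x19024ed752a8604a, 0x11974cf22468a05f, 0x197530eca8642092,
  0x13974f02468ac026, 0x11974cf22468a02a, 0x11224ed974a8602a, 0x11224ed974a8605f,
  0x18ca8f1752246092, 0x122470f974ca8026]), (0x1a6554c, [0x139750eca864202a, 0x1197522a864ce081,
  0xd02596e68b3404b, 0x11974ed22468a058, 0x13974ed02468a083, 0x10ca996e6433402b,
  0x11974eca86432081, 0x1397424ca86f002a, 0x1024796e8ad34063, 0xeca997064334094,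
  0x197530eca8642027]), (0x1a5414c, [0x1752d0f82468a0ad, 0xb529970ec24607f, 0x10cb922e86556048,
  0xb531968642ce054, 0xd318e2a86556084, 0x1596d0f22468a02b, 0xf238cb04695609f, 0x1930d74e2468a02c,
  0x159730eca8642028, 0xca9596e64312060, 0x197530eca864202a]), (0x6994c120, [0x197530eca8642087,
  0xb975290ec246056, 0x1975308eca246047, 0x112254d96e68a0a1, 0x13974cb0e24680af,
  0x18ca90f752642029, 0x13974f0ca864202c, 0x139750eca864202c, 0x1196f4d22468a0a1,
  0x130e2cb9744680af, 0x197530eca8642029]), (0x2a91850114, [0xd9752b0e2468082, 0xd4b29196642e085,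
  0xd52a9196642e06c, 0xd970f34a2468085, 0xd97530a8246e082, 0xd97530a8246e02b, 0xd9752b0e246802b,
  0xd0ea95966432082, 0xd0ea9596643202b, 0xca90f5966432082, 0xca90f596643202b]), (0xaa120736,
  [0x1123974eca8640bd, 0xaed975308642101, 0xb97530ec864206f, 0x159730eca864202e, 0xb9753086ec4206f,
  0x159730e86ca4202e, 0x8cb527970e24070, 0x14cb287970e24080, 0x159730eca864202d,
  0x10eca879752240fd, 0x197530eca864202f]), (0xc626c, [0x18f6cb53086420a6, 0, 0xb96ed53086420f2,
  0xb18ed75286420b2, 0xd390f74a8642122, 0x159730eca8642139, 0x16d8af5302468030, 0x179134eca8642032,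
  0x193570eca8642031, 0x179530eca8642032, 0x197530eca8642031]), (0x3ac625c, [0x139750eca86420a7, 0,
  0xf97530ca86420f3, 0xf97530ca86420cd, 0x139750eca8642124, 0xf97530ca8642031, 0x10a8ec3975246034,
  0x8cb06f9752240a5, 0x10a82cf975246034, 0xa870cf97522405c, 0x197530eca8642033]), (0xaa26b,
  [0x197530eca86420f8, 0, 0xf22a91974c460f1, 0xf75930ca86420b3, 0x159730eca8642123,
  0xf75930ca8642032, 0x8cb0e79752420f5, 0xb02c8f975246034, 0xb028cf975246034, 0xa870ed9752420ef,
  0x197530eca8642035]), (0x3ae715b, [0, 0xf97530ca86420a8, 0x117538ce2468a059, 0xd97530ea8642074,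
  0xd97530ea8642036, 0xf974a8d302460a4, 0x1397502eca864037, 0x1397430eca864037, 0x1396350eca8640f3,
  0xca870f3974240cc, 0xca872f197424033]), (0x2aa625a, [0xb9748d30e2460f0, 0, 0x197528b0ec2460f9,
  0xb97512c8642e05d, 0xd97530ea8642037, 0xf97530ca86420bd, 0x190ed56a8643206a, 0x11752f8a8642c038,
  0xca874f1962520f4, 0xca8753196e4211b, 0x197530eca8642034]), (0x2aa625b, [0x197530eca86420fb, 0,
  0x13974a8d0e2460f0, 0x13974caf024680b5, 0xd97530ea8642035, 0x139750e2a864c0f7, 0x9752a790ec24038,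
  0x97526b90ec24038, 0x130e2a8d974460f0, 0x13024caf974680b5, 0xca8730f97442035]), (0xeb16b, [0,
  0x159730eca86420a7, 0xb038ed752864055, 0xd2390f74a864072, 0x159730eca86420d0, 0x13758f02468ac039,
  0xf96a8d5302460a3, 0x1596d2f02468a03a, 0x15972cf02468a03a, 0x18e36cb5308640f2,
  0x197530eca8642036]), (0xaa26a, [0xb2290f974c460f1, 0, 0x10ca92f9742460fa, 0xb970ed52864205a,
  0x159730eca8642075, 0x11974ce2468b203a, 0xf308ad974246101, 0xd0f2a99746420f6, 0x192370eca8654037,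
  0xa8730f974c420f1, 0x197530eca8642037]), (0x265814d, [0x197530eca864210b, 0xd936f02468b40cf,
  0x11974eca86432071, 0x11974eca86432052, 0x178f4ac2469120a6, 0, 0x178f314ca8642039,
  0xf8b6c86431340a2, 0x159730eca864203b, 0x179530eca8642039, 0x175930eca8642039]), (0xa24152,
  [0x139750eca8642090, 0xd974b0e2469209c, 0xf974d02468b2064, 0xd974b0e2469205e, 0x19752eca86430098,
  0xd9750ea8643203d, 0xd9750ae8643203d, 0xd752b8e2469003e, 0xf74d1922468a0c3, 0x174ed1922468a113,
  0x197530eca864203c]), (0xaa166, [0x197530eca8642099, 0xf230d974a86405f, 0xf230d974a864061,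
  0x18caf1752246809a, 0xd530f96a864208e, 0x159730eca86420c1, 0x18caf1752246803d, 0xd96eb5308642041,
  0x1597302468ace040, 0x1302ed974a86408d, 0x197530eca864203f]), (0xaa168, [0x197530eca864209d,
  0xd9730f4a8642065, 0xf97530ca8642060, 0x18cb5316e24680e4, 0x18cb530f62468041, 0x18cb5316e2468041,
  0xf539630ca8640fc, 0x159730eca86420c2, 0x16cb5318e246803e, 0x1303974eca8640e0,
  0x197530eca8642042]), (0xaa120434, [0x197530eca86420e5, 0xe2597152ca86063, 0xe2597152ca86062,
  0xf5396d02468a09b, 0x1175238ec468a0df, 0x1596caf308642041, 0x115396eca2468043,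
  0x1174ed922468a0df, 0x159730eca8642041, 0x10ed96352a86408f, 0x24797152eca8040]), (0x50920129,
  [0x12d9750ea86420cc, 0, 0xcb9750e8643205c, 0xcb7538e864300e6, 0x18b530ed68642046,
  0x18d530b62468e045, 0x18d5316a2468e045, 0x9530796eca240e2, 0xd4a879730e24135, 0x179530eca8642044,
  0x197530eca8642046]), (0xc6984333, [0, 0xd30eb974864205d, 0xf122d974a8640e7, 0xd122f974a864048,
  0x11342d96ea86411b, 0xf1974ca922460e3, 0x14b96d30e2468045, 0xd122b974e864048, 0xcea9397502460b5,
  0x179530eca8642047, 0x10f22d974a864049]), (0x69420129, [0x12cb9750e86420cd, 0, 0xe25758d068b2059,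
  0xf9752a8c2470102, 0xaed973086434083, 0x12cb9702e8654048, 0x12cb9630e8654048, 0x1530ed968642a0e2,
  0x159730eca8642046, 0xca99730e6434079, 0x1025758ce68b204a]), (0xaa269, [0x197530eca86420b3, 0,
  0xd970eb52864205a, 0x12ecb5196246814a, 0x159730eca864207a, 0x11974ce2468b204b,
  0x15970cb28642e085, 0x1196ce952642a04c, 0x192370eca8654048, 0x192370eca86540b3,
  0x197530eca8642048]), (0xaa26f, [0x197530eca864213c, 0, 0xb96f3148642c06b, 0x1974aed302468149,
  0x1596d0e92642a04c, 0x1596d0f28642a04c, 0x1975122ca864e13c, 0x190f374ca8642049,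
  0x190f722ca8654049, 0x1923174ca864e13c, 0x197530eca8642049]), (0x2565549, [0xf596d122468a0ae,
  0xd9236f0468b4077, 0xaf9748c24712102, 0xd9036ae46934055, 0, 0x14d970f2a864204b,
  0xed3182a86556084, 0x1397430eca86404d, 0x118e36ac469340b2, 0x179530eca864204a,
  0x197530eca864204b]), (0x265814e, [0x197530eca864210c, 0x11974eca864320b1, 0x12ed90a864356076,
  0x18cb6e86431340e6, 0xf9750ca86432052, 0, 0x178f314ca864204d, 0xf0d82a865356086,
  0x159730eca864204e, 0x179530eca864204d, 0x175930eca864204d]), (0xa2414a, [0x11522ed96a86407b,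
  0x11974eca8643205c, 0x17530ad8e24680f2, 0x195230f6ca864052, 0x11974ace24692050,
  0x11974ac2e4692050, 0x397504ca86f206d, 0x11974eca86432051, 0x139630f4ca8640d4,
  0x192250f74ca8610e, 0x197530eca864204f]), (0x28564, [0x197530eca86420d5, 0x11752ed8a864207c,
  0x18256cf068b34059, 0x1596cf122468a0f3, 0x19036ace46934055, 0xaed930864356058, 0xd974ea86431206e,
  0x195316a8642ce054, 0x19036ace46934050, 0x196b50ec8643207b, 0x197530eca8642053]), (0x2a84359,
  [0x130eb974c864205d, 0xea93974d0246126, 0x159730eca8642057, 0x159690ecb2642054,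
  0xf96b530c864206f, 0xf531962ca8640ee, 0xd752a8790e24119, 0x190eb752c8642051, 0x159730eca8642054,
  0x1302d974ea8640ed, 0x197530eca8642056]), (0x2554146, [0x197530eca8642103, 0x19752eca864300bf,
  0x196b4ec8643120ba, 0x12cb90e86435612c, 0, 0x118f6ac246934055, 0xf6b58c8643120b6,
  0x195316a8642ce057, 0x159730eca8642052, 0x11836ace46934055, 0x10396ace46934055]), (0xeb173,
  [0x15308b96ec24605b, 0x159730eca8642142, 0xf52ad970246805a, 0x1396ad430e4680ec,
  0x11528b96ec246054, 0x1396ad0f424680ec, 0x11528aed96246054, 0xd528b970e246070,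
  0x1196ed52a864206c, 0x1024ed9752a8607d, 0x197530eca8642058]), (0x222445a, [0x197530eca864211c, 0,
  0xf2a990d4643614c, 0xb9752ec864300bb, 0xf59728ac247005b, 0xeb3168d824740b7, 0x18f5316ca864205a,
  0x178254cf068b2059, 0x14d238af046960c0, 0x179530eca8642055, 0x197530eca864205a]), (0xeb18d31810a,
  [0xf974b30c86420bc, 0xf7592a8d024614b, 0, 0x139748ecb064205b, 0xf974b30c86420b8,
  0xd7592a8f0246146, 0x119752eca8642057, 0x139750eca864205b, 0x139714eca864205b, 0xca99374f0246146,
  0x10ed5396a8642057]), (0x3184359, [0, 0xea93974d0246129, 0x178eb530c86420ba, 0x38d1752e468a059,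
  0xea93974d02460b9, 0x130ed9634a86411e, 0x159730eca864211a, 0x190eb752c864205c, 0x38c5752f068a059,
  0x112eb974c864205d, 0x10f2b974c864205d]), (0xeb175, [0, 0x159730eca8642144, 0x1596f30ca86420bc,
  0x1596f02cb286405a, 0x1596f02d2a86405a, 0xd96f30b486420be, 0x1597122eca86411d,
  0x190f374ca864205d, 0x13970ecb4864206b, 0x1523196eca86411d, 0x197530eca864205d]), (0xa2445b,
  [0x195236cf0468a071, 0x197530eca86420b2, 0xf52396d0468a07b, 0x13974caf02468079,
  0x19530caf62468060, 0x139750e2a864c081, 0x1397502eca86405f, 0x1397430eca86405f,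
  0xd74b930e8642104, 0x1922574f068ac10f, 0x197530eca864205e]), (0x28569, [0x197530eca8642104,
  0x197530eca8642077, 0xf7530d8a864207c, 0x1596cf122468a0cd, 0x19236cf0468b4072,
  0x159630f2ca864062, 0x1887516a42cf207f, 0x182556f068ad2063, 0x19236cf0468b405f,
  0x14cb930e864360d4, 0x197530eca8642061]), (0xeb120121, [0x119722f4ca86407a, 0xd9752f02468a07d,
  0x159730eca86420b4, 0x159730eca8642073, 0x39752f0468ac063, 0x39752e5068ac063, 0x119752eca8642082,
  0xf74cb1922468153, 0x159730eca8642060, 0xecb751922468153, 0x153196eca8642060]), (0x1a65547,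
  [0x139750eca8642061, 0xf974d122468a076, 0xd5238f0468b607b, 0x11974cf22468a0cc,
  0x13974cf02468a074, 0x1930f4d62468a065, 0x11974cf22468a07e, 0x139742eca8650061,
  0xd74b90e864320d5, 0x174cb90e86432111, 0x197530eca8642064]), (0x3ac541c112, [0x1197522eca864075,
  0xf97530ca86420ce, 0xf97152c2468a07d, 0x159730eca8642078, 0x397152e468ac062, 0xd9750eb28642080,
  0x1396d0f4a864213d, 0x139750eca8642065, 0x396552f068ac062, 0x130ed974a864213d,
  0x130f596ca8642065]), (0x315c154, [0x1974cf302468a088, 0xf390d74a864208d, 0xf96d1522468a092,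
  0x10f8d3742468a090, 0x12f8d1742468a08b, 0xf97314ca86420d8, 0x179530eca8642112,
  0x18f4d7302468a068, 0x13182f74ca864067, 0x179530eca8642066, 0x12390f74ca864067]), (0x2866c,
  [0x1596f122468ac0d6, 0x197530eca8642089, 0xf538d02468b608e, 0xf9750ca86432093, 0xf9750ca8643208e,
  0x19236f0468ad4089, 0x1596f122468ac069, 0x18ed570a86432069, 0x19236f0468ad4067,
  0x14ed930a864360d6, 0x197530eca8642067]), (0x69120132, [0x1197234eca86408c, 0xf975302468ac091,
  0x119752eca8642094, 0x397530ec468a08f, 0x15970f2ca864208a, 0xf97530ca8642069, 0xf9752d0a8642069,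
  0x1752ed902468a0d7, 0x159730eca8642068, 0x16ed53902468a0d7, 0x153196eca8642068]), (0xaa380,
  [0xb9693142ec46152, 0, 0xb97530ec864212e, 0x8cb19752642e0e8, 0xb9753086ec42152,
  0x1087596eca43206a, 0xb9748730ec42152, 0x10874ed96a43206a, 0x1086f9752a42c06a,
  0x1486f9730a42c06b, 0x197530eca86420f6]), (0x2aa6758, [0xb975230ec4680a9, 0xb975230ec4680dc,
  0x11974eca864320f1, 0x1753182a864ce0b6, 0x19530e29664ac06e, 0x19530e36864ac06e,
  0xb974873024ce0b9, 0x1953162a864ce06f, 0xb968c730e4340ec, 0xca874530e37813d,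
  0x197530eca864206d]), (0x69320124, [0xb31748ed82460b7, 0xea997152c6420f4, 0xb75318ec86420b7,
  0x1197528cae246070, 0x12a99750ec6420dd, 0x14a996f30c6420ab, 0x115396eca8642070,
  0x1196a8d52e2460ee, 0x159730eca864206e, 0x10a996f52c6420ee, 0x1531968cae24606e]), (0xeb120122,
  [0xf9730cb486420be, 0x10eca97592246125, 0x159730eca86420b8, 0x15970eca92642070,
  0x15970ecb28642070, 0x159730eca86420de, 0xb9752870ec420fd, 0x1196ed52a864212a,
  0x159730eca864206f, 0x10ed9752a864212a, 0x153196eca864206f]), (0x2554147, [0x197530eca8642105,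
  0x12ed914a86436148, 0xf7538ca864300bf, 0x17914ace2469211f, 0, 0x13916ce2468b4072,
  0x174d38ea864300c5, 0x194d36ea86430073, 0x159730eca8642071, 0x13836cf0468b4072,
  0x12396cf0468b4072]), (0x8856a, [0x197530eca8642137, 0, 0x15138eca86436121, 0x10d58af2246960c0,
  0xf4d930a86436141, 0x178d30f4a8642072, 0x16d94af0246920c7, 0x191536eca8642075,
  0x192d70ea86434074, 0x179530eca8642072, 0x197530eca8642075]), (0xc6164, [0, 0xd74af93024680bf,
  0x14ecb1396246813f, 0x14ecb13962468141, 0x159730eca8642131, 0x18ecb13742468076,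
  0x1952ad70e2468078, 0x150cb2f9624680eb, 0x13902ed74a864077, 0x13830ed74a864077,
  0x12390ed74a864077]), (0x88569, [0x197530eca8642136, 0, 0xed58b12246960c0, 0x152d90ea86436145,
  0xf2d914a86436148, 0x178d30f4a8642077, 0x118d56ea864320e9, 0x191536eca864207a,
  0x192d70ea86434079, 0x179530eca8642077, 0x197530eca864207a]), (0x255414a, [0x197530eca8642108,
  0xd538af0246960c0, 0x10cb92f48643611e, 0x17914ace2469211c, 0x174b38ec864300bf,
  0x15318ac2e46960ec, 0x150b8f2c864360ee, 0x190356ce468b207d, 0x159730eca864207b,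
  0x179530eca864207c, 0x175930eca864207c]), (0xeb16f, [0xd52b6f9024680c7, 0x1397142ca864e11b,
  0xd96f530a86420ee, 0x1196f52ca86420eb, 0x1486b9712ec2407f, 0x1486b9730ec2407f,
  0x11972ed4a8642115, 0x13970254ca86e0a1, 0x1196ecb528642080, 0x130f974ca8642119,
  0x197530eca864207e]), (0xaa481, [0x197530eca8642153, 0x190f56ca864320e9, 0xd438b30e46960ec,
  0x1174cf922468a0b3, 0x156f38ca864300c5, 0x99750a642cf207f, 0x997506a42cf207f, 0x190f56ca86432082,
  0x19236b0ec4694081, 0x10ed6b9224694116, 0x197530eca864209f]), (0xeb17a, [0, 0xb314996ec24605b,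
  0x159730eca864214a, 0xd53970ea86420e9, 0x1930cae374468084, 0xd5396a90e6420e9, 0x1930cb74e2468084,
  0x1196cf4b28642085, 0x1196ed4b28642085, 0xca94f97302460b4, 0x197530eca8642083]), (0xaa988437,
  [0x13974f0ca86420ea, 0x11974f2ca86420e7, 0xb0ed59286436057, 0, 0x13974ceb08642084,
  0x13974cf0a8642084, 0xd7538b0e2468087, 0x139750eca8642084, 0xf96314ca86520eb, 0x16ca9950e24720b0,
  0x197530eca8642086]), (0xc6165, [0, 0xf930d74a86420cf, 0xf96d1522468a0b1, 0x130ed5962468a0d1,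
  0x1974cf302468a0d3, 0x159730eca8642132, 0x1596cf302468a088, 0x1952d70e2468a08a,
  0x13902f74ca864089, 0x13830f74ca864089, 0x12390f74ca864089]), (0x8866c, [0x197530eca8642139, 0,
  0xf3590ca864360d0, 0x114f92ca864360ae, 0xf9750ca864320d2, 0x17952eca864300d3, 0x178f314ca8642089,
  0x191536eca864208c, 0x192f70ca8643408b, 0x179530eca8642089, 0x197530eca864208c]), (0x2856b,
  [0x197530eca86420cf, 0x197530eca8642122, 0x11974cf22468a0d4, 0xf75930ca8642104,
  0x19536cf02468a0d2, 0x15970e32a864c08f, 0x13750e38a864c0df, 0x1952d6f02468a08e,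
  0x19536cf02468a08e, 0x174d930ea8642110, 0x197530eca864208d]), (0xeb181, [0x13970f4ca86420d0,
  0x15970f2ca8642124, 0x1174cf922468a0d5, 0x1174cf922468a104, 0x119752eca86420d1,
  0x1596cf122468a08e, 0x1596cf302468a08e, 0x1596f30ca86420fc, 0x15972f02468ac091,
  0x174cf1922468a10e, 0x197530eca8642090]), (0x1524149, [0x14f9730ca86420ae, 0xf974d122468a0d5,
  0x1953096eca2460e2, 0xf59730ca86420d4, 0x197530eca86420b1, 0x18d530f6a8642093,
  0x117538eca86420ad, 0x14f9730ca8642094, 0x1794cf122468a10f, 0x179530eca8642092,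
  0x197530eca8642093]), (0x28868, [0x1174ecb9224680c3, 0x11972254eca860c1, 0x11972254eca860d6,
  0x19530256eca860d9, 0x15970ed22468a096, 0x15970ec32468a096, 0x1174ecb9224680d8,
  0x1974ecb3024680da, 0x13970254eca86097, 0x194324770eca8130, 0x197530eca8642095]), (0xc6166, [0,
  0xf96d1522468a071, 0x10ecb39742468076, 0x12ecb197424680c9, 0x150ed3962468a0d1,
  0x159730eca8642133, 0x178caf5302468098, 0xd96eb53086420e4, 0x179350eca8642099,
  0x179530eca8642099, 0x175930eca8642099]), (0x222455c, [0x139750eca8642122, 0, 0xf97530ca8642072,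
  0xf97530ca8642077, 0xd9752ea864300ca, 0xd9316ea864340e5, 0x18f5316ca864209b, 0x178cb50e8643209a,
  0x178cb50e864320d2, 0xf8cb73086434099, 0x197530eca864209b]), (0xc6168, [0, 0xf31974ca8642074,
  0xf31974ca8642079, 0xf31974ca86420c9, 0xd91752ea864209a, 0xd91752ae864209a, 0x114f9632ca864124,
  0x159730eca8642135, 0x18cb7530e246809c, 0x179530eca864209d, 0x175930eca864209d]), (0x2a8855c,
  [0x139750eca8642123, 0, 0xf97530ca8642075, 0xf97530ca864207a, 0x1196f52ca86420cb,
  0x1596d0f2a864209b, 0x1596f12a8642c09e, 0x1374d18a8642e09d, 0x159730eca864209b,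
  0x130358eca8656123, 0x130ed78a8643409d]), (0x2424157, [0x135970eca8642115, 0xf396ca9024740b5,
  0xed97302a86540ed, 0xed97302a86540ea, 0x13196eca2469409f, 0xf396ca9024740c8, 0x1952316eca8640a1,
  0x1952370eca8640a1, 0x1952370eca86410a, 0x179530eca86420a0, 0x12396ecb0469409f]), (0x4c920122,
  [0x197530eca86420b6, 0xf8ca975302460f8, 0, 0x18b530ec966420a3, 0x18b530ed686420a3,
  0x13974f02a864c0fe, 0x1953036eca8640c4, 0x1953036eca8640c5, 0xf8ca9753024613a,
  0x179530eca86420a2, 0x197530eca86420a3]), (0x69320122, [0x197530eca86420b7, 0xaed7487902520f9, 0,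
  0x93196eca6434101, 0x93196ec6a434101, 0x13974f02a864c0ff, 0x1953036eca8640c6, 0x1953036eca8640c7,
  0x159730eca86420a3, 0x130396a8ec474126, 0x197530eca86420a4]), (0x3ae7161, [0, 0x139750eca86420fa,
  0x13974a8ed02460b9, 0x13974a8ed02460a4, 0x13974a902ec460b9, 0x13974a902ec460a4,
  0x1397502eca8640bd, 0x1397430eca8640bd, 0x1396350eca864142, 0x14a86ed9730240ce,
  0x197530eca86420a5]), (0xc626b, [0, 0, 0x10d2a8f97424612c, 0xb970ed52864211f, 0x159730eca8642138,
  0x1596ecb3086420a6, 0x178f314ca86420f8, 0x193516eca86420a7, 0x193570eca86420a7,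
  0x179530eca86420f8, 0x197530eca86420a7]), (0xeb17b, [0, 0, 0x159730eca864214c,
  0x13970f4ca8642121, 0xd97314ea86420a7, 0x8ed90a7752420f9, 0x8ed906b752420f9, 0x8cb270f974240fa,
  0x8ca730f974240fa, 0x1302eca997464129, 0x197530eca86420a8]), (0xeb174, [0xb9693034ec460ff,
  0xd0f2a87974420f0, 0xd97530ea86420dd, 0x159730eca8642115, 0x15970ca92246e0aa, 0xd96ea8753042100,
  0xb96ec87530420ab, 0xb96e8c7530420ab, 0x159730eca86420fd, 0xca8f303974460ed,
  0x197530eca86420a9]), (0x2877c, [0x1974a8ed302460fe, 0xd970f52a86420ef, 0x197530eca86420fe,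
  0x1952ca2516e680aa, 0x1952ca2570e680aa, 0x1396a9430ec460dc, 0xb7592870ec42116,
  0x19531624ca86e0aa, 0x19537024ca86e0aa, 0x174b92870ec42109, 0x197530eca86420ac]), (0xaa270,
  [0x197530eca8642119, 0x1196ecb5224680e3, 0x1974ca930e246119, 0x19536cb0e24680b0,
  0x150f6cb9224680ad, 0x150f6cb3824680ad, 0x19530e36ca8640b0, 0x150f9236ca8640ad,
  0x150f3836ca8640ad, 0x170f9234ca86410a, 0x197530eca86420af]), (0x3188, [0, 0xf74d1922468a103,
  0x179530eca8642159, 0xf97314ca8642131, 0x17930f4ca8642107, 0x1596cf122468a0b1,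
  0x1596cf302468a0b1, 0x1590f36ca86420b0, 0x195370eca86420ae, 0x195730eca86420ae,
  0x197530eca86420ae]), (0xc6269, [0x1916ecb52864211f, 0, 0xd970eb52864211c, 0x12d4af1962468145,
  0x159730eca8642136, 0x1718ecb5286420b2, 0x18d4af73024680b4, 0x179134eca86420b3,
  0x193570eca86420cd, 0x179530eca86420b3, 0x197530eca86420cd]), (0x2790, [0x197530eca8642161, 0,
  0xf59122ca865611d, 0xf59122ca865613e, 0xd97122ea86540b3, 0xd97122ae86540b3, 0x1916ce32a8654120,
  0x191536eca864211b, 0x1791522ca864e13c, 0x18d6ea93024740b5, 0x197530eca864211b]), (0xc5320122,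
  [0xa9974ed3024614d, 0xf0d9752a864212b, 0, 0x178b30ec946420b7, 0x178b30ed486420b7,
  0x113596eca8642150, 0x14ed9730a8642100, 0xcf8a9753024613b, 0x159730eca86420b6,
  0x179530eca86420b7, 0x197530eca86420b8]), (0xaa378, [0x197530eca8642147, 0, 0x13438a90ec476128,
  0x18ed6a930247414d, 0x12ed6a99024740b7, 0x12ed6a91824740b7, 0x18cb2f74864300be,
  0x18cb36f4864300be, 0x18ed6a93024740b9, 0x10ed8a952247614f, 0x14ed8a93024760ff]), (0xc5320123,
  [0, 0xeb9748d30246151, 0, 0x178b30ec946420bb, 0x178b30ed486420bb, 0xeb9748d3024614d,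
  0x12f5970ca86420bc, 0xd78a8f15224615a, 0x159730eca86420ba, 0x179530eca86420bb,
  0x197530eca86420bc]), (0xaa273, [0x197530eca8642125, 0, 0xb96f1528642c12f, 0x15972eca864300be,
  0x19308aed74246101, 0x15972e86ca4300be, 0x19308b74ec246101, 0x159712ca8642e0e8,
  0x192370eca86540bd, 0x192370eca8654125, 0x197530eca86420bd]), (0x248e, [0x197530eca864215f,
  0x178caf152246815a, 0x178caf1522468156, 0, 0x18d530eb686420c0, 0x18d530f6a86420c0,
  0x178caf530246813b, 0x178cb4f302468146, 0x13790ed4a86420bf, 0x13718ed4a86420bf,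
  0x197530eca86420c0]), (0x84666, [0x197530eca8642133, 0xf795122468ac10f, 0x11972f4ca8642111,
  0x18d4b730e2468135, 0xf97314ca864210e, 0x179530eca864210c, 0x178f314ca86420c3,
  0x18d4b730e24680c2, 0x193570eca86420c1, 0x179530eca86420c3, 0x197530eca86420c1]), (0xaa750127,
  [0x1396f14ca86420c8, 0xf52d90a86436100, 0xd758b30e24680fb, 0, 0x1596d0eb286420c6,
  0x1596d0f2a86420c6, 0xf96d42a86512100, 0x139750eca86420c4, 0x159730eca86420c6,
  0x1302f84ca87560c8, 0x1303584ca86f60c4]), (0xaa379, [0xf74cb9302468140, 0xf74cb930246813b,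
  0xd752b90e2468120, 0, 0x156f90cb286420c7, 0x156f90d2a86420c7, 0x156f912ca86420c7,
  0x136f914ca86420c5, 0x136f194ca86420c5, 0x10ed6b9522468117, 0x197530eca86420c8]), (0x2284,
  [0x197530eca8642155, 0, 0x11592eca86436141, 0x15390eca86436148, 0, 0x1792ecb4864300ca,
  0x1792ed4a864300ca, 0x1792f4ca864300ca, 0x193570eca86420cb, 0x19370eca864340c9,
  0x197530eca86420cb]), (0xeb178, [0x1196f4d2a8642121, 0, 0x159730eca864211e, 0xf97350ca864213f,
  0xd97350ea86420cd, 0xd97350ae86420cd, 0x1597122ca864e11b, 0x1597032ca864e11b, 0x13970ed4a86420ce,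
  0x1286b9750ec2411a, 0x197530eca86420cc]), (0xc456b, [0, 0x179530eca8642138, 0x11794cf22468a103,
  0x11794cf22468a105, 0x19734cf02468a106, 0x178d30f4a86420cf, 0x178f314ca864213a,
  0x193516eca86420d0, 0x193570eca86420d0, 0x179530eca86420cf, 0x197530eca86420d0]), (0x3184,
  [0x174cf9302468a106, 0x179530eca8642155, 0x114cf9722468a131, 0xf93174ca8642105, 0,
  0x156cf9122468a0d2, 0x156cf9302468a0d2, 0x156cf3902468a0d2, 0x16ed59302468a0e1,
  0x195730eca86420d1, 0x197530eca86420d1]), (0xc655412c, [0, 0xf7934d02468a106, 0xf97530ca8642107,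
  0xf97530ca8642106, 0, 0x1378f4d02468a0d3, 0x13974f0ca86420d3, 0x139750eca86420d3,
  0x137914ce2468a0d3, 0x137194ce2468a0d3, 0x131758eca86420d3]), (0x84564, [0x197530eca8642131,
  0x11972ed4a8642108, 0x195316a8642ce11a, 0x1758cf122468a137, 0x179530eca8642103,
  0x178d30f4a86420d5, 0x18d2b570e246813d, 0x16d2b590e2468119, 0x193570eca86420d4,
  0x179530eca86420d5, 0x197530eca86420d4]), (0x84665, [0x197530eca8642132, 0x11972f4ca8642110,
  0x11972f4ca864210f, 0x11972f4ca864210e, 0x1758f122468ac139, 0x179530eca864210b,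
  0x178f314ca86420d8, 0x159712eca86420d7, 0x193570eca86420d6, 0x179530eca86420d8,
  0x197530eca86420d6]), (0x265814f, [0x197530eca864210d, 0x11974f22468ac132, 0x11974f22468ac133,
  0x117592eca864210c, 0x117592eca864210b, 0, 0x178f314ca86420da, 0x159712eca86420d9,
  0x159730eca86420d9, 0x179530eca86420da, 0x175930eca86420da]), (0x84767, [0x197530eca8642134,
  0x139750eca8642130, 0x1179522468ace112, 0x119734eca8642113, 0x119734eca8642112,
  0x1379142468ace130, 0x1957122468ace134, 0x179134eca86420db, 0x1719522468ace0db,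
  0x179530eca86420db, 0x1759122468ace0db]), (0x318f, [0x14a90ed396246150, 0x12a90ed596246154,
  0xb530ec99664214f, 0x179530eca8642160, 0x18a90ed3742460dc, 0x18a94ed7302460de,
  0x150ea8739624c150, 0xb30c8759624e0dd, 0xb308c759624e0dd, 0x195730eca86420dd,
  0x197530eca86420dd]), (0xaa26d, [0x197530eca864213a, 0xf97314ca8642123, 0x159730ca8642e13d,
  0x1174ed922468a153, 0x1974ed302468a0e1, 0x17230f94a864c0df, 0x17230f58a864c0df,
  0x1952f70ca86420fc, 0x19536f0ca86420fc, 0x10ed9374a8642109, 0x197530eca86420e0]), (0x2388,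
  [0x197530eca8642159, 0xb929750ec24611a, 0, 0xb951728642ce11a, 0x196ed1522468a159,
  0x1394f690642ac0e2, 0x1394f708642ac0e2, 0x191536eca86420e3, 0x1389174eca2460e2,
  0x1390974eca2460e2, 0x197530eca86420e3]), (0xc6120434, [0, 0xf4d96b302468073, 0xd5396b0e2468078,
  0x130f96d42468a0cb, 0xf93750ca86420e1, 0x1596caf3086420e4, 0x178f314ca86420e5, 0xf92cb17486420e1,
  0x159730eca86420e4, 0x179530eca86420e5, 0x175930eca86420e5]), (0xc69a2135, [0, 0xd9530f6a86420ba,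
  0, 0x18b5308ed6246102, 0x18b5308f6c246102, 0x18b53096ec246102, 0x1319742eca8640e7,
  0x1359630eca86413f, 0xf6ca91952246159, 0x179530eca86420e6, 0x1239750eca8640e7]), (0xaa271,
  [0x159730eca864213e, 0, 0xd972f4a864300bc, 0, 0x18ecb5316246814a, 0x18ecb5370246814a,
  0x18ecb5730246814a, 0xf74ad9302468149, 0x192370eca86540e7, 0x152390eca865613e,
  0x197530eca86420e7]), (0xaa272, [0x197530eca8642140, 0x119752eca864213e, 0xf74cb9302468146, 0,
  0x150ecb97224680e9, 0x150ecb93624680e9, 0x150ecb39624680e9, 0x1952f70ca86420eb,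
  0x19536f0ca86420eb, 0x170ecb9522468118, 0x197530eca86420ea]), (0x248f, [0x197530eca8642160,
  0x10d9522ea865611d, 0x1196ca8f22474147, 0x1936ca8f02474146, 0x18b530ed686420ec,
  0x14b90ed28643612a, 0x18d7302ea865413b, 0x1914f62ca86520ee, 0x19156e2ca86520ee,
  0x18d7302ea86540ed, 0x197530eca86420ec]), (0xc6274, [0x190cea8775242127, 0, 0x14b290ed96246154,
  0xd93570ea8642161, 0x190cea87752420ef, 0x18ac90e375246127, 0x10ac92e3974460f0,
  0x10ac8f23974460f0, 0x112cea87974420f0, 0x179530eca8642143, 0x10ed2a87974420f0]), (0xaa275,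
  [0xb4299730ec46128, 0, 0xd53196ea864212b, 0xb53196ec86420f4, 0xb53196e8c6420f4,
  0x1530f962a864c152, 0xd96ea915224611d, 0x1922f750a864c0f1, 0xf74ca9192246125, 0x10ed5972a8642154,
  0x197530eca86420f0]), (0xc626a, [0xcb28f197424612c, 0, 0xb2f0c9974642129, 0xb970ed52864211c,
  0x159730eca8642137, 0x1596ecb3086420f2, 0xb2f0c9974642126, 0x12b082f974c460f1,
  0x193570eca86420f3, 0x12a290f974c460f1, 0x197530eca86420f3]), (0x3ac625a, [0x1396f0d4a864214c, 0,
  0x12a8f4d19624614c, 0xd9712f4a864211e, 0xd97530ea86420f3, 0xf97530ca8642142, 0x1596f12ca86420f4,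
  0xaed491396246142, 0x159730eca86420f4, 0xca914f39624611e, 0xca94f13962460f3]), (0xaa274,
  [0x197530eca8642143, 0, 0xf314a8796c42152, 0xd751922a864e13c, 0x18ca90e3752460f5,
  0x18ca90e37524612d, 0x9974a650ec3206a, 0x99746a50ec3206a, 0xb2290ed974460f7, 0x10ed7922a8654143,
  0x197530eca86420f7]), (0x2aa6260, [0xb7528d90e246127, 0, 0, 0xf7528b90c2460f9, 0xf7528b8d02460f9,
  0xf7528ad902460f9, 0xd7528b90e24612d, 0xb7528d90e2460fb, 0x119634eca865212b, 0x12a876d90e254120,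
  0xca876f9302540f8]), (0x31a6262, [0, 0, 0x10b429972ec46128, 0x178870ecb52420f9,
  0xeb30996d424612e, 0xb596c8730e24144, 0x190caf75286420fa, 0x191536eca864212f, 0x10aec99734246128,
  0x179530eca86420f9, 0x197530eca864212f]), (0x8c77c, [0x197530eca864214e, 0xd96a9530e246127, 0,
  0x18b530ec966420ff, 0x18b530ed686420ff, 0x13590f62a864c150, 0x178b0e875224c117,
  0x18d4f730a8642100, 0x18d56f30a8642100, 0x179530eca86420fe, 0x197530eca86420ff]), (0xeb1a2345,
  [0, 0xd31758ea86420bb, 0, 0xb96ed314864214a, 0xb96ed309464214a, 0xaed97493024614a,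
  0xaed96953024614a, 0xd96a9314e642145, 0x159730eca8642102, 0xca9974f30246145,
  0x153196a8ec246102]), (0xc4569, [0x1758cf122468a105, 0x179530eca8642136, 0xf9730d4a8642108,
  0x1758cf122468a136, 0x179530eca8642105, 0x178d30f4a8642104, 0x178f314ca8642153,
  0x16f8d5122468a153, 0x16d94f122468a104, 0x179530eca8642104, 0x1758cf122468a104]), (0xc6482,
  [0x195730eca8642117, 0x138d570ea8642161, 0xd97530ea8642160, 0x18d4b70f22468118,
  0x178b30ed48642116, 0x1916f522a864c117, 0x1914f362a864c115, 0x1914f722a864c115,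
  0x193570eca8642115, 0x179530eca8642116, 0x197530eca8642115]), (0x2285, [0x197530eca8642156, 0,
  0x179314ca8642e158, 0x196caf152246815a, 0x15790ecb2864211c, 0x15790ed2a864211c,
  0x17192f4ca8642147, 0x191536eca864211d, 0x19136f4ca864211e, 0x19172f4ca864211e,
  0x197530eca864211d]), (0x318845b, [0, 0, 0xf96d530a8642156, 0xf96d530a8642157,
  0x1596b0ed2864211f, 0x178d30f4a8642120, 0x19152f6ca8642121, 0x191536eca8642121,
  0x159730eca864211f, 0x179530eca8642120, 0x197530eca8642121]), (0x8856b, [0x197530eca8642138, 0,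
  0xf75930ca8642137, 0xf75930ca8642136, 0x116f952ca8642155, 0x178d30f4a8642122, 0x18f5316ca8642123,
  0x195316eca8642124, 0x195370eca8642124, 0x179530eca8642122, 0x197530eca8642123]), (0xaa37b,
  [0x197530eca864214b, 0, 0x1396a94d0e246144, 0xd75930ea8642147, 0x18a930ed74642126,
  0x16ed9314a8642125, 0x16ed9350a8642125, 0x18ed3750a8642142, 0x18ed7350a8642142,
  0xca9930f74642147, 0x197530eca8642126]), (0x238b, [0x197530eca864215c, 0, 0, 0x18b530ec96642128,
  0x18b530ed68642128, 0x178f0a875224c15e, 0x18d4f162a865212b, 0x18d4f702a865212b,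
  0x136f1942a864c15d, 0x1794ca870e252127, 0x197530eca8642128]), (0xaa37f, [0x197530eca8642151, 0,
  0, 0x1196a94d2e246144, 0x1196a94cf2246144, 0x15970f22a864c128, 0x15970e32a864c128,
  0xb9748ed3024614c, 0xb9694ed3024614c, 0xa8731956c42e158, 0x197530eca8642129]), (0xc637b, [0, 0,
  0xb8930ed74642151, 0xd8f5370a8642156, 0x18d0a92f7424612c, 0x14d0a8f39624612b, 0x14d0a92f9624612b,
  0x193516eca864214c, 0x193570eca864214c, 0x179530eca864214b, 0x197530eca864214c]), (0x238c,
  [0x197530eca864215d, 0, 0, 0x18b530ec9664212e, 0x18b530ed6864212e, 0x196f3142a864c15d,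
  0x1788cb530e24612d, 0x196f4330a864c15d, 0x178952cb0e24612d, 0x1794ca870e25212d,
  0x197530eca864212e]), (0x2286, [0x197530eca8642157, 0, 0x116caf952246815a, 0, 0x194caf3162468145,
  0x194caf3702468145, 0x194caf7302468145, 0x191536eca864213e, 0x195370eca864213f,
  0x195730eca864213f, 0x197530eca864213e]), (0x3186, [0, 0x179530eca8642157, 0xf95316ca864215f, 0,
  0x18ecb53162468148, 0x18ecb53702468148, 0x18ecb57302468148, 0x179314eca8642140,
  0x195370eca8642141, 0x195730eca8642141, 0x197530eca8642141]), (0xc637c, [0, 0x119752eca864215e,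
  0, 0x178b30ec9464214d, 0x178b30ed4864214d, 0x119752eca864215b, 0x159730eca864214e,
  0x16b894ed3024614d, 0x16b948ed3024614d, 0x179530eca864214d, 0x1758a8ed3024614d]), (0x238a,
  [0x197530eca864215b, 0x137950eca864215c, 0, 0x18b530ec9664214f, 0x18b530ed6864214f,
  0x1790ea875224c15b, 0x1950f362a864c150, 0x1950f722a864c150, 0x195370eca8642150,
  0x195730eca8642150, 0x197530eca864214f]), (0xc637f, [0, 0, 0, 0x178b30ec94642151,
  0x178b30ed48642151, 0xf97530ca864215e, 0xf9752d0a864215e, 0x16b894ed30246151, 0x16b948ed30246151,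
  0x179530eca8642151, 0x1758a8ed30246151]), (0x2691, [0x197530eca8642162, 0, 0x178f3142a864c15d,
  0x18b53086f6c42152, 0x18b530876ec42152, 0x16af30879424c15d, 0x18f5316ca8642152,
  0x16b2ec8794250162, 0xb1686ed92254143, 0xb0974ed92246143, 0x197530eca8642152]), (0x318b,
  [0x16a930ed9424615c, 0, 0x179530eca864215c, 0x18a930ed56246154, 0x18a930ed74246154,
  0x17952a870ec4215c, 0x18a935630ec46154, 0x18a937430ec46154, 0x139516eca8642162,
  0x195730eca8642154, 0x197530eca8642154])]

/-- The trees with 12 vertices: how to `draw` them. -/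
def trees12 : List (ℕ × List ℕ) := [
  (0x2ca24156, []), (0xa1824156, []), (0x2ca2414d, []), (0xb28767, []), (0xae865856, []),
  (0xb28163, []), (0x2ca2414c, []), (0x6d724155, []), (0xb28920434, []), (0xb28920344, []),
  (0x1b69950126, []), (0x265892012f, []), (0x31aa167, []), (0x99a6564f, []), (0xae66564f, []),
  (0xb28920437, []), (0x2baa26c, []), (0x2b8892043a, []), (0xaeaa625c, []), (0x31aa9a2133, []),
  (0x2baa22043a, []), (0x3bc69a2133, []), (0x2ca24150, []), (0x3128163, []), (0x2ca24158, []),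
  (0xb28665, []), (0x2b9995412e, []), (0x2ca2414b, []), (0x2ca24359, []), (0x2baa66152e, []),
  (0xae72414c, []), (0x54a2414b, []), (0xaeaa674c, []), (0xaea9c14c, []), (0xb28920124, []),
  (0x2ca24151, []), (0x2ca24147, []), (0x54a2414c, []), (0xb28666, []), (0x6da6554c, []),
  (0x6d52414c, []), (0x1b6994c120, []), (0x6da5414c, []), (0xef12414c, []), (0x1b69320120, []),
  (0x2b84920736, []), (0xef15081c114, []), (0x2baa120736, []), (0x1328920121, []), (0x3bc626c, []),
  (0x31aa26c, []), (0xefac625c, []), (0xaeaa625a, []), (0x2baa26b, []), (0x3beb16b, []),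
  (0x2baa26a, []), (0xc6aa6159, []), (0x99a5814d, []), (0xae565548, []), (0x9962414d, []),
  (0x2ca24152, []), (0x2ca24148, []), (0x2128920434, []), (0x2baa166, []), (0xae765755, []),
  (0x2b84920434, []), (0x2baa168, []), (0xef1a645d414108, []), (0x1428920129, []), (0xae46585d412,
  []), (0x1b50920129, []), (0x31aa984333, []), (0x2baa269, []), (0x2baa26f, []), (0x95a65549, []),
  (0xae565549, []), (0xef1a635d114109, []), (0x99a5814e, []), (0x9962414e, []), (0x2ca2414a, []),
  (0x2ca2445a, []), (0xefae715d, []), (0x95524146, []), (0xb28564, []), (0xae124359, []),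
  (0x88a2445a, []), (0xaea84359, []), (0x3bc634c71810a, []), (0x3beb173, []), (0x95a65546, []),
  (0xae22445a, []), (0x3bc636131810a, []), (0xefae715e, []), (0x3beb175, []), (0x2ca2445b, []),
  (0xb2856a, []), (0x3bc4920121, []), (0xb28569, []), (0xae665651, []), (0xae665653, []),
  (0x6da65547, []), (0xef15081c112, []), (0xc5a5c154, []), (0xb2866c, []), (0x1b44920132, []),
  (0xef12414d, []), (0xef1a6159, []), (0x3bc636111810e, []), (0xef16531c10f, []), (0xaeaa6758, []),
  (0x1b4c920124, []), (0x3bc4920122, []), (0xef16531c110, []), (0x95524147, []), (0x222856a, []),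
  (0x3bc5420127, []), (0x3beb177, []), (0x2b8856a, []), (0x3beb171, []), (0x2228569, []),
  (0xef19141c112, []), (0x3beb16e, []), (0x2b88569, []), (0x9552414a, []), (0x95a5414a, []),
  (0xae56554a, []), (0x3beb16f, []), (0xae165759, []), (0xef19141c114, []), (0x2baa482, []),
  (0x6d124158, []), (0x3beb17a, []), (0x2baa220437, []), (0xef19541c115, []), (0x2baa988437, []),
  (0x316994c120, []), (0x255492012c, []), (0x222866c, []), (0xef19551c116, []), (0x3beb16d, []),
  (0x2b8866c, []), (0xb2856b, []), (0x6d524148, []), (0xae56554b, []), (0x3beb181, []),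
  (0xae665652, []), (0x54a24149, []), (0x6d524149, []), (0xef124151, []), (0xb28868, []),
  (0x1b5c163, []), (0x3bc562012f, []), (0x1428920128, []), (0x31aa166, []), (0xc4a24148, []),
  (0xae22455c, []), (0x1b69950128, []), (0x31aa168, []), (0xef1a615841a, []), (0x2baa481, []),
  (0x90a24157, []), (0xae75414c, []), (0x1328920122, []), (0x1b4c920122, []), (0x1b69320122, []),
  (0xefae7161, []), (0x318892043b, []), (0x3bc626b, []), (0x3beb17b, []), (0x3beb174, []),
  (0xae724158, []), (0x3bc69a2238, []), (0xb2877c, []), (0xc552414c, []), (0xef188, []),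
  (0x2baa270, []), (0x319594c120, []), (0x95524149, []), (0x88a2445b, []), (0x31aa269, []),
  (0x3bc5320121, []), (0x2baa376, []), (0x314c920122, []), (0x3169320122, []), (0x3bc5320122, []),
  (0x2baa37c, []), (0x314c920123, []), (0x3169320123, []), (0x3bc5320123, []), (0x2baa273, []),
  (0x3bc5320124, []), (0x3191420125, []), (0xae48e, []), (0x2b84666, []), (0x2b84868, []),
  (0x2128666, []), (0x2b9d420127, []), (0x319d420127, []), (0x2b9d950127, []), (0x319d950127, []),
  (0x2baa379, []), (0x3beb172, []), (0x3169420128, []), (0xae284, []), (0x3beb178, []), (0x3bc6269,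
  []), (0x3bc5420129, []), (0x312856b, []), (0x3bc456b, []), (0xef184, []), (0xc5524148, []),
  (0x319552012c, []), (0x2b84564, []), (0x2128564, []), (0x2b84665, []), (0x319995412e, []),
  (0x2128665, []), (0x9962414f, []), (0x99a5814f, []), (0x2128767, []), (0x3beb17d, []), (0xef18f,
  []), (0x3bc5620131, []), (0x95a5414b, []), (0x2baa26d, []), (0x31aa444132, []), (0x3185620333,
  []), (0xae388, []), (0x3184920434, []), (0x31aa120434, []), (0x31aa9a2135, []), (0x2baa271, []),
  (0x3bc6984736, []), (0xc5124158, []), (0x2baa272, []), (0x3bc6988437, []), (0xae48f, []),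
  (0x2baa26e, []), (0x3bc6988438, []), (0xaeaa625e, []), (0x2baa275, []), (0x2baa683, []),
  (0x3188920439, []), (0x3bc626a, []), (0xef1a625a, []), (0xaeaa6261, []), (0x2baa380, []),
  (0x2baa274, []), (0x31aa26b, []), (0xc6aa6262, []), (0xefac6261, []), (0xc6aa625b, []),
  (0x3bc698853c, []), (0x6d124157, []), (0x232877c, []), (0x2b8c77c, []), (0x3bc69a2241, []),
  (0x3beb1a2243, []), (0x3bc69a2345, []), (0xc6554146, []), (0x3128569, []), (0xc6554147, []),
  (0xc6554148, []), (0xc6554149, []), (0xc655414a, []), (0xc655414b, []), (0xc675414c, []),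
  (0xc665814d, []), (0xc665814e, []), (0xc665814f, []), (0xc6658150, []), (0xc6658151, []),
  (0xc6658152, []), (0xc6658153, []), (0xc675c154, []), (0xc675c155, []), (0xc6860156, []),
  (0x3bc6482, []), (0x31aa482, []), (0xc6444157, []), (0xc6744158, []), (0x31aa270, []),
  (0xc615c359, []), (0xae790, []), (0xc622445a, []), (0xae285, []), (0x3bc6378, []), (0xc622445b,
  []), (0xc6a8845b, []), (0xef18845b, []), (0x222856b, []), (0x2b8856b, []), (0xef18855c, []),
  (0x31aa273, []), (0x2baa37b, []), (0xc6aa625e, []), (0xae38b, []), (0x2baa37f, []), (0xef1a625f,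
  []), (0xef1a6260, []), (0xefac6260, []), (0xc6aa6261, []), (0xae38c, []), (0xef1a6262, []),
  (0x315c163, []), (0x3184564, []), (0x3184665, []), (0x3184666, []), (0x3184767, []), (0x3184868,
  []), (0x3188569, []), (0x318856a, []), (0x318856b, []), (0x318866c, []), (0x31aa26d, []),
  (0x31aa26e, []), (0x31aa26f, []), (0x3bc6270, []), (0xae286, []), (0x3bc6271, []), (0x31aa272,
  []), (0xef186, []), (0x3bc6273, []), (0x31aa274, []), (0x3bc6275, []), (0x3bc6376, []),
  (0x31aa377, []), (0x31aa378, []), (0x3bc6379, []), (0x31aa37a, []), (0x3bc637a, []), (0x31aa37b,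
  []), (0x3bc637b, []), (0x31aa37c, []), (0x318c77c, []), (0xae38a, []), (0x3bc637d, []),
  (0x31aa37f, []), (0xae691, []), (0x31aa481, []), (0xef18b, []), (0xc6284, []), (0xc6285, []),
  (0xc6286, []), (0xc6287, []), (0xc6388, []), (0xc6389, []), (0xc638a, []), (0xc638b, []),
  (0xc638c, []), (0xc638d, []), (0xc648e, []), (0xc648f, []), (0xc6790, []), (0xc6691, [])]

/-- The lists of all trees with maximum degree at most four. -/
def levels : List (List (ℕ × List ℕ)) :=
  [trees1, trees2, trees3, trees4, trees5, trees6, trees7, trees8, trees9, trees10, trees11,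
    trees12]

set_option maxRecDepth 100000 in
theorem bases_check : bases.all Base.check = true := by decide +kernel

set_option maxRecDepth 100000 in
theorem levels_check : checkLevels bases 1 levels = true := by decide +kernel

/-- Every tree on `n ≤ 12` vertices with maximum degree at most 4 admits an
L-shaped embedding in every point set of `n` points. -/
theorem small_trees_embed (n : ℕ) (hn : n ≤ 12)
    (G : SimpleGraph (Fin n)) (hG : G.IsTree)
    (hdeg : ∀ v, (G.neighborSet v).ncard ≤ 4)
    (S : Finset (ℝ × ℝ)) (hS : IsPointSet S) (hcard : S.card = n) :
    HasLEmbedding G S :=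
  hasLEmbedding_of_checkLevels bases_check levels_check rfl
    ⟨trees1, rfl, _, List.mem_cons_self, by decide +kernel⟩ hn hG hdeg hS hcard
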